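/- Let k ≥ 3 and let D be a digraph with λ(D) = k. Then χ⃗(D) = λ(D) + 1 = k + 1 if and only if some block of some strong component of D belongs to H⃗_k. -/

import Mathlib

/-!
Common framework: finite digraphs on vertex set a `Finset ℕ`,
loopless and without parallel arcs (arcs are a `Finset (ℕ × ℕ)`).
-/

structure Dgraph where
  verts : Finset ℕ
  arcs : Finset (ℕ × ℕ)

namespace Dgraph

/-- Well-formedness: every arc joins two distinct vertices of the digraph
(no loops, arcs within the vertex set). -/
def WF (D : Dgraph) : Prop :=
  ∀ a ∈ D.arcs, a.1 ∈ D.verts ∧ a.2 ∈ D.verts ∧ a.1 ≠ a.2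

/-- `p` is a directed path from `u` to `v` in `D` (vertices pairwise distinct,
consecutive pairs are arcs). -/
def IsDipath (D : Dgraph) (p : List ℕ) (u v : ℕ) : Prop :=
  p.Nodup ∧ p.head? = some u ∧ p.getLast? = some v ∧
    (∀ x ∈ p, x ∈ D.verts) ∧ p.Chain' (fun a b => (a, b) ∈ D.arcs)

/-- The set of arcs used by a path (consecutive pairs). -/
def arcsOf (p : List ℕ) : Finset (ℕ × ℕ) := (p.zip p.tail).toFinset

/-- Local arc-connectivity `λ(u,v)`: the maximum number of pairwise
arc-disjoint directed paths from `u` to `v`. -/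
noncomputable def locLam (D : Dgraph) (u v : ℕ) : ℕ :=
  sSup {n | ∃ P : Fin n → List ℕ, (∀ i, D.IsDipath (P i) u v) ∧
    Pairwise fun i j => Disjoint (arcsOf (P i)) (arcsOf (P j))}

/-- Maximum local arc-connectivity `λ(D)`. -/
noncomputable def lam (D : Dgraph) : ℕ :=
  sSup {n | ∃ u ∈ D.verts, ∃ v ∈ D.verts, u ≠ v ∧ n = D.locLam u v}

/-- `p` is a directed cycle of `D` (cyclically consecutive pairs are arcs,
vertices pairwise distinct). -/
def IsDicycle (D : Dgraph) (p : List ℕ) : Prop :=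
  2 ≤ p.length ∧ p.Nodup ∧ (∀ x ∈ p, x ∈ D.verts) ∧
    p.Chain' (fun a b => (a, b) ∈ D.arcs) ∧
    ∀ x y, p.getLast? = some x → p.head? = some y → (x, y) ∈ D.arcs

/-- A colouring `φ` of the vertices with `k` colours is a `k`-dicolouring if
no directed cycle is monochromatic, i.e. every colour class induces an
acyclic subdigraph. -/
def IsDicolouring (D : Dgraph) (k : ℕ) (φ : ℕ → Fin k) : Prop :=
  ∀ p, D.IsDicycle p → ¬∃ c, ∀ x ∈ p, φ x = c

/-- The dichromatic number: least `k` admitting a `k`-dicolouring. -/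
noncomputable def dichi (D : Dgraph) : ℕ :=
  sInf {k | ∃ φ : ℕ → Fin k, D.IsDicolouring k φ}

/-- A monochromatic list of vertices. -/
def Mono {k : ℕ} (φ : ℕ → Fin k) (p : List ℕ) : Prop := ∃ c, ∀ x ∈ p, φ x = c

/-- `D` is strong: any vertex can reach any other by a directed path. -/
def Strong (D : Dgraph) : Prop :=
  ∀ u ∈ D.verts, ∀ v ∈ D.verts, u ≠ v → ∃ p, D.IsDipath p u v

/-- Induced subdigraph on `S`. -/
def induce (D : Dgraph) (S : Finset ℕ) : Dgraph where
  verts := D.verts ∩ S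
  arcs := D.arcs.filter fun a => a.1 ∈ S ∧ a.2 ∈ S

/-- Adjacency in the underlying undirected graph. -/
def adj (D : Dgraph) (x y : ℕ) : Prop := (x, y) ∈ D.arcs ∨ (y, x) ∈ D.arcs

/-- Reachability in the underlying undirected graph. -/
def UReach (D : Dgraph) (x y : ℕ) : Prop := Relation.ReflTransGen D.adj x y

/-- Connectivity of the underlying undirected graph. -/
def UConnected (D : Dgraph) : Prop :=
  D.verts.Nonempty ∧ ∀ u ∈ D.verts, ∀ v ∈ D.verts, D.UReach u v

/-- Deletion of a vertex. -/
def delVert (D : Dgraph) (v : ℕ) : Dgraph := D.induce (D.verts.erase v)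

/-- `v` is a cutvertex: its removal disconnects the underlying graph. -/
def IsCutvertex (D : Dgraph) (v : ℕ) : Prop :=
  v ∈ D.verts ∧ ¬(D.delVert v).UConnected

/-- Biconnected: the underlying graph is connected and has no cutvertex. -/
def Biconnected (D : Dgraph) : Prop :=
  D.UConnected ∧ ∀ v, ¬D.IsCutvertex v

/-- `D` is `k`-extremal: biconnected, strong and `χ⃗(D) = λ(D) + 1 = k + 1`. -/
def Extremal (k : ℕ) (D : Dgraph) : Prop :=
  D.Biconnected ∧ D.Strong ∧ D.dichi = k + 1 ∧ D.lam = k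

/-- The arcs of the dicut `(X, X̄)`: arcs from `X` to its complement. -/
def dicutArcs (D : Dgraph) (X : Finset ℕ) : Finset (ℕ × ℕ) :=
  D.arcs.filter fun a => a.1 ∈ X ∧ a.2 ∉ X

/-- `X` is the side of a dicut: `∅ ≠ X ⊊ V(D)`. -/
def IsDicutSide (D : Dgraph) (X : Finset ℕ) : Prop :=
  X ⊆ D.verts ∧ X.Nonempty ∧ X ≠ D.verts

/-- `(X, X̄)` is a minimum dicut of `D`. -/
def IsMinDicut (D : Dgraph) (X : Finset ℕ) : Prop :=
  D.IsDicutSide X ∧ ∀ Y, D.IsDicutSide Y → (D.dicutArcs X).card ≤ (D.dicutArcs Y).card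

def outdeg (D : Dgraph) (v : ℕ) : ℕ := (D.arcs.filter fun a => a.1 = v).card
def indeg (D : Dgraph) (v : ℕ) : ℕ := (D.arcs.filter fun a => a.2 = v).card

/-- Eulerian: every vertex has equal in- and out-degree. -/
def Eulerian (D : Dgraph) : Prop := ∀ v ∈ D.verts, D.outdeg v = D.indeg v

/-- Deleting a set of arcs. -/
def delArcs (D : Dgraph) (s : Finset (ℕ × ℕ)) : Dgraph := ⟨D.verts, D.arcs \ s⟩

/-- Adding an arc. -/
def addArc (D : Dgraph) (u v : ℕ) : Dgraph :=
  ⟨insert u (insert v D.verts), insert (u, v) D.arcs⟩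

/-- `D` is `m`-dicritical: `χ⃗(D) = m` and deleting any arc drops the
dichromatic number to at most `m - 1`. -/
def Dicritical (m : ℕ) (D : Dgraph) : Prop :=
  D.dichi = m ∧ ∀ a ∈ D.arcs, (D.delArcs {a}).dichi ≤ m - 1

/-- Renaming a vertex `x` to `y`. -/
def ren (x y z : ℕ) : ℕ := if z = x then y else z

def renArc (x y : ℕ) (a : ℕ × ℕ) : ℕ × ℕ := (ren x y a.1, ren x y a.2)

/-- Cyclically consecutive pairs of a list: the arcs of the directed cycle
through `p` in this cyclic order. -/
def cycArcs (p : List ℕ) : Finset (ℕ × ℕ) := (p.zip (p.rotate 1)).toFinset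

/-- `D` is a directed cycle. -/
def IsDirectedCycleGraph (D : Dgraph) : Prop :=
  ∃ p : List ℕ, 2 ≤ p.length ∧ p.Nodup ∧ D.verts = p.toFinset ∧ D.arcs = cycArcs p

/-- `D` is the bidirected complete digraph `↔K_n`. -/
def IsBiComplete (D : Dgraph) (n : ℕ) : Prop :=
  D.verts.card = n ∧ D.arcs = (D.verts ×ˢ D.verts).filter fun a => a.1 ≠ a.2

/-- Arcs of a bidirected (symmetric) cycle through `p`. -/
def symmCyc (p : List ℕ) : Finset (ℕ × ℕ) := cycArcs p ∪ (cycArcs p).image Prod.swap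

/-- `D` is a symmetric odd wheel: a bidirected odd cycle (≥ 3 vertices)
plus a hub joined by digons to all cycle vertices. -/
def IsSymOddWheel (D : Dgraph) : Prop :=
  ∃ (p : List ℕ) (x : ℕ), 3 ≤ p.length ∧ Odd p.length ∧ p.Nodup ∧ x ∉ p ∧
    D.verts = insert x p.toFinset ∧
    D.arcs = symmCyc p ∪ p.toFinset.image (fun y => (x, y)) ∪
      p.toFinset.image (fun y => (y, x))

/-- A fresh vertex not in `D`. -/
def fresh (D : Dgraph) : ℕ := (D.verts.sup id) + 1

/-- Contraction `D/X`: `X` is contracted into a single new vertex; arcs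
inside `X` are deleted and parallel arcs created by contraction are
identified. -/
def contract (D : Dgraph) (X : Finset ℕ) : Dgraph where
  verts := insert (fresh D) (D.verts \ X)
  arcs := (D.arcs.image fun a =>
      (if a.1 ∈ X then fresh D else a.1, if a.2 ∈ X then fresh D else a.2)).filter
      fun a => a.1 ≠ a.2

/-- `D` is the directed Hajós join of `D1` and `D2` with respect to the arcs
`(u,v1) ∈ A(D1)` and `(v2,w) ∈ A(D2)`, the vertices `v1, v2` being
identified into the new vertex `v`, and the arc `(u,w)` being added. -/
def IsDirHajosJoinAt (D D1 D2 : Dgraph) (u v1 v2 w v : ℕ) : Prop :=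
  D1.WF ∧ D2.WF ∧ Disjoint D1.verts D2.verts ∧
  (u, v1) ∈ D1.arcs ∧ (v2, w) ∈ D2.arcs ∧
  v ∉ (D1.verts.erase v1) ∪ (D2.verts.erase v2) ∧
  D.verts = insert v ((D1.verts.erase v1) ∪ (D2.verts.erase v2)) ∧
  D.arcs = insert (u, w)
    (((D1.arcs.erase (u, v1)) ∪ (D2.arcs.erase (v2, w))).image
      fun a => renArc v2 v (renArc v1 v a))

def IsDirHajosJoin (D D1 D2 : Dgraph) : Prop :=
  ∃ u v1 v2 w v, IsDirHajosJoinAt D D1 D2 u v1 v2 w v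

/-- Bidirected Hajós join with respect to the digons `[u,v1] ⊆ A(D1)` and
`[w,v2] ⊆ A(D2)`. -/
def IsBidirHajosJoinAt (D D1 D2 : Dgraph) (u v1 v2 w v : ℕ) : Prop :=
  D1.WF ∧ D2.WF ∧ Disjoint D1.verts D2.verts ∧
  (u, v1) ∈ D1.arcs ∧ (v1, u) ∈ D1.arcs ∧ (w, v2) ∈ D2.arcs ∧ (v2, w) ∈ D2.arcs ∧
  v ∉ (D1.verts.erase v1) ∪ (D2.verts.erase v2) ∧
  D.verts = insert v ((D1.verts.erase v1) ∪ (D2.verts.erase v2)) ∧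
  D.arcs = insert (u, w) (insert (w, u)
    (((D1.arcs \ {(u, v1), (v1, u)}) ∪ (D2.arcs \ {(w, v2), (v2, w)})).image
      fun a => renArc v2 v (renArc v1 v a)))

def IsBidirHajosJoin (D D1 D2 : Dgraph) : Prop :=
  ∃ u v1 v2 w v, IsBidirHajosJoinAt D D1 D2 u v1 v2 w v

/-- Hajós bijoin of `D1` and `D2` with respect to `((t,a1,w),(v,a2,u))`:
`ta1, a1w ∈ A(D1)` with `t,w` in the same connected component of `D1 ∖ a1`,
`va2, a2u ∈ A(D2)` with `u,v` in the same connected component of `D2 ∖ a2`;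
`a1` and `a2` are identified into the new vertex `a` and the arcs
`tu` and `vw` are added. -/
def IsHajosBijoinAt (D D1 D2 : Dgraph) (t a1 w v a2 u a : ℕ) : Prop :=
  D1.WF ∧ D2.WF ∧ Disjoint D1.verts D2.verts ∧
  (t, a1) ∈ D1.arcs ∧ (a1, w) ∈ D1.arcs ∧
  (v, a2) ∈ D2.arcs ∧ (a2, u) ∈ D2.arcs ∧
  (D1.delVert a1).UReach t w ∧
  (D2.delVert a2).UReach u v ∧
  a ∉ (D1.verts.erase a1) ∪ (D2.verts.erase a2) ∧
  D.verts = insert a ((D1.verts.erase a1) ∪ (D2.verts.erase a2)) ∧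
  D.arcs = insert (t, u) (insert (v, w)
    (((D1.arcs \ {(t, a1), (a1, w)}) ∪ (D2.arcs \ {(v, a2), (a2, u)})).image
      fun x => renArc a2 a (renArc a1 a x)))

def IsHajosBijoin (D D1 D2 : Dgraph) : Prop :=
  ∃ t a1 w v a2 u a, IsHajosBijoinAt D D1 D2 t a1 w v a2 u a

/-! ### Trees, Euler tours and Hajós tree joins -/

/-- Vertex set of the tree given by edges `e : Fin n → ℕ × ℕ`. -/
def treeVerts (n : ℕ) (e : Fin n → ℕ × ℕ) : Finset ℕ :=
  Finset.univ.image (fun i => (e i).1) ∪ Finset.univ.image (fun i => (e i).2)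

/-- The bidirected digraph `↔T` of the tree. -/
def treeDigraph (n : ℕ) (e : Fin n → ℕ × ℕ) : Dgraph where
  verts := treeVerts n e
  arcs := Finset.univ.image (fun i : Fin n => e i) ∪
    Finset.univ.image (fun i : Fin n => (e i).swap)

/-- `e` lists the edges of a tree: loopless, pairwise distinct edges,
connected, with `n + 1` vertices for `n` edges. -/
def IsTree (n : ℕ) (e : Fin n → ℕ × ℕ) : Prop :=
  (∀ i, (e i).1 ≠ (e i).2) ∧
  (∀ i j, i ≠ j → e i ≠ e j ∧ e i ≠ (e j).swap) ∧
  (treeDigraph n e).UConnected ∧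
  (treeVerts n e).card = n + 1

/-- The leaves of the tree: vertices incident to exactly one edge. -/
def leafSet (n : ℕ) (e : Fin n → ℕ × ℕ) : Finset ℕ :=
  (treeVerts n e).filter fun x =>
    (Finset.univ.filter fun i : Fin n => (e i).1 = x ∨ (e i).2 = x).card = 1

/-- `L` is an Eulerian list of the tree: the cyclic sequence of consecutive
pairs of `L` traverses each arc of `↔T` exactly once. -/
def IsEulerTour (n : ℕ) (e : Fin n → ℕ × ℕ) (L : List ℕ) : Prop :=
  ((L.zip (L.rotate 1) : List (ℕ × ℕ)) : Multiset (ℕ × ℕ)) = (treeDigraph n e).arcs.val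

/-- `C` is a partial Eulerian list: a circular sublist of an Eulerian list
containing every leaf, in which every non-leaf vertex appears at most once. -/
def IsPartialEulerList (n : ℕ) (e : Fin n → ℕ × ℕ) (C : List ℕ) : Prop :=
  ∃ L m, IsEulerTour n e L ∧ List.Sublist C (L.rotate m) ∧
    (∀ x ∈ leafSet n e, x ∈ C) ∧
    ∀ x ∈ C, x ∉ leafSet n e → C.count x ≤ 1

/-- Compatibility of the data of a (extended) Hajós tree join:
a tree with edges `uᵢvᵢ = e i`, digraphs `Ds i` with
`V(Ds i) ∩ V(T) = {uᵢ, vᵢ}`, `[uᵢ,vᵢ] ⊆ A(Ds i)` and whose remaining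
vertex sets are pairwise disjoint. -/
def JoinCompat (n : ℕ) (e : Fin n → ℕ × ℕ) (Ds : Fin n → Dgraph) : Prop :=
  IsTree n e ∧ (∀ i, (Ds i).WF) ∧
  (∀ i, (Ds i).verts ∩ treeVerts n e = {(e i).1, (e i).2}) ∧
  (∀ i, e i ∈ (Ds i).arcs ∧ (e i).swap ∈ (Ds i).arcs) ∧
  (∀ i j, i ≠ j →
    Disjoint ((Ds i).verts \ {(e i).1, (e i).2}) ((Ds j).verts \ {(e j).1, (e j).2}))

/-- The digraph obtained from the digraphs `Ds i − [uᵢ,vᵢ]` by adding the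
directed cycle through the list `C`. -/
def joinOf (n : ℕ) (e : Fin n → ℕ × ℕ) (Ds : Fin n → Dgraph) (C : List ℕ) : Dgraph where
  verts := Finset.univ.biUnion fun i => (Ds i).verts
  arcs := (Finset.univ.biUnion fun i => (Ds i).arcs \ {e i, (e i).swap}) ∪ cycArcs C

/-- `D` is the Hajós tree join `T(D₁, …, Dₙ; C)`: the peripheral cycle runs
through the leaves of `T` in the circular order given by a plane embedding
of `T` (equivalently, the order of the leaves along an Euler tour of `↔T`). -/
def IsHajosTreeJoin (D : Dgraph) (n : ℕ) (e : Fin n → ℕ × ℕ)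
    (Ds : Fin n → Dgraph) : Prop :=
  JoinCompat n e Ds ∧ ∃ L, IsEulerTour n e L ∧
    D = joinOf n e Ds (L.filter fun x => decide (x ∈ leafSet n e))

/-- `D` is an extended Hajós tree join: the peripheral cycle runs through a
partial Eulerian list of `T`. -/
def IsExtHajosTreeJoin (D : Dgraph) (n : ℕ) (e : Fin n → ℕ × ℕ)
    (Ds : Fin n → Dgraph) : Prop :=
  JoinCompat n e Ds ∧ ∃ C, IsPartialEulerList n e C ∧ D = joinOf n e Ds C

/-- Hajós star join: a Hajós tree join whose tree is a star. -/
def IsHajosStarJoin (D : Dgraph) (n : ℕ) (e : Fin n → ℕ × ℕ)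
    (Ds : Fin n → Dgraph) : Prop :=
  IsHajosTreeJoin D n e Ds ∧ ∃ c, ∀ i, (e i).1 = c ∨ (e i).2 = c

/-- The class `H⃗_k`: for `k = 3` the smallest class containing the symmetric
odd wheels and closed under directed Hajós joins and Hajós tree joins; for
`k ≥ 4` the smallest class containing `↔K_{k+1}` and closed under directed
Hajós joins and Hajós tree joins. -/
inductive HClass (k : ℕ) : Dgraph → Prop
  | wheel (D : Dgraph) (hk : k = 3) (h : IsSymOddWheel D) : HClass k D
  | complete (D : Dgraph) (hk : 4 ≤ k) (h : IsBiComplete D (k + 1)) : HClass k D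
  | dirJoin (D D1 D2 : Dgraph) (h1 : HClass k D1) (h2 : HClass k D2)
      (h : IsDirHajosJoin D D1 D2) : HClass k D
  | treeJoin (D : Dgraph) (n : ℕ) (e : Fin n → ℕ × ℕ) (Ds : Fin n → Dgraph)
      (h : ∀ i, HClass k (Ds i)) (hj : IsHajosTreeJoin D n e Ds) : HClass k D

/-- The class `EH⃗T_k`: for `k = 3` the smallest class containing the
symmetric odd wheels and closed under extended Hajós tree joins; for `k ≥ 4`
the smallest class containing `↔K_{k+1}` and closed under extended Hajós
tree joins. -/
inductive EHTClass (k : ℕ) : Dgraph → Prop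
  | wheel (D : Dgraph) (hk : k = 3) (h : IsSymOddWheel D) : EHTClass k D
  | complete (D : Dgraph) (hk : 4 ≤ k) (h : IsBiComplete D (k + 1)) : EHTClass k D
  | extJoin (D : Dgraph) (n : ℕ) (e : Fin n → ℕ × ℕ) (Ds : Fin n → Dgraph)
      (h : ∀ i, EHTClass k (Ds i)) (hj : IsExtHajosTreeJoin D n e Ds) : EHTClass k D

/-- Parallel Hajós join of `D_AC` and `D_B` with respect to
`(t, u, v, w, [a,b])`. -/
def IsParallelHajosJoinAt (D DAC DB : Dgraph) (A C : Finset ℕ)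
    (x t u v w a b : ℕ) : Prop :=
  DAC.WF ∧ DB.WF ∧
  (a, b) ∈ DB.arcs ∧ (b, a) ∈ DB.arcs ∧
  DAC.verts = A ∪ C ∧ A ∩ C = {x} ∧
  t ∈ A.erase x ∧ w ∈ A.erase x ∧ u ∈ C.erase x ∧ v ∈ C.erase x ∧
  (t, u) ∈ DAC.arcs ∧ (v, w) ∈ DAC.arcs ∧
  (DAC.delVert x).UReach t w ∧
  ((DAC.induce C).delVert x).UReach u v ∧
  Disjoint DAC.verts DB.verts ∧
  D.verts = DB.verts ∪ (A.erase x) ∪ (C.erase x) ∧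
  D.arcs = insert (t, u) (insert (v, w)
    ((DB.arcs \ {(a, b), (b, a)}) ∪
      ((DAC.induce A).arcs.image (renArc x a)) ∪
      ((DAC.induce C).arcs.image (renArc x b))))

def IsParallelHajosJoin (D DAC DB : Dgraph) : Prop :=
  ∃ A C x t u v w a b, IsParallelHajosJoinAt D DAC DB A C x t u v w a b

/-- `S` is (the vertex set of) a strong component of `D`. -/
def IsStrongComponent (D : Dgraph) (S : Finset ℕ) : Prop :=
  S ⊆ D.verts ∧ S.Nonempty ∧ (D.induce S).Strong ∧
  ∀ S', S ⊆ S' → S' ⊆ D.verts → (D.induce S').Strong → S' = S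

/-- `B` is (the vertex set of) a block of `D`: a maximal set inducing a
biconnected subdigraph. -/
def IsBlock (D : Dgraph) (B : Finset ℕ) : Prop :=
  B ⊆ D.verts ∧ (D.induce B).Biconnected ∧
  ∀ B', B ⊆ B' → B' ⊆ D.verts → (D.induce B').Biconnected → B' = B

end Dgraph

open Dgraph

open Dgraph

namespace Dgraph

open Relation

/-! ### Relations -/

def Acy (r : ℕ → ℕ → Prop) : Prop := ∀ p q, r p q → ¬ ReflTransGen r q p

theorem Acy.mono {r s : ℕ → ℕ → Prop} (h : ∀ p q, s p q → r p q) (hr : Acy r) : Acy s :=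
  fun p q hpq hqp => hr p q (h p q hpq) (ReflTransGen.mono h _ _ hqp)

def addRel (r : ℕ → ℕ → Prop) (P : Prop) (x y : ℕ) (p q : ℕ) : Prop :=
  r p q ∨ (P ∧ p = x ∧ q = y)

theorem rtg_add {r : ℕ → ℕ → Prop} {P : Prop} {x y a b : ℕ}
    (h : ReflTransGen (addRel r P x y) a b) :
    ReflTransGen r a b ∨ (P ∧ ReflTransGen r a x ∧ ReflTransGen r y b) := by
  induction h with
  | refl => exact Or.inl .refl
  | tail _ hbc ih =>
    rcases hbc with hbc | ⟨hP, rfl, rfl⟩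
    · rcases ih with ih | ⟨hP, h1, h2⟩
      · exact Or.inl (ih.tail hbc)
      · exact Or.inr ⟨hP, h1, h2.tail hbc⟩
    · rcases ih with ih | ⟨_, h1, h2⟩
      · exact Or.inr ⟨hP, ih, .refl⟩
      · exact Or.inr ⟨hP, h1, .refl⟩

theorem acy_add {r : ℕ → ℕ → Prop} {P : Prop} {x y : ℕ} (hr : Acy r)
    (h : P → ¬ ReflTransGen r y x) : Acy (addRel r P x y) := by
  intro p q hpq hqp
  rcases hpq with hpq | ⟨hP, rfl, rfl⟩
  · rcases rtg_add hqp with h1 | ⟨hP, h1, h2⟩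
    · exact hr _ _ hpq h1
    · exact h hP ((h2.tail hpq).trans h1)
  · rcases rtg_add hqp with h1 | ⟨_, h1, h2⟩
    · exact h hP h1
    · exact h hP h1

def orRel (r s : ℕ → ℕ → Prop) (p q : ℕ) : Prop := r p q ∨ s p q

def SuppOn (r : ℕ → ℕ → Prop) (S : Finset ℕ) : Prop := ∀ p q, r p q → p ∈ S ∧ q ∈ S

theorem rtg_supp {r : ℕ → ℕ → Prop} {S : Finset ℕ} (hr : SuppOn r S) {a b : ℕ}
    (h : ReflTransGen r a b) (ha : a ∈ S) : b ∈ S := by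
  induction h with
  | refl => exact ha
  | tail _ hbc _ => exact (hr _ _ hbc).2

theorem rtg_supp' {r : ℕ → ℕ → Prop} {S : Finset ℕ} (hr : SuppOn r S) {a b : ℕ}
    (h : ReflTransGen r a b) (hb : b ∈ S) : a ∈ S := by
  induction h using ReflTransGen.head_induction_on with
  | refl => exact hb
  | head hbc _ _ => exact (hr _ _ hbc).1

/-- reachability in the union of two relations whose supports meet in mutually unreachable
vertices. -/
theorem rtg_glue {r s : ℕ → ℕ → Prop} {S T : Finset ℕ} (hr : SuppOn r S) (hs : SuppOn s T)
    (h1 : ∀ p ∈ S, ∀ q ∈ S, p ∈ T → q ∈ T → ReflTransGen r p q → p = q)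
    (h2 : ∀ p ∈ S, ∀ q ∈ S, p ∈ T → q ∈ T → ReflTransGen s p q → p = q)
    {a b : ℕ} (ha : a ∈ S) (h : ReflTransGen (orRel r s) a b) :
    (b ∈ S → ReflTransGen r a b) ∧
    (b ∈ T → ∃ m, m ∈ S ∧ m ∈ T ∧ ReflTransGen r a m ∧ ReflTransGen s m b) := by
  induction h with
  | refl => exact ⟨fun _ => .refl, fun hT => ⟨a, ha, hT, .refl, .refl⟩⟩
  | @tail b c _ hbc ih =>
    obtain ⟨i1, i2⟩ := ih
    rcases hbc with hbc | hbc
    · obtain ⟨hb, hc⟩ := hr _ _ hbc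
      have h3 := (i1 hb).tail hbc
      exact ⟨fun _ => h3, fun hT => ⟨c, hc, hT, h3, .refl⟩⟩
    · obtain ⟨hb, hc⟩ := hs _ _ hbc
      obtain ⟨m, hmS, hmT, h3, h4⟩ := i2 hb
      refine ⟨fun hcS => ?_, fun _ => ⟨m, hmS, hmT, h3, h4.tail hbc⟩⟩
      have := h2 m hmS c hcS hmT hc (h4.tail hbc)
      exact this ▸ h3

theorem orRel_comm (r s : ℕ → ℕ → Prop) : orRel r s = orRel s r := by
  funext p q; simp [orRel, or_comm]

theorem acy_glue {r s : ℕ → ℕ → Prop} {S T : Finset ℕ} (hr : SuppOn r S) (hs : SuppOn s T)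
    (h1 : ∀ p ∈ S, ∀ q ∈ S, p ∈ T → q ∈ T → ReflTransGen r p q → p = q)
    (h2 : ∀ p ∈ S, ∀ q ∈ S, p ∈ T → q ∈ T → ReflTransGen s p q → p = q)
    (ar : Acy r) (as : Acy s) : Acy (orRel r s) := by
  intro p q hpq hqp
  rcases hpq with hpq | hpq
  · obtain ⟨hp, hq⟩ := hr _ _ hpq
    exact ar _ _ hpq ((rtg_glue hr hs h1 h2 hq hqp).1 hp)
  · obtain ⟨hp, hq⟩ := hs _ _ hpq
    rw [orRel_comm] at hqp
    exact as _ _ hpq ((rtg_glue hs hr (fun p a q b c d e => h2 p c q d a b e)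
      (fun p a q b c d e => h1 p c q d a b e) hq hqp).1 hp)

/-- The relational combine lemma. -/
theorem acy_combine {r rA rB : ℕ → ℕ → Prop} {A B : Finset ℕ} {v t u w w' : ℕ} {P Q : Prop}
    (hA : SuppOn rA (insert v A)) (hB : SuppOn rB (insert v B)) (hAB : Disjoint A B)
    (ht : t ∈ A) (hw : w ∈ A) (hu : u ∈ B) (hw' : w' ∈ B)
    (hvA : v ∉ A) (hvB : v ∉ B)
    (aA : Acy rA) (aB : Acy rB)
    (hr : ∀ p q, r p q → rA p q ∨ rB p q ∨ (P ∧ p = t ∧ q = u) ∨ (Q ∧ p = w' ∧ q = w))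
    (h1 : P → ¬ (ReflTransGen rA v t ∧ ReflTransGen rB u v))
    (h2 : Q → ¬ (ReflTransGen rB v w' ∧ ReflTransGen rA w v))
    (h3 : P → Q → ¬ (ReflTransGen rA w t ∧ ReflTransGen rB u w')) : Acy r := by
  have hmeet : ∀ p ∈ insert v A, ∀ q ∈ insert v A, p ∈ insert v B → q ∈ insert v B → p = q := by
    intro p hp q hq hp' hq'
    rw [Finset.disjoint_left] at hAB
    simp only [Finset.mem_insert] at *
    grind
  have hint1 : ∀ m, m ∈ insert v A → m ∈ insert v B → m = v := by
    intro m hm hm'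
    exact hmeet m hm v (by simp) hm' (by simp)
  have g1 : ∀ p ∈ insert v A, ∀ q ∈ insert v A, p ∈ insert v B → q ∈ insert v B →
      ReflTransGen rA p q → p = q := fun p a q b c d _ => hmeet p a q b c d
  have g2 : ∀ p ∈ insert v A, ∀ q ∈ insert v A, p ∈ insert v B → q ∈ insert v B →
      ReflTransGen rB p q → p = q := fun p a q b c d _ => hmeet p a q b c d
  have acy := acy_glue hA hB g1 g2 aA aB
  have AB := @rtg_glue rA rB _ _ hA hB g1 g2
  have BA := @rtg_glue rB rA _ _ hB hA (fun p a q b c d _ => hmeet p c q d a b)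
    (fun p a q b c d _ => hmeet p c q d a b)
  rw [orRel_comm rB rA] at BA
  have it := Finset.mem_insert_of_mem (b := v) ht
  have iw := Finset.mem_insert_of_mem (b := v) hw
  have iu := Finset.mem_insert_of_mem (b := v) hu
  have iw' := Finset.mem_insert_of_mem (b := v) hw'
  have a1 : Acy (addRel (orRel rA rB) P t u) := by
    refine acy_add acy fun hP h => ?_
    obtain ⟨m, hm1, hm2, h4, h5⟩ := (BA iu h).2 it
    have := hint1 m hm2 hm1
    subst this
    exact h1 hP ⟨h5, h4⟩
  refine (acy_add (P := Q) (x := w') (y := w) a1 fun hQ h => ?_).mono (r := addRel _ Q w' w) ?_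
  · rcases rtg_add h with h | ⟨hP, h4, h5⟩
    · obtain ⟨m, hm1, hm2, h4, h5⟩ := (AB iw h).2 iw'
      have := hint1 m hm1 hm2
      subst this
      exact h2 hQ ⟨h5, h4⟩
    · exact h3 hP hQ ⟨(AB iw h4).1 it, (BA iu h5).1 iw'⟩
  · intro p q hpq
    rcases hr p q hpq with h | h | h | h
    · exact Or.inl (Or.inl (Or.inl h))
    · exact Or.inl (Or.inl (Or.inr h))
    · exact Or.inl (Or.inr h)
    · exact Or.inr h

/-- simple paths from reachability -/
theorem exists_nodup_path {r : ℕ → ℕ → Prop} {a b : ℕ} (h : ReflTransGen r a b) :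
    ∃ l : List ℕ, l.Nodup ∧ l.head? = some a ∧ l.getLast? = some b ∧ l.IsChain r ∧
      ∀ x ∈ l, ReflTransGen r a x ∧ ReflTransGen r x b := by
  induction h using ReflTransGen.head_induction_on with
  | refl => exact ⟨[b], by simp, by simp, by simp, by simp, by simp [ReflTransGen.refl]⟩
  | @head a c hac hcb ih =>
    obtain ⟨l, h1, h2, h3, h4, h5⟩ := ih
    by_cases ha : a ∈ l
    · obtain ⟨l1, l2, rfl⟩ := List.append_of_mem ha
      refine ⟨a :: l2, ?_, by simp, ?_, ?_, ?_⟩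
      · exact (List.nodup_append.1 h1).2.1
      · simpa [List.getLast?_append] using h3
      · exact h4.right_of_append
      · intro x hx
        exact ⟨(ReflTransGen.single hac).trans (h5 x (by simp_all)).1, (h5 x (by simp_all)).2⟩
    · cases l with
      | nil => simp at h2
      | cons d l =>
        simp at h2; subst h2
        refine ⟨a :: d :: l, ?_, by simp, by simpa using h3, ?_, ?_⟩
        · exact List.nodup_cons.2 ⟨ha, h1⟩
        · exact List.isChain_cons_cons.2 ⟨hac, h4⟩
        · intro x hx
          rcases List.mem_cons.1 hx with rfl | hx
          · exact ⟨.refl, hcb.head hac⟩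
          · exact ⟨(h5 x hx).1.head hac, (h5 x hx).2⟩

theorem rtg_of_chain {r : ℕ → ℕ → Prop} : ∀ {l : List ℕ} {a b : ℕ}, l.IsChain r →
    l.head? = some a → l.getLast? = some b → ReflTransGen r a b
  | [], _, _, _, h, _ => by simp at h
  | [x], a, b, _, h, h' => by simp at h h'; subst h; subst h'; exact .refl
  | x :: y :: l, a, b, hc, h, h' => by
    simp at h; subst h
    rw [List.isChain_cons_cons] at hc
    exact (rtg_of_chain hc.2 (by simp) (by simpa using h')).head hc.1

/-! ### Colourings -/

variable {k : ℕ}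

def mono (D : Dgraph) (φ : ℕ → Fin k) (p q : ℕ) : Prop := (p, q) ∈ D.arcs ∧ φ p = φ q

def Good (D : Dgraph) (φ : ℕ → Fin k) : Prop := Acy (D.mono φ)

def Col (k : ℕ) (D : Dgraph) : Prop := ∃ φ : ℕ → Fin k, D.Good φ

theorem rtg_mono_color {D : Dgraph} {φ : ℕ → Fin k} {a b : ℕ}
    (h : ReflTransGen (D.mono φ) a b) : φ a = φ b := by
  induction h with
  | refl => rfl
  | tail _ h ih => exact ih.trans h.2

theorem Good.dicol {D : Dgraph} {φ : ℕ → Fin k} (h : D.Good φ) : D.IsDicolouring k φ := by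
  rintro p ⟨hl, _, _, hc, hx⟩ ⟨c, hcol⟩
  have hne : p ≠ [] := by rintro rfl; simp at hl
  have h1 : p.head? = some (p.head hne) := List.head?_eq_some_head hne
  have h2 : p.getLast? = some (p.getLast hne) := List.getLast?_eq_some_getLast hne
  have hc' : p.IsChain (D.mono φ) := by
    have : p.IsChain (fun a b => (a, b) ∈ D.arcs) := hc
    rw [List.isChain_iff_getElem] at this ⊢
    intro i hi
    exact ⟨this i hi, by rw [hcol _ (List.getElem_mem _), hcol _ (List.getElem_mem _)]⟩
  refine h _ _ ⟨hx _ _ h2 h1, ?_⟩ (rtg_of_chain hc' h1 h2)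
  rw [hcol _ (List.getLast_mem hne), hcol _ (List.head_mem hne)]

theorem good_of_dicol {D : Dgraph} (hD : D.WF) {φ : ℕ → Fin k} (h : D.IsDicolouring k φ) :
    D.Good φ := by
  intro p q hpq hqp
  obtain ⟨l, h1, h2, h3, h4, h5⟩ := exists_nodup_path hqp
  have hne : l ≠ [] := by rintro rfl; simp at h2
  have hw := hD _ hpq.1
  refine h l ⟨?_, h1, ?_, ?_, ?_⟩ ⟨φ q, fun x hx => (rtg_mono_color (h5 x hx).1).symm⟩
  · match l, h2, h3 with
    | [], h2, _ => simp at h2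
    | [x], h2, h3 => simp at h2 h3; exact absurd (h3.symm.trans h2) hw.2.2
    | x :: y :: l, _, _ => simp
  · intro x hx
    rcases ReflTransGen.cases_head (h5 x hx).2 with h | ⟨c, h, _⟩
    · rw [h]; exact hw.1
    · exact (hD _ h.1).1
  · exact List.IsChain.imp (fun a b h => h.1) h4
  · intro x y hx hy
    rw [h3] at hx; rw [h2] at hy
    simp at hx hy; subst hx; subst hy; exact hpq.1

theorem Good.of_imp {D D' : Dgraph} {j k : ℕ} {φ : ℕ → Fin k} {φ' : ℕ → Fin j} (h : D.Good φ)
    (hi : ∀ p q, (p, q) ∈ D'.arcs → φ' p = φ' q → (p, q) ∈ D.arcs ∧ φ p = φ q) : D'.Good φ' :=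
  Acy.mono (fun p q hpq => hi p q hpq.1 hpq.2) h

theorem Good.sub {D D' : Dgraph} {φ : ℕ → Fin k} (h : D.Good φ) (hi : D'.arcs ⊆ D.arcs) :
    D'.Good φ := h.of_imp fun _ _ a b => ⟨hi a, b⟩

theorem Good.perm {D : Dgraph} {φ : ℕ → Fin k} (h : D.Good φ) (σ : Equiv.Perm (Fin k)) :
    D.Good (fun x => σ (φ x)) := h.of_imp fun _ _ a b => ⟨a, σ.injective b⟩

/-- colouring on `S` matters only -/
theorem Good.congr {D : Dgraph} {φ ψ : ℕ → Fin k} {S : Finset ℕ} (h : D.Good φ)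
    (hS : ∀ p q, (p, q) ∈ D.arcs → p ∈ S ∧ q ∈ S) (he : ∀ x ∈ S, ψ x = φ x) : D.Good ψ :=
  h.of_imp fun p q a b => ⟨a, by rw [← he p (hS _ _ a).1, ← he q (hS _ _ a).2, b]⟩

theorem Col.sub {D D' : Dgraph} (h : D.Col k) (hi : D'.arcs ⊆ D.arcs) : D'.Col k :=
  let ⟨φ, hφ⟩ := h; ⟨φ, hφ.sub hi⟩

/-- `D[S] + E` -/
def pc (D : Dgraph) (S : Finset ℕ) (E : Finset (ℕ × ℕ)) : Dgraph :=
  ⟨S, (D.arcs.filter fun a => a.1 ∈ S ∧ a.2 ∈ S) ∪ E⟩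

@[simp] theorem pc_verts (D : Dgraph) (S E) : (D.pc S E).verts = S := rfl

@[simp] theorem mem_pc {D : Dgraph} {S E} {a : ℕ × ℕ} :
    a ∈ (D.pc S E).arcs ↔ (a ∈ D.arcs ∧ a.1 ∈ S ∧ a.2 ∈ S) ∨ a ∈ E := by
  simp [pc]

theorem supp_pc (D : Dgraph) (S) (φ : ℕ → Fin k) : SuppOn ((D.pc S ∅).mono φ) S := by
  rintro p q ⟨h, _⟩
  simp at h
  exact h.2

/-- cross structure: at `v` with sides `A`, `B`; cross arcs are among `t→u`, `w'→w`. -/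
structure Sep (D : Dgraph) (v : ℕ) (A B : Finset ℕ) (t w u w' : ℕ) : Prop where
  wf : D.WF
  verts : D.verts = insert v (A ∪ B)
  disj : Disjoint A B
  vA : v ∉ A
  vB : v ∉ B
  tA : t ∈ A
  wA : w ∈ A
  uB : u ∈ B
  wB : w' ∈ B
  cAB : ∀ p ∈ A, ∀ q ∈ B, (p, q) ∈ D.arcs → p = t ∧ q = u
  cBA : ∀ p ∈ B, ∀ q ∈ A, (p, q) ∈ D.arcs → p = w' ∧ q = w

theorem Sep.symm {D : Dgraph} {v A B t w u w'} (h : Sep D v A B t w u w') :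
    Sep D v B A w' u w t :=
  ⟨h.wf, by rw [h.verts, Finset.union_comm], h.disj.symm, h.vB, h.vA, h.wB, h.uB, h.wA, h.tA,
    h.cBA, h.cAB⟩

theorem perm1 (a c : Fin k) : ∃ σ : Equiv.Perm (Fin k), σ a = c :=
  ⟨Equiv.swap a c, by simp⟩

theorem perm2 {a b c d : Fin k} (hab : a ≠ b) (hcd : c ≠ d) :
    ∃ σ : Equiv.Perm (Fin k), σ a = c ∧ σ b = d := by
  refine ⟨(Equiv.swap a c).trans (Equiv.swap (Equiv.swap a c b) d), ?_, by simp⟩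
  simp only [Equiv.trans_apply, Equiv.swap_apply_left]
  refine Equiv.swap_apply_of_ne_of_ne ?_ hcd
  intro h
  have : Equiv.swap a c a = Equiv.swap a c b := by rw [← h]; simp
  exact hab ((Equiv.swap a c).injective this)

theorem third (hk : 3 ≤ k) (a b : Fin k) : ∃ c, c ≠ a ∧ c ≠ b := by
  have : ({a, b} : Finset (Fin k)).card < (Finset.univ : Finset (Fin k)).card := by
    have := Finset.card_le_two (a := a) (b := b)
    simp; omega
  obtain ⟨c, _, hc⟩ := Finset.exists_mem_notMem_of_card_lt_card this
  exact ⟨c, by simp at hc; tauto, by simp at hc; tauto⟩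

theorem combine {D : Dgraph} {v A B t w u w'} (S : Sep D v A B t w u w')
    {φ ψ : ℕ → Fin k} (hφ : (D.pc (insert v A) ∅).Good φ) (hψ : (D.pc (insert v B) ∅).Good ψ)
    (h1 : (t, u) ∈ D.arcs → ¬ (ReflTransGen ((D.pc (insert v A) ∅).mono φ) v t ∧
      ReflTransGen ((D.pc (insert v B) ∅).mono ψ) u v))
    (h2 : (w', w) ∈ D.arcs → ¬ (ReflTransGen ((D.pc (insert v B) ∅).mono ψ) v w' ∧
      ReflTransGen ((D.pc (insert v A) ∅).mono φ) w v))
    (h3 : (t, u) ∈ D.arcs → (w', w) ∈ D.arcs →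
      ¬ (ReflTransGen ((D.pc (insert v A) ∅).mono φ) w t ∧ φ t = φ v ∧
        ReflTransGen ((D.pc (insert v B) ∅).mono ψ) u w' ∧ ψ u = ψ v))
    (hk : (t, u) ∈ D.arcs → 3 ≤ k ∨ φ t = φ v ∨ ψ u = ψ v) :
    ∃ (θ : ℕ → Fin k) (σ : Equiv.Perm (Fin k)), D.Good θ ∧ (∀ x ∈ insert v A, θ x = φ x) ∧
      (∀ x ∈ insert v B, θ x = σ (ψ x)) := by
  have hσ : ∃ σ : Equiv.Perm (Fin k), σ (ψ v) = φ v ∧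
      ((t, u) ∈ D.arcs → σ (ψ u) = φ t → φ t = φ v ∧ ψ u = ψ v) := by
    by_cases e0 : (t, u) ∈ D.arcs
    swap
    · obtain ⟨σ, hs⟩ := perm1 (ψ v) (φ v)
      exact ⟨σ, hs, fun h => absurd h e0⟩
    by_cases e1 : ψ u = ψ v
    · obtain ⟨σ, hs⟩ := perm1 (ψ v) (φ v)
      exact ⟨σ, hs, fun _ h => ⟨by rw [← h, e1, hs], e1⟩⟩
    by_cases e2 : φ t = φ v
    · obtain ⟨σ, hs⟩ := perm1 (ψ v) (φ v)
      exact ⟨σ, hs, fun _ h => absurd (σ.injective (by rw [h, hs, e2])) e1⟩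
    · have hk : 3 ≤ k := by tauto
      obtain ⟨c, hc1, hc2⟩ := third hk (φ v) (φ t)
      obtain ⟨σ, hs1, hs2⟩ := perm2 (a := ψ v) (b := ψ u) (c := φ v) (d := c)
        (Ne.symm e1) hc1.symm
      exact ⟨σ, hs1, fun _ h => absurd (hs2 ▸ h) hc2⟩
  obtain ⟨σ, hs1, hs2⟩ := hσ
  let θ : ℕ → Fin k := fun x => if x ∈ insert v A then φ x else σ (ψ x)
  have hA : ∀ x ∈ insert v A, θ x = φ x := fun x hx => by simp only [θ, if_pos hx]
  have hB : ∀ x ∈ insert v B, θ x = σ (ψ x) := by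
    intro x hx
    by_cases hxA : x ∈ insert v A
    · have : x = v := by
        have := S.disj
        rw [Finset.disjoint_left] at this
        simp at hx hxA
        rcases hx with h | h
        · exact h
        · rcases hxA with h' | h'
          · exact h'
          · exact absurd h (this h')
      subst this
      rw [hA _ hxA, hs1]
    · simp only [θ, if_neg hxA]
  refine ⟨θ, σ, ?_, hA, hB⟩
  have htu : (t, u) ∈ D.arcs → θ t = θ u → φ t = φ v ∧ ψ u = ψ v := by
    intro h0 h
    rw [hA t (by simp [S.tA]), hB u (by simp [S.uB])] at h
    exact hs2 h0 h.symm
  refine acy_combine (rA := (D.pc (insert v A) ∅).mono φ) (rB := (D.pc (insert v B) ∅).mono ψ)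
    (P := (t, u) ∈ D.arcs ∧ θ t = θ u) (Q := (w', w) ∈ D.arcs)
    (supp_pc _ _ _) (supp_pc _ _ _) S.disj S.tA S.wA S.uB S.wB S.vA S.vB hφ hψ ?_ ?_ ?_ ?_
  · rintro p q ⟨hpq, hc⟩
    obtain ⟨hp, hq, _⟩ := S.wf _ hpq
    simp only [S.verts, Finset.mem_insert, Finset.mem_union] at hp hq
    have fA : p ∈ insert v A → q ∈ insert v A → (D.pc (insert v A) ∅).mono φ p q :=
      fun h h' => ⟨by rw [mem_pc]; exact Or.inl ⟨hpq, h, h'⟩, by rw [← hA _ h, ← hA _ h', hc]⟩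
    have fB : p ∈ insert v B → q ∈ insert v B → (D.pc (insert v B) ∅).mono ψ p q :=
      fun h h' => ⟨by rw [mem_pc]; exact Or.inl ⟨hpq, h, h'⟩, by
        apply σ.injective; rw [← hB _ h, ← hB _ h', hc]⟩
    simp only [Finset.mem_insert] at fA fB
    have e1 := S.cAB p
    have e2 := S.cBA p
    rcases hp with pv | pA | pB
    · rcases hq with qv | qA | qB
      · exact Or.inl (fA (Or.inl pv) (Or.inl qv))
      · exact Or.inl (fA (Or.inl pv) (Or.inr qA))
      · exact Or.inr (Or.inl (fB (Or.inl pv) (Or.inr qB)))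
    · rcases hq with qv | qA | qB
      · exact Or.inl (fA (Or.inr pA) (Or.inl qv))
      · exact Or.inl (fA (Or.inr pA) (Or.inr qA))
      · obtain ⟨rfl, rfl⟩ := e1 pA q qB hpq
        exact Or.inr (Or.inr (Or.inl ⟨⟨hpq, hc⟩, rfl, rfl⟩))
    · rcases hq with qv | qA | qB
      · exact Or.inr (Or.inl (fB (Or.inr pB) (Or.inl qv)))
      · obtain ⟨rfl, rfl⟩ := e2 pB q qA hpq
        exact Or.inr (Or.inr (Or.inr ⟨hpq, rfl, rfl⟩))
      · exact Or.inr (Or.inl (fB (Or.inr pB) (Or.inr qB)))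
  · intro hP; exact h1 hP.1
  · exact h2
  · intro hP hQ h
    exact h3 hP.1 hQ ⟨h.1, (htu hP.1 hP.2).1, h.2, (htu hP.1 hP.2).2⟩

end Dgraph

namespace Dgraph

open Relation

variable {k : ℕ}

/-! ### Permutation lemma -/

theorem perm_lemma {α : Type*} [DecidableEq α] (hk : 2 ≤ k) (M : Finset α) (f g : α → Fin k)
    (h : ∀ σ : Equiv.Perm (Fin k), ∃ a ∈ M, σ (f a) = g a) :
    k ≤ M.card ∧ (M.card = k →
      (∀ a ∈ M, ∀ b ∈ M, f a = f b ∧ (a ≠ b → g a ≠ g b)) ∨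
      (∀ a ∈ M, ∀ b ∈ M, g a = g b ∧ (a ≠ b → f a ≠ f b))) := by
  haveI : NeZero k := ⟨by omega⟩
  have surj : ∀ τ : Equiv.Perm (Fin k), M.image (fun a => g a - τ (f a)) = Finset.univ := by
    intro τ
    ext c
    simp only [Finset.mem_image, Finset.mem_univ, iff_true]
    obtain ⟨a, ha, hc⟩ := h (τ.trans (Equiv.addRight c))
    refine ⟨a, ha, ?_⟩
    rw [← hc]; simp
  have hcard : ∀ τ : Equiv.Perm (Fin k), (M.image (fun a => g a - τ (f a))).card = k := by
    intro τ; rw [surj]; simp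
  refine ⟨by rw [← hcard 1]; exact Finset.card_image_le, fun hM => ?_⟩
  have inj : ∀ τ : Equiv.Perm (Fin k), Set.InjOn (fun a => g a - τ (f a)) M := by
    intro τ
    apply Finset.card_image_iff.1
    rw [hcard τ, hM]
  have col : ∀ a ∈ M, ∀ b ∈ M, a ≠ b → (f a = f b ∧ g a ≠ g b) ∨ (f a ≠ f b ∧ g a = g b) := by
    intro a ha b hb hab
    by_cases h1 : f a = f b
    · by_cases h2 : g a = g b
      · exact absurd (inj 1 ha hb (by simp [h1, h2])) hab
      · exact Or.inl ⟨h1, h2⟩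
    · by_cases h2 : g a = g b
      · exact Or.inr ⟨h1, h2⟩
      · obtain ⟨σ, hs1, hs2⟩ := perm2 h1 h2
        exact absurd (inj σ ha hb (by simp [hs1, hs2])) hab
  have hM2 : 1 < M.card := by omega
  obtain ⟨a, ha, b, hb, hab⟩ := Finset.one_lt_card.1 hM2
  rcases col a ha b hb hab with ⟨h1, h2⟩ | ⟨h1, h2⟩
  · left
    have : ∀ c ∈ M, f c = f a := by
      intro c hc
      by_cases hca : c = a
      · rw [hca]
      by_cases hcb : c = b
      · rw [hcb, h1]
      rcases col c hc a ha hca with h3 | h3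
      · exact h3.1
      rcases col c hc b hb hcb with h4 | h4
      · rw [h4.1, h1]
      · exact absurd (h3.2.symm.trans h4.2) h2
    intro c hc d hd
    have e : f c = f d := by rw [this c hc, this d hd]
    refine ⟨e, fun hcd => ?_⟩
    rcases col c hc d hd hcd with h3 | h3
    · exact h3.2
    · exact absurd e h3.1
  · right
    have : ∀ c ∈ M, g c = g a := by
      intro c hc
      by_cases hca : c = a
      · rw [hca]
      by_cases hcb : c = b
      · rw [hcb, h2]
      rcases col c hc a ha hca with h3 | h3
      · rcases col c hc b hb hcb with h4 | h4
        · exact absurd (h3.1.symm.trans h4.1) h1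
        · rw [h4.2, h2]
      · exact h3.2
    intro c hc d hd
    have e : g c = g d := by rw [this c hc, this d hd]
    refine ⟨e, fun hcd => ?_⟩
    rcases col c hc d hd hcd with h3 | h3
    · exact absurd e h3.2
    · exact h3.1

/-! ### Critical digraphs -/

structure Crit (k : ℕ) (D : Dgraph) : Prop where
  wf : D.WF
  nc : ¬ D.Col k
  amin : ∀ a ∈ D.arcs, Col k ⟨D.verts, D.arcs.erase a⟩
  noiso : ∀ x ∈ D.verts, ∃ a ∈ D.arcs, a.1 = x ∨ a.2 = x

def dO (D : Dgraph) (X : Finset ℕ) : ℕ := (D.dicutArcs X).card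
def dI (D : Dgraph) (X : Finset ℕ) : ℕ := (D.arcs.filter fun a => a.1 ∉ X ∧ a.2 ∈ X).card

def CC (k : ℕ) (D : Dgraph) : Prop :=
  ∀ u ∈ D.verts, ∀ v ∈ D.verts, u ≠ v → ∃ X : Finset ℕ, u ∈ X ∧ v ∉ X ∧ D.dO X ≤ k

structure Ext (k : ℕ) (D : Dgraph) : Prop extends Crit k D where
  cc : CC k D

theorem mem_cut {D : Dgraph} {X : Finset ℕ} {a : ℕ × ℕ} :
    a ∈ D.dicutArcs X ↔ a ∈ D.arcs ∧ a.1 ∈ X ∧ a.2 ∉ X := by simp [dicutArcs]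

theorem exists_crit {D : Dgraph} (hD : D.WF) (h : ¬ D.Col k) :
    ∃ H : Dgraph, Crit k H ∧ H.verts ⊆ D.verts ∧ H.arcs ⊆ D.arcs := by
  classical
  obtain ⟨E, hE, hmin⟩ := Finset.exists_min_image
    (D.arcs.powerset.filter fun E => ¬ Col k ⟨∅, E⟩) Finset.card
    ⟨D.arcs, by
      simp only [Finset.mem_filter, Finset.mem_powerset_self, true_and]
      intro h'; exact h (h'.sub (D' := D) (by simp))⟩
  simp only [Finset.mem_filter, Finset.mem_powerset] at hE hmin
  refine ⟨⟨E.image Prod.fst ∪ E.image Prod.snd, E⟩, ⟨?_, ?_, ?_, ?_⟩, ?_, hE.1⟩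
  · intro a ha
    refine ⟨?_, ?_, (hD a (hE.1 ha)).2.2⟩
    · exact Finset.mem_union_left _ (Finset.mem_image_of_mem _ ha)
    · exact Finset.mem_union_right _ (Finset.mem_image_of_mem _ ha)
  · intro h'; exact hE.2 (h'.sub (by simp))
  · intro a ha
    by_contra hc
    have := hmin (E.erase a) ⟨(Finset.erase_subset _ _).trans hE.1,
      fun h' => hc (h'.sub (by simp))⟩
    exact absurd (Finset.card_erase_lt_of_mem (s := E) ha) (by omega)
  · intro x hx
    simp only [Finset.mem_union, Finset.mem_image] at hx
    rcases hx with ⟨a, ha, rfl⟩ | ⟨a, ha, rfl⟩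
    · exact ⟨a, ha, Or.inl rfl⟩
    · exact ⟨a, ha, Or.inr rfl⟩
  · intro x hx
    simp only [Finset.mem_union, Finset.mem_image] at hx
    rcases hx with ⟨a, ha, rfl⟩ | ⟨a, ha, rfl⟩
    · exact (hD a (hE.1 ha)).1
    · exact (hD a (hE.1 ha)).2.1

theorem Crit.col_sub {D : Dgraph} (h : Crit k D) {D' : Dgraph} (hs : D'.arcs ⊆ D.arcs)
    {a : ℕ × ℕ} (ha : a ∈ D.arcs) (ha' : a ∉ D'.arcs) : D'.Col k :=
  (h.amin a ha).sub fun b hb => by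
    simp only [Finset.mem_erase]
    exact ⟨by rintro rfl; exact ha' hb, hs hb⟩

theorem Crit.col_ind {D : Dgraph} (h : Crit k D) {S : Finset ℕ} (hS : ∃ x ∈ D.verts, x ∉ S) :
    (D.pc S ∅).Col k := by
  obtain ⟨x, hx, hxS⟩ := hS
  obtain ⟨a, ha, hax⟩ := h.noiso x hx
  refine h.col_sub (a := a) (fun b hb => ?_) ha ?_
  · rw [mem_pc] at hb; simp at hb; exact hb.1
  · rw [mem_pc]; simp only [Finset.notMem_empty, or_false, not_and]
    rintro _ h1 h2
    rcases hax with rfl | rfl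
    · exact hxS h1
    · exact hxS h2

theorem acy_cut {r : ℕ → ℕ → Prop} {S : Finset ℕ} (h : ∀ p q, r p q → p ∈ S → q ∈ S)
    (h1 : Acy fun p q => r p q ∧ p ∈ S ∧ q ∈ S) (h2 : Acy fun p q => r p q ∧ p ∉ S ∧ q ∉ S) :
    Acy r := by
  intro p q hpq hqp
  have stay : ∀ {a b}, ReflTransGen r a b → a ∈ S →
      b ∈ S ∧ ReflTransGen (fun p q => r p q ∧ p ∈ S ∧ q ∈ S) a b := by
    intro a b hab ha
    induction hab with
    | refl => exact ⟨ha, .refl⟩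
    | tail _ hbc ih => exact ⟨h _ _ hbc ih.1, ih.2.tail ⟨hbc, ih.1, h _ _ hbc ih.1⟩⟩
  have stay' : ∀ {a b}, ReflTransGen r a b → b ∉ S →
      a ∉ S ∧ ReflTransGen (fun p q => r p q ∧ p ∉ S ∧ q ∉ S) a b := by
    intro a b hab ha
    induction hab using ReflTransGen.head_induction_on with
    | refl => exact ⟨ha, .refl⟩
    | head hbc _ ih =>
      have := fun hs => ih.1 (h _ _ hbc hs)
      exact ⟨this, ih.2.head ⟨hbc, this, ih.1⟩⟩
  by_cases hq : q ∈ S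
  · obtain ⟨hp, h3⟩ := stay hqp hq
    exact h1 p q ⟨hpq, hp, hq⟩ h3
  · have hp : p ∉ S := fun hp => hq (h _ _ hpq hp)
    exact h2 p q ⟨hpq, hp, hq⟩ (stay' hqp hp).2

theorem good_cut {D : Dgraph} (hD : D.WF) {X : Finset ℕ} {φ ψ : ℕ → Fin k}
    (hφ : (D.pc (D.verts ∩ X) ∅).Good φ) (hψ : (D.pc (D.verts \ X) ∅).Good ψ)
    (h : ∀ a ∈ D.dicutArcs X, φ a.1 ≠ ψ a.2) :
    D.Good (fun x => if x ∈ X then φ x else ψ x) := by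
  refine acy_cut (S := X) ?_ (Acy.mono ?_ hφ) (Acy.mono ?_ hψ)
  · rintro p q ⟨hpq, hc⟩ hp
    by_contra hq
    simp only [if_pos hp, if_neg hq] at hc
    exact h (p, q) (mem_cut.2 ⟨hpq, hp, hq⟩) hc
  · rintro p q ⟨⟨hpq, hc⟩, hp, hq⟩
    simp only [if_pos hp, if_pos hq] at hc
    have := hD _ hpq
    exact ⟨by simp [hpq, hp, hq, this.1, this.2.1], hc⟩
  · rintro p q ⟨⟨hpq, hc⟩, hp, hq⟩
    simp only [if_neg hp, if_neg hq] at hc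
    have := hD _ hpq
    exact ⟨by simp [hpq, hp, hq, this.1, this.2.1], hc⟩

theorem Crit.noavoid {D : Dgraph} (h : Crit k D) {X : Finset ℕ} {φ ψ : ℕ → Fin k}
    (hφ : (D.pc (D.verts ∩ X) ∅).Good φ) (hψ : (D.pc (D.verts \ X) ∅).Good ψ)
    (σ : Equiv.Perm (Fin k)) : ∃ a ∈ D.dicutArcs X, σ (φ a.1) = ψ a.2 := by
  by_contra hc
  push Not at hc
  exact h.nc ⟨_, good_cut h.wf (hφ.perm σ) hψ hc⟩

theorem Crit.cut_ge {D : Dgraph} (hk : 2 ≤ k) (h : Crit k D) {X : Finset ℕ}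
    (h1 : ∃ x ∈ D.verts, x ∈ X) (h2 : ∃ x ∈ D.verts, x ∉ X) : k ≤ D.dO X := by
  obtain ⟨φ, hφ⟩ := h.col_ind (S := D.verts ∩ X)
    (by obtain ⟨x, hx, hx'⟩ := h2; exact ⟨x, hx, by simp [hx']⟩)
  obtain ⟨ψ, hψ⟩ := h.col_ind (S := D.verts \ X)
    (by obtain ⟨x, hx, hx'⟩ := h1; exact ⟨x, hx, by simp [hx']⟩)
  exact (perm_lemma hk _ (fun a => φ a.1) (fun a => ψ a.2) (h.noavoid hφ hψ)).1

theorem Crit.rowcol {D : Dgraph} (hk : 2 ≤ k) (h : Crit k D) {X : Finset ℕ} (hX : D.dO X = k)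
    {φ ψ : ℕ → Fin k}
    (hφ : (D.pc (D.verts ∩ X) ∅).Good φ) (hψ : (D.pc (D.verts \ X) ∅).Good ψ) :
    (∀ a ∈ D.dicutArcs X, ∀ b ∈ D.dicutArcs X, φ a.1 = φ b.1 ∧ (a ≠ b → ψ a.2 ≠ ψ b.2)) ∨
    (∀ a ∈ D.dicutArcs X, ∀ b ∈ D.dicutArcs X, ψ a.2 = ψ b.2 ∧ (a ≠ b → φ a.1 ≠ φ b.1)) :=
  (perm_lemma hk _ (fun a => φ a.1) (fun a => ψ a.2) (h.noavoid hφ hψ)).2 hX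

def arc (D : Dgraph) (p q : ℕ) : Prop := (p, q) ∈ D.arcs

/-- all cuts are nonempty -/
def Cut1 (D : Dgraph) : Prop :=
  ∀ a ∈ D.verts, ∀ b ∈ D.verts, ReflTransGen D.arc a b

theorem cut1_of {D : Dgraph} (hD : D.WF)
    (h : ∀ X ⊆ D.verts, (∃ x ∈ D.verts, x ∈ X) → (∃ x ∈ D.verts, x ∉ X) →
      ∃ p q, (p, q) ∈ D.arcs ∧ p ∈ X ∧ q ∉ X) : D.Cut1 := by
  classical
  intro a ha b hb
  by_contra hc
  obtain ⟨p, q, hpq, hp, hq⟩ := h (D.verts.filter fun x => ReflTransGen D.arc a x)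
    (Finset.filter_subset _ _) ⟨a, ha, by simp [ha, ReflTransGen.refl]⟩ ⟨b, hb, by simp [hc]⟩
  simp only [Finset.mem_filter] at hp hq
  exact hq ⟨(hD _ hpq).2.1, hp.2.tail hpq⟩

theorem Crit.cut1 {D : Dgraph} (hk : 2 ≤ k) (h : Crit k D) : D.Cut1 := by
  refine cut1_of h.wf fun X _ h1 h2 => ?_
  have := h.cut_ge hk h1 h2
  have : 0 < (D.dicutArcs X).card := by unfold dO at this; omega
  obtain ⟨⟨p, q⟩, ha⟩ := Finset.card_pos.1 this
  rw [mem_cut] at ha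
  exact ⟨p, q, ha⟩

/-- a path leaving a set crosses its boundary -/
theorem exit_arc {r : ℕ → ℕ → Prop} {a b : ℕ} (h : ReflTransGen r a b) {X : Finset ℕ}
    (ha : a ∈ X) (hb : b ∉ X) : ∃ p q, r p q ∧ p ∈ X ∧ q ∉ X := by
  induction h with
  | refl => exact absurd ha hb
  | @tail b c _ hbc ih =>
    by_cases h : b ∈ X
    · exact ⟨b, c, hbc, h, hb⟩
    · exact ih h

def NoCut (D : Dgraph) : Prop :=
  ∀ z ∈ D.verts, ∀ N ⊆ D.verts, N.Nonempty → z ∉ N → (∃ y ∈ D.verts, y ≠ z ∧ y ∉ N) →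
    ∃ p ∈ N, ∃ q ∈ D.verts, q ≠ z ∧ q ∉ N ∧ D.adj p q

theorem Crit.nocut {D : Dgraph} (h : Crit k D) : D.NoCut := by
  intro z hz N hN ⟨n, hn⟩ hzN ⟨y, hy, hyz, hyN⟩
  by_contra hc
  push Not at hc
  let M := (D.verts \ N).erase z
  have hyM : y ∈ M := by simp [M, hy, hyz, hyN]
  have memM : ∀ q, q ∈ M → q ∈ D.verts ∧ q ≠ z ∧ q ∉ N := by
    intro q hq; simp [M] at hq; exact ⟨hq.2.1, hq.1, hq.2.2⟩
  have S : Sep D z N M n n y y := by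
    refine ⟨h.wf, ?_, ?_, hzN, by simp [M], hn, hn, hyM, hyM, ?_, ?_⟩
    · ext x
      simp only [M, Finset.mem_insert, Finset.mem_union, Finset.mem_erase, Finset.mem_sdiff]
      have := @hN x
      by_cases x = z <;> by_cases x ∈ N <;> simp_all
    · rw [Finset.disjoint_left]; intro x hx hx'; exact (memM x hx').2.2 hx
    · intro p hp q hq hpq
      exact absurd (Or.inl hpq) (hc p hp q (memM q hq).1 (memM q hq).2.1 (memM q hq).2.2)
    · intro p hp q hq hpq
      exact absurd (Or.inr hpq) (hc q hq p (memM p hp).1 (memM p hp).2.1 (memM p hp).2.2)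
  have no1 : (n, y) ∉ D.arcs := fun h' => hc n hn y hy hyz hyN (Or.inl h')
  have no2 : (y, n) ∉ D.arcs := fun h' => hc n hn y hy hyz hyN (Or.inr h')
  obtain ⟨φ, hφ⟩ := h.col_ind (S := insert z N) ⟨y, hy, by simp [hyz, hyN]⟩
  obtain ⟨ψ, hψ⟩ := h.col_ind (S := insert z M) ⟨n, hN hn, by
    simp only [Finset.mem_insert, not_or]
    exact ⟨by rintro rfl; exact hzN hn, fun h' => (memM n h').2.2 hn⟩⟩
  obtain ⟨θ, _, hθ, _⟩ := combine S hφ hψ (fun h => absurd h no1) (fun h => absurd h no2)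
    (fun h => absurd h no1) (fun h => absurd h no1)
  exact h.nc ⟨θ, hθ⟩

/-! ### Ear lemma -/

def Le (H D : Dgraph) : Prop := H.verts ⊆ D.verts ∧ H.arcs ⊆ D.arcs

def arcOff (Q H : Dgraph) (p q : ℕ) : Prop := (p, q) ∈ Q.arcs ∧ (p, q) ∉ H.arcs

theorem ear_nopath (hk : 2 ≤ k) {Q H : Dgraph} (hcc : CC k Q) (hH : Crit k H) (hle : Le H Q)
    {h h' : ℕ} (hh : h ∈ H.verts) (hh' : h' ∈ H.verts) (hp : ReflTransGen (arcOff Q H) h h') :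
    h = h' := by
  by_contra hne
  obtain ⟨X, h1, h2, h3⟩ := hcc h (hle.1 hh) h' (hle.1 hh') hne
  obtain ⟨p, q, hpq, hpX, hqX⟩ := exit_arc hp h1 h2
  have h4 := hH.cut_ge hk ⟨h, hh, h1⟩ ⟨h', hh', h2⟩
  have hsub : H.dicutArcs X ⊆ Q.dicutArcs X := by
    intro a ha; rw [mem_cut] at ha ⊢; exact ⟨hle.2 ha.1, ha.2⟩
  have heq := Finset.eq_of_subset_of_card_le hsub (by unfold dO at h3 h4; omega)
  have : (p, q) ∈ H.dicutArcs X := by rw [heq, mem_cut]; exact ⟨hpq.1, hpX, hqX⟩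
  exact hpq.2 (mem_cut.1 this).1

theorem ear_arcs (hk : 2 ≤ k) {Q H : Dgraph} (hQ : Q.WF) (hcc : CC k Q) (hH : Crit k H)
    (hle : Le H Q) {a : ℕ × ℕ} (ha : a ∈ Q.arcs) (h1 : a.1 ∈ H.verts) (h2 : a.2 ∈ H.verts) :
    a ∈ H.arcs := by
  by_contra hn
  exact (hQ a ha).2.2 (ear_nopath hk hcc hH hle h1 h2 (.single ⟨ha, hn⟩))

theorem first_hit {r : ℕ → ℕ → Prop} {a b : ℕ} (h : ReflTransGen r a b) {S : Finset ℕ}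
    (hb : b ∈ S) : ∃ s ∈ S, ReflTransGen (fun p q => r p q ∧ p ∉ S) a s := by
  induction h using ReflTransGen.head_induction_on with
  | refl => exact ⟨b, hb, .refl⟩
  | @head a c hac _ ih =>
    by_cases ha : a ∈ S
    · exact ⟨a, ha, .refl⟩
    · obtain ⟨s, hs, h⟩ := ih
      exact ⟨s, hs, h.head ⟨hac, ha⟩⟩

theorem last_hit {r : ℕ → ℕ → Prop} {a b : ℕ} (h : ReflTransGen r a b) {S : Finset ℕ}
    (ha : a ∈ S) : ∃ s ∈ S, ReflTransGen (fun p q => r p q ∧ q ∉ S) s b := by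
  induction h with
  | refl => exact ⟨a, ha, .refl⟩
  | @tail b c _ hbc ih =>
    by_cases hc : c ∈ S
    · exact ⟨c, hc, .refl⟩
    · obtain ⟨s, hs, h⟩ := ih
      exact ⟨s, hs, h.tail ⟨hbc, hc⟩⟩

theorem Crit.nonempty (hk : 1 ≤ k) {D : Dgraph} (h : Crit k D) : ∃ a, a ∈ D.arcs := by
  by_contra hc
  push Not at hc
  exact h.nc ⟨fun _ => ⟨0, hk⟩, fun p q hpq => absurd hpq.1 (hc _)⟩

theorem ear (hk : 2 ≤ k) {Q H : Dgraph} (hQ : Q.WF) (hcc : CC k Q) (hs : Q.Cut1) (hH : Crit k H)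
    (hle : Le H Q) {w : ℕ} (hw : w ∈ Q.verts) (hwH : w ∉ H.verts) :
    ∃ z ∈ H.verts, ∃ N ⊆ Q.verts, w ∈ N ∧ (∀ x ∈ N, x ∉ H.verts) ∧
      ∀ p ∈ N, ∀ q ∈ Q.verts, q ≠ z → q ∉ N → ¬ Q.adj p q := by
  classical
  obtain ⟨a0, ha0⟩ := hH.nonempty (by omega)
  have hh0 := (hH.wf _ ha0).1
  have out : ∀ x ∈ Q.verts, ∃ h ∈ H.verts, ReflTransGen (arcOff Q H) x h := by
    intro x hx
    obtain ⟨s, hs, h⟩ := first_hit (hs x hx _ (hle.1 hh0)) hh0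
    exact ⟨s, hs, ReflTransGen.mono (fun p q hpq => ⟨hpq.1, fun h' => hpq.2 (hH.wf _ h').1⟩) _ _ h⟩
  have inn : ∀ x ∈ Q.verts, ∃ h ∈ H.verts, ReflTransGen (arcOff Q H) h x := by
    intro x hx
    obtain ⟨s, hs, h⟩ := last_hit (hs _ (hle.1 hh0) x hx) hh0
    exact ⟨s, hs, ReflTransGen.mono
      (fun p q hpq => ⟨hpq.1, fun h' => hpq.2 (hH.wf _ h').2.1⟩) _ _ h⟩
  have key := @ear_nopath k hk Q H hcc hH hle
  obtain ⟨z, hz, hwz⟩ := out w hw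
  refine ⟨z, hz, Q.verts.filter fun x => x ∉ H.verts ∧ ReflTransGen (arcOff Q H) x z,
    Finset.filter_subset _ _, by simp [hw, hwH, hwz], by simp +contextual, ?_⟩
  intro p hp q hq hqz hqN hadj
  simp only [Finset.mem_filter] at hp hqN
  obtain ⟨hpV, hpH, hpz⟩ := hp
  -- p is attached to z on the in-side too
  obtain ⟨z1, hz1, hzp⟩ := inn p hpV
  have := key hz1 hz (hzp.trans hpz); subst this
  obtain ⟨h, hh, hqh⟩ := out q hq
  obtain ⟨h', hh', hhq⟩ := inn q hq
  have e := key hh' hh (hhq.trans hqh); subst e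
  rcases hadj with ha | ha
  · have hoff : arcOff Q H p q := ⟨ha, fun h' => hpH (hH.wf _ h').1⟩
    have := key hz1 hh' ((hzp.tail hoff).trans hqh); subst this
    by_cases hqH : q ∈ H.verts
    · exact hqz (key hz1 hqH (hzp.tail hoff)).symm
    · exact hqN ⟨hq, hqH, hqh⟩
  · have hoff : arcOff Q H q p := ⟨ha, fun h' => hpH (hH.wf _ h').2.1⟩
    by_cases hqH : q ∈ H.verts
    · exact hqz (key hqH hz (hpz.head hoff))
    · exact hqN ⟨hq, hqH, hpz.head hoff⟩

theorem eq_of_ear (hk : 2 ≤ k) {Q H : Dgraph} (hQ : Q.WF) (hcc : CC k Q) (hs : Q.Cut1)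
    (hn : Q.NoCut) (hH : Crit k H) (hle : Le H Q) : H = Q := by
  have hv : H.verts = Q.verts := by
    refine Finset.Subset.antisymm hle.1 fun w hw => ?_
    by_contra hwH
    obtain ⟨z, hz, N, hN, hwN, hNH, hno⟩ := ear hk hQ hcc hs hH hle hw hwH
    obtain ⟨a, ha⟩ := hH.nonempty (by omega)
    have hwf := hH.wf a ha
    have : ∃ y ∈ Q.verts, y ≠ z ∧ y ∉ N := by
      by_cases h1 : a.1 = z
      · exact ⟨a.2, hle.1 hwf.2.1, fun h => hwf.2.2 (h1.trans h.symm), fun h => hNH _ h hwf.2.1⟩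
      · exact ⟨a.1, hle.1 hwf.1, h1, fun h => hNH _ h hwf.1⟩
    obtain ⟨p, hp, q, hq, hqz, hqN, hadj⟩ := hn z (hle.1 hz) N hN ⟨w, hwN⟩
      (fun h => hNH z h hz) this
    exact hno p hp q hq hqz hqN hadj
  have ha : H.arcs = Q.arcs := by
    refine Finset.Subset.antisymm hle.2 fun a ha => ?_
    exact ear_arcs hk hQ hcc hH hle ha (hv ▸ (hQ a ha).1) (hv ▸ (hQ a ha).2.1)
  cases H; cases Q; simp_all

theorem ext_of (hk : 2 ≤ k) {Q : Dgraph} (hQ : Q.WF) (hnc : ¬ Q.Col k) (hcc : CC k Q)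
    (hs : Q.Cut1) (hn : Q.NoCut) : Ext k Q := by
  obtain ⟨H, hH, hle⟩ := exists_crit hQ hnc
  have := eq_of_ear hk hQ hcc hs hn hH hle
  subst this
  exact ⟨hH, hcc⟩

/-- a critical subdigraph of a CC graph satisfies CC -/
theorem CC.sub {Q H : Dgraph} (hcc : CC k Q) (hle : Le H Q) : CC k H := by
  intro u hu v hv huv
  obtain ⟨X, h1, h2, h3⟩ := hcc u (hle.1 hu) v (hle.1 hv) huv
  refine ⟨X, h1, h2, le_trans (Finset.card_le_card ?_) h3⟩
  intro a ha; rw [mem_cut] at ha ⊢; exact ⟨hle.2 ha.1, ha.2⟩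

end Dgraph

namespace Dgraph

open Relation

variable {k : ℕ}

/-! ### Cuts and the Eulerian property -/

theorem dO_eq_sum (D : Dgraph) (X : Finset ℕ) :
    D.dO X = ∑ a ∈ D.arcs, if a.1 ∈ X ∧ a.2 ∉ X then 1 else 0 := by
  unfold dO dicutArcs; rw [Finset.card_filter]

theorem dI_eq_sum (D : Dgraph) (X : Finset ℕ) :
    D.dI X = ∑ a ∈ D.arcs, if a.1 ∉ X ∧ a.2 ∈ X then 1 else 0 := by
  unfold dI; rw [Finset.card_filter]

theorem dO_submod (D : Dgraph) (X Y : Finset ℕ) :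
    D.dO (X ∪ Y) + D.dO (X ∩ Y) ≤ D.dO X + D.dO Y := by
  simp only [dO_eq_sum, ← Finset.sum_add_distrib]
  refine Finset.sum_le_sum fun a _ => ?_
  simp only [Finset.mem_union, Finset.mem_inter]
  by_cases h1 : a.1 ∈ X <;> by_cases h2 : a.1 ∈ Y <;> by_cases h3 : a.2 ∈ X <;>
    by_cases h4 : a.2 ∈ Y <;> simp [h1, h2, h3, h4]

theorem dI_submod (D : Dgraph) (X Y : Finset ℕ) :
    D.dI (X ∪ Y) + D.dI (X ∩ Y) ≤ D.dI X + D.dI Y := by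
  simp only [dI_eq_sum, ← Finset.sum_add_distrib]
  refine Finset.sum_le_sum fun a _ => ?_
  simp only [Finset.mem_union, Finset.mem_inter]
  by_cases h1 : a.1 ∈ X <;> by_cases h2 : a.1 ∈ Y <;> by_cases h3 : a.2 ∈ X <;>
    by_cases h4 : a.2 ∈ Y <;> simp [h1, h2, h3, h4]

/-- the cut depends only on the trace on the vertex set; in-cuts are out-cuts of complements -/
theorem dI_eq_dO {D : Dgraph} (hD : D.WF) {X Y : Finset ℕ}
    (h : ∀ x ∈ D.verts, x ∈ X ↔ x ∉ Y) : D.dI X = D.dO Y := by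
  unfold dI dO dicutArcs
  congr 1
  apply Finset.filter_congr
  intro a ha
  rw [h _ (hD a ha).1, h _ (hD a ha).2.1]
  simp

theorem dO_congr {D : Dgraph} (hD : D.WF) {X Y : Finset ℕ}
    (h : ∀ x ∈ D.verts, x ∈ X ↔ x ∈ Y) : D.dO X = D.dO Y := by
  unfold dO dicutArcs
  congr 1
  apply Finset.filter_congr
  intro a ha
  rw [h _ (hD a ha).1, h _ (hD a ha).2.1]

theorem dI_congr {D : Dgraph} (hD : D.WF) {X Y : Finset ℕ}
    (h : ∀ x ∈ D.verts, x ∈ X ↔ x ∈ Y) : D.dI X = D.dI Y := by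
  unfold dI
  congr 1
  apply Finset.filter_congr
  intro a ha
  rw [h _ (hD a ha).1, h _ (hD a ha).2.1]

def exc (D : Dgraph) (w : ℕ) : ℤ := (D.indeg w : ℤ) - D.outdeg w

theorem exc_sum (D : Dgraph) (S : Finset ℕ) :
    ∑ w ∈ S, D.exc w = (D.dI S : ℤ) - D.dO S := by
  have h1 : ∑ w ∈ S, D.indeg w = ∑ a ∈ D.arcs, if a.2 ∈ S then 1 else 0 := by
    unfold indeg
    simp only [Finset.card_filter]
    rw [Finset.sum_comm]
    refine Finset.sum_congr rfl fun a _ => ?_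
    simp
  have h2 : ∑ w ∈ S, D.outdeg w = ∑ a ∈ D.arcs, if a.1 ∈ S then 1 else 0 := by
    unfold outdeg
    simp only [Finset.card_filter]
    rw [Finset.sum_comm]
    refine Finset.sum_congr rfl fun a _ => ?_
    simp
  have h3 : ∑ w ∈ S, D.exc w = ((∑ w ∈ S, D.indeg w : ℕ) : ℤ) - (∑ w ∈ S, D.outdeg w : ℕ) := by
    unfold exc; push_cast; rw [Finset.sum_sub_distrib]
  rw [h3, h1, h2, dO_eq_sum, dI_eq_sum]
  push_cast
  rw [← Finset.sum_sub_distrib, ← Finset.sum_sub_distrib]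
  refine Finset.sum_congr rfl fun a _ => ?_
  by_cases h1 : a.1 ∈ S <;> by_cases h2 : a.2 ∈ S <;> simp [h1, h2]

theorem Crit.in_ge {D : Dgraph} (hk : 2 ≤ k) (h : Crit k D) {X : Finset ℕ}
    (h1 : ∃ x ∈ D.verts, x ∈ X) (h2 : ∃ x ∈ D.verts, x ∉ X) : k ≤ D.dI X := by
  rw [dI_eq_dO (Y := D.verts \ X) h.wf (by intro x hx; simp [hx])]
  obtain ⟨x, hx, hx'⟩ := h1
  obtain ⟨y, hy, hy'⟩ := h2
  exact h.cut_ge hk ⟨y, hy, by simp [hy, hy']⟩ ⟨x, hx, by simp [hx']⟩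

theorem Ext.exc_nonneg {D : Dgraph} (hk : 2 ≤ k) (h : Ext k D) {u : ℕ} (hu : u ∈ D.verts) :
    0 ≤ D.exc u := by
  classical
  let V' := D.verts.erase u
  let 𝒜 : Finset (Finset ℕ) := V'.powerset.filter fun A => A.Nonempty ∧ D.dI A = k
  have mem𝒜 : ∀ A, A ∈ 𝒜 ↔ A ⊆ V' ∧ A.Nonempty ∧ D.dI A = k := by intro A; simp [𝒜]
  have ge : ∀ A ⊆ V', A.Nonempty → k ≤ D.dI A ∧ k ≤ D.dO A := by
    intro A hA ⟨a, ha⟩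
    have h1 : ∃ x ∈ D.verts, x ∈ A := ⟨a, Finset.mem_of_mem_erase (hA ha), ha⟩
    have h2 : ∃ x ∈ D.verts, x ∉ A := ⟨u, hu, fun hx => by simpa [V'] using hA hx⟩
    exact ⟨h.in_ge hk h1 h2, h.cut_ge hk h1 h2⟩
  have cover : ∀ w ∈ V', ∃ A ∈ 𝒜, w ∈ A := by
    intro w hw
    have hw' := Finset.mem_erase.1 hw
    obtain ⟨X, h1, h2, h3⟩ := h.cc u hu w hw'.2 hw'.1.symm
    have hsub : D.verts \ X ⊆ V' := by
      intro x hx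
      simp only [Finset.mem_sdiff] at hx
      exact Finset.mem_erase.2 ⟨by rintro rfl; exact hx.2 h1, hx.1⟩
    have hwX : w ∈ D.verts \ X := by simp [hw'.2, h2]
    refine ⟨D.verts \ X, (mem𝒜 _).2 ⟨hsub, ⟨w, hwX⟩, ?_⟩, hwX⟩
    have := (ge _ hsub ⟨w, hwX⟩).1
    rw [dI_eq_dO (Y := X) h.wf (by intro x hx; simp [hx])] at this ⊢
    omega
  have join : ∀ A ∈ 𝒜, ∀ B ∈ 𝒜, (A ∩ B).Nonempty → A ∪ B ∈ 𝒜 := by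
    intro A hA B hB hAB
    rw [mem𝒜] at hA hB ⊢
    have hs := Finset.union_subset hA.1 hB.1
    have hne : (A ∪ B).Nonempty := hA.2.1.mono Finset.subset_union_left
    refine ⟨hs, hne, ?_⟩
    have h1 := (ge _ hs hne).1
    have h2 := (ge _ (Finset.inter_subset_left.trans hA.1) hAB).1
    have h3 := D.dI_submod A B
    omega
  obtain ⟨U, hU, hmax⟩ := Finset.exists_max_image
    (V'.powerset.filter fun U => ∑ w ∈ U, D.exc w ≤ 0 ∧ ∀ A ∈ 𝒜, (A ∩ U).Nonempty → A ⊆ U)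
    Finset.card ⟨∅, by simp⟩
  simp only [Finset.mem_filter, Finset.mem_powerset] at hU hmax
  obtain ⟨hU1, hU2, hU3⟩ := hU
  have hUV : U = V' := by
    refine Finset.Subset.antisymm hU1 fun w hw => ?_
    by_contra hwU
    obtain ⟨A0, hA0, hwA0⟩ := cover w hw
    obtain ⟨A, hA, hAmax⟩ := Finset.exists_max_image (𝒜.filter fun A => w ∈ A) Finset.card
      ⟨A0, by simp [hA0, hwA0]⟩
    simp only [Finset.mem_filter] at hA hAmax
    obtain ⟨hA, hwA⟩ := hA
    have hdis : Disjoint U A := by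
      rw [Finset.disjoint_iff_inter_eq_empty]
      by_contra hne
      have : (A ∩ U).Nonempty := by
        rw [Finset.inter_comm]; exact Finset.nonempty_iff_ne_empty.2 hne
      exact hwU (hU3 A hA this hwA)
    have hA' := (mem𝒜 A).1 hA
    have := hmax (U ∪ A) ⟨Finset.union_subset hU1 hA'.1, ?_, ?_⟩
    · have h1 : U.card < (U ∪ A).card := Finset.card_lt_card
        ⟨Finset.subset_union_left, fun h => hwU (h (by simp [hwA]))⟩
      omega
    · rw [Finset.sum_union hdis, D.exc_sum A]
      have := (ge A hA'.1 hA'.2.1).2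
      have := hA'.2.2
      omega
    · intro B hB hBU
      by_cases hB1 : (B ∩ U).Nonempty
      · exact (hU3 B hB hB1).trans Finset.subset_union_left
      · have hB2 : (A ∩ B).Nonempty := by
          obtain ⟨x, hx⟩ := hBU
          simp only [Finset.mem_inter, Finset.mem_union] at hx
          rcases hx.2 with h | h
          · exact absurd ⟨x, by simp [hx.1, h]⟩ hB1
          · exact ⟨x, by simp [hx.1, h]⟩
        have hj := hAmax _ ⟨join A hA B hB hB2, by simp [hwA]⟩
        have : A = A ∪ B := Finset.eq_of_subset_of_card_le Finset.subset_union_left hj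
        have hBA : B ⊆ A := by rw [this]; exact Finset.subset_union_right
        exact hBA.trans Finset.subset_union_right
  have htot : ∑ w ∈ D.verts, D.exc w = 0 := by
    rw [exc_sum]
    have e1 : D.dI D.verts = 0 := by
      unfold dI; rw [Finset.card_eq_zero, Finset.filter_eq_empty_iff]
      intro a ha hc; exact hc.1 (h.wf a ha).1
    have e2 : D.dO D.verts = 0 := by
      unfold dO dicutArcs; rw [Finset.card_eq_zero, Finset.filter_eq_empty_iff]
      intro a ha hc; exact hc.2 (h.wf a ha).2.1
    rw [e1, e2]; simp
  rw [← Finset.add_sum_erase _ _ hu] at htot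
  rw [hUV] at hU2
  simp only [V'] at hU2
  omega

theorem Ext.exc_zero {D : Dgraph} (hk : 2 ≤ k) (h : Ext k D) {u : ℕ} (hu : u ∈ D.verts) :
    D.exc u = 0 := by
  have htot : ∑ w ∈ D.verts, D.exc w = 0 := by
    rw [exc_sum]
    have e1 : D.dI D.verts = 0 := by
      unfold dI; rw [Finset.card_eq_zero, Finset.filter_eq_empty_iff]
      intro a ha hc; exact hc.1 (h.wf a ha).1
    have e2 : D.dO D.verts = 0 := by
      unfold dO dicutArcs; rw [Finset.card_eq_zero, Finset.filter_eq_empty_iff]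
      intro a ha hc; exact hc.2 (h.wf a ha).2.1
    rw [e1, e2]; simp
  exact (Finset.sum_eq_zero_iff_of_nonneg fun w hw => h.exc_nonneg hk hw).1 htot u hu

theorem Ext.deg_eq {D : Dgraph} (hk : 2 ≤ k) (h : Ext k D) {u : ℕ} (hu : u ∈ D.verts) :
    D.indeg u = D.outdeg u := by
  have := h.exc_zero hk hu
  unfold exc at this; omega

theorem Ext.dI_eq {D : Dgraph} (hk : 2 ≤ k) (h : Ext k D) (X : Finset ℕ) : D.dI X = D.dO X := by
  have e : ∀ x ∈ D.verts, x ∈ X ↔ x ∈ X ∩ D.verts := by intro x hx; simp [hx]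
  rw [dI_congr h.wf e, dO_congr h.wf e]
  have := D.exc_sum (X ∩ D.verts)
  rw [Finset.sum_eq_zero fun w hw => h.exc_zero hk (Finset.mem_inter.1 hw).2] at this
  omega

theorem outdeg_eq {D : Dgraph} (hD : D.WF) (v : ℕ) : D.outdeg v = D.dO {v} := by
  unfold outdeg dO dicutArcs
  congr 1
  apply Finset.filter_congr
  intro a ha
  have := (hD a ha).2.2
  simp only [Finset.mem_singleton]
  constructor
  · intro h; exact ⟨h, by rw [← h]; exact this.symm⟩
  · exact fun h => h.1

theorem indeg_eq {D : Dgraph} (hD : D.WF) (v : ℕ) : D.indeg v = D.dI {v} := by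
  unfold indeg dI
  congr 1
  apply Finset.filter_congr
  intro a ha
  have := (hD a ha).2.2
  simp only [Finset.mem_singleton]
  constructor
  · intro h; exact ⟨by rw [← h]; exact this, h⟩
  · exact fun h => h.2

theorem Crit.other (hk : 1 ≤ k) {D : Dgraph} (h : Crit k D) (v : ℕ) :
    ∃ y ∈ D.verts, y ≠ v := by
  obtain ⟨a, ha⟩ := h.nonempty hk
  have := h.wf a ha
  by_cases h1 : a.1 = v
  · exact ⟨a.2, this.2.1, fun h => this.2.2 (h1.trans h.symm)⟩
  · exact ⟨a.1, this.1, h1⟩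

theorem Crit.outdeg_ge {D : Dgraph} (hk : 2 ≤ k) (h : Crit k D) {v : ℕ} (hv : v ∈ D.verts) :
    k ≤ D.outdeg v := by
  rw [outdeg_eq h.wf]
  obtain ⟨y, hy, hyv⟩ := h.other (by omega) v
  exact h.cut_ge hk ⟨v, hv, by simp⟩ ⟨y, hy, by simp [hyv]⟩

theorem Crit.indeg_ge {D : Dgraph} (hk : 2 ≤ k) (h : Crit k D) {v : ℕ} (hv : v ∈ D.verts) :
    k ≤ D.indeg v := by
  rw [indeg_eq h.wf]
  obtain ⟨y, hy, hyv⟩ := h.other (by omega) v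
  exact h.in_ge hk ⟨v, hv, by simp⟩ ⟨y, hy, by simp [hyv]⟩

/-- reversing all arcs -/
def rev (D : Dgraph) : Dgraph := ⟨D.verts, D.arcs.image Prod.swap⟩

end Dgraph

namespace Dgraph

open Relation

variable {k : ℕ}

def HStr (D : Dgraph) (v : ℕ) (A B : Finset ℕ) (t u : ℕ) : Prop :=
  Sep D v A B t t u u ∧ (t, u) ∈ D.arcs ∧ (u, t) ∉ D.arcs

def HasH (D : Dgraph) : Prop := ∃ v A B t u, HStr D v A B t u

def Bij (D : Dgraph) (v : ℕ) (A B : Finset ℕ) (t w u w' : ℕ) : Prop :=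
  Sep D v A B t w u w' ∧ (t, u) ∈ D.arcs ∧ (w', w) ∈ D.arcs

theorem Bij.symm {D : Dgraph} {v A B t w u w'} (h : Bij D v A B t w u w') :
    Bij D v B A w' u w t := ⟨h.1.symm, h.2.2, h.2.1⟩

namespace Sep

variable {D : Dgraph} {v : ℕ} {A B : Finset ℕ} {t w u w' : ℕ}

theorem verts_split {V N I : Finset ℕ} {z : ℕ} (h : insert z I ⊆ V) (hN : N ⊆ insert z I) :
    V = insert z (N ∪ V \ insert z N) := by
  ext x
  have h1 : x = z → x ∈ V := fun e => h (by simp [e])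
  have h2 : x ∈ N → x ∈ V := fun e => h (hN e)
  simp only [Finset.mem_insert, Finset.mem_union, Finset.mem_sdiff]
  by_cases e : x = z
  · subst e; simp [h1 rfl]
  · by_cases e' : x ∈ N
    · simp [e', h2 e']
    · simp [e, e']

theorem AV (S : Sep D v A B t w u w') : insert v A ⊆ D.verts := by
  rw [S.verts]; exact Finset.insert_subset_insert _ Finset.subset_union_left

theorem vV (S : Sep D v A B t w u w') : v ∈ D.verts := by rw [S.verts]; simp

theorem notA (S : Sep D v A B t w u w') {x : ℕ} (hx : x ∈ B) : x ∉ insert v A := by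
  simp only [Finset.mem_insert, not_or]
  exact ⟨by rintro rfl; exact S.vB hx, fun h => Finset.disjoint_left.1 S.disj h hx⟩

theorem memV (S : Sep D v A B t w u w') {x : ℕ} : x ∈ D.verts ↔ x = v ∨ x ∈ A ∨ x ∈ B := by
  rw [S.verts]; simp

theorem card_lt (S : Sep D v A B t w u w') : (insert v A).card < D.verts.card :=
  Finset.card_lt_card ⟨S.AV, fun h => S.notA S.uB (h (by rw [S.memV]; exact Or.inr (Or.inr S.uB)))⟩

theorem colA (S : Sep D v A B t w u w') (h : Crit k D) : (D.pc (insert v A) ∅).Col k :=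
  h.col_ind ⟨u, by rw [S.memV]; exact Or.inr (Or.inr S.uB), S.notA S.uB⟩

/-- from every vertex of `A` one reaches `v` inside `A ∪ v`. -/
theorem reach_v (S : Sep D v A B t w u w') (hk : 2 ≤ k) (h : Crit k D) {a : ℕ} (ha : a ∈ A) :
    ReflTransGen (D.pc (insert v A) ∅).arc a v := by
  classical
  by_contra hc
  let X := A.filter fun x => ReflTransGen (D.pc (insert v A) ∅).arc a x
  have haX : a ∈ X := by simp [X, ha, ReflTransGen.refl]
  have h1 := h.cut_ge hk (X := X) ⟨a, S.AV (by simp [ha]), haX⟩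
    ⟨v, S.vV, by simp [X, S.vA]⟩
  have h2 : D.dicutArcs X ⊆ {(t, u)} := by
    rintro ⟨p, q⟩ hpq
    rw [mem_cut] at hpq
    obtain ⟨hpq, hp, hq⟩ := hpq
    simp only [X, Finset.mem_filter] at hp hq
    rcases S.memV.1 (S.wf _ hpq).2.1 with rfl | hqA | hqB
    · exact absurd (hp.2.tail (by simp [arc, hpq, hp.1])) hc
    · exact absurd ⟨hqA, hp.2.tail (by simp only [arc, mem_pc]; exact Or.inl ⟨hpq, by simp [hp.1], by simp [hqA]⟩)⟩ hq
    · obtain ⟨rfl, rfl⟩ := S.cAB p hp.1 q hqB hpq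
      simp
  have := Finset.card_le_card h2
  unfold dO at h1
  simp at this; omega

theorem v_reach (S : Sep D v A B t w u w') (hk : 2 ≤ k) (h : Crit k D) {a : ℕ} (ha : a ∈ A) :
    ReflTransGen (D.pc (insert v A) ∅).arc v a := by
  classical
  by_contra hc
  let X := A.filter fun x => ReflTransGen (D.pc (insert v A) ∅).arc x a
  have haX : a ∈ X := by simp [X, ha, ReflTransGen.refl]
  have h1 := h.in_ge hk (X := X) ⟨a, S.AV (by simp [ha]), haX⟩
    ⟨v, S.vV, by simp [X, S.vA]⟩
  have h2 : (D.arcs.filter fun a => a.1 ∉ X ∧ a.2 ∈ X) ⊆ {(w', w)} := by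
    rintro ⟨p, q⟩ hpq
    rw [Finset.mem_filter] at hpq
    obtain ⟨hpq, hp, hq⟩ := hpq
    simp only [X, Finset.mem_filter] at hp hq
    rcases S.memV.1 (S.wf _ hpq).1 with rfl | hqA | hqB
    · exact absurd (hq.2.head (by simp [arc, hpq, hq.1])) hc
    · exact absurd ⟨hqA, hq.2.head (by simp only [arc, mem_pc]; exact Or.inl ⟨hpq, by simp [hqA], by simp [hq.1]⟩)⟩ hp
    · obtain ⟨rfl, rfl⟩ := S.cBA p hqB q hq.1 hpq
      simp
  have := Finset.card_le_card h2
  unfold dI at h1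
  simp at this; omega

theorem not_in_A (S : Sep D v A B t w u w') {p q : ℕ} (h : (D.pc (insert v B) ∅).arc p q) :
    (p, q) ∈ D.arcs ∧ ¬ (p ∈ insert v A ∧ q ∈ insert v A) := by
  simp only [arc, mem_pc, Finset.notMem_empty, or_false] at h
  refine ⟨h.1, fun hc => ?_⟩
  have e : ∀ x, x ∈ insert v B → x ∈ insert v A → x = v := by
    intro x h1 h2
    rcases Finset.mem_insert.1 h1 with h | h
    · exact h
    · exact absurd h2 (S.notA h)
  exact (S.wf _ h.1).2.2 ((e p h.2.1 hc.1).trans (e q h.2.2 hc.2).symm)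

theorem cross_t (S : Sep D v A B t w u w') (hk : 2 ≤ k) (h : Crit k D) (htu : (t, u) ∈ D.arcs)
    {X : Finset ℕ} (h1 : t ∈ X) (h2 : v ∉ X) :
    ∃ a ∈ D.dicutArcs X, ¬ (a.1 ∈ insert v A ∧ a.2 ∈ insert v A) := by
  by_cases hu : u ∈ X
  · obtain ⟨p, q, hpq, hp, hq⟩ := exit_arc (S.symm.reach_v hk h S.uB) hu h2
    exact ⟨(p, q), mem_cut.2 ⟨(S.not_in_A hpq).1, hp, hq⟩, (S.not_in_A hpq).2⟩
  · exact ⟨(t, u), mem_cut.2 ⟨htu, h1, hu⟩, fun hc => S.notA S.uB hc.2⟩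

theorem cross_w (S : Sep D v A B t w u w') (hk : 2 ≤ k) (h : Crit k D) (hw : (w', w) ∈ D.arcs)
    {X : Finset ℕ} (h1 : v ∈ X) (h2 : w ∉ X) :
    ∃ a ∈ D.dicutArcs X, ¬ (a.1 ∈ insert v A ∧ a.2 ∈ insert v A) := by
  by_cases hu : w' ∈ X
  · exact ⟨(w', w), mem_cut.2 ⟨hw, hu, h2⟩, fun hc => S.notA S.wB hc.1⟩
  · obtain ⟨p, q, hpq, hp, hq⟩ := exit_arc (S.symm.v_reach hk h S.wB) h1 hu
    exact ⟨(p, q), mem_cut.2 ⟨(S.not_in_A hpq).1, hp, hq⟩, (S.not_in_A hpq).2⟩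

end Sep

theorem cc_piece {D : Dgraph} {S : Finset ℕ} {E : Finset (ℕ × ℕ)} (hcc : CC k D)
    (hS : S ⊆ D.verts)
    (h1 : ∀ X : Finset ℕ, ∀ e ∈ E, ∀ e' ∈ E, e.1 ∈ X → e.2 ∉ X → e'.1 ∈ X → e'.2 ∉ X → e = e')
    (h2 : ∀ X : Finset ℕ, ∀ e ∈ E, e.1 ∈ X → e.2 ∉ X →
      ∃ a ∈ D.dicutArcs X, ¬ (a.1 ∈ S ∧ a.2 ∈ S)) : CC k (D.pc S E) := by
  intro x hx y hy hxy
  obtain ⟨X, hX1, hX2, hX3⟩ := hcc x (hS hx) y (hS hy) hxy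
  refine ⟨X, hX1, hX2, le_trans ?_ hX3⟩
  let F := (D.dicutArcs X).filter fun a => a.1 ∈ S ∧ a.2 ∈ S
  by_cases hE : ∃ e ∈ E, e.1 ∈ X ∧ e.2 ∉ X
  · obtain ⟨e, he, he1, he2⟩ := hE
    obtain ⟨a, ha, haS⟩ := h2 X e he he1 he2
    have c1 : (D.pc S E).dicutArcs X ⊆ insert e F := by
      intro b hb
      rw [mem_cut, mem_pc] at hb
      obtain ⟨hb | hb, hb1, hb2⟩ := hb
      · simp only [F, Finset.mem_insert, Finset.mem_filter, mem_cut]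
        exact Or.inr ⟨⟨hb.1, hb1, hb2⟩, hb.2⟩
      · rw [h1 X b hb e he hb1 hb2 he1 he2]; simp
    have c2 : insert a F ⊆ D.dicutArcs X := by
      intro b hb
      simp only [F, Finset.mem_insert, Finset.mem_filter] at hb
      rcases hb with rfl | hb
      · exact ha
      · exact hb.1
    have c3 : a ∉ F := by simp [F]; intro _ h h'; exact haS ⟨h, h'⟩
    calc (D.pc S E).dO X ≤ (insert e F).card := Finset.card_le_card c1
      _ ≤ F.card + 1 := Finset.card_insert_le _ _
      _ = (insert a F).card := (Finset.card_insert_of_notMem c3).symm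
      _ ≤ _ := Finset.card_le_card c2
  · push Not at hE
    refine Finset.card_le_card fun b hb => ?_
    rw [mem_cut, mem_pc] at hb
    obtain ⟨hb | hb, hb1, hb2⟩ := hb
    · exact mem_cut.2 ⟨hb.1, hb1, hb2⟩
    · exact absurd (hE b hb hb1) hb2

def EA (D : Dgraph) (v t w u w' : ℕ) : Finset (ℕ × ℕ) :=
  (if (t, u) ∈ D.arcs then {(t, v)} else ∅) ∪ (if (w', w) ∈ D.arcs then {(v, w)} else ∅)

theorem mem_EA {D : Dgraph} {v t w u w' : ℕ} {a : ℕ × ℕ} :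
    a ∈ EA D v t w u w' ↔ ((t, u) ∈ D.arcs ∧ a = (t, v)) ∨ ((w', w) ∈ D.arcs ∧ a = (v, w)) := by
  unfold EA
  by_cases h1 : (t, u) ∈ D.arcs <;> by_cases h2 : (w', w) ∈ D.arcs <;> simp [h1, h2]

/-- the piece on the side `A` -/
def pA (D : Dgraph) (v : ℕ) (A : Finset ℕ) (t w u w' : ℕ) : Dgraph :=
  D.pc (insert v A) (EA D v t w u w')

namespace Sep

variable {D : Dgraph} {v : ℕ} {A B : Finset ℕ} {t w u w' : ℕ}

theorem wf_pA (S : Sep D v A B t w u w') : (pA D v A t w u w').WF := by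
  intro a ha
  have vt : t ≠ v := fun h => S.vA (h ▸ S.tA)
  have vw : w ≠ v := fun h => S.vA (h ▸ S.wA)
  rw [pA, mem_pc, mem_EA] at ha
  show a.1 ∈ insert v A ∧ a.2 ∈ insert v A ∧ _
  rcases ha with ha | ⟨_, rfl⟩ | ⟨_, rfl⟩
  · exact ⟨ha.2.1, ha.2.2, (S.wf _ ha.1).2.2⟩
  · simp [S.tA, vt]
  · simp [S.wA, vw.symm]

theorem cut1_pA (S : Sep D v A B t w u w') (hk : 2 ≤ k) (h : Crit k D) :
    (pA D v A t w u w').Cut1 := by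
  have m : ∀ {a b}, ReflTransGen (D.pc (insert v A) ∅).arc a b →
      ReflTransGen (pA D v A t w u w').arc a b := by
    intro a b hab
    refine ReflTransGen.mono (fun p q hpq => ?_) _ _ hab
    simp only [arc, mem_pc, Finset.notMem_empty, or_false, pA] at hpq ⊢
    exact Or.inl hpq
  intro a ha b hb
  have h1 : ReflTransGen (pA D v A t w u w').arc a v := by
    rcases Finset.mem_insert.1 ha with rfl | ha
    · exact .refl
    · exact m (S.reach_v hk h ha)
  have h2 : ReflTransGen (pA D v A t w u w').arc v b := by
    rcases Finset.mem_insert.1 hb with rfl | hb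
    · exact .refl
    · exact m (S.v_reach hk h hb)
  exact h1.trans h2

theorem cc_pA (S : Sep D v A B t w u w') (hk : 2 ≤ k) (h : Ext k D) :
    CC k (pA D v A t w u w') := by
  refine cc_piece h.cc S.AV ?_ ?_
  · intro X e he e' he' h1 h2 h3 h4
    rw [mem_EA] at he he'
    rcases he with ⟨_, rfl⟩ | ⟨_, rfl⟩ <;> rcases he' with ⟨_, rfl⟩ | ⟨_, rfl⟩ <;> simp_all
  · intro X e he h1 h2
    rw [mem_EA] at he
    rcases he with ⟨h0, rfl⟩ | ⟨h0, rfl⟩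
    · exact S.cross_t hk h.toCrit h0 h1 h2
    · exact S.cross_w hk h.toCrit h0 h1 h2

theorem nocut_pA (S : Sep D v A B t w u w') (h : Crit k D) (hH : t = w ∨ ¬ HasH D) :
    (pA D v A t w u w').NoCut := by
  intro z hz N hN hNne hzN ⟨y, hy, hyz, hyN⟩
  by_contra hc
  push Not at hc
  replace hN : N ⊆ insert v A := hN
  replace hy : y ∈ insert v A := hy
  replace hz : z ∈ insert v A := hz
  replace hc : ∀ p ∈ N, ∀ q ∈ insert v A, q ≠ z → q ∉ N → ¬ (pA D v A t w u w').adj p q := hc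
  have hc1 : ∀ p ∈ N, ∀ q ∈ insert v A, q ≠ z → q ∉ N → ¬ D.adj p q := by
    intro p hp q hq h1 h2 h3
    refine hc p hp q hq h1 h2 ?_
    rcases h3 with h3 | h3
    · exact Or.inl (by rw [pA, mem_pc]; exact Or.inl ⟨h3, hN hp, hq⟩)
    · exact Or.inr (by rw [pA, mem_pc]; exact Or.inl ⟨h3, hq, hN hp⟩)
  have et : (t, u) ∈ D.arcs → (pA D v A t w u w').adj t v := fun h => Or.inl (by
    rw [pA, mem_pc, mem_EA]; exact Or.inr (Or.inl ⟨h, rfl⟩))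
  have ew : (w', w) ∈ D.arcs → (pA D v A t w u w').adj v w := fun h => Or.inl (by
    rw [pA, mem_pc, mem_EA]; exact Or.inr (Or.inr ⟨h, rfl⟩))
  have adjs : ∀ {p q}, (pA D v A t w u w').adj p q → (pA D v A t w u w').adj q p := Or.symm
  -- a general contradiction: if cross arcs touch N only at z we get a cutvertex of D
  have cut1 : ∀ N ⊆ insert v A, N.Nonempty → z ∉ N → (∃ y ∈ insert v A, y ≠ z ∧ y ∉ N) →
      (∀ p ∈ N, ∀ q ∈ insert v A, q ≠ z → q ∉ N → ¬ D.adj p q) → v ∉ N →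
      ((t, u) ∈ D.arcs → t ∉ N) → ((w', w) ∈ D.arcs → w ∉ N) → False := by
    intro N hN hNne hzN ⟨y, hy, hyz, hyN⟩ hcc hvN ht hw
    obtain ⟨p, hp, q, hq, hqz, hqN, hadj⟩ := h.nocut z (S.AV hz) N (hN.trans S.AV) hNne hzN
      ⟨y, S.AV hy, hyz, hyN⟩
    have hpA : p ∈ A := by
      rcases Finset.mem_insert.1 (hN hp) with rfl | h
      · exact absurd hp hvN
      · exact h
    by_cases hqA : q ∈ insert v A
    · exact hcc p hp q hqA hqz hqN hadj
    · have hqB : q ∈ B := by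
        rcases S.memV.1 hq with h | h | h
        · exact absurd (by simp [h]) hqA
        · exact absurd (by simp [h]) hqA
        · exact h
      rcases hadj with hadj | hadj
      · obtain ⟨rfl, rfl⟩ := S.cAB p hpA q hqB hadj
        exact ht hadj hp
      · obtain ⟨rfl, rfl⟩ := S.cBA q hqB p hpA hadj
        exact hw hadj hp
  -- the complement of N
  let M := ((insert v A) \ N).erase z
  have hM : ∀ x, x ∈ M ↔ x ∈ insert v A ∧ x ≠ z ∧ x ∉ N := by
    intro x; simp only [M, Finset.mem_erase, Finset.mem_sdiff]; tauto
  have cutM : v ∉ M → ((t, u) ∈ D.arcs → t ∉ M) → ((w', w) ∈ D.arcs → w ∉ M) → False := by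
    obtain ⟨n, hn⟩ := hNne
    refine cut1 M (fun x hx => ((hM x).1 hx).1) ⟨y, (hM y).2 ⟨hy, hyz, hyN⟩⟩
      (fun h => ((hM z).1 h).2.1 rfl)
      ⟨n, hN hn, by rintro rfl; exact hzN hn, fun h => ((hM n).1 h).2.2 hn⟩ ?_
    intro p hp q hq hqz hqM hadj
    have hp' := (hM p).1 hp
    have hqN : q ∈ N := by by_contra h; exact hqM ((hM q).2 ⟨hq, hqz, h⟩)
    exact hc1 q hqN p hp'.1 hp'.2.1 hp'.2.2 (Or.symm hadj)
  by_cases hzv : z = v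
  · subst hzv
    by_cases htN : (t, u) ∈ D.arcs ∧ t ∈ N
    · by_cases hwN : (w', w) ∈ D.arcs ∧ w ∉ N
      · -- split: HStr
        rcases hH with rfl | hH
        · exact hwN.2 htN.2
        refine hH ⟨z, N, D.verts \ insert z N, t, u, ⟨S.wf, ?_, ?_, hzN, by simp, htN.2, htN.2, ?_, ?_,
          ?_, ?_⟩, htN.1, ?_⟩
        · exact verts_split S.AV hN
        · rw [Finset.disjoint_left]; intro x hx; simp [hx]
        · simp [(S.wf _ htN.1).2.1]
          exact ⟨fun h => S.vB (h ▸ S.uB), fun h => S.notA S.uB (hN h)⟩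
        · simp [(S.wf _ htN.1).2.1]
          exact ⟨fun h => S.vB (h ▸ S.uB), fun h => S.notA S.uB (hN h)⟩
        · intro p hp q hq hpq
          simp only [Finset.mem_insert, Finset.mem_sdiff, not_or] at hq
          by_cases hqA : q ∈ insert z A
          · exact absurd (Or.inl hpq) (hc1 p hp q hqA hq.2.1 hq.2.2)
          · refine S.cAB p ?_ q ?_ hpq
            · exact (Finset.mem_insert.1 (hN hp)).resolve_left (by rintro rfl; exact hzN hp)
            · rcases S.memV.1 hq.1 with h | h | h
              · exact absurd h hq.2.1
              · exact absurd (by simp [h]) hqA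
              · exact h
        · intro p hp q hq hpq
          simp only [Finset.mem_insert, Finset.mem_sdiff, not_or] at hp
          by_cases hqA : p ∈ insert z A
          · exact absurd (Or.inr hpq) (hc1 q hq p hqA hp.2.1 hp.2.2)
          · obtain ⟨rfl, rfl⟩ : p = w' ∧ q = w := by
              refine S.cBA p ?_ q ?_ hpq
              · rcases S.memV.1 hp.1 with h | h | h
                · exact absurd h hp.2.1
                · exact absurd (by simp [h]) hqA
                · exact h
              · exact (Finset.mem_insert.1 (hN hq)).resolve_left (by rintro rfl; exact hzN hq)
            exact absurd hq hwN.2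
        · intro hut
          obtain ⟨rfl, rfl⟩ := S.cBA u S.uB t S.tA hut
          exact hwN.2 htN.2
      · -- all of the attached vertices in N
        push Not at hwN
        exact cutM (fun h => ((hM _).1 h).2.1 rfl) (fun _ h => ((hM _).1 h).2.2 htN.2)
          (fun h' h => ((hM _).1 h).2.2 (hwN h'))
    · push Not at htN
      by_cases hwN : (w', w) ∈ D.arcs ∧ w ∈ N
      · by_cases htu : (t, u) ∈ D.arcs
        · rcases hH with rfl | hH
          · exact htN htu hwN.2
          have htM : t ∈ M := (hM t).2 ⟨by simp [S.tA], fun h => S.vA (h ▸ S.tA), htN htu⟩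
          have hcM : ∀ p ∈ M, ∀ q ∈ insert z A, q ≠ z → q ∉ M → ¬ D.adj p q := by
            intro p hp q hq hqz hqM hadj
            have hp' := (hM p).1 hp
            have hqN : q ∈ N := by by_contra h; exact hqM ((hM q).2 ⟨hq, hqz, h⟩)
            exact hc1 q hqN p hp'.1 hp'.2.1 hp'.2.2 (Or.symm hadj)
          have hMA : M ⊆ insert z A := fun x hx => ((hM x).1 hx).1
          have hzM : z ∉ M := fun h => ((hM z).1 h).2.1 rfl
          refine hH ⟨z, M, D.verts \ insert z M, t, u, ⟨S.wf, ?_, ?_, hzM, by simp, htM, htM, ?_, ?_,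
            ?_, ?_⟩, htu, ?_⟩
          · exact verts_split S.AV hMA
          · rw [Finset.disjoint_left]; intro x hx; simp [hx]
          · simp [(S.wf _ htu).2.1]
            exact ⟨fun h => S.vB (h ▸ S.uB), fun h => S.notA S.uB (hMA h)⟩
          · simp [(S.wf _ htu).2.1]
            exact ⟨fun h => S.vB (h ▸ S.uB), fun h => S.notA S.uB (hMA h)⟩
          · intro p hp q hq hpq
            simp only [Finset.mem_insert, Finset.mem_sdiff, not_or] at hq
            by_cases hqA : q ∈ insert z A
            · exact absurd (Or.inl hpq) (hcM p hp q hqA hq.2.1 hq.2.2)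
            · refine S.cAB p ?_ q ?_ hpq
              · exact (Finset.mem_insert.1 (hMA hp)).resolve_left (by rintro rfl; exact hzM hp)
              · rcases S.memV.1 hq.1 with h | h | h
                · exact absurd h hq.2.1
                · exact absurd (by simp [h]) hqA
                · exact h
          · intro p hp q hq hpq
            simp only [Finset.mem_insert, Finset.mem_sdiff, not_or] at hp
            by_cases hqA : p ∈ insert z A
            · exact absurd (Or.inr hpq) (hcM q hq p hqA hp.2.1 hp.2.2)
            · obtain ⟨rfl, rfl⟩ : p = w' ∧ q = w := by
                refine S.cBA p ?_ q ?_ hpq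
                · rcases S.memV.1 hp.1 with h | h | h
                  · exact absurd h hp.2.1
                  · exact absurd (by simp [h]) hqA
                  · exact h
                · exact (Finset.mem_insert.1 (hMA hq)).resolve_left (by rintro rfl; exact hzM hq)
              exact absurd hwN.2 ((hM _).1 hq).2.2
          · intro hut
            obtain ⟨rfl, rfl⟩ := S.cBA u S.uB t S.tA hut
            exact htN htu hwN.2
        · exact cutM (fun h => ((hM _).1 h).2.1 rfl) (fun h => absurd h htu)
            (fun _ h => ((hM _).1 h).2.2 hwN.2)
      · push Not at hwN
        exact cut1 N hN hNne hzN ⟨y, hy, hyz, hyN⟩ hc1 hzN htN hwN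
  · by_cases hvN : v ∈ N
    · refine cutM (fun h => ((hM _).1 h).2.2 hvN) ?_ ?_
      · intro h0 h1
        have := (hM _).1 h1
        exact hc v hvN t this.1 this.2.1 this.2.2 (adjs (et h0))
      · intro h0 h1
        have := (hM _).1 h1
        exact hc v hvN w this.1 this.2.1 this.2.2 (ew h0)
    · refine cut1 N hN hNne hzN ⟨y, hy, hyz, hyN⟩ hc1 hvN ?_ ?_
      · intro h0 h1
        exact hc t h1 v (by simp) (Ne.symm hzv) hvN (et h0)
      · intro h0 h1
        exact hc w h1 v (by simp) (Ne.symm hzv) hvN (adjs (ew h0))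

/-- reach in `D[A∪v]` lifts to the piece -/
theorem lift_mono (S : Sep D v A B t w u w') {φ : ℕ → Fin k} {a b : ℕ}
    (h : ReflTransGen ((D.pc (insert v A) ∅).mono φ) a b) :
    ReflTransGen ((pA D v A t w u w').mono φ) a b := by
  refine ReflTransGen.mono (fun p q hpq => ⟨?_, hpq.2⟩) _ _ h
  have := hpq.1
  simp only [mem_pc, Finset.notMem_empty, or_false, pA] at this ⊢
  exact Or.inl this

theorem nc_pA (S : Sep D v A B t w u w') (h : Crit k D)
    (hk : 3 ≤ k ∨ (∀ φ : ℕ → Fin k, (D.pc (insert v A) ∅).Good φ → φ t = φ v) ∨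
      (∀ φ : ℕ → Fin k, (D.pc (insert v B) ∅).Good φ → φ u = φ v)) :
    ¬ (pA D v A t w u w').Col k := by
  rintro ⟨φ, hφ⟩
  have hφ' : (D.pc (insert v A) ∅).Good φ := hφ.sub (by
    intro a ha; rw [pA, mem_pc]; rw [mem_pc] at ha; simp only [Finset.notMem_empty, or_false] at ha; exact Or.inl ha)
  obtain ⟨ψ, hψ⟩ := S.symm.colA h
  have n1 : (t, u) ∈ D.arcs → ¬ ReflTransGen ((D.pc (insert v A) ∅).mono φ) v t := by
    intro h0 h1
    refine hφ t v ⟨?_, (rtg_mono_color h1).symm⟩ (S.lift_mono h1)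
    rw [pA, mem_pc, mem_EA]; exact Or.inr (Or.inl ⟨h0, rfl⟩)
  have n2 : (w', w) ∈ D.arcs → ¬ ReflTransGen ((D.pc (insert v A) ∅).mono φ) w v := by
    intro h0 h1
    refine hφ v w ⟨?_, (rtg_mono_color h1).symm⟩ (S.lift_mono h1)
    rw [pA, mem_pc, mem_EA]; exact Or.inr (Or.inr ⟨h0, rfl⟩)
  obtain ⟨θ, _, hθ, _⟩ := combine S hφ' hψ (fun h0 h1 => n1 h0 h1.1) (fun h0 h1 => n2 h0 h1.2)
    (by
      rintro h0 h0' ⟨h1, h2, _⟩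
      have h3 : (pA D v A t w u w').mono φ t v :=
        ⟨by rw [pA, mem_pc, mem_EA]; exact Or.inr (Or.inl ⟨h0, rfl⟩), h2⟩
      refine hφ v w ⟨?_, ?_⟩ ((S.lift_mono h1).tail h3)
      · rw [pA, mem_pc, mem_EA]; exact Or.inr (Or.inr ⟨h0', rfl⟩)
      · rw [← h2, rtg_mono_color h1])
    (by
      intro _
      rcases hk with hk | hk | hk
      · exact Or.inl hk
      · exact Or.inr (Or.inl (hk φ hφ'))
      · exact Or.inr (Or.inr (hk ψ hψ)))
  exact h.nc ⟨θ, hθ⟩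

theorem ext_pA' (S : Sep D v A B t w u w') (hk2 : 2 ≤ k) (h : Ext k D)
    (hk : 3 ≤ k ∨ (∀ φ : ℕ → Fin k, (D.pc (insert v A) ∅).Good φ → φ t = φ v) ∨
      (∀ φ : ℕ → Fin k, (D.pc (insert v B) ∅).Good φ → φ u = φ v))
    (hH : t = w ∨ ¬ HasH D) : Ext k (pA D v A t w u w') :=
  ext_of hk2 S.wf_pA (S.nc_pA h.toCrit hk) (S.cc_pA hk2 h) (S.cut1_pA hk2 h.toCrit)
    (S.nocut_pA h.toCrit hH)

theorem ext_pA (S : Sep D v A B t w u w') (hk : 3 ≤ k) (h : Ext k D)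
    (hH : t = w ∨ ¬ HasH D) : Ext k (pA D v A t w u w') :=
  S.ext_pA' (by omega) h (Or.inl hk) hH

/-- the new arcs of a piece are really new -/
theorem tv_new (S : Sep D v A B t w u w') (hk : 2 ≤ k) (h : Ext k D)
    (hp : Crit k (pA D v A t w u w')) (htu : (t, u) ∈ D.arcs) : (t, v) ∉ D.arcs := by
  intro htv
  have vt : t ≠ v := fun h => S.vA (h ▸ S.tA)
  obtain ⟨X, h1, h2, h3⟩ := h.cc t (S.AV (by simp [S.tA])) v S.vV vt
  have h4 := hp.cut_ge hk (X := X) ⟨t, by simp [pA, S.tA], h1⟩ ⟨v, by simp [pA], h2⟩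
  obtain ⟨a, ha, haA⟩ := S.cross_t hk h.toCrit htu h1 h2
  have hsub : insert a ((pA D v A t w u w').dicutArcs X) ⊆ D.dicutArcs X := by
    intro b hb
    rcases Finset.mem_insert.1 hb with rfl | hb
    · exact ha
    rw [mem_cut, pA, mem_pc, mem_EA] at hb
    obtain ⟨hb | ⟨_, rfl⟩ | ⟨_, rfl⟩, hb1, hb2⟩ := hb
    · exact mem_cut.2 ⟨hb.1, hb1, hb2⟩
    · exact mem_cut.2 ⟨htv, hb1, hb2⟩
    · exact absurd hb1 h2
  have hna : a ∉ (pA D v A t w u w').dicutArcs X := by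
    intro hc; exact haA ⟨(S.wf_pA _ (mem_cut.1 hc).1).1, (S.wf_pA _ (mem_cut.1 hc).1).2.1⟩
  have := Finset.card_le_card hsub
  rw [Finset.card_insert_of_notMem hna] at this
  unfold dO at h3 h4
  omega

theorem vw_new (S : Sep D v A B t w u w') (hk : 2 ≤ k) (h : Ext k D)
    (hp : Crit k (pA D v A t w u w')) (htu : (w', w) ∈ D.arcs) : (v, w) ∉ D.arcs := by
  intro htv
  have vt : v ≠ w := fun h => S.vA (h ▸ S.wA)
  obtain ⟨X, h1, h2, h3⟩ := h.cc v S.vV w (S.AV (by simp [S.wA])) vt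
  have h4 := hp.cut_ge hk (X := X) ⟨v, by simp [pA], h1⟩ ⟨w, by simp [pA, S.wA], h2⟩
  obtain ⟨a, ha, haA⟩ := S.cross_w hk h.toCrit htu h1 h2
  have hsub : insert a ((pA D v A t w u w').dicutArcs X) ⊆ D.dicutArcs X := by
    intro b hb
    rcases Finset.mem_insert.1 hb with rfl | hb
    · exact ha
    rw [mem_cut, pA, mem_pc, mem_EA] at hb
    obtain ⟨hb | ⟨_, rfl⟩ | ⟨_, rfl⟩, hb1, hb2⟩ := hb
    · exact mem_cut.2 ⟨hb.1, hb1, hb2⟩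
    · exact absurd h1 hb2
    · exact mem_cut.2 ⟨htv, hb1, hb2⟩
  have hna : a ∉ (pA D v A t w u w').dicutArcs X := by
    intro hc; exact haA ⟨(S.wf_pA _ (mem_cut.1 hc).1).1, (S.wf_pA _ (mem_cut.1 hc).1).2.1⟩
  have := Finset.card_le_card hsub
  rw [Finset.card_insert_of_notMem hna] at this
  unfold dO at h3 h4
  omega

/-- degree of the join vertex -/
theorem deg_A (S : Sep D v A B t w u w') (hk : 2 ≤ k) (h : Crit k D) :
    k ≤ (D.arcs.filter fun a => a.1 = v ∧ a.2 ∈ A).card + (if (w', w) ∈ D.arcs then 1 else 0) := by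
  have h1 := h.in_ge hk (X := A) ⟨t, S.AV (by simp [S.tA]), S.tA⟩ ⟨v, S.vV, S.vA⟩
  have key : ∀ a ∈ D.arcs, a.1 ∉ A → a.2 ∈ A → a.1 = v ∨ a = (w', w) := by
    rintro ⟨p, q⟩ ha hp hq
    rcases S.memV.1 (S.wf _ ha).1 with h | h | h
    · exact Or.inl h
    · exact absurd h hp
    · obtain ⟨rfl, rfl⟩ := S.cBA p h q hq ha; exact Or.inr rfl
  unfold dI at h1
  split_ifs with hw
  · refine h1.trans (le_trans (Finset.card_le_card (t := insert (w', w)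
      (D.arcs.filter fun a => a.1 = v ∧ a.2 ∈ A)) ?_) (Finset.card_insert_le _ _))
    intro a ha
    simp only [Finset.mem_filter, Finset.mem_insert] at ha ⊢
    rcases key a ha.1 ha.2.1 ha.2.2 with h | h
    · exact Or.inr ⟨ha.1, h, ha.2.2⟩
    · exact Or.inl h
  · refine h1.trans (Finset.card_le_card ?_)
    intro a ha
    simp only [Finset.mem_filter] at ha ⊢
    rcases key a ha.1 ha.2.1 ha.2.2 with h | h
    · exact ⟨ha.1, h, ha.2.2⟩
    · exact absurd (h ▸ ha.1) hw

theorem deg_v (S : Sep D v A B t w u w') (hk : 2 ≤ k) (h : Crit k D) :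
    2 * k ≤ D.outdeg v + (if (w', w) ∈ D.arcs then 1 else 0) +
      (if (t, u) ∈ D.arcs then 1 else 0) := by
  have h1 := S.deg_A hk h
  have h2 := S.symm.deg_A hk h
  have h3 : (D.arcs.filter fun a => a.1 = v ∧ a.2 ∈ A).card +
      (D.arcs.filter fun a => a.1 = v ∧ a.2 ∈ B).card ≤ D.outdeg v := by
    rw [← Finset.card_union_of_disjoint]
    · unfold outdeg
      apply Finset.card_le_card
      intro a ha
      simp only [Finset.mem_union, Finset.mem_filter] at ha ⊢
      rcases ha with ha | ha
      · exact ⟨ha.1, ha.2.1⟩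
      · exact ⟨ha.1, ha.2.1⟩
    · rw [Finset.disjoint_left]
      intro a ha hb
      simp only [Finset.mem_filter] at ha hb
      exact Finset.disjoint_left.1 S.disj ha.2.2 hb.2.2
  omega

end Sep

theorem HStr.deg {D : Dgraph} {v A B t u} (S : HStr D v A B t u) (hk : 2 ≤ k) (h : Crit k D) :
    2 * k - 1 ≤ D.outdeg v := by
  have := S.1.deg_v hk h
  rw [if_neg S.2.2, if_pos S.2.1] at this
  omega

/-- the forcing lemma -/
theorem Bij.forced {D : Dgraph} {v A B t w u w'} (S : Bij D v A B t w u w') (hk : 3 ≤ k)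
    (h : Ext k D) (hH : u = w' ∨ ¬ HasH D) {φ : ℕ → Fin k} (hφ : (D.pc (insert v A) ∅).Good φ) :
    ReflTransGen ((D.pc (insert v A) ∅).mono φ) w t ∧ φ t = φ v := by
  by_contra hc
  have hE := S.symm.1.ext_pA hk h (hH.imp Eq.symm id)
  have a1 : (w', v) ∈ (pA D v B w' u w t).arcs := by
    rw [pA, mem_pc, mem_EA]; exact Or.inr (Or.inl ⟨S.2.2, rfl⟩)
  have a2 : (v, u) ∈ (pA D v B w' u w t).arcs := by
    rw [pA, mem_pc, mem_EA]; exact Or.inr (Or.inr ⟨S.2.1, rfl⟩)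
  have n1 := S.symm.1.tv_new (by omega) h hE.toCrit S.2.2
  have n2 := S.symm.1.vw_new (by omega) h hE.toCrit S.2.1
  have vu : v ≠ u := fun h => S.1.vB (h ▸ S.1.uB)
  have vw : v ≠ w' := fun h => S.1.vB (h ▸ S.1.wB)
  have sub1 : ∀ e, e ∉ D.arcs → (D.pc (insert v B) ∅).arcs ⊆ (pA D v B w' u w t).arcs.erase e := by
    intro e he a ha
    rw [mem_pc] at ha
    simp only [Finset.notMem_empty, or_false] at ha
    rw [Finset.mem_erase, pA, mem_pc]
    exact ⟨by rintro rfl; exact he ha.1, Or.inl ha⟩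
  have fin : ∀ ψ : ℕ → Fin k, (D.pc (insert v B) ∅).Good ψ →
      ¬ (ReflTransGen ((D.pc (insert v A) ∅).mono φ) v t ∧
      ReflTransGen ((D.pc (insert v B) ∅).mono ψ) u v) →
      ¬ (ReflTransGen ((D.pc (insert v B) ∅).mono ψ) v w' ∧
      ReflTransGen ((D.pc (insert v A) ∅).mono φ) w v) → False := by
    intro ψ hψ h1 h2
    obtain ⟨θ, _, hθ, _⟩ := combine S.1 hφ hψ (fun _ => h1) (fun _ => h2)
      (fun _ _ h3 => hc ⟨h3.1, h3.2.1⟩) (fun _ => Or.inl hk)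
    exact h.nc ⟨θ, hθ⟩
  by_cases hvt : ReflTransGen ((D.pc (insert v A) ∅).mono φ) v t
  · have hwv : ¬ ReflTransGen ((D.pc (insert v A) ∅).mono φ) w v := fun h =>
      hc ⟨h.trans hvt, (rtg_mono_color hvt).symm⟩
    obtain ⟨ψ, hψ⟩ := hE.amin _ a1
    have hψ' := hψ.sub (D' := D.pc (insert v B) ∅) (sub1 _ n1)
    refine fin ψ hψ' (fun h => ?_) (fun h => hwv h.2)
    refine hψ v u ⟨?_, (rtg_mono_color h.2).symm⟩ (ReflTransGen.mono ?_ _ _ h.2)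
    · simp only [Finset.mem_erase]; exact ⟨by simp [vw], a2⟩
    · intro p q hpq; exact ⟨sub1 _ n1 hpq.1, hpq.2⟩
  · obtain ⟨ψ, hψ⟩ := hE.amin _ a2
    have hψ' := hψ.sub (D' := D.pc (insert v B) ∅) (sub1 _ n2)
    refine fin ψ hψ' (fun h => hvt h.1) (fun h => ?_)
    refine hψ w' v ⟨?_, (rtg_mono_color h.1).symm⟩ (ReflTransGen.mono ?_ _ _ h.1)
    · simp only [Finset.mem_erase]; exact ⟨by simp [vw.symm], a1⟩
    · intro p q hpq; exact ⟨sub1 _ n2 hpq.1, hpq.2⟩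

end Dgraph

namespace Dgraph
open Relation
variable {k : ℕ}

theorem rtg_swap {r : ℕ → ℕ → Prop} {a b : ℕ} (h : ReflTransGen (fun p q => r q p) a b) :
    ReflTransGen r b a := by
  induction h with
  | refl => exact .refl
  | tail _ h2 ih => exact ih.head h2

theorem acy_swap {r : ℕ → ℕ → Prop} (h : Acy fun p q => r q p) : Acy r := by
  intro p q hpq hqp
  exact h q p hpq (rtg_swap (r := fun p q => r q p) hqp)

theorem acy_del {r : ℕ → ℕ → Prop} {c : ℕ} (h : Acy fun p q => r p q ∧ p ≠ c ∧ q ≠ c)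
    (ho : ∀ q, ¬ r c q) : Acy r := by
  refine acy_cut (S := {c}) ?_ ?_ ?_
  · intro p q h1 h2; rw [Finset.mem_singleton] at h2; subst h2; exact (ho _ h1).elim
  · rintro p q ⟨h1, h2, _⟩ _
    rw [Finset.mem_singleton] at h2; subst h2; exact (ho _ h1).elim
  · refine h.mono fun p q hpq => ?_
    simpa using hpq

theorem acy_del' {r : ℕ → ℕ → Prop} {c : ℕ} (h : Acy fun p q => r p q ∧ p ≠ c ∧ q ≠ c)
    (ho : ∀ q, ¬ r q c) : Acy r := by
  apply acy_swap
  refine acy_del (c := c) ?_ ho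
  apply acy_swap
  exact h.mono fun p q hpq => ⟨hpq.1, hpq.2.2, hpq.2.1⟩

theorem good_upd {D : Dgraph} {φ : ℕ → Fin k} {c : ℕ} {i : Fin k}
    (h : Acy (fun p q => D.mono φ p q ∧ p ≠ c ∧ q ≠ c))
    (ho : (∀ q, (c, q) ∈ D.arcs → q ≠ c ∧ φ q ≠ i) ∨ (∀ q, (q, c) ∈ D.arcs → q ≠ c ∧ φ q ≠ i)) :
    D.Good (Function.update φ c i) := by
  have h' : Acy (fun p q => D.mono (Function.update φ c i) p q ∧ p ≠ c ∧ q ≠ c) := by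
    refine h.mono ?_
    rintro p q ⟨⟨h1, h2⟩, h3, h4⟩
    rw [Function.update_of_ne h3, Function.update_of_ne h4] at h2
    exact ⟨⟨h1, h2⟩, h3, h4⟩
  rcases ho with ho | ho
  · refine acy_del h' ?_
    rintro q ⟨h1, h2⟩
    have := ho q h1
    rw [Function.update_of_ne this.1, Function.update_self] at h2
    exact this.2 h2.symm
  · refine acy_del' h' ?_
    rintro q ⟨h1, h2⟩
    have := ho q h1
    rw [Function.update_of_ne this.1, Function.update_self] at h2
    exact this.2 h2

def outN (D : Dgraph) (v : ℕ) : Finset ℕ := (D.arcs.filter fun a => a.1 = v).image Prod.snd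
def inN (D : Dgraph) (v : ℕ) : Finset ℕ := (D.arcs.filter fun a => a.2 = v).image Prod.fst

@[simp] theorem mem_outN {D : Dgraph} {v x : ℕ} : x ∈ D.outN v ↔ (v, x) ∈ D.arcs := by
  simp only [outN, Finset.mem_image, Finset.mem_filter]
  constructor
  · rintro ⟨⟨a, b⟩, ⟨h1, h2⟩, h3⟩; simp at h2 h3; subst h2; subst h3; exact h1
  · intro h; exact ⟨_, ⟨h, rfl⟩, rfl⟩

@[simp] theorem mem_inN {D : Dgraph} {v x : ℕ} : x ∈ D.inN v ↔ (x, v) ∈ D.arcs := by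
  simp only [inN, Finset.mem_image, Finset.mem_filter]
  constructor
  · rintro ⟨⟨a, b⟩, ⟨h1, h2⟩, h3⟩; simp at h2 h3; subst h2; subst h3; exact h1
  · intro h; exact ⟨_, ⟨h, rfl⟩, rfl⟩

theorem card_outN (D : Dgraph) (v : ℕ) : (D.outN v).card = D.outdeg v := by
  rw [outN, outdeg, Finset.card_image_of_injOn]
  rintro ⟨a, b⟩ h ⟨c, d⟩ h' e
  simp at h h' e
  rw [h.2, h'.2, e]

theorem card_inN (D : Dgraph) (v : ℕ) : (D.inN v).card = D.indeg v := by
  rw [inN, indeg, Finset.card_image_of_injOn]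
  rintro ⟨a, b⟩ h ⟨c, d⟩ h' e
  simp at h h' e
  rw [h.2, h'.2, e]

theorem free_col (X : Finset ℕ) (φ : ℕ → Fin k)
    (h : X.card < k ∨ (X.card ≤ k ∧ ∃ a ∈ X, ∃ b ∈ X, a ≠ b ∧ φ a = φ b)) :
    ∃ i, ∀ x ∈ X, φ x ≠ i := by
  by_contra hc
  push Not at hc
  have h1 : X.image φ = Finset.univ := by
    ext i; simp; exact hc i
  have h2 : (X.image φ).card = k := by rw [h1]; simp
  rcases h with h | ⟨h, a, ha, b, hb, hab, he⟩
  · have := Finset.card_image_le (s := X) (f := φ); omega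
  · have : (X.image φ).card = X.card := le_antisymm Finset.card_image_le (by omega)
    rw [Finset.card_image_iff] at this
    exact hab (this ha hb he)

/-- recolouring: if `c` is always coloured as `v`, many neighbours on that side -/
theorem many_nb {D : Dgraph} {S N : Finset ℕ} {v c : ℕ} (hD : D.WF) (hvc : v ≠ c) (hcN : c ∉ N)
    (hS : S = insert v (insert c N))
    (hcol : (D.pc S ∅).Col k) (heq : ∀ φ : ℕ → Fin k, (D.pc S ∅).Good φ → φ c = φ v) :
    k ≤ ((D.outN c) ∩ N).card + 1 ∧ k ≤ ((D.inN c) ∩ N).card + 1 := by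
  obtain ⟨φ, hφ⟩ := hcol
  have key : ∀ i, i ≠ φ v → ¬ ((∀ q, (c, q) ∈ (D.pc S ∅).arcs → q ≠ c ∧ φ q ≠ i) ∨
      (∀ q, (q, c) ∈ (D.pc S ∅).arcs → q ≠ c ∧ φ q ≠ i)) := by
    intro i hi ho
    have := heq _ (good_upd (hφ.mono fun p q h => h.1) ho)
    rw [Function.update_self, Function.update_of_ne hvc] at this
    exact hi this
  constructor
  · have : Finset.univ.erase (φ v) ⊆ ((D.outN c) ∩ N).image φ := by
      intro i hi
      have hi := Finset.ne_of_mem_erase hi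
      have h1 := key i hi
      push Not at h1
      obtain ⟨q, hq, hq'⟩ := h1.1
      simp only [mem_pc, Finset.notMem_empty, or_false] at hq
      have hqc : q ≠ c := (hD _ hq.1).2.2.symm
      have := hq' hqc
      rw [Finset.mem_image]
      refine ⟨q, ?_, this⟩
      have h2 := hq.2.2
      rw [hS] at h2
      simp only [Finset.mem_insert] at h2
      rcases h2 with h2 | h2 | h2
      · rw [h2] at this; exact (hi this.symm).elim
      · exact (hqc h2).elim
      · simp [hq.1, h2]
    have := (Finset.card_le_card this).trans Finset.card_image_le
    rw [Finset.card_erase_of_mem (Finset.mem_univ _)] at this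
    simp at this; omega
  · have : Finset.univ.erase (φ v) ⊆ ((D.inN c) ∩ N).image φ := by
      intro i hi
      have hi := Finset.ne_of_mem_erase hi
      have h1 := key i hi
      push Not at h1
      obtain ⟨q, hq, hq'⟩ := h1.2
      simp only [mem_pc, Finset.notMem_empty, or_false] at hq
      have hqc : q ≠ c := (hD _ hq.1).2.2
      have := hq' hqc
      rw [Finset.mem_image]
      refine ⟨q, ?_, this⟩
      have h2 := hq.2.1
      rw [hS] at h2
      simp only [Finset.mem_insert] at h2
      rcases h2 with h2 | h2 | h2
      · rw [h2] at this; exact (hi this.symm).elim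
      · exact (hqc h2).elim
      · simp [hq.1, h2]
    have := (Finset.card_le_card this).trans Finset.card_image_le
    rw [Finset.card_erase_of_mem (Finset.mem_univ _)] at this
    simp at this; omega

theorem twocut_side {D : Dgraph} (h : Crit k D) {v c : ℕ} {N M : Finset ℕ} (hvc : v ≠ c)
    (hV : D.verts = insert v (insert c (N ∪ M))) (hNM : Disjoint N M) (hvN : v ∉ N) (hvM : v ∉ M)
    (hcN : c ∉ N) (hcM : c ∉ M) (hM : M.Nonempty)
    (hno : ∀ p ∈ N, ∀ q ∈ M, ¬ D.adj p q) (ho : D.outdeg c ≤ k) (hi : D.indeg c ≤ k)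
    (heq : ∀ φ : ℕ → Fin k, (D.pc (insert v (insert c N)) ∅).Good φ → φ c = φ v) :
    ∃ A B u w', Sep D v A B c c u w' ∧
      ∀ φ : ℕ → Fin k, (D.pc (insert v A) ∅).Good φ → φ c = φ v := by
  have hcol : (D.pc (insert v (insert c N)) ∅).Col k := by
    apply h.col_ind
    obtain ⟨m, hm⟩ := hM
    refine ⟨m, by rw [hV]; simp [hm], ?_⟩
    simp only [Finset.mem_insert]
    rintro (e | e | e)
    · exact hvM (e ▸ hm)
    · exact hcM (e ▸ hm)
    · exact Finset.disjoint_left.1 hNM e hm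
  obtain ⟨n1, n2⟩ := many_nb h.wf hvc hcN rfl hcol heq
  have o1 : ((D.outN c) ∩ M).card ≤ 1 := by
    have : (D.outN c ∩ N) ∪ (D.outN c ∩ M) ⊆ D.outN c :=
      Finset.union_subset Finset.inter_subset_left Finset.inter_subset_left
    have h2 := Finset.card_le_card this
    rw [Finset.card_union_of_disjoint (by
      exact (hNM.mono Finset.inter_subset_right Finset.inter_subset_right)), card_outN] at h2
    omega
  have o2 : ((D.inN c) ∩ M).card ≤ 1 := by
    have : (D.inN c ∩ N) ∪ (D.inN c ∩ M) ⊆ D.inN c :=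
      Finset.union_subset Finset.inter_subset_left Finset.inter_subset_left
    have h2 := Finset.card_le_card this
    rw [Finset.card_union_of_disjoint (by
      exact (hNM.mono Finset.inter_subset_right Finset.inter_subset_right)), card_inN] at h2
    omega
  obtain ⟨m, hm⟩ := hM
  obtain ⟨u, hu, hu'⟩ : ∃ u ∈ M, ∀ q ∈ M, (c, q) ∈ D.arcs → q = u := by
    by_cases he : ∃ q ∈ M, (c, q) ∈ D.arcs
    · obtain ⟨q, hq, hcq⟩ := he
      refine ⟨q, hq, fun q' hq' hcq' => ?_⟩
      exact Finset.card_le_one.1 o1 _ (by simp [hcq', hq']) _ (by simp [hcq, hq])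
    · push Not at he
      exact ⟨m, hm, fun q hq hcq => (he q hq hcq).elim⟩
  obtain ⟨w', hw, hw'⟩ : ∃ u ∈ M, ∀ q ∈ M, (q, c) ∈ D.arcs → q = u := by
    by_cases he : ∃ q ∈ M, (q, c) ∈ D.arcs
    · obtain ⟨q, hq, hcq⟩ := he
      refine ⟨q, hq, fun q' hq' hcq' => ?_⟩
      exact Finset.card_le_one.1 o2 _ (by simp [hcq', hq']) _ (by simp [hcq, hq])
    · push Not at he
      exact ⟨m, hm, fun q hq hcq => (he q hq hcq).elim⟩
  refine ⟨insert c N, M, u, w', ⟨h.wf, ?_, ?_, ?_, hvM, by simp, by simp, hu, hw, ?_, ?_⟩, heq⟩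
  · rw [hV, Finset.insert_union]
  · rw [Finset.disjoint_insert_left]; exact ⟨hcM, hNM⟩
  · simp [hvc, hvN]
  · intro p hp q hq hpq
    rcases Finset.mem_insert.1 hp with rfl | hp
    · exact ⟨rfl, hu' q hq hpq⟩
    · exact (hno p hp q hq (Or.inl hpq)).elim
  · intro p hp q hq hpq
    rcases Finset.mem_insert.1 hq with rfl | hq
    · exact ⟨hw' p hp hpq, rfl⟩
    · exact (hno q hq p hp (Or.inr hpq)).elim

theorem twocut {D : Dgraph} (h : Crit k D) {v c : ℕ} {N M : Finset ℕ} (hvc : v ≠ c)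
    (hV : D.verts = insert v (insert c (N ∪ M))) (hNM : Disjoint N M) (hvN : v ∉ N) (hvM : v ∉ M)
    (hcN : c ∉ N) (hcM : c ∉ M) (hN : N.Nonempty) (hM : M.Nonempty)
    (hno : ∀ p ∈ N, ∀ q ∈ M, ¬ D.adj p q) (ho : D.outdeg c ≤ k) (hi : D.indeg c ≤ k) :
    ∃ A B u w', Sep D v A B c c u w' ∧
      ∀ φ : ℕ → Fin k, (D.pc (insert v A) ∅).Good φ → φ c = φ v := by
  by_cases e1 : ∀ φ : ℕ → Fin k, (D.pc (insert v (insert c N)) ∅).Good φ → φ c = φ v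
  · exact twocut_side h hvc hV hNM hvN hvM hcN hcM hM hno ho hi e1
  by_cases e2 : ∀ φ : ℕ → Fin k, (D.pc (insert v (insert c M)) ∅).Good φ → φ c = φ v
  · exact twocut_side h hvc (by rw [hV, Finset.union_comm]) hNM.symm hvM hvN hcM hcN hN
      (fun p hp q hq hpq => hno q hq p hp hpq.symm) ho hi e2
  exfalso
  push Not at e1 e2
  obtain ⟨φ, hφ, hne⟩ := e1
  obtain ⟨ψ', hψ', hne'⟩ := e2
  obtain ⟨σ, hσ1, hσ2⟩ := perm2 hne' hne
  have hψ := hψ'.perm σ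
  set ψ := fun x => σ (ψ' x) with hψd
  let θ : ℕ → Fin k := fun x => if x ∈ M then ψ x else φ x
  have tN : ∀ x ∈ insert v (insert c N), θ x = φ x := by
    intro x hx
    have : x ∉ M := by
      simp only [Finset.mem_insert] at hx
      rcases hx with rfl | rfl | hx
      · exact hvM
      · exact hcM
      · exact Finset.disjoint_left.1 hNM hx
    simp [θ, this]
  have tM : ∀ x ∈ insert v (insert c M), θ x = ψ x := by
    intro x hx
    simp only [Finset.mem_insert] at hx
    rcases hx with rfl | rfl | hx
    · simp only [θ, if_neg hvM]; exact hσ2.symm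
    · simp only [θ, if_neg hcM]; exact hσ1.symm
    · simp only [θ, if_pos hx]
  have g1 : (D.pc (insert v (insert c N)) ∅).Good θ := hφ.congr (S := insert v (insert c N)) (by
    intro p q hpq; simp only [mem_pc, Finset.notMem_empty, or_false] at hpq; exact hpq.2) tN
  have g2 : (D.pc (insert v (insert c M)) ∅).Good θ := hψ.congr (S := insert v (insert c M)) (by
    intro p q hpq; simp only [mem_pc, Finset.notMem_empty, or_false] at hpq; exact hpq.2) tM
  have hcv : θ c ≠ θ v := by rw [tN c (by simp), tN v (by simp)]; exact hne
  have key : ∀ p ∈ insert v (insert c N), ∀ q ∈ insert v (insert c N),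
      p ∈ insert v (insert c M) → q ∈ insert v (insert c M) → θ p = θ q → p = q := by
    have h0 : ∀ p ∈ insert v (insert c N), p ∈ insert v (insert c M) → p = v ∨ p = c := by
      intro p h1 h2
      simp only [Finset.mem_insert] at h1 h2
      rcases h1 with h1 | h1 | h1
      · exact Or.inl h1
      · exact Or.inr h1
      · rcases h2 with h2 | h2 | h2
        · exact Or.inl h2
        · exact Or.inr h2
        · exact (Finset.disjoint_left.1 hNM h1 h2).elim
    intro p hp q hq hp' hq' e
    rcases h0 p hp hp' with rfl | rfl <;> rcases h0 q hq hq' with rfl | rfl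
    · rfl
    · exact (hcv e.symm).elim
    · exact (hcv e).elim
    · rfl
  refine h.nc ⟨θ, ?_⟩
  refine Acy.mono ?_ (acy_glue (supp_pc D _ θ) (supp_pc D _ θ)
    (fun p hp q hq hp' hq' hr => key p hp q hq hp' hq' (rtg_mono_color hr))
    (fun p hp q hq hp' hq' hr => key p hp q hq hp' hq' (rtg_mono_color hr)) g1 g2)
  rintro p q ⟨hpq, he⟩
  have h1 := (h.wf _ hpq).1
  have h2 := (h.wf _ hpq).2.1
  rw [hV] at h1 h2
  by_cases hm : p ∈ M ∨ q ∈ M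
  · right
    refine ⟨?_, he⟩
    simp only [mem_pc, Finset.notMem_empty, or_false]
    refine ⟨hpq, ?_, ?_⟩
    · simp only [Finset.mem_insert, Finset.mem_union] at h1 ⊢
      rcases h1 with h1 | h1 | h1 | h1
      · exact Or.inl h1
      · exact Or.inr (Or.inl h1)
      · rcases hm with hm | hm
        · exact Or.inr (Or.inr hm)
        · exact (hno _ h1 _ hm (Or.inl hpq)).elim
      · exact Or.inr (Or.inr h1)
    · simp only [Finset.mem_insert, Finset.mem_union] at h2 ⊢
      rcases h2 with h1 | h1 | h1 | h1
      · exact Or.inl h1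
      · exact Or.inr (Or.inl h1)
      · rcases hm with hm | hm
        · exact (hno _ h1 _ hm (Or.inr hpq)).elim
        · exact Or.inr (Or.inr hm)
      · exact Or.inr (Or.inr h1)
  · left
    push Not at hm
    refine ⟨?_, he⟩
    simp only [mem_pc, Finset.notMem_empty, or_false]
    simp only [Finset.mem_insert, Finset.mem_union, hm.1, hm.2, or_false] at h1 h2 ⊢
    exact ⟨hpq, h1, h2⟩

/-! greedy colouring -/
inductive Conn (D : Dgraph) (r : ℕ) : Finset ℕ → Prop
  | base : Conn D r {r}
  | step (T : Finset ℕ) (w : ℕ) (h : Conn D r T) (hw : w ∉ T) (ha : ∃ x ∈ T, D.adj w x) :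
      Conn D r (insert w T)

theorem Conn.mem {D : Dgraph} {r : ℕ} {T : Finset ℕ} (h : Conn D r T) : r ∈ T := by
  induction h with
  | base => simp
  | step T w h hw ha ih => simp [ih]

theorem conn_of {D : Dgraph} {r : ℕ} {T : Finset ℕ} (hr : r ∈ T)
    (h : ∀ N ⊆ T, r ∈ N → N ≠ T → ∃ x ∈ N, ∃ w ∈ T, w ∉ N ∧ D.adj w x) : Conn D r T := by
  classical
  have hne : (T.powerset.filter fun N => Conn D r N).Nonempty :=
    ⟨{r}, by simp [hr, Conn.base]⟩
  obtain ⟨N, hN, hmax⟩ := Finset.exists_max_image _ Finset.card hne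
  simp only [Finset.mem_filter, Finset.mem_powerset] at hN hmax
  by_cases e : N = T
  · exact e ▸ hN.2
  · obtain ⟨x, hx, w, hw, hwN, ha⟩ := h N hN.1 hN.2.mem e
    have := hmax (insert w N) ⟨Finset.insert_subset hw hN.1, .step N w hN.2 hwN ⟨x, hx, ha⟩⟩
    rw [Finset.card_insert_of_notMem hwN] at this
    omega

theorem greedy {D : Dgraph} (hD : D.WF) {r : ℕ} {T : Finset ℕ} (hT : Conn D r T) :
    ∀ φ : ℕ → Fin k, T ⊆ D.verts → (∀ x ∈ T, D.outdeg x ≤ k ∧ D.indeg x ≤ k) →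
    (D.pc (D.verts \ T) ∅).Good φ →
    (∃ a b, a ∉ T ∧ b ∉ T ∧ a ≠ b ∧ φ a = φ b ∧
      (((r, a) ∈ D.arcs ∧ (r, b) ∈ D.arcs) ∨ ((a, r) ∈ D.arcs ∧ (b, r) ∈ D.arcs))) → D.Col k := by
  induction hT with
  | base =>
    intro φ hV hdeg hφ ⟨a, b, ha, hb, hab, he, hor⟩
    have hr := hdeg r (by simp)
    have hbase : Acy (fun p q => D.mono φ p q ∧ p ≠ r ∧ q ≠ r) := by
      refine hφ.mono ?_
      rintro p q ⟨⟨h1, h2⟩, h3, h4⟩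
      refine ⟨?_, h2⟩
      simp [h1, h3, h4, (hD _ h1).1, (hD _ h1).2.1]
    rcases hor with ⟨h1, h2⟩ | ⟨h1, h2⟩
    · obtain ⟨i, hi⟩ := free_col (D.outN r) φ (Or.inr ⟨by rw [card_outN]; exact hr.1, a, by simpa,
        b, by simpa, hab, he⟩)
      exact ⟨_, good_upd hbase (Or.inl fun q hq => ⟨(hD _ hq).2.2.symm, hi q (by simpa)⟩)⟩
    · obtain ⟨i, hi⟩ := free_col (D.inN r) φ (Or.inr ⟨by rw [card_inN]; exact hr.2, a, by simpa,
        b, by simpa, hab, he⟩)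
      exact ⟨_, good_upd hbase (Or.inr fun q hq => ⟨(hD _ hq).2.2, hi q (by simpa)⟩)⟩
  | step T w hc hw hadj ih =>
    intro φ hV hdeg hφ ⟨a, b, ha, hb, hab, he, hor⟩
    have hr := hdeg w (by simp)
    obtain ⟨x, hx, hwx⟩ := hadj
    have hbase : Acy (fun p q => (D.pc (D.verts \ T) ∅).mono φ p q ∧ p ≠ w ∧ q ≠ w) := by
      refine hφ.mono ?_
      rintro p q ⟨⟨h1, h2⟩, h3, h4⟩
      refine ⟨?_, h2⟩
      simp only [mem_pc, Finset.notMem_empty, or_false, Finset.mem_sdiff] at h1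
      simp [h1, h3, h4]
    have hfree : ∃ i, (∀ q, (w, q) ∈ (D.pc (D.verts \ T) ∅).arcs → q ≠ w ∧ φ q ≠ i) ∨
        (∀ q, (q, w) ∈ (D.pc (D.verts \ T) ∅).arcs → q ≠ w ∧ φ q ≠ i) := by
      rcases hwx with hwx | hwx
      · obtain ⟨i, hi⟩ := free_col ((D.outN w).erase x) φ (Or.inl (by
          have h1 : x ∈ D.outN w := by simpa
          have := Finset.card_erase_lt_of_mem h1
          rw [card_outN] at this; omega))
        refine ⟨i, Or.inl fun q hq => ?_⟩
        simp only [mem_pc, Finset.notMem_empty, or_false, Finset.mem_sdiff] at hq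
        refine ⟨(hD _ hq.1).2.2.symm, hi q ?_⟩
        simp [hq.1]; rintro rfl; exact hq.2.2.2 hx
      · obtain ⟨i, hi⟩ := free_col ((D.inN w).erase x) φ (Or.inl (by
          have h1 : x ∈ D.inN w := by simpa
          have := Finset.card_erase_lt_of_mem h1
          rw [card_inN] at this; omega))
        refine ⟨i, Or.inr fun q hq => ?_⟩
        simp only [mem_pc, Finset.notMem_empty, or_false, Finset.mem_sdiff] at hq
        refine ⟨(hD _ hq.1).2.2, hi q ?_⟩
        simp [hq.1]; rintro rfl; exact hq.2.1.2 hx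
    obtain ⟨i, hi⟩ := hfree
    have ha' : a ≠ w := fun e => ha (by simp [e])
    have hb' : b ≠ w := fun e => hb (by simp [e])
    refine ih _ (fun y hy => hV (by simp [hy])) (fun y hy => hdeg y (by simp [hy]))
      (good_upd hbase hi) ⟨a, b, fun h => ha (by simp [h]), fun h => hb (by simp [h]), hab, ?_, hor⟩
    rw [Function.update_of_ne ha', Function.update_of_ne hb', he]

end Dgraph

namespace Dgraph
open Relation
variable {k : ℕ}

theorem pair_step {D : Dgraph} (hk : 1 ≤ k) (h : Crit k D) {a b r : ℕ} (hab : a ≠ b)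
    (hdeg : ∀ x ∈ D.verts, x ≠ a → D.outdeg x ≤ k ∧ D.indeg x ≤ k)
    (hor : ((r, a) ∈ D.arcs ∧ (r, b) ∈ D.arcs) ∨ ((a, r) ∈ D.arcs ∧ (b, r) ∈ D.arcs)) :
    ((a, b) ∈ D.arcs ∧ (b, a) ∈ D.arcs) ∨ (∃ A B u w', Sep D a A B b b u w' ∧
      ∀ φ : ℕ → Fin k, (D.pc (insert a A) ∅).Good φ → φ b = φ a) := by
  have hr : r ∈ D.verts ∧ a ∈ D.verts ∧ b ∈ D.verts ∧ r ≠ a ∧ r ≠ b := by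
    rcases hor with ⟨h1, h2⟩ | ⟨h1, h2⟩
    · exact ⟨(h.wf _ h1).1, (h.wf _ h1).2.1, (h.wf _ h2).2.1, (h.wf _ h1).2.2, (h.wf _ h2).2.2⟩
    · exact ⟨(h.wf _ h1).2.1, (h.wf _ h1).1, (h.wf _ h2).1, (h.wf _ h1).2.2.symm,
        (h.wf _ h2).2.2.symm⟩
  obtain ⟨hrV, haV, hbV, hra, hrb⟩ := hr
  by_cases hd : (a, b) ∈ D.arcs ∧ (b, a) ∈ D.arcs
  · exact Or.inl hd
  right
  set T := D.verts \ {a, b} with hTd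
  have memT : ∀ x, x ∈ T ↔ x ∈ D.verts ∧ x ≠ a ∧ x ≠ b := by
    intro x; simp [hTd]
  by_cases hc : ∀ N ⊆ T, r ∈ N → N ≠ T → ∃ x ∈ N, ∃ w ∈ T, w ∉ N ∧ D.adj w x
  · exfalso
    have hconn := conn_of (D := D) ((memT r).2 ⟨hrV, hra, hrb⟩) hc
    refine h.nc (greedy h.wf hconn (fun _ => ⟨0, hk⟩) Finset.sdiff_subset ?_ ?_ ?_)
    · intro x hx; exact hdeg x ((memT x).1 hx).1 ((memT x).1 hx).2.1
    · have hin : ∀ p q, (D.pc (D.verts \ T) ∅).mono (fun _ => (⟨0, hk⟩ : Fin k)) p q →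
          (p, q) ∈ D.arcs ∧ ((p = a ∧ q = b) ∨ (p = b ∧ q = a)) := by
        rintro p q ⟨h1, -⟩
        simp only [mem_pc, Finset.notMem_empty, or_false, Finset.mem_sdiff, memT] at h1
        obtain ⟨h1, ⟨h2, h3⟩, h4, h5⟩ := h1
        have hpq := (h.wf _ h1).2.2
        have h3 : p = a ∨ p = b := by by_contra hh; push Not at hh; exact h3 ⟨h2, hh⟩
        have h5 : q = a ∨ q = b := by by_contra hh; push Not at hh; exact h5 ⟨h4, hh⟩
        refine ⟨h1, ?_⟩
        rcases h3 with rfl | rfl <;> rcases h5 with rfl | rfl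
        · exact (hpq rfl).elim
        · exact Or.inl ⟨rfl, rfl⟩
        · exact Or.inr ⟨rfl, rfl⟩
        · exact (hpq rfl).elim
      by_cases h1 : (a, b) ∈ D.arcs
      · have h2 : (b, a) ∉ D.arcs := fun h2 => hd ⟨h1, h2⟩
        refine acy_del (c := b) ?_ ?_
        · rintro p q ⟨hpq, h3, h4⟩ _
          rcases (hin p q hpq).2 with ⟨e1, e2⟩ | ⟨e1, e2⟩
          · exact h4 e2
          · exact h3 e1
        · intro q hq
          obtain ⟨h3, ⟨e1, e2⟩ | ⟨e1, e2⟩⟩ := hin _ _ hq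
          · exact hab e1.symm
          · subst e2; exact h2 h3
      · refine acy_del (c := a) ?_ ?_
        · rintro p q ⟨hpq, h3, h4⟩ _
          rcases (hin p q hpq).2 with ⟨e1, e2⟩ | ⟨e1, e2⟩
          · exact h3 e1
          · exact h4 e2
        · intro q hq
          obtain ⟨h3, ⟨e1, e2⟩ | ⟨e1, e2⟩⟩ := hin _ _ hq
          · subst e2; exact h1 h3
          · exact hab e1
    · exact ⟨a, b, fun h => ((memT a).1 h).2.1 rfl, fun h => ((memT b).1 h).2.2 rfl, hab, rfl, hor⟩
  · push Not at hc
    obtain ⟨N, hNT, hrN, hne, hno⟩ := hc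
    have hM : (T \ N).Nonempty := by
      rw [Finset.sdiff_nonempty]; intro hs; exact hne (Finset.Subset.antisymm hNT hs)
    refine twocut h hab (N := N) (M := T \ N) ?_ Finset.disjoint_sdiff ?_ ?_ ?_ ?_ ⟨r, hrN⟩ hM ?_
      (hdeg b hbV hab.symm).1 (hdeg b hbV hab.symm).2
    · ext x
      rw [Finset.union_sdiff_of_subset hNT]
      simp only [Finset.mem_insert, memT]
      by_cases e1 : x = a
      · simp [e1, haV]
      · by_cases e2 : x = b
        · simp [e2, hbV]
        · simp [e1, e2]
    · exact fun hh => ((memT a).1 (hNT hh)).2.1 rfl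
    · exact fun hh => ((memT a).1 (Finset.mem_sdiff.1 hh).1).2.1 rfl
    · exact fun hh => ((memT b).1 (hNT hh)).2.2 rfl
    · exact fun hh => ((memT b).1 (Finset.mem_sdiff.1 hh).1).2.2 rfl
    · intro p hp q hq hadj
      rw [Finset.mem_sdiff] at hq
      exact hno p hp q hq.1 hq.2 hadj.symm

theorem reg_complete {D : Dgraph} (hk : 2 ≤ k) (h : Crit k D) (hdeg : ∀ x ∈ D.verts, D.outdeg x ≤ k)
    (hd : ∀ r a b, a ≠ b → (((r, a) ∈ D.arcs ∧ (r, b) ∈ D.arcs) ∨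
      ((a, r) ∈ D.arcs ∧ (b, r) ∈ D.arcs)) → (a, b) ∈ D.arcs ∧ (b, a) ∈ D.arcs) :
    IsBiComplete D (k + 1) := by
  obtain ⟨r, hr, -⟩ := h.other (by omega) 0
  have hout : ∀ x ∈ D.verts, (D.outN x).card = k := fun x hx => by
    rw [card_outN]; exact le_antisymm (hdeg x hx) (h.outdeg_ge hk hx)
  have hrr : ∀ x, x ∉ D.outN x := fun x hx => (h.wf _ (mem_outN.1 hx)).2.2 rfl
  set W := insert r (D.outN r) with hW
  have hWc : W.card = k + 1 := by
    rw [hW, Finset.card_insert_of_notMem (hrr r), hout r hr]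
  have hrb : ∀ b ∈ D.outN r, (b, r) ∈ D.arcs := by
    intro b hb
    obtain ⟨a, ha, hab⟩ := Finset.exists_mem_ne (by rw [hout r hr]; omega) b
    rw [mem_outN] at ha hb
    have h1 := hd r a b hab (Or.inl ⟨ha, hb⟩)
    exact (hd a r b (h.wf _ hb).2.2 (Or.inr ⟨ha, h1.2⟩)).2
  have hall : ∀ x ∈ W, ∀ y ∈ W, x ≠ y → (x, y) ∈ D.arcs := by
    intro x hx y hy hxy
    rcases Finset.mem_insert.1 hx with rfl | hx
    · rcases Finset.mem_insert.1 hy with rfl | hy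
      · exact (hxy rfl).elim
      · exact mem_outN.1 hy
    · rcases Finset.mem_insert.1 hy with rfl | hy
      · exact hrb _ hx
      · exact (hd r x y hxy (Or.inl ⟨mem_outN.1 hx, mem_outN.1 hy⟩)).1
  have hWV : W ⊆ D.verts := by
    intro x hx
    rcases Finset.mem_insert.1 hx with rfl | hx
    · exact hr
    · exact (h.wf _ (mem_outN.1 hx)).2.1
  have hcl : ∀ x ∈ W, D.outN x = W.erase x := by
    intro x hx
    symm
    apply Finset.eq_of_subset_of_card_le
    · intro y hy
      rw [Finset.mem_erase] at hy
      exact mem_outN.2 (hall x hx y hy.2 hy.1.symm)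
    · rw [hout x (hWV hx), Finset.card_erase_of_mem hx, hWc]; simp
  have hWe : W = D.verts := by
    apply Finset.Subset.antisymm hWV
    intro y hy
    by_contra hyW
    obtain ⟨p, q, hpq, hp, hq⟩ := exit_arc (h.cut1 hk r hr y hy) (X := W) (by simp [hW]) hyW
    have : q ∈ D.outN p := mem_outN.2 hpq
    rw [hcl p hp] at this
    exact hq (Finset.mem_of_mem_erase this)
  refine ⟨by rw [← hWe, hWc], ?_⟩
  ext ⟨x, y⟩
  simp only [Finset.mem_filter, Finset.mem_product]
  constructor
  · intro hxy; exact ⟨⟨(h.wf _ hxy).1, (h.wf _ hxy).2.1⟩, (h.wf _ hxy).2.2⟩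
  · rintro ⟨⟨h1, h2⟩, h3⟩
    rw [← hWe] at h1 h2
    exact hall x h1 y h2 h3

theorem reg_big {D : Dgraph} (hk : 3 ≤ k) (h : Ext k D) (hdeg : ∀ x ∈ D.verts, D.outdeg x ≤ k) :
    IsBiComplete D (k + 1) := by
  refine reg_complete (by omega) h.toCrit hdeg ?_
  intro r a b hab hor
  rcases pair_step (by omega) h.toCrit hab (fun x hx _ => ⟨hdeg x hx, by
    rw [h.deg_eq (by omega) hx]; exact hdeg x hx⟩) hor with h1 | ⟨A, B, u, w', S, -⟩
  · exact h1
  · exfalso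
    have h1 := S.deg_v (by omega) h.toCrit
    have h2 := hdeg a S.vV
    split_ifs at h1 <;> omega

/-- deleting a hub -/
theorem ext_del {m : ℕ} {D : Dgraph} (hm : 2 ≤ m) (h : Ext (m + 1) D) {v : ℕ} (hv : v ∈ D.verts)
    (hub : ∀ x ∈ D.verts, x ≠ v → (x, v) ∈ D.arcs ∧ (v, x) ∈ D.arcs) :
    Ext m (D.pc (D.verts.erase v) ∅) ∧
    ∀ x ∈ D.verts, x ≠ v → (D.pc (D.verts.erase v) ∅).outdeg x + 1 = D.outdeg x := by
  set G := D.pc (D.verts.erase v) ∅ with hG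
  have memG : ∀ p q, (p, q) ∈ G.arcs ↔ (p, q) ∈ D.arcs ∧ p ≠ v ∧ q ≠ v := by
    intro p q
    simp only [hG, mem_pc, Finset.notMem_empty, or_false, Finset.mem_erase]
    constructor
    · rintro ⟨h1, h2, h3⟩; exact ⟨h1, h2.1, h3.1⟩
    · rintro ⟨h1, h2, h3⟩; exact ⟨h1, ⟨h2, (h.wf _ h1).1⟩, h3, (h.wf _ h1).2.1⟩
  have hdeg : ∀ x ∈ D.verts, x ≠ v → G.outdeg x + 1 = D.outdeg x := by
    intro x hx hxv
    rw [← card_outN, ← card_outN]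
    have : D.outN x = insert v (G.outN x) := by
      ext y; simp only [mem_outN, Finset.mem_insert, memG]
      by_cases e : y = v
      · simp [e, (hub x hx hxv).1]
      · simp [e, hxv]
    rw [this, Finset.card_insert_of_notMem]
    simp [memG]
  refine ⟨⟨⟨?_, ?_, ?_, ?_⟩, ?_⟩, hdeg⟩
  · rintro ⟨p, q⟩ ha
    have := (memG p q).1 ha
    have hw := h.wf _ this.1
    simp only [hG, pc_verts, Finset.mem_erase]
    exact ⟨⟨this.2.1, hw.1⟩, ⟨this.2.2, hw.2.1⟩, hw.2.2⟩
  · rintro ⟨φ, hφ⟩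
    apply h.nc
    let ψ : ℕ → Fin (m + 1) := fun x => if x = v then Fin.last m else (φ x).castSucc
    refine ⟨ψ, ?_⟩
    have hne : ∀ x, x ≠ v → ψ x ≠ ψ v := by
      intro x hx; simp only [ψ, if_neg hx, if_true]; exact (Fin.castSucc_lt_last _).ne
    refine acy_del (c := v) ?_ ?_
    · refine hφ.mono ?_
      rintro p q ⟨⟨h1, h2⟩, h3, h4⟩
      refine ⟨(memG p q).2 ⟨h1, h3, h4⟩, ?_⟩
      simp only [ψ, if_neg h3, if_neg h4] at h2
      exact Fin.castSucc_injective _ h2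
    · rintro q ⟨h1, h2⟩
      exact hne q (h.wf _ h1).2.2.symm h2.symm
  · rintro ⟨p, q⟩ ha
    have ha' := (memG p q).1 ha
    obtain ⟨φ0, hφ0⟩ := h.amin _ ha'.1
    obtain ⟨σ, hσ⟩ := perm1 (φ0 v) (Fin.last m)
    have hφ := hφ0.perm σ
    set φ := fun x => σ (φ0 x) with hφd
    have hφv : φ v = Fin.last m := hσ
    have hne : ∀ x ∈ D.verts, x ≠ v → φ x ≠ Fin.last m := by
      intro x hx hxv e
      have hh := hub x hx hxv
      have m1 : Dgraph.mono ⟨D.verts, D.arcs.erase (p, q)⟩ φ x v := by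
        refine ⟨?_, by rw [e, hφv]⟩
        simp only [Finset.mem_erase]
        refine ⟨fun e => ha'.2.2 (by rw [Prod.mk.injEq] at e; exact e.2.symm), hh.1⟩
      have m2 : Dgraph.mono ⟨D.verts, D.arcs.erase (p, q)⟩ φ v x := by
        refine ⟨?_, by rw [e, hφv]⟩
        simp only [Finset.mem_erase]
        refine ⟨fun e => ha'.2.1 (by rw [Prod.mk.injEq] at e; exact e.1.symm), hh.2⟩
      exact hφ x v m1 (.single m2)
    let ψ : ℕ → Fin m := fun x => if hx : φ x = Fin.last m then ⟨0, by omega⟩ else (φ x).castPred hx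
    refine ⟨ψ, hφ.of_imp ?_⟩
    intro a b hab he
    simp only [Finset.mem_erase] at hab ⊢
    have hab' := (memG a b).1 hab.2
    have h1 := hne a (h.wf _ hab'.1).1 hab'.2.1
    have h2 := hne b (h.wf _ hab'.1).2.1 hab'.2.2
    simp only [ψ, dif_neg h1, dif_neg h2] at he
    refine ⟨⟨hab.1, hab'.1⟩, ?_⟩
    have := congrArg Fin.castSucc he
    simpa using this
  · intro x hx
    simp only [hG, pc_verts, Finset.mem_erase] at hx
    have h1 := hdeg x hx.2 hx.1
    have h2 := h.toCrit.outdeg_ge (by omega) hx.2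
    have : (G.outN x).Nonempty := by
      rw [← Finset.card_pos, card_outN]; omega
    obtain ⟨y, hy⟩ := this
    exact ⟨(x, y), mem_outN.1 hy, Or.inl rfl⟩
  · intro x hx y hy hxy
    simp only [hG, pc_verts, Finset.mem_erase] at hx hy
    obtain ⟨X, hxX, hyX, hX⟩ := h.cc x hx.2 y hy.2 hxy
    refine ⟨X, hxX, hyX, ?_⟩
    have hlt : (G.dicutArcs X).card < (D.dicutArcs X).card := by
      apply Finset.card_lt_card
      rw [Finset.ssubset_iff_of_subset]
      · by_cases hvX : v ∈ X
        · refine ⟨(v, y), mem_cut.2 ⟨(hub y hy.2 hy.1).2, hvX, hyX⟩, ?_⟩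
          rw [mem_cut, memG]; simp
        · refine ⟨(x, v), mem_cut.2 ⟨(hub x hx.2 hx.1).1, hxX, hvX⟩, ?_⟩
          rw [mem_cut, memG]; simp
      · rintro ⟨p, q⟩ ha
        rw [mem_cut] at ha ⊢
        exact ⟨((memG p q).1 ha.1).1, ha.2⟩
    simp only [dO] at hX ⊢
    omega

theorem noH2 {D : Dgraph} (h : Ext 2 D) (hdeg : ∀ x ∈ D.verts, D.outdeg x ≤ 2) : ¬ HasH D := by
  rintro ⟨v, A, B, t, u, S⟩
  have h1 := S.deg (le_refl 2) h.toCrit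
  have h2 := hdeg v S.1.vV
  omega

theorem pA_deg2 {D : Dgraph} {v : ℕ} {A B : Finset ℕ} {t w u w' : ℕ} (S : Sep D v A B t w u w')
    (h : Ext 2 D) (hdeg : ∀ x ∈ D.verts, D.outdeg x ≤ 2) (h1 : (t, u) ∈ D.arcs) :
    ∀ x ∈ (pA D v A t w u w').verts, (pA D v A t w u w').outdeg x ≤ 2 := by
  intro x hx
  have hx' : x ∈ insert v A := hx
  rw [← card_outN]
  have mp : ∀ p q, (p, q) ∈ (pA D v A t w u w').arcs ↔
    ((p, q) ∈ D.arcs ∧ p ∈ insert v A ∧ q ∈ insert v A) ∨ ((t, u) ∈ D.arcs ∧ p = t ∧ q = v) ∨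
      ((w', w) ∈ D.arcs ∧ p = v ∧ q = w) := by
    intro p q; rw [pA, mem_pc, mem_EA]; simp only [Prod.mk.injEq]
  by_cases hxv : x = v
  · subst hxv
    have hB := S.symm.deg_A (le_refl 2) h.toCrit
    rw [if_pos h1] at hB
    have e1 : (pA D x A t w u w').outN x ⊆ insert w (D.outN x ∩ A) := by
      intro y hy
      rw [mem_outN, mp] at hy
      rw [Finset.mem_insert, Finset.mem_inter, mem_outN]
      rcases hy with hy | hy | hy
      · right
        refine ⟨hy.1, ?_⟩
        rcases Finset.mem_insert.1 hy.2.2 with e | e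
        · exact ((h.wf _ hy.1).2.2 e.symm).elim
        · exact e
      · exact (S.vA (hy.2.1 ▸ S.tA)).elim
      · exact Or.inl hy.2.2
    have e2 : (D.arcs.filter fun a => a.1 = x ∧ a.2 ∈ B).card = (D.outN x ∩ B).card := by
      have : (D.arcs.filter fun a => a.1 = x ∧ a.2 ∈ B) = (D.outN x ∩ B).image (fun y => (x, y)) := by
        ext ⟨p, q⟩
        simp only [Finset.mem_filter, Finset.mem_image, Finset.mem_inter, mem_outN, Prod.mk.injEq]
        constructor
        · rintro ⟨a, rfl, b⟩; exact ⟨q, ⟨a, b⟩, rfl, rfl⟩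
        · rintro ⟨y, ⟨a, b⟩, rfl, rfl⟩; exact ⟨a, rfl, b⟩
      rw [this, Finset.card_image_of_injective]
      intro a b e; simpa using e
    have e3 : (D.outN x ∩ A).card + (D.outN x ∩ B).card ≤ 2 := by
      rw [← Finset.card_union_of_disjoint (S.disj.mono Finset.inter_subset_right
        Finset.inter_subset_right)]
      refine (Finset.card_le_card (Finset.union_subset Finset.inter_subset_left
        Finset.inter_subset_left)).trans ?_
      rw [card_outN]; exact hdeg x S.vV
    have := (Finset.card_le_card e1).trans (Finset.card_insert_le _ _)
    omega
  · have hxA : x ∈ A := (Finset.mem_insert.1 hx').resolve_left hxv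
    refine le_trans ?_ (hdeg x (S.AV hx'))
    rw [← card_outN]
    apply Finset.card_le_card_of_injOn (fun y => if (x, y) ∈ D.arcs then y else u)
    · intro y hy
      rw [Finset.mem_coe, mem_outN, mp] at hy
      rw [Finset.mem_coe, mem_outN]
      rcases hy with hy | hy | hy
      · simp [hy.1]
      · dsimp only
        split_ifs with e
        · exact e
        · rw [hy.2.1]; exact h1
      · exact (hxv hy.2.1).elim
    · intro y hy z hz e
      rw [Finset.mem_coe, mem_outN, mp] at hy hz
      have aux : ∀ y, (x, y) ∈ D.arcs → y ∈ insert v A → y ≠ u := by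
        intro y _ h2 e; exact S.notA S.uB (e ▸ h2)
      by_cases a1 : (x, y) ∈ D.arcs <;> by_cases a2 : (x, z) ∈ D.arcs
      · simpa [a1, a2] using e
      · simp only [a1, a2, if_true, if_false] at e
        rcases hy with hy | hy | hy
        · exact (aux y hy.1 hy.2.2 e).elim
        · exact (S.notA S.uB (by rw [← e, hy.2.2]; simp)).elim
        · exact (hxv hy.2.1).elim
      · simp only [a1, a2, if_true, if_false] at e
        rcases hz with hy | hy | hy
        · exact (aux z hy.1 hy.2.2 e.symm).elim
        · exact (S.notA S.uB (by rw [e, hy.2.2]; simp)).elim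
        · exact (hxv hy.2.1).elim
      · simp only [a1, a2, false_and, false_or] at hy hz
        rcases hy with hy | hy
        · rcases hz with hz | hz
          · rw [hy.2.2, hz.2.2]
          · exact (hxv hz.2.1).elim
        · exact (hxv hy.2.1).elim

def Symm (D : Dgraph) : Prop := ∀ p q, (p, q) ∈ D.arcs → (q, p) ∈ D.arcs

theorem reg2_symm : ∀ (n : ℕ) {D : Dgraph}, D.verts.card ≤ n → Ext 2 D →
    (∀ x ∈ D.verts, D.outdeg x ≤ 2) → Symm D := by
  intro n
  induction n with
  | zero =>
    intro D hn h _ p q hpq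
    have : D.verts = ∅ := by rw [← Finset.card_eq_zero]; omega
    have := (h.wf _ hpq).1
    simp_all
  | succ n ih =>
    intro D hn h hdeg
    by_cases hd : ∀ r a b, a ≠ b → (((r, a) ∈ D.arcs ∧ (r, b) ∈ D.arcs) ∨
      ((a, r) ∈ D.arcs ∧ (b, r) ∈ D.arcs)) → (a, b) ∈ D.arcs ∧ (b, a) ∈ D.arcs
    · obtain ⟨-, ha⟩ := reg_complete (le_refl 2) h.toCrit hdeg hd
      intro p q hpq
      rw [ha] at hpq ⊢
      simp only [Finset.mem_filter, Finset.mem_product] at hpq ⊢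
      exact ⟨⟨hpq.1.2, hpq.1.1⟩, hpq.2.symm⟩
    push Not at hd
    obtain ⟨r, b, a, hab, hor, hnd⟩ := hd
    rcases pair_step (by omega) h.toCrit hab (fun x hx _ => ⟨hdeg x hx, by
      rw [h.deg_eq (by omega) hx]; exact hdeg x hx⟩) hor with h1 | ⟨A, B, y, x, S, hf⟩
    · exact (hnd h1.1 h1.2).elim
    have hH := noH2 h hdeg
    have h1 := S.deg_v (le_refl 2) h.toCrit
    have h2 := hdeg b S.vV
    have hay : (a, y) ∈ D.arcs := by by_contra e; rw [if_neg e] at h1; split_ifs at h1 <;> omega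
    have hxa : (x, a) ∈ D.arcs := by by_contra e; rw [if_neg e] at h1; split_ifs at h1 <;> omega
    have EAx := S.ext_pA' (le_refl 2) h (Or.inr (Or.inl hf)) (Or.inl rfl)
    have EBx := S.symm.ext_pA' (le_refl 2) h (Or.inr (Or.inr hf)) (Or.inr hH)
    have sA := ih (D := pA D b A a a y x) (by have := S.card_lt; simp only [pA, pc_verts]; omega) EAx
      (pA_deg2 S h hdeg hay)
    have sB := ih (D := pA D b B x y a a) (by have := S.symm.card_lt; simp only [pA, pc_verts]; omega)
      EBx (pA_deg2 S.symm h hdeg hxa)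
    have mA : ∀ p q, (p, q) ∈ (pA D b A a a y x).arcs ↔
      ((p, q) ∈ D.arcs ∧ p ∈ insert b A ∧ q ∈ insert b A) ∨ (p = a ∧ q = b) ∨
        (p = b ∧ q = a) := by
      intro p q; rw [pA, mem_pc, mem_EA]; simp only [Prod.mk.injEq, hay, hxa, true_and]
    have mB : ∀ p q, (p, q) ∈ (pA D b B x y a a).arcs ↔
      ((p, q) ∈ D.arcs ∧ p ∈ insert b B ∧ q ∈ insert b B) ∨ (p = x ∧ q = b) ∨
        (p = b ∧ q = y) := by
      intro p q; rw [pA, mem_pc, mem_EA]; simp only [Prod.mk.injEq, hay, hxa, true_and]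
    have hba : b ≠ a := fun e => S.vA (e ▸ S.tA)
    have hxy : x = y := by
      by_contra hxy
      have hxb : (x, b) ∈ (pA D b B x y a a).arcs := (mB x b).2 (Or.inr (Or.inl ⟨rfl, rfl⟩))
      have hab' : (a, b) ∈ (pA D b A a a y x).arcs := (mA a b).2 (Or.inr (Or.inl ⟨rfl, rfl⟩))
      obtain ⟨ψ, hψ⟩ := EBx.amin _ hxb
      obtain ⟨φ, hφ⟩ := EAx.amin _ hab'
      have nab := S.tv_new (le_refl 2) h EAx.toCrit hay
      have nxb := S.symm.tv_new (le_refl 2) h EBx.toCrit hxa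
      have hyb : ψ y ≠ ψ b := by
        intro e
        refine hψ b y ⟨?_, e.symm⟩ (.single ⟨?_, e⟩)
        · simp only [Finset.mem_erase]
          refine ⟨fun e => ?_, (mB b y).2 (Or.inr (Or.inr ⟨rfl, rfl⟩))⟩
          rw [Prod.mk.injEq] at e; exact S.vB (e.1 ▸ S.wB)
        · simp only [Finset.mem_erase]
          refine ⟨fun e => ?_, sB _ _ ((mB b y).2 (Or.inr (Or.inr ⟨rfl, rfl⟩)))⟩
          rw [Prod.mk.injEq] at e; exact hxy e.1.symm
      have gA : (D.pc (insert b A) ∅).Good φ := hφ.sub (by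
        rintro ⟨p, q⟩ hpq
        simp only [mem_pc, Finset.notMem_empty, or_false] at hpq
        rw [Finset.mem_erase]
        refine ⟨fun e => nab (e ▸ hpq.1), (mA p q).2 (Or.inl hpq)⟩)
      have gB : (D.pc (insert b B) ∅).Good ψ := hψ.sub (by
        rintro ⟨p, q⟩ hpq
        simp only [mem_pc, Finset.notMem_empty, or_false] at hpq
        rw [Finset.mem_erase]
        refine ⟨fun e => nxb (e ▸ hpq.1), (mB p q).2 (Or.inl hpq)⟩)
      have fab := hf φ gA
      obtain ⟨θ, σ, hθ, -, -⟩ := combine S gA gB (fun _ hh => hyb (rtg_mono_color hh.2))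
        (by
          rintro _ ⟨-, hh⟩
          refine hφ b a ⟨?_, fab.symm⟩ (ReflTransGen.mono ?_ _ _ hh)
          · simp only [Finset.mem_erase]
            refine ⟨fun e => ?_, (mA b a).2 (Or.inr (Or.inr ⟨rfl, rfl⟩))⟩
            rw [Prod.mk.injEq] at e; exact hba e.1
          · rintro p q ⟨hpq, e⟩
            refine ⟨?_, e⟩
            simp only [mem_pc, Finset.notMem_empty, or_false] at hpq
            simp only [Finset.mem_erase]
            exact ⟨fun e => nab (e ▸ hpq.1), (mA p q).2 (Or.inl hpq)⟩)
        (fun _ _ hh => hyb hh.2.2.2) (fun _ => Or.inr (Or.inl fab))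
      exact h.nc ⟨θ, hθ⟩
    subst hxy
    have nab := S.tv_new (le_refl 2) h EAx.toCrit hay
    have nba := S.vw_new (le_refl 2) h EAx.toCrit hxa
    have nxb := S.symm.tv_new (le_refl 2) h EBx.toCrit hxa
    have nbx := S.symm.vw_new (le_refl 2) h EBx.toCrit hay
    intro p q hpq
    have hw := h.wf _ hpq
    rw [S.memV, S.memV] at hw
    dsimp only at hw
    have caseA : p ∈ insert b A → q ∈ insert b A → (q, p) ∈ D.arcs := by
      intro hp hq
      rcases (mA q p).1 (sA p q ((mA p q).2 (Or.inl ⟨hpq, hp, hq⟩))) with h3 | ⟨rfl, rfl⟩ | ⟨rfl, rfl⟩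
      · exact h3.1
      · exact (nba hpq).elim
      · exact (nab hpq).elim
    have caseB : p ∈ insert b B → q ∈ insert b B → (q, p) ∈ D.arcs := by
      intro hp hq
      rcases (mB q p).1 (sB p q ((mB p q).2 (Or.inl ⟨hpq, hp, hq⟩))) with h3 | ⟨rfl, rfl⟩ | ⟨rfl, rfl⟩
      · exact h3.1
      · exact (nbx hpq).elim
      · exact (nxb hpq).elim
    rcases hw with ⟨h3 | h3 | h3, h4 | h4 | h4, -⟩
    · exact caseA (by simp [h3]) (by simp [h4])
    · exact caseA (by simp [h3]) (by simp [h4])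
    · exact caseB (by simp [h3]) (by simp [h4])
    · exact caseA (by simp [h3]) (by simp [h4])
    · exact caseA (by simp [h3]) (by simp [h4])
    · obtain ⟨rfl, rfl⟩ := S.cAB p h3 q h4 hpq; exact hxa
    · exact caseB (by simp [h3]) (by simp [h4])
    · obtain ⟨rfl, rfl⟩ := S.cBA p h3 q h4 hpq; exact hay
    · exact caseB (by simp [h3]) (by simp [h4])

end Dgraph

namespace Dgraph
open Relation
variable {k : ℕ}

theorem mem_cycArcs {p : List ℕ} {x y : ℕ} : (x, y) ∈ cycArcs p ↔
    ∃ i, ∃ h : i < p.length, p[i] = x ∧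
      p[(i + 1) % p.length]'(Nat.mod_lt _ (by omega)) = y := by
  simp only [cycArcs, List.mem_toFinset, List.mem_iff_getElem]
  constructor
  · rintro ⟨i, hi, e⟩
    have hi' : i < p.length := by simp at hi; exact hi
    refine ⟨i, hi', ?_⟩
    simp only [List.getElem_zip, List.getElem_rotate, Prod.mk.injEq] at e
    exact e
  · rintro ⟨i, hi, e1, e2⟩
    refine ⟨i, by simp [hi], ?_⟩
    simp only [List.getElem_zip, List.getElem_rotate, Prod.mk.injEq]
    exact ⟨e1, e2⟩

theorem odd_cycle {D : Dgraph} (h : Ext 2 D) (hdeg : ∀ x ∈ D.verts, D.outdeg x ≤ 2) (hs : Symm D) :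
    ∃ p : List ℕ, 3 ≤ p.length ∧ Odd p.length ∧ p.Nodup ∧ D.verts = p.toFinset ∧
      D.arcs = symmCyc p := by
  classical
  have hout : ∀ x ∈ D.verts, (D.outN x).card = 2 := fun x hx => by
    rw [card_outN]; exact le_antisymm (hdeg x hx) (h.toCrit.outdeg_ge (le_refl 2) hx)
  obtain ⟨r, hr, -⟩ := h.toCrit.other (by omega) 0
  let P : List ℕ → Prop := fun p => p ≠ [] ∧ p.Nodup ∧ (∀ x ∈ p, x ∈ D.verts) ∧ p.IsChain D.arc
  have hlen : ∀ p, P p → p.length ≤ D.verts.card := by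
    intro p hp
    rw [← List.toFinset_card_of_nodup hp.2.1]
    exact Finset.card_le_card fun x hx => hp.2.2.1 x (by simpa using hx)
  obtain ⟨p, hp, hmax⟩ : ∃ p, P p ∧ ∀ q, P q → q.length ≤ p.length := by
    by_contra hc
    push Not at hc
    have : ∀ n, ∃ p, P p ∧ n ≤ p.length := by
      intro n
      induction n with
      | zero => exact ⟨[r], ⟨by simp, by simp, by simpa, by simp⟩, by simp⟩
      | succ n ih =>
        obtain ⟨p, hp, hn⟩ := ih
        obtain ⟨q, hq, hlt⟩ := hc p hp
        exact ⟨q, hq, by omega⟩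
    obtain ⟨p, hp, hn⟩ := this (D.verts.card + 1)
    have := hlen p hp
    omega
  obtain ⟨hne, hnd, hpV, hch⟩ := hp
  have hpos : 0 < p.length := List.length_pos_iff.2 hne
  have inj : ∀ i j (hi : i < p.length) (hj : j < p.length), p[i] = p[j] → i = j :=
    fun i j hi hj e => (List.Nodup.getElem_inj_iff hnd).1 e
  have step : ∀ i (hi : i + 1 < p.length), (p[i], p[i+1]) ∈ D.arcs := fun i hi =>
    (List.isChain_iff_getElem.1 hch) i hi
  have hin : ∀ q, (p[0], q) ∈ D.arcs → q ∈ p := by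
    intro q hq
    by_contra hqp
    have := hmax (q :: p) ⟨by simp, by simp [hqp, hnd], by
      intro x hx
      rcases List.mem_cons.1 hx with rfl | hx
      · exact (h.wf _ hq).2.1
      · exact hpV x hx, by
      rcases p with _ | ⟨a, l⟩
      · simp at hpos
      · rw [List.isChain_cons_cons]
        exact ⟨hs _ _ hq, hch⟩⟩
    simp at this
  have hp0 : p[0] ∈ D.verts := hpV _ (List.getElem_mem _)
  obtain ⟨j, hj, hj1, hj0, hja⟩ : ∃ j, ∃ hj : j < p.length, j ≠ 1 ∧ j ≠ 0 ∧ (p[0], p[j]) ∈ D.arcs := by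
    by_cases h1 : 1 < p.length
    · obtain ⟨q, hq, hq1⟩ := Finset.exists_mem_ne (by rw [hout _ hp0]; omega) p[1] 
      have hq := mem_outN.1 hq
      obtain ⟨j, hj, rfl⟩ := List.mem_iff_getElem.1 (hin q hq)
      refine ⟨j, hj, fun e => hq1 (by subst e; rfl), fun e => ?_, hq⟩
      subst e; exact (h.wf _ hq).2.2 rfl
    · obtain ⟨q, hq⟩ : (D.outN p[0]).Nonempty := by rw [← Finset.card_pos, hout _ hp0]; omega
      have hq := mem_outN.1 hq
      obtain ⟨j, hj, rfl⟩ := List.mem_iff_getElem.1 (hin q hq)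
      have : j = 0 := by omega
      subst this
      exact ((h.wf _ hq).2.2 rfl).elim
  have hjl : j + 1 = p.length := by
    by_contra hne'
    have hj' : j + 1 < p.length := by omega
    have h3 : ({p[j-1], p[j+1], p[0]} : Finset ℕ) ⊆ D.outN p[j] := by
      intro x hx
      simp only [Finset.mem_insert, Finset.mem_singleton] at hx
      rw [mem_outN]
      rcases hx with rfl | rfl | rfl
      · have := hs _ _ (step (j-1) (by omega))
        convert this using 4
        omega
      · exact step j hj'
      · exact hs _ _ hja
    have := Finset.card_le_card h3
    rw [hout _ (hpV _ (List.getElem_mem _)), Finset.card_insert_of_notMem,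
      Finset.card_insert_of_notMem, Finset.card_singleton] at this
    · omega
    · rw [Finset.mem_singleton]; intro e; have := inj _ _ _ _ e; omega
    · simp only [Finset.mem_insert, Finset.mem_singleton]
      rintro (e | e) <;> have := inj _ _ _ _ e <;> omega
  set n := p.length with hn
  have hn3 : 3 ≤ n := by omega
  have cyc : ∀ i (hi : i < n), (p[i], p[(i+1) % n]'(Nat.mod_lt _ hpos)) ∈ D.arcs := by
    intro i hi
    by_cases e : i + 1 < n
    · have := step i e
      convert this using 3
      exact Nat.mod_eq_of_lt e
    · have e' : i + 1 = n := by omega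
      have hij : i = j := by omega
      subst hij
      have := hs _ _ hja
      convert this using 3
      rw [e', Nat.mod_self]
  have pred : ∀ i (hi : i < n), ∃ j, ∃ hj : j < n, (j + 1) % n = i ∧ j ≠ (i + 1) % n := by
    intro i hi
    rcases Nat.eq_zero_or_pos i with rfl | hi0
    · refine ⟨n - 1, by omega, ?_, ?_⟩
      · rw [Nat.sub_add_cancel (by omega), Nat.mod_self]
      · rw [Nat.mod_eq_of_lt (by omega)]; omega
    · refine ⟨i - 1, by omega, ?_, ?_⟩
      · rw [Nat.sub_add_cancel (by omega), Nat.mod_eq_of_lt hi]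
      · by_cases e : i + 1 < n
        · rw [Nat.mod_eq_of_lt e]; omega
        · have : i + 1 = n := by omega
          rw [this, Nat.mod_self]; omega
  have outs : ∀ i (hi : i < n) y, (p[i], y) ∈ D.arcs →
      (p[i], y) ∈ cycArcs p ∨ (y, p[i]) ∈ cycArcs p := by
    intro i hi y hy
    obtain ⟨j, hj, e1, e2⟩ := pred i hi
    have hsub : ({p[(i+1) % n]'(Nat.mod_lt _ hpos), p[j]} : Finset ℕ) ⊆ D.outN p[i] := by
      intro x hx
      simp only [Finset.mem_insert, Finset.mem_singleton] at hx
      rw [mem_outN]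
      rcases hx with rfl | rfl
      · exact cyc i hi
      · have := hs _ _ (cyc j hj)
        simpa only [e1] using this
    have heq := Finset.eq_of_subset_of_card_le hsub (by
      rw [hout _ (hpV _ (List.getElem_mem _)), Finset.card_pair]
      intro e; exact e2 (inj _ _ _ _ e).symm)
    have : y ∈ D.outN p[i] := mem_outN.2 hy
    rw [← heq] at this
    simp only [Finset.mem_insert, Finset.mem_singleton] at this
    rcases this with rfl | rfl
    · left; rw [mem_cycArcs]; exact ⟨i, hi, rfl, rfl⟩
    · right; rw [mem_cycArcs]; exact ⟨j, hj, rfl, by simp only [← hn, e1]⟩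
  have inp : ∀ x y, (x, y) ∈ cycArcs p → x ∈ p ∧ y ∈ p := by
    intro x y hxy
    obtain ⟨i, hi, rfl, rfl⟩ := mem_cycArcs.1 hxy
    exact ⟨List.getElem_mem _, List.getElem_mem _⟩
  have hV : D.verts = p.toFinset := by
    apply Finset.Subset.antisymm
    · intro y hy
      by_contra hyp
      obtain ⟨a, b, hab, ha, hb⟩ := exit_arc (h.toCrit.cut1 (le_refl 2) p[0] hp0 y hy)
        (X := p.toFinset) (by simp) hyp
      simp only [List.mem_toFinset] at ha hb
      obtain ⟨i, hi, rfl⟩ := List.mem_iff_getElem.1 ha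
      rcases outs i hi b hab with h1 | h1
      · exact hb (inp _ _ h1).2
      · exact hb (inp _ _ h1).1
    · intro x hx; exact hpV x (by simpa using hx)
  have memS : ∀ x y, (x, y) ∈ symmCyc p ↔ (x, y) ∈ cycArcs p ∨ (y, x) ∈ cycArcs p := by
    intro x y
    simp only [symmCyc, Finset.mem_union, Finset.mem_image, Prod.exists, Prod.swap_prod_mk,
      Prod.mk.injEq]
    constructor
    · rintro (h1 | ⟨a, b, h1, rfl, rfl⟩)
      · exact Or.inl h1
      · exact Or.inr h1
    · rintro (h1 | h1)
      · exact Or.inl h1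
      · exact Or.inr ⟨_, _, h1, rfl, rfl⟩
  have hA : D.arcs = symmCyc p := by
    ext ⟨x, y⟩
    rw [memS]
    constructor
    · intro hxy
      have := (h.wf _ hxy).1
      rw [hV, List.mem_toFinset] at this
      obtain ⟨i, hi, rfl⟩ := List.mem_iff_getElem.1 this
      exact outs i hi y hxy
    · rintro (hxy | hxy)
      · obtain ⟨i, hi, rfl, rfl⟩ := mem_cycArcs.1 hxy
        exact cyc i hi
      · obtain ⟨i, hi, rfl, rfl⟩ := mem_cycArcs.1 hxy
        exact hs _ _ (cyc i hi)
  refine ⟨p, hn3, ?_, hnd, hV, hA⟩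
  by_contra hodd
  rw [Nat.not_odd_iff_even] at hodd
  apply h.nc
  let φ : ℕ → Fin 2 := fun x => ⟨p.idxOf x % 2, Nat.mod_lt _ (by omega)⟩
  have hφ : ∀ x y, (x, y) ∈ cycArcs p → φ x ≠ φ y := by
    intro x y hxy e
    obtain ⟨i, hi, rfl, rfl⟩ := mem_cycArcs.1 hxy
    simp only [φ, Fin.mk.injEq, List.Nodup.idxOf_getElem hnd] at e
    rw [Nat.mod_mod_of_dvd _ hodd.two_dvd] at e
    omega
  refine ⟨φ, ?_⟩
  rintro x y ⟨hxy, e⟩ _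
  rw [hA, memS] at hxy
  rcases hxy with h1 | h1
  · exact hφ _ _ h1 e
  · exact hφ _ _ h1 e.symm

def Base (k : ℕ) (D : Dgraph) : Prop :=
  (k = 3 ∧ IsSymOddWheel D) ∨ (4 ≤ k ∧ IsBiComplete D (k + 1))

theorem case2a {D : Dgraph} (hk : 3 ≤ k) (h : Ext k D) {v : ℕ} (hv : v ∈ D.verts)
    (hdeg : ∀ x ∈ D.verts, x ≠ v → D.outdeg x ≤ k) :
    Base k D ∨ ∃ v A B t w u w', Sep D v A B t w u w' := by
  by_cases hS : ∃ v A B t w u w', Sep D v A B t w u w'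
  · exact Or.inr hS
  left
  have hdig : ∀ r b, b ≠ v → (((r, v) ∈ D.arcs ∧ (r, b) ∈ D.arcs) ∨
      ((v, r) ∈ D.arcs ∧ (b, r) ∈ D.arcs)) → (v, b) ∈ D.arcs ∧ (b, v) ∈ D.arcs := by
    intro r b hb hor
    rcases pair_step (by omega) h.toCrit hb.symm (fun x hx hxv => ⟨hdeg x hx hxv, by
      rw [h.deg_eq (by omega) hx]; exact hdeg x hx hxv⟩) hor with h1 | ⟨A, B, u, w', S, -⟩
    · exact h1
    · exact (hS ⟨_, _, _, _, _, _, _, S⟩).elim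
  let Z := D.verts.filter fun x => (v, x) ∈ D.arcs ∧ (x, v) ∈ D.arcs
  have memZ : ∀ x, x ∈ Z ↔ (v, x) ∈ D.arcs ∧ (x, v) ∈ D.arcs := by
    intro x; simp only [Z, Finset.mem_filter]
    exact ⟨fun h => h.2, fun h' => ⟨(h.wf _ h'.1).2.1, h'⟩⟩
  have hZne : Z.Nonempty := by
    obtain ⟨r, hr⟩ : (D.inN v).Nonempty := by
      rw [← Finset.card_pos, card_inN]
      have := h.toCrit.indeg_ge (by omega) hv
      omega
    rw [mem_inN] at hr
    obtain ⟨b, hb, hbv⟩ := Finset.exists_mem_ne (s := D.outN r) (by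
      rw [card_outN]; have : k ≤ D.outdeg r := h.toCrit.outdeg_ge (by omega) (h.wf _ hr).1
      omega) v
    rw [mem_outN] at hb
    exact ⟨b, (memZ b).2 (hdig r b hbv (Or.inl ⟨hr, hb⟩))⟩
  have hub : ∀ x ∈ D.verts, x ≠ v → (x, v) ∈ D.arcs ∧ (v, x) ∈ D.arcs := by
    by_contra hc
    push Not at hc
    obtain ⟨y, hy, hyv, hyn⟩ := hc
    obtain ⟨p, hp, q, hq, hqv, hqZ, hpq⟩ := h.toCrit.nocut v hv Z (Finset.filter_subset _ _) hZne
      (fun hh => (h.wf _ ((memZ v).1 hh).1).2.2 rfl) ⟨y, hy, hyv, fun hh =>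
        hyn ((memZ y).1 hh).2 ((memZ y).1 hh).1⟩
    rw [memZ] at hp hqZ
    rcases hpq with hpq | hpq
    · exact hqZ (hdig p q hqv (Or.inl ⟨hp.2, hpq⟩))
    · exact hqZ (hdig p q hqv (Or.inr ⟨hp.1, hpq⟩))
  obtain ⟨m, rfl⟩ : ∃ m, k = m + 1 := ⟨k - 1, by omega⟩
  obtain ⟨hG, hGd⟩ := ext_del (by omega) h hv hub
  have hGdeg : ∀ x ∈ (D.pc (D.verts.erase v) ∅).verts, (D.pc (D.verts.erase v) ∅).outdeg x ≤ m := by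
    intro x hx
    simp only [pc_verts, Finset.mem_erase] at hx
    have := hGd x hx.2 hx.1
    have := hdeg x hx.2 hx.1
    omega
  by_cases hm : m = 2
  · subst hm
    left
    refine ⟨rfl, ?_⟩
    obtain ⟨p, h3, hodd, hnd, hV, hA⟩ := odd_cycle hG hGdeg (reg2_symm _ (le_refl _) hG hGdeg)
    simp only [pc_verts] at hV
    refine ⟨p, v, h3, hodd, hnd, ?_, ?_, ?_⟩
    · intro hvp
      rw [← List.mem_toFinset, ← hV] at hvp; simp at hvp
    · rw [← hV, Finset.insert_erase hv]
    · rw [← hA]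
      ext ⟨x, y⟩
      simp only [Finset.mem_union, mem_pc, Finset.notMem_empty, or_false, Finset.mem_image, ← hV,
        Finset.mem_erase, Prod.mk.injEq]
      constructor
      · intro hxy
        have hw := h.wf _ hxy
        by_cases e1 : x = v
        · left; right; exact ⟨y, ⟨fun e => hw.2.2 (e1.trans e.symm), hw.2.1⟩, e1.symm, rfl⟩
        · by_cases e2 : y = v
          · right; exact ⟨x, ⟨e1, hw.1⟩, rfl, e2.symm⟩
          · left; left; exact ⟨hxy, ⟨e1, hw.1⟩, e2, hw.2.1⟩
      · rintro ((h1 | ⟨z, ⟨h1, h2⟩, rfl, rfl⟩) | ⟨z, ⟨h1, h2⟩, rfl, rfl⟩)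
        · exact h1.1
        · exact (hub _ h2 h1).2
        · exact (hub _ h2 h1).1
  · right
    refine ⟨by omega, ?_⟩
    obtain ⟨hc, hA⟩ := reg_big (by omega) hG hGdeg
    simp only [pc_verts] at hc hA
    refine ⟨?_, ?_⟩
    · rw [← Finset.card_erase_add_one hv, hc]
    · ext ⟨x, y⟩
      simp only [Finset.mem_filter, Finset.mem_product]
      constructor
      · intro hxy; exact ⟨⟨(h.wf _ hxy).1, (h.wf _ hxy).2.1⟩, (h.wf _ hxy).2.2⟩
      · rintro ⟨⟨h1, h2⟩, h3⟩
        by_cases e1 : x = v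
        · subst e1; exact (hub y h2 h3.symm).2
        · by_cases e2 : y = v
          · subst e2; exact (hub x h1 h3).1
          · have : (x, y) ∈ (D.pc (D.verts.erase v) ∅).arcs := by
              rw [hA]; simp only [Finset.mem_filter, Finset.mem_product, Finset.mem_erase]
              exact ⟨⟨⟨e1, h1⟩, e2, h2⟩, h3⟩
            simp only [mem_pc, Finset.notMem_empty, or_false] at this
            exact this.1

end Dgraph

namespace Dgraph
open Relation
variable {k : ℕ}

/-! ### Tight cuts -/

theorem acy_color {r : ℕ → ℕ → Prop} {α : Type*} (f : ℕ → α) (hf : ∀ p q, r p q → f p = f q)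
    (h : ∀ c, Acy fun p q => r p q ∧ f p = c) : Acy r := by
  intro p q hpq hqp
  have key : ∀ a b, ReflTransGen r a b → f a = f p →
      ReflTransGen (fun x y => r x y ∧ f x = f p) a b ∧ f b = f p := by
    intro a b hab ha
    induction hab with
    | refl => exact ⟨.refl, ha⟩
    | tail _ hbc ih => exact ⟨ih.1.tail ⟨hbc, ih.2⟩, (hf _ _ hbc).symm.trans ih.2⟩
  exact h (f p) p q ⟨hpq, rfl⟩ (key q p hqp (hf _ _ hpq).symm).1

theorem good_cut2 {D : Dgraph} (hD : D.WF) {X : Finset ℕ} (hX : X ⊆ D.verts) {θ : ℕ → Fin k}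
    (h1 : (D.pc X ∅).Good θ) (h2 : (D.pc (D.verts \ X) ∅).Good θ)
    (h : ∀ p q p' q', (p, q) ∈ D.arcs → p ∈ X → q ∉ X → (p', q') ∈ D.arcs → p' ∉ X → q' ∈ X →
      θ p = θ q → θ p' = θ q' → θ p ≠ θ p') : D.Good θ := by
  refine acy_color θ (fun p q h => h.2) fun c => ?_
  by_cases hc : ∃ p q, (p, q) ∈ D.arcs ∧ p ∈ X ∧ q ∉ X ∧ θ p = θ q ∧ θ p = c
  · obtain ⟨p, q, hpq, hp, hq, he, hpc⟩ := hc
    refine acy_cut (S := D.verts \ X) ?_ ?_ ?_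
    · rintro p' q' ⟨⟨h3, h4⟩, h5⟩ h6
      rw [Finset.mem_sdiff] at h6 ⊢
      refine ⟨(hD _ h3).2.1, fun h7 => ?_⟩
      exact h p q p' q' hpq hp hq h3 h6.2 h7 he h4 (hpc.trans h5.symm)
    · refine Acy.mono ?_ h2
      rintro a b ⟨⟨⟨h3, h4⟩, h5⟩, h6, h7⟩
      exact ⟨by rw [mem_pc]; exact Or.inl ⟨h3, h6, h7⟩, h4⟩
    · refine Acy.mono ?_ h1
      rintro a b ⟨⟨⟨h3, h4⟩, h5⟩, h6, h7⟩
      have := hD _ h3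
      refine ⟨by rw [mem_pc]; refine Or.inl ⟨h3, ?_, ?_⟩ <;> by_contra hh <;> simp_all, h4⟩
  · refine acy_cut (S := X) ?_ ?_ ?_
    · rintro p' q' ⟨⟨h3, h4⟩, h5⟩ h6
      by_contra h7
      exact hc ⟨p', q', h3, h6, h7, h4, h5⟩
    · refine Acy.mono ?_ h1
      rintro a b ⟨⟨⟨h3, h4⟩, h5⟩, h6, h7⟩
      exact ⟨by rw [mem_pc]; exact Or.inl ⟨h3, h6, h7⟩, h4⟩
    · refine Acy.mono ?_ h2
      rintro a b ⟨⟨⟨h3, h4⟩, h5⟩, h6, h7⟩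
      have := hD _ h3
      exact ⟨by rw [mem_pc]; refine Or.inl ⟨h3, ?_, ?_⟩ <;> simp_all, h4⟩

theorem good_cross {D : Dgraph} (hD : D.WF) {X : Finset ℕ} (hX : X ⊆ D.verts) {θ : ℕ → Fin k}
    (h1 : (D.pc X ∅).Good θ) (h2 : (D.pc (D.verts \ X) ∅).Good θ) {t0 h0 t1 s0 : ℕ}
    (ht0 : t0 ∈ X) (hh0 : h0 ∉ X) (ht1 : t1 ∉ X) (hs0 : s0 ∈ X)
    (ho : ∀ p q, (p, q) ∈ D.arcs → p ∈ X → q ∉ X → θ p = θ q → p = t0 ∧ q = h0)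
    (hi : ∀ p q, (p, q) ∈ D.arcs → p ∉ X → q ∈ X → θ p = θ q → p = t1 ∧ q = s0)
    (hn : ¬ ReflTransGen ((D.pc X ∅).mono θ) s0 t0) : D.Good θ := by
  set r0 := orRel ((D.pc X ∅).mono θ) ((D.pc (D.verts \ X) ∅).mono θ) with hr0
  have supp : ∀ p q, r0 p q → (p ∈ X ↔ q ∈ X) := by
    rintro p q (h | h)
    · have := supp_pc D X θ p q h
      exact ⟨fun _ => this.2, fun _ => this.1⟩
    · have := supp_pc D _ θ p q h
      simp only [Finset.mem_sdiff] at this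
      exact ⟨fun h => absurd h this.1.2, fun h => absurd h this.2.2⟩
  have suppr : ∀ p q, ReflTransGen r0 p q → (p ∈ X ↔ q ∈ X) := by
    intro p q h
    induction h with
    | refl => rfl
    | tail _ hbc ih => exact ih.trans (supp _ _ hbc)
  have inX : ∀ p q, ReflTransGen r0 p q → p ∈ X → ReflTransGen ((D.pc X ∅).mono θ) p q := by
    intro p q h hp
    induction h with
    | refl => rfl
    | tail hab hbc ih =>
      refine ih.tail ?_
      rcases hbc with h | h
      · exact h
      · have := (supp_pc D _ θ _ _ h).1
        rw [Finset.mem_sdiff] at this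
        exact absurd ((suppr _ _ hab).1 hp) this.2
  have a0 : Acy r0 := by
    refine acy_cut (S := X) (fun p q h hp => (supp p q h).1 hp) ?_ ?_
    · refine Acy.mono ?_ h1
      rintro p q ⟨h | h, hp, hq⟩
      · exact h
      · have := (supp_pc D _ θ _ _ h).1
        rw [Finset.mem_sdiff] at this
        exact absurd hp this.2
    · refine Acy.mono ?_ h2
      rintro p q ⟨h | h, hp, hq⟩
      · exact absurd (supp_pc D _ θ _ _ h).1 hp
      · exact h
  have a1 : Acy (addRel r0 True t0 h0) := acy_add a0 fun _ h => hh0 ((suppr _ _ h).2 ht0)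
  have a2 : Acy (addRel (addRel r0 True t0 h0) True t1 s0) := by
    refine acy_add a1 fun _ h => ?_
    rcases rtg_add h with h | ⟨_, h, _⟩
    · exact ht1 ((suppr _ _ h).1 hs0)
    · exact hn (inX _ _ h hs0)
  refine Acy.mono ?_ a2
  rintro p q ⟨h, he⟩
  have := hD _ h
  by_cases hp : p ∈ X <;> by_cases hq : q ∈ X
  · exact Or.inl (Or.inl (Or.inl ⟨by rw [mem_pc]; exact Or.inl ⟨h, hp, hq⟩, he⟩))
  · exact Or.inl (Or.inr ⟨trivial, ho p q h hp hq he⟩)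
  · exact Or.inr ⟨trivial, hi p q h hp hq he⟩
  · refine Or.inl (Or.inl (Or.inr ⟨by rw [mem_pc]; refine Or.inl ⟨h, ?_, ?_⟩ <;> simp_all, he⟩))

/-- `X` is a monochromatic side of a tight cut, with `ψ` a colouring of the other side. -/
structure MS (k : ℕ) (D : Dgraph) (X : Finset ℕ) (ψ : ℕ → Fin k) : Prop where
  XV : X ⊆ D.verts
  good : (D.pc (D.verts \ X) ∅).Good ψ
  oex : ∀ c, ∃ t h, (t, h) ∈ D.arcs ∧ t ∈ X ∧ h ∉ X ∧ ψ h = c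
  oun : ∀ t h t' h', (t, h) ∈ D.arcs → t ∈ X → h ∉ X → (t', h') ∈ D.arcs → t' ∈ X → h' ∉ X →
    ψ h = ψ h' → t = t' ∧ h = h'
  iex : ∀ c, ∃ t s, (t, s) ∈ D.arcs ∧ t ∉ X ∧ s ∈ X ∧ ψ t = c
  iun : ∀ t s t' s', (t, s) ∈ D.arcs → t ∉ X → s ∈ X → (t', s') ∈ D.arcs → t' ∉ X → s' ∈ X →
    ψ t = ψ t' → t = t' ∧ s = s'
  mono : ∀ φ : ℕ → Fin k, (D.pc X ∅).Good φ → ∀ t h t' s, (t, h) ∈ D.arcs → t ∈ X → h ∉ X →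
    (t', s) ∈ D.arcs → t' ∉ X → s ∈ X → φ t = φ s

/-- the alternative for one tight out-cut -/
theorem tight_alt {D : Dgraph} (hk : 2 ≤ k) (h : Crit k D) {X : Finset ℕ} (hXV : X ⊆ D.verts)
    (hX : D.dO X = k) (h1 : ∃ x, x ∈ X) (h2 : ∃ x ∈ D.verts, x ∉ X) :
    (∀ φ ψ : ℕ → Fin k, (D.pc X ∅).Good φ → (D.pc (D.verts \ X) ∅).Good ψ →
      (∀ a ∈ D.dicutArcs X, ∀ b ∈ D.dicutArcs X, φ a.1 = φ b.1 ∧ (a ≠ b → ψ a.2 ≠ ψ b.2))) ∨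
    (∀ φ ψ : ℕ → Fin k, (D.pc X ∅).Good φ → (D.pc (D.verts \ X) ∅).Good ψ →
      (∀ a ∈ D.dicutArcs X, ∀ b ∈ D.dicutArcs X, ψ a.2 = ψ b.2 ∧ (a ≠ b → φ a.1 ≠ φ b.1))) := by
  have hVX : D.verts ∩ X = X := Finset.inter_eq_right.2 hXV
  have rc := fun (φ ψ : ℕ → Fin k) h1 h2 => h.rowcol hk hX (φ := φ) (ψ := ψ) h1 h2
  rw [hVX] at rc
  obtain ⟨φ0, hφ0⟩ : (D.pc X ∅).Col k := h.col_ind h2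
  obtain ⟨ψ0, hψ0⟩ : (D.pc (D.verts \ X) ∅).Col k := by
    obtain ⟨x, hx⟩ := h1
    exact h.col_ind ⟨x, hXV hx, by simp [hx]⟩
  obtain ⟨a, ha, b, hb, hab⟩ : ∃ a ∈ D.dicutArcs X, ∃ b ∈ D.dicutArcs X, a ≠ b := by
    have : 1 < (D.dicutArcs X).card := by
      have : (D.dicutArcs X).card = k := hX
      omega
    exact Finset.one_lt_card.1 this
  rcases rc φ0 ψ0 hφ0 hψ0 with h0 | h0
  · left
    intro φ ψ hφ hψ
    rcases rc φ0 ψ hφ0 hψ with h3 | h3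
    · rcases rc φ ψ hφ hψ with h4 | h4
      · exact h4
      · exact absurd (h4 a ha b hb).1 ((h3 a ha b hb).2 hab)
    · exact absurd (h0 a ha b hb).1 ((h3 a ha b hb).2 hab)
  · right
    intro φ ψ hφ hψ
    rcases rc φ0 ψ hφ0 hψ with h3 | h3
    · exact absurd (h3 a ha b hb).1 ((h0 a ha b hb).2 hab)
    · rcases rc φ ψ hφ hψ with h4 | h4
      · exact absurd (h3 a ha b hb).1 ((h4 a ha b hb).2 hab)
      · exact h4

theorem surj_of {α : Type*} (F : Finset α) (hF : F.card = k) (f : α → Fin k)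
    (h : ∀ a ∈ F, ∀ b ∈ F, a ≠ b → f a ≠ f b) (c : Fin k) : ∃ a ∈ F, f a = c := by
  classical
  have h1 : (F.image f).card = k := by
    rw [Finset.card_image_of_injOn, hF]
    intro a ha b hb hab
    by_contra hh
    exact h a ha b hb hh hab
  have h2 : F.image f = Finset.univ := by
    rw [← Finset.card_eq_iff_eq_univ]; simpa using h1
  have := Finset.mem_univ c
  rw [← h2, Finset.mem_image] at this
  exact this

/-- perms with two prescribed values -/
theorem perm_avoid (hk : 2 ≤ k) (a c : Fin k) : ∃ σ : Equiv.Perm (Fin k), σ a ≠ c := by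
  haveI : Nontrivial (Fin k) := Fin.nontrivial_iff_two_le.2 hk
  obtain ⟨d, hd⟩ := exists_ne c
  obtain ⟨σ, hσ⟩ := perm1 a d
  exact ⟨σ, by rw [hσ]; exact hd⟩

theorem pc_congr_col {D : Dgraph} {S : Finset ℕ} {φ ψ : ℕ → Fin k} (h : (D.pc S ∅).Good φ)
    (he : ∀ x ∈ S, ψ x = φ x) : (D.pc S ∅).Good ψ := by
  refine h.congr (S := S) ?_ he
  intro p q hpq
  simp only [mem_pc, Finset.notMem_empty, or_false] at hpq
  exact hpq.2

theorem ms_exists {D : Dgraph} (hk : 2 ≤ k) (h : Ext k D) {X : Finset ℕ} (hXV : X ⊆ D.verts)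
    (hX : D.dO X = k) (h1 : ∃ x, x ∈ X) (h2 : ∃ x ∈ D.verts, x ∉ X) :
    (∃ ψ, MS k D X ψ) ∨ (∃ ψ, MS k D (D.verts \ X) ψ) := by
  have hDI : D.dO (D.verts \ X) = k := by
    rw [← hX, ← h.dI_eq hk X]
    symm; apply dI_eq_dO h.wf
    intro x hx; simp [hx]
  have hVV : D.verts \ (D.verts \ X) = X := by rw [Finset.sdiff_sdiff_eq_self hXV]
  have t1 := tight_alt hk h.toCrit hXV hX h1 h2
  have t2 := tight_alt hk h.toCrit (X := D.verts \ X) Finset.sdiff_subset hDI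
    (by obtain ⟨x, hx, hx'⟩ := h2; exact ⟨x, by simp [hx, hx']⟩)
    (by obtain ⟨x, hx⟩ := h1; exact ⟨x, hXV hx, by simp [hx]⟩)
  rw [hVV] at t2
  have mo : ∀ p q, (p, q) ∈ D.dicutArcs X ↔ (p, q) ∈ D.arcs ∧ p ∈ X ∧ q ∉ X :=
    fun p q => mem_cut
  have mi : ∀ p q, (p, q) ∈ D.dicutArcs (D.verts \ X) ↔ (p, q) ∈ D.arcs ∧ p ∉ X ∧ q ∈ X := by
    intro p q
    rw [mem_cut]
    constructor
    · rintro ⟨h3, h4, h5⟩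
      have := h.wf _ h3
      simp_all
    · rintro ⟨h3, h4, h5⟩
      have := h.wf _ h3
      simp_all
  obtain ⟨φ0, hφ0⟩ : (D.pc X ∅).Col k := h.toCrit.col_ind h2
  obtain ⟨ψ0, hψ0⟩ : (D.pc (D.verts \ X) ∅).Col k := by
    obtain ⟨x, hx⟩ := h1
    exact h.toCrit.col_ind ⟨x, hXV hx, by simp [hx]⟩
  have sides : ∀ (φ ψ : ℕ → Fin k), (D.pc X ∅).Good φ → (D.pc (D.verts \ X) ∅).Good ψ →
      ∃ p q p' q', (p, q) ∈ D.dicutArcs X ∧ (p', q') ∈ D.dicutArcs (D.verts \ X) ∧ φ p = ψ q ∧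
        ψ p' = φ q' ∧ φ p = ψ p' := by
    intro φ ψ hφ hψ
    by_contra hc
    refine h.nc ⟨fun x => if x ∈ X then φ x else ψ x, good_cut2 h.wf hXV ?_ ?_ ?_⟩
    · exact pc_congr_col hφ (fun x hx => by simp [hx])
    · exact pc_congr_col hψ (fun x hx => by simp at hx; simp [hx])
    · intro p q p' q' a1 a2 a3 a4 a5 a6 a7 a8 a9
      simp only [a2, a3, a5, a6, if_true, if_false] at a7 a8 a9
      exact hc ⟨p, q, p', q', (mo _ _).2 ⟨a1, a2, a3⟩, (mi _ _).2 ⟨a4, a5, a6⟩, a7, a8, a9⟩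
  have cF : (D.dicutArcs X).card = k := hX
  have cF' : (D.dicutArcs (D.verts \ X)).card = k := hDI
  rcases t1 with t1 | t1 <;> rcases t2 with t2 | t2
  · exfalso
    obtain ⟨a, ha⟩ : (D.dicutArcs X).Nonempty := by rw [← Finset.card_pos]; omega
    obtain ⟨b, hb⟩ : (D.dicutArcs (D.verts \ X)).Nonempty := by rw [← Finset.card_pos]; omega
    obtain ⟨σ, hσ⟩ := perm_avoid hk (ψ0 b.1) (φ0 a.1)
    have hψ1 := hψ0.perm σ
    obtain ⟨p, q, p', q', e1, e2, e3, e4, e5⟩ := sides φ0 _ hφ0 hψ1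
    have f1 := (t1 φ0 ψ0 hφ0 hψ0 a ha _ e1).1
    have f2 := (t2 ψ0 φ0 hψ0 hφ0 b hb _ e2).1
    simp only at f1 f2
    exact hσ (by rw [f1, f2]; exact e5.symm)
  · left
    refine ⟨ψ0, hXV, hψ0, ?_, ?_, ?_, ?_, ?_⟩
    · intro c
      obtain ⟨⟨t, x⟩, ha, hc⟩ := surj_of _ cF (fun a => ψ0 a.2)
        (fun a ha b hb hab => (t1 φ0 ψ0 hφ0 hψ0 a ha b hb).2 hab) c
      have := (mo _ _).1 ha
      exact ⟨t, x, this.1, this.2.1, this.2.2, hc⟩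
    · intro t x t' x' a1 a2 a3 b1 b2 b3 he
      by_contra hne
      exact (t1 φ0 ψ0 hφ0 hψ0 (t, x) ((mo _ _).2 ⟨a1, a2, a3⟩) (t', x') ((mo _ _).2 ⟨b1, b2, b3⟩)).2
        (by simpa using hne) he
    · intro c
      obtain ⟨⟨t, x⟩, ha, hc⟩ := surj_of _ cF' (fun a => ψ0 a.1)
        (fun a ha b hb hab => (t2 ψ0 φ0 hψ0 hφ0 a ha b hb).2 hab) c
      have := (mi _ _).1 ha
      exact ⟨t, x, this.1, this.2.1, this.2.2, hc⟩
    · intro t x t' x' a1 a2 a3 b1 b2 b3 he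
      by_contra hne
      exact (t2 ψ0 φ0 hψ0 hφ0 (t, x) ((mi _ _).2 ⟨a1, a2, a3⟩) (t', x') ((mi _ _).2 ⟨b1, b2, b3⟩)).2
        (by simpa using hne) he
    · intro φ hφ t x t' s a1 a2 a3 b1 b2 b3
      obtain ⟨p, q, p', q', e1, e2, e3, e4, e5⟩ := sides φ _ hφ hψ0
      have f1 := (t1 φ ψ0 hφ hψ0 _ ((mo _ _).2 ⟨a1, a2, a3⟩) _ e1).1
      have f2 := (t2 ψ0 φ hψ0 hφ _ ((mi _ _).2 ⟨b1, b2, b3⟩) _ e2).1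
      simp only at f1 f2
      rw [f1, f2, e5, e4]
  · right
    have mV : ∀ x, x ∈ D.verts → (x ∉ D.verts \ X ↔ x ∈ X) := by intro x hx; simp [hx]
    have mo' : ∀ p q, (p, q) ∈ D.arcs → p ∈ D.verts \ X → q ∉ D.verts \ X →
        (p, q) ∈ D.dicutArcs (D.verts \ X) := by
      intro p q a1 a2 a3
      have := h.wf _ a1
      refine (mi _ _).2 ⟨a1, (Finset.mem_sdiff.1 a2).2, (mV _ this.2.1).1 a3⟩
    have mi' : ∀ p q, (p, q) ∈ D.arcs → p ∉ D.verts \ X → q ∈ D.verts \ X →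
        (p, q) ∈ D.dicutArcs X := by
      intro p q a1 a2 a3
      have := h.wf _ a1
      refine (mo _ _).2 ⟨a1, (mV _ this.1).1 a2, (Finset.mem_sdiff.1 a3).2⟩
    refine ⟨φ0, Finset.sdiff_subset, by rw [hVV]; exact hφ0, ?_, ?_, ?_, ?_, ?_⟩
    · intro c
      obtain ⟨⟨t, x⟩, ha, hc⟩ := surj_of _ cF' (fun a => φ0 a.2)
        (fun a ha b hb hab => (t2 ψ0 φ0 hψ0 hφ0 a ha b hb).2 hab) c
      have := (mi _ _).1 ha
      have hw := h.wf _ this.1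
      exact ⟨t, x, this.1, Finset.mem_sdiff.2 ⟨hw.1, this.2.1⟩, (mV _ hw.2.1).2 this.2.2, hc⟩
    · intro t x t' x' a1 a2 a3 b1 b2 b3 he
      by_contra hne
      exact (t2 ψ0 φ0 hψ0 hφ0 (t, x) (mo' _ _ a1 a2 a3) (t', x') (mo' _ _ b1 b2 b3)).2
        (by simpa using hne) he
    · intro c
      obtain ⟨⟨t, x⟩, ha, hc⟩ := surj_of _ cF (fun a => φ0 a.1)
        (fun a ha b hb hab => (t1 φ0 ψ0 hφ0 hψ0 a ha b hb).2 hab) c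
      have := (mo _ _).1 ha
      have hw := h.wf _ this.1
      exact ⟨t, x, this.1, (mV _ hw.1).2 this.2.1, Finset.mem_sdiff.2 ⟨hw.2.1, this.2.2⟩, hc⟩
    · intro t x t' x' a1 a2 a3 b1 b2 b3 he
      by_contra hne
      exact (t1 φ0 ψ0 hφ0 hψ0 (t, x) (mi' _ _ a1 a2 a3) (t', x') (mi' _ _ b1 b2 b3)).2
        (by simpa using hne) he
    · intro ψ hψ t x t' s a1 a2 a3 b1 b2 b3
      obtain ⟨p, q, p', q', e1, e2, e3, e4, e5⟩ := sides φ0 _ hφ0 hψ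
      have f1 := (t1 φ0 ψ hφ0 hψ _ (mi' _ _ b1 b2 b3) _ e1).1
      have f2 := (t2 ψ φ0 hψ hφ0 _ (mo' _ _ a1 a2 a3) _ e2).1
      simp only at f1 f2
      rw [f1, f2, ← e3, e5]
  · exfalso
    obtain ⟨a, ha⟩ : (D.dicutArcs X).Nonempty := by rw [← Finset.card_pos]; omega
    obtain ⟨b, hb⟩ : (D.dicutArcs (D.verts \ X)).Nonempty := by rw [← Finset.card_pos]; omega
    obtain ⟨σ, hσ⟩ := perm_avoid hk (ψ0 a.2) (φ0 b.2)
    have hψ1 := hψ0.perm σ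
    obtain ⟨p, q, p', q', e1, e2, e3, e4, e5⟩ := sides φ0 _ hφ0 hψ1
    have f1 := (t1 φ0 ψ0 hφ0 hψ0 a ha _ e1).1
    have f2 := (t2 ψ0 φ0 hψ0 hφ0 b hb _ e2).1
    simp only at f1 f2
    exact hσ (by rw [f1, f2, ← e3, e5, e4])

end Dgraph

namespace Dgraph
open Relation
variable {k : ℕ}

def KH (H : Fin k → ℕ) : Finset ℕ := Finset.univ.image H

theorem mem_KH {H : Fin k → ℕ} {x : ℕ} : x ∈ KH H ↔ ∃ c, H c = x := by simp [KH]

/-- contraction of the rainbow side to a complete digraph on `k` vertices -/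
def dx (D : Dgraph) (X : Finset ℕ) (ψ : ℕ → Fin k) (H : Fin k → ℕ) : Dgraph where
  verts := X ∪ KH H
  arcs := (D.arcs.filter fun a => a.1 ∈ X) ∪ ((KH H ×ˢ KH H).filter fun a => a.1 ≠ a.2) ∪
    ((D.arcs.filter fun a => a.1 ∉ X ∧ a.2 ∈ X).image fun a => (H (ψ a.1), a.2))

theorem mem_dx {D : Dgraph} {X : Finset ℕ} {ψ : ℕ → Fin k} {H : Fin k → ℕ} {p q : ℕ} :
    (p, q) ∈ (D.dx X ψ H).arcs ↔ ((p, q) ∈ D.arcs ∧ p ∈ X) ∨ (p ∈ KH H ∧ q ∈ KH H ∧ p ≠ q) ∨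
      (∃ t, (t, q) ∈ D.arcs ∧ t ∉ X ∧ q ∈ X ∧ H (ψ t) = p) := by
  simp only [dx, Finset.mem_union, Finset.mem_filter, Finset.mem_product, Finset.mem_image,
    Prod.exists, Prod.mk.injEq]
  constructor
  · rintro ((h | h) | ⟨a, b, h1, h2, h3⟩)
    · exact Or.inl h
    · exact Or.inr (Or.inl ⟨h.1.1, h.1.2, h.2⟩)
    · subst h3; exact Or.inr (Or.inr ⟨a, h1.1, h1.2.1, h1.2.2, h2⟩)
  · rintro (h | h | ⟨t, h1, h2, h3, h4⟩)
    · exact Or.inl (Or.inl h)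
    · exact Or.inl (Or.inr ⟨⟨h.1, h.2.1⟩, h.2.2⟩)
    · exact Or.inr ⟨t, q, ⟨h1, h2, h3⟩, h4, rfl⟩

def HH (D : Dgraph) (X : Finset ℕ) (ψ : ℕ → Fin k) (H : Fin k → ℕ) : Prop :=
  ∀ c, H c ∉ X ∧ ψ (H c) = c ∧ ∃ t ∈ X, (t, H c) ∈ D.arcs

namespace MS
variable {D : Dgraph} {X : Finset ℕ} {ψ : ℕ → Fin k} {H : Fin k → ℕ}

theorem exH (M : MS k D X ψ) : ∃ H, HH D X ψ H := by
  have : ∀ c, ∃ y, y ∉ X ∧ ψ y = c ∧ ∃ t ∈ X, (t, y) ∈ D.arcs := by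
    intro c
    obtain ⟨t, y, h1, h2, h3, h4⟩ := M.oex c
    exact ⟨y, h3, h4, t, h2, h1⟩
  choose H hH using this
  exact ⟨H, hH⟩

theorem head (M : MS k D X ψ) (hH : HH D X ψ H) {t y : ℕ} (h : (t, y) ∈ D.arcs) (ht : t ∈ X)
    (hy : y ∉ X) : H (ψ y) = y := by
  obtain ⟨h1, h2, t', h3, h4⟩ := hH (ψ y)
  exact (M.oun t' _ t y h4 h3 h1 h ht hy h2).2

theorem KX (hH : HH D X ψ H) {x : ℕ} (hx : x ∈ KH H) : x ∉ X := by
  obtain ⟨c, rfl⟩ := mem_KH.1 hx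
  exact (hH c).1

theorem KV (M : MS k D X ψ) (hD : D.WF) (hH : HH D X ψ H) {x : ℕ} (hx : x ∈ KH H) :
    x ∈ D.verts := by
  obtain ⟨c, rfl⟩ := mem_KH.1 hx
  obtain ⟨_, _, t, _, h⟩ := hH c
  exact (hD _ h).2.1

theorem Hinj (hH : HH D X ψ H) {c d : Fin k} (h : H c = H d) : c = d := by
  rw [← (hH c).2.1, h, (hH d).2.1]

theorem cardK (hH : HH D X ψ H) : (KH H).card = k := by
  rw [KH, Finset.card_image_of_injective _ (fun c d h => Hinj hH h)]; simp

theorem wf_dx (M : MS k D X ψ) (hD : D.WF) (hH : HH D X ψ H) : (D.dx X ψ H).WF := by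
  rintro ⟨p, q⟩ h
  have hv : (D.dx X ψ H).verts = X ∪ KH H := rfl
  rw [hv]
  simp only [Finset.mem_union]
  rcases mem_dx.1 h with ⟨h1, h2⟩ | ⟨h1, h2, h3⟩ | ⟨t, h1, h2, h3, h4⟩
  · refine ⟨Or.inl h2, ?_, (hD _ h1).2.2⟩
    by_cases hq : q ∈ X
    · exact Or.inl hq
    · exact Or.inr (mem_KH.2 ⟨ψ q, M.head hH h1 h2 hq⟩)
  · exact ⟨Or.inr h1, Or.inr h2, h3⟩
  · refine ⟨Or.inr (mem_KH.2 ⟨ψ t, h4⟩), Or.inl h3, ?_⟩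
    rintro he
    subst he; subst h4
    exact (hH _).1 h3

theorem nc_dx (M : MS k D X ψ) (h : Crit k D) (hH : HH D X ψ H) : ¬ (D.dx X ψ H).Col k := by
  rintro ⟨ξ, hξ⟩
  have gX : (D.pc X ∅).Good ξ := by
    refine hξ.sub ?_
    rintro ⟨p, q⟩ hpq
    simp only [mem_pc, Finset.notMem_empty, or_false] at hpq
    exact mem_dx.2 (Or.inl ⟨hpq.1, hpq.2.1⟩)
  -- ξ is injective on K
  have inj : ∀ c d, c ≠ d → ξ (H c) ≠ ξ (H d) := by
    intro c d hcd he
    have hne : H c ≠ H d := fun h => hcd (Hinj hH h)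
    have a1 : (D.dx X ψ H).mono ξ (H c) (H d) :=
      ⟨mem_dx.2 (Or.inr (Or.inl ⟨mem_KH.2 ⟨c, rfl⟩, mem_KH.2 ⟨d, rfl⟩, hne⟩)), he⟩
    have a2 : (D.dx X ψ H).mono ξ (H d) (H c) :=
      ⟨mem_dx.2 (Or.inr (Or.inl ⟨mem_KH.2 ⟨d, rfl⟩, mem_KH.2 ⟨c, rfl⟩, hne.symm⟩)), he.symm⟩
    exact hξ _ _ a1 (.single a2)
  have mon := M.mono ξ gX
  -- the common colour
  haveI : Nonempty (Fin k) := ⟨ξ 0⟩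
  obtain ⟨c1⟩ : Nonempty (Fin k) := this
  obtain ⟨tt, hh, k1, k2, k3, k4⟩ := M.oex c1
  obtain ⟨c, -, hc⟩ := surj_of (k := k) (Finset.univ : Finset (Fin k)) (by simp) (fun c => ξ (H c))
    (fun a _ b _ hab => inj a b hab) (ξ tt)
  obtain ⟨hcX, hψc, t0, ht0, harc⟩ := hH c
  obtain ⟨t1, s0, i1, i2, i3, i4⟩ := M.iex c
  have e1 : ξ tt = ξ s0 := mon _ _ _ _ k1 k2 k3 i1 i2 i3
  have e2 : ξ t0 = ξ s0 := mon _ _ _ _ harc ht0 hcX i1 i2 i3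
  obtain ⟨σ, hσ⟩ := perm1 c (ξ s0)
  refine h.nc ⟨fun x => if x ∈ X then ξ x else σ (ψ x), good_cross h.wf M.XV
    (pc_congr_col gX (fun x hx => by simp [hx]))
    (pc_congr_col (M.good.perm σ) (fun x hx => by simp at hx; simp [hx])) ht0 hcX i2 i3
    ?_ ?_ ?_⟩
  · intro p q h1 h2 h3 h4
    simp only [h2, h3, if_true, if_false] at h4
    have e3 : ξ p = ξ s0 := mon _ _ _ _ h1 h2 h3 i1 i2 i3
    have : ψ q = c := σ.injective (by rw [← h4, e3, hσ])
    exact M.oun p q t0 (H c) h1 h2 h3 harc ht0 hcX (by rw [this, hψc])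
  · intro p q h1 h2 h3 h4
    simp only [h2, h3, if_true, if_false] at h4
    have e3 : ξ tt = ξ q := mon _ _ _ _ k1 k2 k3 h1 h2 h3
    have : ψ p = c := σ.injective (by rw [h4, ← e3, e1, hσ])
    exact M.iun p q t1 s0 h1 h2 h3 i1 i2 i3 (by rw [this, i4])
  · intro hp
    have hp' : ReflTransGen ((D.dx X ψ H).mono ξ) s0 t0 := by
      refine ReflTransGen.mono ?_ _ _ hp
      rintro a b ⟨h1, h2⟩
      simp only [mem_pc, Finset.notMem_empty, or_false] at h1
      simp only [h1.2.1, h1.2.2, if_true] at h2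
      exact ⟨mem_dx.2 (Or.inl ⟨h1.1, h1.2.1⟩), h2⟩
    have b1 : (D.dx X ψ H).mono ξ (H c) s0 :=
      ⟨mem_dx.2 (Or.inr (Or.inr ⟨t1, i1, i2, i3, by rw [i4]⟩)), by
        rw [hc, e1]⟩
    have b2 : (D.dx X ψ H).mono ξ t0 (H c) :=
      ⟨mem_dx.2 (Or.inl ⟨harc, ht0⟩), by rw [hc, e1, e2]⟩
    exact hξ _ _ b1 (hp'.tail b2)

/-- out-cuts inside `X` -/
theorem dO_sub (D : Dgraph) (ψ : ℕ → Fin k) (hH : HH D X ψ H) {Z : Finset ℕ} (hZ : Z ⊆ X) :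
    (D.dx X ψ H).dO Z ≤ D.dO Z := by
  refine Finset.card_le_card ?_
  rintro ⟨p, q⟩ h
  rw [mem_cut] at h ⊢
  rcases mem_dx.1 h.1 with ⟨h1, h2⟩ | ⟨h1, h2, h3⟩ | ⟨t, h1, h2, h3, h4⟩
  · exact ⟨h1, h.2⟩
  · exact absurd (hZ h.2.1) (KX hH h1)
  · exact absurd (hZ h.2.1) (KX hH (mem_KH.2 ⟨_, h4⟩))

theorem dO_sup (M : MS k D X ψ) (hD : D.WF) (hH : HH D X ψ H) {Y : Finset ℕ}
    (hY : ∀ x ∈ D.verts, x ∉ X → x ∈ Y) :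
    (D.dx X ψ H).dO ((Y ∩ X) ∪ KH H) ≤ D.dO Y := by
  classical
  refine (Finset.card_le_card (t := (D.dicutArcs Y).image
    fun a => (if a.1 ∈ X then a.1 else H (ψ a.1), a.2)) ?_).trans Finset.card_image_le
  rintro ⟨p, q⟩ h
  rw [mem_cut] at h
  simp only [Finset.mem_union, Finset.mem_inter, not_or] at h
  rw [Finset.mem_image]
  rcases mem_dx.1 h.1 with ⟨h1, h2⟩ | ⟨h1, h2, h3⟩ | ⟨t, h1, h2, h3, h4⟩
  · refine ⟨(p, q), mem_cut.2 ⟨h1, ?_, ?_⟩, by simp [h2]⟩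
    · rcases h.2.1 with h5 | h5
      · exact h5.1
      · exact absurd h2 (KX hH h5)
    · intro hq
      apply h.2.2.2
      by_cases hqX : q ∈ X
      · exact absurd ⟨hq, hqX⟩ h.2.2.1
      · exact mem_KH.2 ⟨_, M.head hH h1 h2 hqX⟩
  · exact absurd h2 h.2.2.2
  · refine ⟨(t, q), mem_cut.2 ⟨h1, hY _ (hD _ h1).1 h2, ?_⟩, by simp [h2, h4]⟩
    intro hq; exact h.2.2.1 ⟨hq, h3⟩

theorem outN_K (M : MS k D X ψ) (hD : D.WF) (hH : HH D X ψ H) (hk : 1 ≤ k) {x : ℕ}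
    (hx : x ∈ KH H) : (D.dx X ψ H).outdeg x ≤ k := by
  obtain ⟨c, rfl⟩ := mem_KH.1 hx
  obtain ⟨t1, s0, i1, i2, i3, i4⟩ := M.iex c
  rw [← card_outN]
  have : (D.dx X ψ H).outN (H c) ⊆ insert s0 ((KH H).erase (H c)) := by
    intro q hq
    rw [mem_outN] at hq
    rcases mem_dx.1 hq with ⟨h1, h2⟩ | ⟨h1, h2, h3⟩ | ⟨t, h1, h2, h3, h4⟩
    · exact absurd h2 (KX hH hx)
    · exact Finset.mem_insert_of_mem (Finset.mem_erase.2 ⟨h3.symm, h2⟩)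
    · rw [(M.iun t q t1 s0 h1 h2 h3 i1 i2 i3 (by rw [i4]; exact Hinj hH h4)).2]
      exact Finset.mem_insert_self _ _
  refine (Finset.card_le_card this).trans ((Finset.card_insert_le _ _).trans ?_)
  rw [Finset.card_erase_of_mem hx, cardK hH]; omega

theorem inN_K (M : MS k D X ψ) (hD : D.WF) (hH : HH D X ψ H) (hk : 1 ≤ k) {x : ℕ}
    (hx : x ∈ KH H) : (D.dx X ψ H).indeg x ≤ k := by
  obtain ⟨c, rfl⟩ := mem_KH.1 hx
  obtain ⟨hcX, hψc, t0, ht0, harc⟩ := hH c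
  rw [← card_inN]
  have : (D.dx X ψ H).inN (H c) ⊆ insert t0 ((KH H).erase (H c)) := by
    intro q hq
    rw [mem_inN] at hq
    rcases mem_dx.1 hq with ⟨h1, h2⟩ | ⟨h1, h2, h3⟩ | ⟨t, h1, h2, h3, h4⟩
    · rw [(M.oun q _ t0 _ h1 h2 hcX harc ht0 hcX rfl).1]
      exact Finset.mem_insert_self _ _
    · exact Finset.mem_insert_of_mem (Finset.mem_erase.2 ⟨h3, h1⟩)
    · exact absurd h3 hcX
  refine (Finset.card_le_card this).trans ((Finset.card_insert_le _ _).trans ?_)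
  rw [Finset.card_erase_of_mem hx, cardK hH]; omega

theorem cc_dx (M : MS k D X ψ) (hk : 2 ≤ k) (h : Ext k D) (hH : HH D X ψ H)
    (hX : D.dO X = k) : CC k (D.dx X ψ H) := by
  have hwf := M.wf_dx h.wf hH
  intro u hu v hv huv
  by_cases huK : u ∈ KH H
  · refine ⟨{u}, by simp, by simpa using huv.symm, ?_⟩
    rw [← outdeg_eq hwf]; exact M.outN_K h.wf hH (by omega) huK
  by_cases hvK : v ∈ KH H
  · refine ⟨(D.dx X ψ H).verts.erase v, by simp [huv, hu], by simp, ?_⟩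
    rw [← dI_eq_dO hwf (X := {v}), ← indeg_eq hwf]
    · exact M.inN_K h.wf hH (by omega) hvK
    · intro x hx; simp [hx]
  have huX : u ∈ X := (Finset.mem_union.1 hu).resolve_right huK
  have hvX : v ∈ X := (Finset.mem_union.1 hv).resolve_right hvK
  obtain ⟨Y, hY1, hY2, hY3⟩ := h.cc u (M.XV huX) v (M.XV hvX) huv
  by_cases hc : ∀ x ∈ D.verts, x ∉ X → x ∈ Y
  · refine ⟨(Y ∩ X) ∪ KH H, by simp [hY1, huX], by simp [hY2, hvK], (M.dO_sup h.wf hH hc).trans hY3⟩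
  · push Not at hc
    obtain ⟨x, hx1, hx2, hx3⟩ := hc
    refine ⟨X ∩ Y, by simp [hY1, huX], by simp [hY2], ?_⟩
    refine (dO_sub D ψ hH Finset.inter_subset_left).trans ?_
    have h1 := dO_submod D X Y
    have h2 := h.toCrit.cut_ge hk (X := X ∪ Y) ⟨u, M.XV huX, by simp [huX]⟩
      ⟨x, hx1, by simp [hx2, hx3]⟩
    omega

theorem cut1_dx (M : MS k D X ψ) (hk : 2 ≤ k) (h : Ext k D) (hH : HH D X ψ H) :
    (D.dx X ψ H).Cut1 := by
  have hs := h.toCrit.cut1 hk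
  have cut : ∀ Y : Finset ℕ, (∃ x ∈ D.verts, x ∈ Y) → (∃ x ∈ D.verts, x ∉ Y) →
      ∃ p q, (p, q) ∈ D.arcs ∧ p ∈ Y ∧ q ∉ Y := by
    rintro Y ⟨x, hx, hx'⟩ ⟨y, hy, hy'⟩
    obtain ⟨p, q, h1, h2, h3⟩ := exit_arc (hs x hx y hy) hx' hy'
    exact ⟨p, q, h1, h2, h3⟩
  refine cut1_of (M.wf_dx h.wf hH) ?_
  rintro Z hZ ⟨x, hx, hxZ⟩ ⟨y, hy, hyZ⟩
  by_cases h1 : ∃ a ∈ KH H, a ∈ Z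
  · by_cases h2 : ∃ b ∈ KH H, b ∉ Z
    · obtain ⟨a, ha, ha'⟩ := h1
      obtain ⟨b, hb, hb'⟩ := h2
      exact ⟨a, b, mem_dx.2 (Or.inr (Or.inl ⟨ha, hb, fun e => hb' (e ▸ ha')⟩)), ha', hb'⟩
    · push Not at h2
      have hyX : y ∈ X := by
        rcases Finset.mem_union.1 hy with h | h
        · exact h
        · exact absurd (h2 y h) hyZ
      obtain ⟨a, ha, ha'⟩ := h1
      obtain ⟨p, q, e1, e2, e3⟩ := cut ((Z ∩ X) ∪ (D.verts \ X))
        ⟨a, M.KV h.wf hH ha, by simp [KX hH ha, M.KV h.wf hH ha]⟩ ⟨y, M.XV hyX, by simp [hyX, hyZ]⟩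
      have hw := h.wf _ e1
      simp only [Finset.mem_union, Finset.mem_inter, Finset.mem_sdiff, not_or, not_and, not_not] at e2 e3
      have hqX : q ∈ X := e3.2 hw.2.1
      have hqZ : q ∉ Z := fun hh => e3.1 hh hqX
      rcases e2 with e2 | e2
      · exact ⟨p, q, mem_dx.2 (Or.inl ⟨e1, e2.2⟩), e2.1, hqZ⟩
      · exact ⟨H (ψ p), q, mem_dx.2 (Or.inr (Or.inr ⟨p, e1, e2.2, hqX, rfl⟩)),
          h2 _ (mem_KH.2 ⟨_, rfl⟩), hqZ⟩
  · push Not at h1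
    have hZX : ∀ z ∈ Z, z ∈ X := fun z hz =>
      (Finset.mem_union.1 (hZ hz)).resolve_right fun hh => h1 z hh hz
    obtain ⟨a, ha⟩ : ∃ a, a ∈ KH H := ⟨H ⟨0, by omega⟩, mem_KH.2 ⟨_, rfl⟩⟩
    obtain ⟨p, q, e1, e2, e3⟩ := cut Z ⟨x, M.XV (hZX x hxZ), hxZ⟩ ⟨a, M.KV h.wf hH ha, h1 a ha⟩
    exact ⟨p, q, mem_dx.2 (Or.inl ⟨e1, hZX p e2⟩), e2, e3⟩

theorem nocut_dx (M : MS k D X ψ) (hk : 2 ≤ k) (h : Ext k D) (hH : HH D X ψ H) :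
    (D.dx X ψ H).NoCut := by
  have hwf := M.wf_dx h.wf hH
  have adjsymm : ∀ p q, (D.dx X ψ H).adj p q → (D.dx X ψ H).adj q p := fun p q h => h.symm
  intro z hz N hN hne hzN ⟨y, hy, hyz, hyN⟩
  have key : ∀ N' ⊆ X, N'.Nonempty → z ∉ N' → ∃ p ∈ N', ∃ q ∈ (D.dx X ψ H).verts,
      q ≠ z ∧ q ∉ N' ∧ (D.dx X ψ H).adj p q := by
    intro N' hN' hne' hz'
    obtain ⟨n, hn⟩ := hne'
    by_cases hzK : z ∈ KH H
    · have hge := h.toCrit.cut_ge hk (X := N') ⟨n, M.XV (hN' hn), hn⟩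
        ⟨z, M.KV h.wf hH hzK, hz'⟩
      obtain ⟨a, ha, b, hb, hab⟩ := Finset.one_lt_card.1
        (show 1 < (D.dicutArcs N').card from lt_of_lt_of_le (by omega) hge)
      rw [mem_cut] at ha hb
      have : a.2 ≠ z ∨ b.2 ≠ z := by
        by_contra hc
        push Not at hc
        have hzX := KX hH hzK
        have := M.oun a.1 a.2 b.1 b.2 ha.1 (hN' ha.2.1) (by rw [hc.1]; exact hzX)
          hb.1 (hN' hb.2.1) (by rw [hc.2]; exact hzX) (by rw [hc.1, hc.2])
        exact hab (Prod.ext this.1 this.2)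
      rcases this with e | e
      · have hm : (a.1, a.2) ∈ (D.dx X ψ H).arcs := mem_dx.2 (Or.inl ⟨ha.1, hN' ha.2.1⟩)
        exact ⟨a.1, ha.2.1, a.2, (hwf _ hm).2.1, e, ha.2.2, Or.inl hm⟩
      · have hm : (b.1, b.2) ∈ (D.dx X ψ H).arcs := mem_dx.2 (Or.inl ⟨hb.1, hN' hb.2.1⟩)
        exact ⟨b.1, hb.2.1, b.2, (hwf _ hm).2.1, e, hb.2.2, Or.inl hm⟩
    · have hzX : z ∈ X := (Finset.mem_union.1 hz).resolve_right hzK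
      obtain ⟨a, ha⟩ : ∃ a, a ∈ KH H := ⟨H ⟨0, by omega⟩, mem_KH.2 ⟨_, rfl⟩⟩
      obtain ⟨p, hp, q, hq, hqz, hqN, hadj⟩ := h.toCrit.nocut z (M.XV hzX) N' (hN'.trans M.XV)
        ⟨n, hn⟩ hz' ⟨a, M.KV h.wf hH ha, fun e => hzK (e ▸ ha), fun e => KX hH ha (hN' e)⟩
      rcases hadj with hadj | hadj
      · have hm : (p, q) ∈ (D.dx X ψ H).arcs := mem_dx.2 (Or.inl ⟨hadj, hN' hp⟩)
        exact ⟨p, hp, q, (hwf _ hm).2.1, hqz, hqN, Or.inl hm⟩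
      · by_cases hqX : q ∈ X
        · have hm : (q, p) ∈ (D.dx X ψ H).arcs := mem_dx.2 (Or.inl ⟨hadj, hqX⟩)
          exact ⟨p, hp, q, (hwf _ hm).1, hqz, hqN, Or.inr hm⟩
        · have hm : (H (ψ q), p) ∈ (D.dx X ψ H).arcs :=
            mem_dx.2 (Or.inr (Or.inr ⟨q, hadj, hqX, hN' hp, rfl⟩))
          have hmK : H (ψ q) ∈ KH H := mem_KH.2 ⟨_, rfl⟩
          exact ⟨p, hp, H (ψ q), (hwf _ hm).1, fun e => hzK (e ▸ hmK),
            fun e => KX hH hmK (hN' e), Or.inr hm⟩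
  by_cases h1 : ∃ a ∈ KH H, a ≠ z ∧ a ∈ N
  · by_cases h2 : ∃ b ∈ KH H, b ≠ z ∧ b ∉ N
    · obtain ⟨a, ha, haz, haN⟩ := h1
      obtain ⟨b, hb, hbz, hbN⟩ := h2
      exact ⟨a, haN, b, Finset.mem_union_right _ hb, hbz, hbN, Or.inl (mem_dx.2 (Or.inr (Or.inl
        ⟨ha, hb, fun e => hbN (e ▸ haN)⟩)))⟩
    · push Not at h2
      obtain ⟨p, hp, q, hq, hqz, hqN, hadj⟩ := key ((D.dx X ψ H).verts \ insert z N) (by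
        intro x hx
        simp only [Finset.mem_sdiff, Finset.mem_insert, not_or] at hx
        refine (Finset.mem_union.1 hx.1).resolve_right fun hK => ?_
        exact hx.2.2 (h2 x hK hx.2.1)) ⟨y, by simp [hy, hyz, hyN]⟩ (by simp)
      simp only [Finset.mem_sdiff, Finset.mem_insert, not_or, not_and, not_not] at hp hqN
      have hqN' : q ∈ N := by
        by_contra hh
        exact hh (hqN hq hqz)
      exact ⟨q, hqN', p, hp.1, hp.2.1, hp.2.2, hadj.symm⟩
  · push Not at h1
    exact key N (fun x hx => (Finset.mem_union.1 (hN hx)).resolve_right fun hK =>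
      h1 x hK (fun e => hzN (e ▸ hx)) hx) hne hzN

theorem ext_dx (M : MS k D X ψ) (hk : 2 ≤ k) (h : Ext k D) (hH : HH D X ψ H)
    (hX : D.dO X = k) : Ext k (D.dx X ψ H) :=
  ext_of hk (M.wf_dx h.wf hH) (M.nc_dx h.toCrit hH) (M.cc_dx hk h hH hX) (M.cut1_dx hk h hH)
    (M.nocut_dx hk h hH)

theorem card_dx (M : MS k D X ψ) (hD : D.WF) (hH : HH D X ψ H) {b : ℕ} (hb : b ∈ D.verts)
    (hbX : b ∉ X) (hdeg : k < D.outdeg b) : (D.dx X ψ H).verts.card < D.verts.card := by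
  have hsub : (D.dx X ψ H).verts ⊆ D.verts := by
    intro x hx
    rcases Finset.mem_union.1 hx with h | h
    · exact M.XV h
    · exact M.KV hD hH h
  refine Finset.card_lt_card (Finset.ssubset_iff_subset_ne.2 ⟨hsub, fun he => ?_⟩)
  have hR : ∀ x ∈ D.verts, x ∉ X → x ∈ KH H := by
    intro x hx hxX
    rw [← he] at hx
    exact (Finset.mem_union.1 hx).resolve_left hxX
  have hbK := hR b hb hbX
  obtain ⟨t1, s0, i1, i2, i3, i4⟩ := M.iex (ψ b)
  have : D.outN b ⊆ insert s0 ((KH H).erase b) := by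
    intro q hq
    rw [mem_outN] at hq
    by_cases hqX : q ∈ X
    · rw [(M.iun b q t1 s0 hq hbX hqX i1 i2 i3 i4.symm).2]; exact Finset.mem_insert_self _ _
    · exact Finset.mem_insert_of_mem (Finset.mem_erase.2
        ⟨(hD _ hq).2.2.symm, hR q (hD _ hq).2.1 hqX⟩)
  have h2 := (Finset.card_le_card this).trans (Finset.card_insert_le _ _)
  rw [Finset.card_erase_of_mem hbK, cardK hH, card_outN] at h2
  have := Finset.card_pos.2 ⟨b, hbK⟩
  rw [cardK hH] at this
  omega

theorem sep_pull (M : MS k D X ψ) (hk : 3 ≤ k) (h : Ext k D) (hH : HH D X ψ H)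
    (hX : D.dO X = k) {z A B t w u w'} (S : Sep (D.dx X ψ H) z A B t w u w') :
    ∃ v A B t w u w', Sep D v A B t w u w' := by
  have hE := M.ext_dx (by omega) h hH hX
  have hzK : z ∉ KH H := by
    intro hz
    have h1 := S.deg_v (by omega) hE.toCrit
    have h2 := M.outN_K h.wf hH (by omega) hz
    split_ifs at h1 <;> omega
  have hzX : z ∈ X := (Finset.mem_union.1 S.vV).resolve_right hzK
  have main : ∀ {A B t w u w'}, Sep (D.dx X ψ H) z A B t w u w' → (∀ x ∈ KH H, x ∉ A) →
      ∃ v A B t w u w', Sep D v A B t w u w' := by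
    clear S
    intro A B t w u w' S hK
    have hAX : ∀ x ∈ A, x ∈ X := fun x hx =>
      (Finset.mem_union.1 (S.AV (Finset.mem_insert_of_mem hx))).resolve_right fun h' => hK x h' hx
    have hKB : ∀ x ∈ KH H, x ∈ B := by
      intro x hx
      rcases S.memV.1 (show x ∈ (D.dx X ψ H).verts from Finset.mem_union_right _ hx) with e | e | e
      · exact absurd (e ▸ hx) hzK
      · exact absurd e (hK x hx)
      · exact e
    have hBV : ∀ x ∈ B, x ∈ D.verts := by
      intro x hx
      rcases Finset.mem_union.1 (S.symm.AV (Finset.mem_insert_of_mem hx)) with e | e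
      · exact M.XV e
      · exact M.KV h.wf hH e
    have hBA : ∀ x ∈ B, x ∉ A := fun x hx hx' => Finset.disjoint_left.1 S.disj hx' hx
    -- the new w'
    obtain ⟨w'', hw1, hw2, hw3⟩ : ∃ w'', w'' ∈ D.verts \ insert z A ∧
        (∀ p ∈ X, p = w' → p = w'') ∧ (∀ p s, (p, s) ∈ D.arcs → p ∉ X → s ∈ X →
          H (ψ p) = w' → p = w'') := by
      by_cases hwX : w' ∈ X
      · refine ⟨w', ?_, fun p _ e => e, fun p s _ _ _ e => ?_⟩
        · simp only [Finset.mem_sdiff, Finset.mem_insert, not_or]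
          exact ⟨M.XV hwX, fun e => S.vB (e ▸ S.wB), hBA _ S.wB⟩
        · exact absurd (e ▸ hwX) (hH (ψ p)).1
      · have hwK : w' ∈ KH H := (Finset.mem_union.1 (S.symm.AV
          (Finset.mem_insert_of_mem S.wB))).resolve_left hwX
        obtain ⟨c, rfl⟩ := mem_KH.1 hwK
        obtain ⟨t1, s0, i1, i2, i3, i4⟩ := M.iex c
        refine ⟨t1, ?_, fun p hp e => absurd (e ▸ hp) hwX, fun p s e1 e2 e3 e4 => ?_⟩
        · simp only [Finset.mem_sdiff, Finset.mem_insert, not_or]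
          exact ⟨(h.wf _ i1).1, fun e => i2 (e ▸ hzX), fun e => i2 (hAX _ e)⟩
        · exact (M.iun p s t1 s0 e1 e2 e3 i1 i2 i3 (by rw [i4]; exact Hinj hH e4)).1
    refine ⟨z, A, D.verts \ insert z A, t, w, u, w'', h.wf, ?_, ?_, S.vA, by simp, S.tA, S.wA, ?_,
      hw1, ?_, ?_⟩
    · exact Sep.verts_split (V := D.verts) (N := A) (I := A) (z := z)
        (by
          intro x hx
          rcases Finset.mem_insert.1 hx with e | e
          · exact e ▸ M.XV hzX
          · exact M.XV (hAX x e)) (Finset.subset_insert _ _)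
    · rw [Finset.disjoint_left]; intro x hx; simp [hx]
    · simp only [Finset.mem_sdiff, Finset.mem_insert, not_or]
      exact ⟨hBV u S.uB, fun e => S.vB (e ▸ S.uB), hBA u S.uB⟩
    · intro p hp q hq hpq
      have hm : (p, q) ∈ (D.dx X ψ H).arcs := mem_dx.2 (Or.inl ⟨hpq, hAX p hp⟩)
      simp only [Finset.mem_sdiff, Finset.mem_insert, not_or] at hq
      refine S.cAB p hp q ?_ hm
      rcases S.memV.1 (S.wf _ hm).2.1 with e | e | e
      · exact absurd e hq.2.1
      · exact absurd e hq.2.2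
      · exact e
    · intro p hp q hq hpq
      simp only [Finset.mem_sdiff, Finset.mem_insert, not_or] at hp
      by_cases hpX : p ∈ X
      · have hm : (p, q) ∈ (D.dx X ψ H).arcs := mem_dx.2 (Or.inl ⟨hpq, hpX⟩)
        have : p ∈ B := by
          rcases S.memV.1 (S.wf _ hm).1 with e | e | e
          · exact absurd e hp.2.1
          · exact absurd e hp.2.2
          · exact e
        have := S.cBA p this q hq hm
        exact ⟨hw2 p hpX this.1, this.2⟩
      · have hm : (H (ψ p), q) ∈ (D.dx X ψ H).arcs :=
          mem_dx.2 (Or.inr (Or.inr ⟨p, hpq, hpX, hAX q hq, rfl⟩))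
        have := S.cBA _ (hKB _ (mem_KH.2 ⟨_, rfl⟩)) q hq hm
        exact ⟨hw3 p q hpq hpX (hAX q hq) this.1, this.2⟩
  by_cases hc : ∀ x ∈ KH H, x ∉ A
  · exact main S hc
  · refine main S.symm ?_
    push Not at hc
    obtain ⟨a, ha, haA⟩ := hc
    intro b hb hbB
    have hab : a ≠ b := fun e => Finset.disjoint_left.1 S.disj haA (e ▸ hbB)
    obtain ⟨c, hcc, hca, hcb⟩ : ∃ c ∈ KH H, c ≠ a ∧ c ≠ b := by
      obtain ⟨c, hc⟩ : (((KH H).erase a).erase b).Nonempty := by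
        rw [← Finset.card_pos, Finset.card_erase_of_mem (by simp [hb, hab.symm]),
          Finset.card_erase_of_mem ha, cardK hH]; omega
      simp only [Finset.mem_erase] at hc
      exact ⟨c, hc.2.2, hc.2.1, hc.1⟩
    have ar : ∀ p q, p ∈ KH H → q ∈ KH H → p ≠ q → (p, q) ∈ (D.dx X ψ H).arcs :=
      fun p q h1 h2 h3 => mem_dx.2 (Or.inr (Or.inl ⟨h1, h2, h3⟩))
    rcases S.memV.1 (show c ∈ (D.dx X ψ H).verts from Finset.mem_union_right _ hcc) with e | e | e
    · exact hzK (e ▸ hcc)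
    · have e1 := S.cAB a haA b hbB (ar _ _ ha hb hab)
      have e2 := S.cAB c e b hbB (ar _ _ hcc hb hcb)
      exact hca (e2.1.trans e1.1.symm)
    · have e1 := S.cAB a haA b hbB (ar _ _ ha hb hab)
      have e2 := S.cAB a haA c e (ar _ _ ha hcc hca.symm)
      exact hcb (e2.2.trans e1.2.symm)

end MS

theorem cyc_next {p : List ℕ} (hp : p.Nodup) {x y z : ℕ} (h1 : (x, y) ∈ cycArcs p)
    (h2 : (x, z) ∈ cycArcs p) : y = z := by
  rw [mem_cycArcs] at h1 h2
  obtain ⟨i, hi, e1, e2⟩ := h1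
  obtain ⟨j, hj, e3, e4⟩ := h2
  have : i = j := (hp.getElem_inj_iff).1 (e1.trans e3.symm)
  subst this
  exact e2.symm.trans e4

theorem cyc_prev {p : List ℕ} (hp : p.Nodup) {x y z : ℕ} (h1 : (y, x) ∈ cycArcs p)
    (h2 : (z, x) ∈ cycArcs p) : y = z := by
  rw [mem_cycArcs] at h1 h2
  obtain ⟨i, hi, e1, e2⟩ := h1
  obtain ⟨j, hj, e3, e4⟩ := h2
  have : (i + 1) % p.length = (j + 1) % p.length := (hp.getElem_inj_iff).1 (e2.trans e4.symm)
  have hij : i = j := by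
    rcases Nat.lt_or_ge (i + 1) p.length with a | a <;> rcases Nat.lt_or_ge (j + 1) p.length with b | b
    · rw [Nat.mod_eq_of_lt a, Nat.mod_eq_of_lt b] at this; omega
    · have : j + 1 = p.length := by omega
      simp_all [Nat.mod_eq_of_lt]
    · have : i + 1 = p.length := by omega
      simp_all [Nat.mod_eq_of_lt]
    · omega
  subst hij
  exact e1.symm.trans e3

theorem card_le_one_exists {P : ℕ → Prop} (h : ∀ a b, P a → P b → a = b) : ∃ c, ∀ a, P a → a = c := by
  by_cases hc : ∃ c, P c
  · obtain ⟨c, hc⟩ := hc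
    exact ⟨c, fun a ha => h a c ha hc⟩
  · exact ⟨0, fun a ha => absurd ⟨a, ha⟩ hc⟩

theorem mem_wheel {p : List ℕ} {x : ℕ} {a b : ℕ} :
    (a, b) ∈ symmCyc p ∪ p.toFinset.image (fun y => (x, y)) ∪ p.toFinset.image (fun y => (y, x)) ↔
    (a, b) ∈ cycArcs p ∨ (b, a) ∈ cycArcs p ∨ (a = x ∧ b ∈ p) ∨ (a ∈ p ∧ b = x) := by
  simp only [symmCyc, Finset.mem_union, Finset.mem_image, List.mem_toFinset, Prod.mk.injEq]
  constructor
  · rintro (((h | ⟨⟨c, d⟩, h1, h2⟩) | ⟨y, h1, h2, h3⟩) | ⟨y, h1, h2, h3⟩)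
    · exact Or.inl h
    · simp only [Prod.swap_prod_mk, Prod.mk.injEq] at h2
      obtain ⟨rfl, rfl⟩ := h2
      exact Or.inr (Or.inl h1)
    · subst h3; exact Or.inr (Or.inr (Or.inl ⟨h2.symm, h1⟩))
    · subst h2; exact Or.inr (Or.inr (Or.inr ⟨h1, h3.symm⟩))
  · rintro (h | h | ⟨h1, h2⟩ | ⟨h1, h2⟩)
    · exact Or.inl (Or.inl (Or.inl h))
    · exact Or.inl (Or.inl (Or.inr ⟨(b, a), h, rfl⟩))
    · exact Or.inl (Or.inr ⟨b, h2, h1.symm, rfl⟩)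
    · exact Or.inr ⟨a, h1, rfl, h2.symm⟩

theorem cyc_mem {p : List ℕ} {x y : ℕ} (h : (x, y) ∈ cycArcs p) : x ∈ p ∧ y ∈ p := by
  obtain ⟨i, hi, e1, e2⟩ := mem_cycArcs.1 h
  exact ⟨e1 ▸ List.getElem_mem _, e2 ▸ List.getElem_mem _⟩

theorem Base.hub {D : Dgraph} (hB : Base k D) {a : ℕ} (ha : a ∈ D.verts) (hd : k < D.outdeg a) :
    ∀ x ∈ D.verts, x ≠ a → (x, a) ∈ D.arcs ∧ (a, x) ∈ D.arcs := by
  rcases hB with ⟨rfl, p, x, h1, h2, hp, hx, hV, hA⟩ | ⟨hk, hc, hA⟩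
  · by_cases hax : a = x
    · subst hax
      intro y hy hya
      rw [hV, Finset.mem_insert, List.mem_toFinset] at hy
      have hy' := hy.resolve_left hya
      rw [hA, mem_wheel, mem_wheel]
      exact ⟨Or.inr (Or.inr (Or.inr ⟨hy', rfl⟩)), Or.inr (Or.inr (Or.inl ⟨rfl, hy'⟩))⟩
    · exfalso
      obtain ⟨n, hn⟩ := card_le_one_exists (P := fun b => (a, b) ∈ cycArcs p) fun b c => cyc_next hp
      obtain ⟨m, hm⟩ := card_le_one_exists (P := fun b => (b, a) ∈ cycArcs p) fun b c => cyc_prev hp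
      have : D.outN a ⊆ {n, m, x} := by
        intro b hb
        rw [mem_outN, hA, mem_wheel] at hb
        simp only [Finset.mem_insert, Finset.mem_singleton]
        rcases hb with h | h | h | h
        · exact Or.inl (hn _ h)
        · exact Or.inr (Or.inl (hm _ h))
        · exact absurd h.1 hax
        · exact Or.inr (Or.inr h.2)
      have := (Finset.card_le_card this).trans Finset.card_le_three
      rw [card_outN] at this
      omega
  · intro x hx hxa
    rw [hA]
    simp [hx, ha, hxa, hxa.symm]

theorem step2 (hk : 3 ≤ k) : ∀ (n : ℕ) {D : Dgraph}, D.verts.card ≤ n → Ext k D →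
    Base k D ∨ ∃ v A B t w u w', Sep D v A B t w u w' := by
  intro n
  induction n with
  | zero =>
    intro D hn h
    obtain ⟨a, ha⟩ := h.toCrit.nonempty (by omega)
    have := Finset.card_pos.2 ⟨_, (h.wf _ ha).1⟩
    omega
  | succ n ih =>
    intro D hn h
    by_cases hh : ∃ a ∈ D.verts, ∃ b ∈ D.verts, a ≠ b ∧ k < D.outdeg a ∧ k < D.outdeg b
    · right
      obtain ⟨a, ha, b, hb, hab, hda, hdb⟩ := hh
      obtain ⟨X0, h1, h2, h3⟩ := h.cc a ha b hb hab
      have hX0 : D.dO (D.verts ∩ X0) = k := by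
        rw [dO_congr h.wf (Y := X0) (by intro x hx; simp [hx])]
        exact le_antisymm h3 (h.toCrit.cut_ge (by omega) ⟨a, ha, h1⟩ ⟨b, hb, h2⟩)
      have main : ∀ (X : Finset ℕ) ψ (a b : ℕ), MS k D X ψ → a ∈ X → b ∈ D.verts → b ∉ X →
          k < D.outdeg a → k < D.outdeg b → D.dO X = k →
          ∃ v A B t w u w', Sep D v A B t w u w' := by
        clear hX0 h1 h2 h3 X0 ha hb hab hda hdb a b
        intro X ψ a b M ha hb hbX hda hdb hX
        obtain ⟨H, hH⟩ := M.exH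
        have hE := M.ext_dx (by omega) h hH hX
        rcases ih (by have := M.card_dx h.wf hH hb hbX hdb; omega) hE with hB | ⟨z, A, B, t, w, u, w', S⟩
        · exfalso
          have hdx : (D.dx X ψ H).outdeg a = D.outdeg a := by
            rw [← card_outN, ← card_outN]
            congr 1
            ext q
            rw [mem_outN, mem_outN]
            constructor
            · intro hq
              rcases mem_dx.1 hq with ⟨h1, h2⟩ | ⟨h1, h2, h3⟩ | ⟨t, h1, h2, h3, h4⟩
              · exact h1
              · exact absurd ha (MS.KX hH h1)
              · exact absurd ha (MS.KX hH (mem_KH.2 ⟨_, h4⟩))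
            · intro hq; exact mem_dx.2 (Or.inl ⟨hq, ha⟩)
          have hub := hB.hub (show a ∈ (D.dx X ψ H).verts from Finset.mem_union_left _ ha) (by omega)
          have t1 : ∀ p q, (p, q) ∈ D.arcs → p ∈ X → q ∉ X → p = a := by
            intro p q e1 e2 e3
            have hq : H (ψ q) = q := M.head hH e1 e2 e3
            have hqK : q ∈ KH H := mem_KH.2 ⟨_, hq⟩
            have := (hub q (Finset.mem_union_right _ hqK) (fun e => e3 (e ▸ ha))).2
            rcases mem_dx.1 this with ⟨h1, h2⟩ | ⟨h1, h2, h3⟩ | ⟨t, h1, h2, h3, h4⟩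
            · exact (M.oun p q a q e1 e2 e3 h1 ha e3 rfl).1
            · exact absurd ha (MS.KX hH h1)
            · exact absurd h3 e3
          have t2 : ∀ p q, (p, q) ∈ D.arcs → p ∉ X → q ∈ X → q = a := by
            intro p q e1 e2 e3
            have hqK : H (ψ p) ∈ KH H := mem_KH.2 ⟨_, rfl⟩
            have := (hub _ (Finset.mem_union_right _ hqK) (fun e => MS.KX hH hqK (e ▸ ha))).1
            rcases mem_dx.1 this with ⟨h1, h2⟩ | ⟨h1, h2, h3⟩ | ⟨t, h1, h2, h3, h4⟩
            · exact absurd h2 (MS.KX hH hqK)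
            · exact absurd ha (MS.KX hH h2)
            · exact (M.iun p q t a e1 e2 e3 h1 h2 h3 (MS.Hinj hH h4).symm).2
          by_cases hXa : X = {a}
          · rw [outdeg_eq h.wf, ← hXa] at hda
            omega
          · obtain ⟨y, hy, hya⟩ : ∃ y ∈ X, y ≠ a := by
              by_contra hc
              push Not at hc
              exact hXa (Finset.eq_singleton_iff_unique_mem.2 ⟨ha, hc⟩)
            obtain ⟨p, hp, q, hq, hqa, hqN, hadj⟩ := h.toCrit.nocut a (M.XV ha) (X.erase a)
              ((Finset.erase_subset _ _).trans M.XV) ⟨y, by simp [hy, hya]⟩ (by simp)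
              ⟨b, hb, fun e => hbX (e ▸ ha), fun e => hbX (Finset.mem_of_mem_erase e)⟩
            rw [Finset.mem_erase] at hp
            have hqX : q ∉ X := fun e => hqN (Finset.mem_erase.2 ⟨hqa, e⟩)
            rcases hadj with e | e
            · exact hp.1 (t1 p q e hp.2 hqX)
            · exact hp.1 (t2 q p e hqX hp.2)
        · exact M.sep_pull hk h hH hX S
      rcases ms_exists (by omega) h Finset.inter_subset_left hX0 ⟨a, by simp [ha, h1]⟩
        ⟨b, hb, by simp [h2]⟩ with ⟨ψ, M⟩ | ⟨ψ, M⟩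
      · exact main _ ψ a b M (by simp [ha, h1]) hb (by simp [h2]) hda hdb hX0
      · refine main _ ψ b a M (by simp [hb, h2]) ha (by simp [ha, h1]) hdb hda ?_
        rw [← hX0, ← h.dI_eq (by omega) (D.verts ∩ X0)]
        symm; apply dI_eq_dO h.wf
        intro x hx; simp [hx]
    · push Not at hh
      obtain ⟨a0, ha0⟩ := h.toCrit.nonempty (by omega)
      by_cases hv : ∃ v ∈ D.verts, k < D.outdeg v
      · obtain ⟨v, hv, hdv⟩ := hv
        exact case2a hk h hv fun x hx hxv => hh v hv x hx hxv.symm hdv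
      · push Not at hv
        exact case2a hk h (h.wf _ ha0).1 fun x hx _ => hv x hx

end Dgraph

namespace Dgraph
open Relation
variable {k : ℕ}

/-! ### Open tree joins -/

def del2 (P : Dgraph) (a b : ℕ) : Dgraph := ⟨P.verts, P.arcs \ {(a, b), (b, a)}⟩
def un (F G : Dgraph) : Dgraph := ⟨F.verts ∪ G.verts, F.arcs ∪ G.arcs⟩
def una (F G : Dgraph) (x y : ℕ) : Dgraph := ⟨F.verts ∪ G.verts, insert (x, y) (F.arcs ∪ G.arcs)⟩
def closeB (F1 F2 : Dgraph) (x1 y1 x2 y2 : ℕ) : Dgraph :=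
  ⟨F1.verts ∪ F2.verts, insert (x1, y2) (insert (x2, y1) (F1.arcs ∪ F2.arcs))⟩

inductive Open (Q : Dgraph → Prop) : Dgraph → ℕ → ℕ → ℕ → Prop
  | leaf (P : Dgraph) (v z : ℕ) (hQ : Q P) (h1 : (v, z) ∈ P.arcs) (h2 : (z, v) ∈ P.arcs) :
      Open Q (del2 P v z) z v z
  | edge (P G : Dgraph) (v z x y : ℕ) (hQ : Q P) (h1 : (v, z) ∈ P.arcs) (h2 : (z, v) ∈ P.arcs)
      (hG : Open Q G x z y) (hV : ∀ t, t ∈ P.verts → t ∈ G.verts → t = z) :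
      Open Q (un (del2 P v z) G) x v y
  | seq (F1 F2 : Dgraph) (v x1 y1 x2 y2 : ℕ) (h1 : Open Q F1 x1 v y1) (h2 : Open Q F2 x2 v y2)
      (hV : ∀ t, t ∈ F1.verts → t ∈ F2.verts → t = v) :
      Open Q (una F1 F2 x1 y2) x2 v y1

abbrev TM := List ((ℕ × ℕ) × Dgraph)

def TV (M : TM) : Finset ℕ := (M.map fun m => m.1.1).toFinset ∪ (M.map fun m => m.1.2).toFinset

theorem mem_TV {M : TM} {x : ℕ} : x ∈ TV M ↔ ∃ m ∈ M, m.1.1 = x ∨ m.1.2 = x := by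
  simp only [TV, Finset.mem_union, List.mem_toFinset, List.mem_map]
  constructor
  · rintro (⟨m, h1, h2⟩ | ⟨m, h1, h2⟩)
    · exact ⟨m, h1, Or.inl h2⟩
    · exact ⟨m, h1, Or.inr h2⟩
  · rintro ⟨m, h1, h2 | h2⟩
    · exact Or.inl ⟨m, h1, h2⟩
    · exact Or.inr ⟨m, h1, h2⟩

theorem TV_append (M1 M2 : TM) : TV (M1 ++ M2) = TV M1 ∪ TV M2 := by
  ext x
  simp only [mem_TV, Finset.mem_union, List.mem_append]
  constructor
  · rintro ⟨m, h1 | h1, h2⟩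
    · exact Or.inl ⟨m, h1, h2⟩
    · exact Or.inr ⟨m, h1, h2⟩
  · rintro (⟨m, h1, h2⟩ | ⟨m, h1, h2⟩)
    · exact ⟨m, Or.inl h1, h2⟩
    · exact ⟨m, Or.inr h1, h2⟩

def tarcs (M : TM) : List (ℕ × ℕ) := M.flatMap fun m => [m.1, m.1.swap]

theorem mem_tarcs {M : TM} {a : ℕ × ℕ} : a ∈ tarcs M ↔ ∃ m ∈ M, a = m.1 ∨ a = m.1.swap := by
  simp [tarcs, List.mem_flatMap]

theorem tarcs_append (M1 M2 : TM) : tarcs (M1 ++ M2) = tarcs M1 ++ tarcs M2 := by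
  simp [tarcs]

def cnt (M : TM) (x : ℕ) : ℕ := M.countP fun m => decide (m.1.1 = x ∨ m.1.2 = x)

theorem cnt_append (M1 M2 : TM) (x : ℕ) : cnt (M1 ++ M2) x = cnt M1 x + cnt M2 x := by
  simp [cnt]

theorem cnt_zero {M : TM} {x : ℕ} (h : x ∉ TV M) : cnt M x = 0 := by
  rw [cnt, List.countP_eq_zero]
  intro m hm hx
  exact h (mem_TV.2 ⟨m, hm, by simpa using hx⟩)

theorem cnt_pos {M : TM} {x : ℕ} (h : x ∈ TV M) : 0 < cnt M x := by
  rw [cnt, List.countP_pos_iff]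
  obtain ⟨m, hm, h⟩ := mem_TV.1 h
  exact ⟨m, hm, by simpa using h⟩

/-- tree data without walk -/
structure TB (Q : Dgraph → Prop) (M : TM) (V : Finset ℕ) : Prop where
  q : ∀ m ∈ M, Q m.2
  nd : (tarcs M).Nodup
  lp : ∀ m ∈ M, m.1.1 ≠ m.1.2
  card : (TV M).card = M.length + 1
  int : ∀ m ∈ M, m.2.verts ∩ TV M = {m.1.1, m.1.2}
  dis : M.Pairwise fun m m' =>
    Disjoint (m.2.verts \ {m.1.1, m.1.2}) (m'.2.verts \ {m'.1.1, m'.1.2})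
  dig : ∀ m ∈ M, m.1 ∈ m.2.arcs ∧ m.1.swap ∈ m.2.arcs
  vs : ∀ x, x ∈ V ↔ ∃ m ∈ M, x ∈ m.2.verts

theorem TB.TVV {Q} {M : TM} {V} (h : TB Q M V) {x : ℕ} (hx : x ∈ TV M) : x ∈ V := by
  obtain ⟨m, hm, h1⟩ := mem_TV.1 hx
  rw [h.vs]
  refine ⟨m, hm, ?_⟩
  have : x ∈ m.2.verts ∩ TV M := by
    rw [h.int m hm]
    simp only [Finset.mem_insert, Finset.mem_singleton]
    rcases h1 with h | h
    · exact Or.inl h.symm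
    · exact Or.inr h.symm
  exact (Finset.mem_inter.1 this).1

theorem TB.single {Q : Dgraph → Prop} {P : Dgraph} {v z : ℕ} (hQ : Q P) (hP : P.WF)
    (h1 : (v, z) ∈ P.arcs) (h2 : (z, v) ∈ P.arcs) : TB Q [((v, z), P)] P.verts := by
  have hw := hP _ h1
  have hvz : v ≠ z := hw.2.2
  have hTV : TV [((v, z), P)] = {v, z} := by
    ext x; simp [TV]
  refine ⟨by simpa using hQ, ?_, by simpa using hvz, ?_, ?_, by simp, by simpa using ⟨h1, h2⟩,
    by simp⟩
  · simp [tarcs, hvz, hvz.symm]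
  · rw [hTV, Finset.card_pair hvz]; rfl
  · intro m hm
    rw [List.mem_singleton] at hm
    subst hm
    rw [hTV]
    refine Finset.inter_eq_right.2 ?_
    intro x hx
    simp only [Finset.mem_insert, Finset.mem_singleton] at hx
    rcases hx with rfl | rfl
    · exact hw.1
    · exact hw.2.1

theorem TB.merge {Q : Dgraph → Prop} {M1 M2 : TM} {V1 V2 : Finset ℕ} {c : ℕ} (h1 : TB Q M1 V1)
    (h2 : TB Q M2 V2) (hV : ∀ t, t ∈ V1 → t ∈ V2 → t = c) (hc1 : c ∈ TV M1) (hc2 : c ∈ TV M2) :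
    TB Q (M1 ++ M2) (V1 ∪ V2) := by
  have mV1 : ∀ m ∈ M1, ∀ x ∈ m.2.verts, x ∈ V1 := fun m hm x hx => (h1.vs x).2 ⟨m, hm, hx⟩
  have mV2 : ∀ m ∈ M2, ∀ x ∈ m.2.verts, x ∈ V2 := fun m hm x hx => (h2.vs x).2 ⟨m, hm, hx⟩
  have tt : ∀ t, t ∈ TV M1 → t ∈ TV M2 → t = c := fun t a b => hV t (h1.TVV a) (h2.TVV b)
  refine ⟨?_, ?_, ?_, ?_, ?_, ?_, ?_, ?_⟩
  · intro m hm
    rcases List.mem_append.1 hm with h | h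
    exacts [h1.q m h, h2.q m h]
  · rw [tarcs_append, List.nodup_append']
    refine ⟨h1.nd, h2.nd, ?_⟩
    intro a ha hb
    obtain ⟨m, hm, e⟩ := mem_tarcs.1 ha
    obtain ⟨m', hm', e'⟩ := mem_tarcs.1 hb
    have k1 : a.1 ∈ TV M1 ∧ a.2 ∈ TV M1 := by
      rcases e with rfl | rfl
      · exact ⟨mem_TV.2 ⟨m, hm, Or.inl rfl⟩, mem_TV.2 ⟨m, hm, Or.inr rfl⟩⟩
      · exact ⟨mem_TV.2 ⟨m, hm, Or.inr rfl⟩, mem_TV.2 ⟨m, hm, Or.inl rfl⟩⟩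
    have k2 : a.1 ∈ TV M2 ∧ a.2 ∈ TV M2 := by
      rcases e' with rfl | rfl
      · exact ⟨mem_TV.2 ⟨m', hm', Or.inl rfl⟩, mem_TV.2 ⟨m', hm', Or.inr rfl⟩⟩
      · exact ⟨mem_TV.2 ⟨m', hm', Or.inr rfl⟩, mem_TV.2 ⟨m', hm', Or.inl rfl⟩⟩
    have k3 : a.1 = a.2 := (tt _ k1.1 k2.1).trans (tt _ k1.2 k2.2).symm
    rcases e with rfl | rfl
    · exact h1.lp m hm k3
    · exact h1.lp m hm k3.symm
  · intro m hm
    rcases List.mem_append.1 hm with h | h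
    exacts [h1.lp m h, h2.lp m h]
  · rw [TV_append]
    have := Finset.card_union_add_card_inter (TV M1) (TV M2)
    have hi : TV M1 ∩ TV M2 = {c} := by
      ext t
      simp only [Finset.mem_inter, Finset.mem_singleton]
      exact ⟨fun h => tt t h.1 h.2, fun h => h ▸ ⟨hc1, hc2⟩⟩
    rw [hi, Finset.card_singleton, h1.card, h2.card] at this
    rw [List.length_append]
    omega
  · intro m hm
    rw [TV_append, Finset.inter_union_distrib_left]
    rcases List.mem_append.1 hm with h | h
    · rw [h1.int m h]
      refine Finset.union_eq_left.2 ?_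
      intro x hx
      rw [Finset.mem_inter] at hx
      have := hV x (mV1 m h x hx.1) (h2.TVV hx.2)
      rw [← h1.int m h]
      exact Finset.mem_inter.2 ⟨hx.1, this ▸ hc1⟩
    · rw [h2.int m h]
      refine Finset.union_eq_right.2 ?_
      intro x hx
      rw [Finset.mem_inter] at hx
      have := hV x (h1.TVV hx.2) (mV2 m h x hx.1)
      rw [← h2.int m h]
      exact Finset.mem_inter.2 ⟨hx.1, this ▸ hc2⟩
  · rw [List.pairwise_append]
    refine ⟨h1.dis, h2.dis, ?_⟩
    intro m hm m' hm'
    rw [Finset.disjoint_left]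
    intro x hx hx'
    rw [Finset.mem_sdiff] at hx hx'
    have := hV x (mV1 m hm x hx.1) (mV2 m' hm' x hx'.1)
    apply hx.2
    rw [← h1.int m hm]
    exact Finset.mem_inter.2 ⟨hx.1, this ▸ hc1⟩
  · intro m hm
    rcases List.mem_append.1 hm with h | h
    exacts [h1.dig m h, h2.dig m h]
  · intro x
    rw [Finset.mem_union, h1.vs, h2.vs]
    constructor
    · rintro (⟨m, h, e⟩ | ⟨m, h, e⟩)
      · exact ⟨m, List.mem_append_left _ h, e⟩
      · exact ⟨m, List.mem_append_right _ h, e⟩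
    · rintro ⟨m, h, e⟩
      rcases List.mem_append.1 h with h | h
      exacts [Or.inl ⟨m, h, e⟩, Or.inr ⟨m, h, e⟩]

/-- consecutive pairs of a list -/
def cons2 (l : List ℕ) : List (ℕ × ℕ) := l.zip l.tail

theorem cons2_append : ∀ (l1 l2 : List ℕ) (x y : ℕ), l1.getLast? = some x → l2.head? = some y →
    cons2 (l1 ++ l2) = cons2 l1 ++ (x, y) :: cons2 l2
  | [], _, _, _, h, _ => by simp at h
  | [a], [], _, _, _, h => by simp at h
  | [a], b :: l, x, y, h, h' => by
    simp at h h'; subst h; subst h'; simp [cons2]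
  | a :: b :: l, l2, x, y, h, h' => by
    have := cons2_append (b :: l) l2 x y (by simpa using h) h'
    simp only [cons2, List.cons_append, List.tail_cons, List.zip_cons_cons] at this ⊢
    rw [this]

def cyc2 (l : List ℕ) (v : ℕ) : List (ℕ × ℕ) := l.zip (l.tail ++ [v])

theorem cyc2_eq : ∀ (l : List ℕ) (v : ℕ), l ≠ [] → cyc2 l v = cons2 (l ++ [v])
  | [], _, h => absurd rfl h
  | [a], v, _ => by simp [cyc2, cons2]
  | a :: b :: l, v, _ => by
    have := cyc2_eq (b :: l) v (by simp)
    simp only [cyc2, cons2, List.cons_append, List.tail_cons, List.zip_cons_cons] at this ⊢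
    rw [this]

theorem getLast_of_ne {l : List ℕ} (h : l ≠ []) : ∃ x, l.getLast? = some x := by
  rw [← Option.isSome_iff_exists]; simpa using h

theorem ne_of_head {l : List ℕ} {v : ℕ} (h : l.head? = some v) : l ≠ [] := by
  rintro rfl; simp at h

theorem cyc2_append {l1 l2 : List ℕ} {v : ℕ} (h1 : l1.head? = some v) (h2 : l2.head? = some v) :
    cyc2 (l1 ++ l2) v = cyc2 l1 v ++ cyc2 l2 v := by
  have n1 := ne_of_head h1
  have n2 := ne_of_head h2
  obtain ⟨x, hx⟩ := getLast_of_ne n1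
  rw [cyc2_eq _ _ (by simp [n1]), cyc2_eq _ _ n1, cyc2_eq _ _ n2, List.append_assoc,
    cons2_append l1 (l2 ++ [v]) x v hx (by simp [List.head?_append, h2]),
    cons2_append l1 [v] x v hx rfl]
  simp [cons2]

theorem cyc2_edge {l : List ℕ} {v z : ℕ} (h : l.head? = some z) :
    cyc2 (v :: (l ++ [z])) v = (v, z) :: (cyc2 l z ++ [(z, v)]) := by
  have n := ne_of_head h
  rw [cyc2_eq _ _ (by simp), cyc2_eq _ _ n]
  have e1 : v :: (l ++ [z]) ++ [v] = [v] ++ ((l ++ [z]) ++ [v]) := by simp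
  rw [e1, cons2_append [v] _ v z rfl (by simp [List.head?_append, h]),
    cons2_append (l ++ [z]) [v] z v (by simp) rfl]
  simp [cons2]

structure TD (Q : Dgraph → Prop) (F : Dgraph) (x v y : ℕ) (M : TM) (W : List ℕ) (S : Finset ℕ) :
    Prop extends TB Q M F.verts where
  vT : v ∈ TV M
  hd : W.head? = some v
  prs : (cyc2 W v).Perm (tarcs M)
  sub : ∀ s ∈ S, s ∈ TV M ∧ s ≠ v
  lf : ∀ s ∈ TV M, s ≠ v → (s ∈ S ↔ cnt M s = 1)
  hy : (W.filter fun s => decide (s ∈ S)).head? = some y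
  hx : (W.filter fun s => decide (s ∈ S)).getLast? = some x
  fa : ∀ a, a ∈ F.arcs ↔ (∃ m ∈ M, a ∈ m.2.arcs ∧ a ≠ m.1 ∧ a ≠ m.1.swap) ∨
    a ∈ cons2 (W.filter fun s => decide (s ∈ S))

theorem walk_TV {M : TM} {W : List ℕ} {v : ℕ} (h : (cyc2 W v).Perm (tarcs M)) {x : ℕ}
    (hx : x ∈ W) : x ∈ TV M := by
  have : ∃ q, (x, q) ∈ cyc2 W v := by
    obtain ⟨i, hi, rfl⟩ := List.getElem_of_mem hx
    have hi' : i < (cyc2 W v).length := by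
      simp [cyc2]; omega
    exact ⟨((cyc2 W v)[i]).2, by
      have := List.getElem_mem hi'
      simpa [cyc2, List.getElem_zip] using this⟩
  obtain ⟨q, hq⟩ := this
  obtain ⟨m, hm, e⟩ := mem_tarcs.1 (h.mem_iff.1 hq)
  rcases e with e | e
  · exact mem_TV.2 ⟨m, hm, Or.inl (by rw [← e])⟩
  · exact mem_TV.2 ⟨m, hm, Or.inr (by have := congrArg Prod.fst e; exact this.symm)⟩

theorem filter_append_S {W1 W2 : List ℕ} {S1 S2 : Finset ℕ} (h1 : ∀ x ∈ W1, x ∉ S2)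
    (h2 : ∀ x ∈ W2, x ∉ S1) :
    ((W1 ++ W2).filter fun s => decide (s ∈ S1 ∪ S2)) =
      (W1.filter fun s => decide (s ∈ S1)) ++ (W2.filter fun s => decide (s ∈ S2)) := by
  rw [List.filter_append]
  congr 1
  · refine List.filter_congr fun x hx => ?_
    simp [h1 x hx]
  · refine List.filter_congr fun x hx => ?_
    simp [h2 x hx]

theorem Open.data {Q : Dgraph → Prop} (hQ : ∀ P, Q P → P.WF) {F : Dgraph} {x v y : ℕ}
    (h : Open Q F x v y) : ∃ M W S, TD Q F x v y M W S := by
  induction h with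
  | leaf P v z q h1 h2 =>
    have hvz : v ≠ z := (hQ P q _ h1).2.2
    have hTV : TV [((v, z), P)] = {v, z} := by ext x; simp [TV]
    refine ⟨[((v, z), P)], [v, z], {z}, TB.single q (hQ P q) h1 h2, ?_, rfl, ?_, ?_, ?_, ?_, ?_, ?_⟩
    · simp [hTV]
    · simp [cyc2, tarcs]
    · simp [hTV, hvz.symm]
    · intro s hs hsv
      rw [hTV] at hs
      simp only [Finset.mem_insert, Finset.mem_singleton] at hs
      have := hs.resolve_left hsv
      subst this
      simp [cnt]
    · simp [List.filter_cons, hvz]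
    · simp [List.filter_cons, hvz]
    · intro a
      simp [List.filter_cons, hvz, cons2, del2]
  | edge P G v z x y q h1 h2 hG hV ih =>
    obtain ⟨M, W, S, T⟩ := ih
    have hvz : v ≠ z := (hQ P q _ h1).2.2
    have hTV : TV [((v, z), P)] = {v, z} := by ext x; simp [TV]
    have hvG : v ∉ G.verts := fun e => hvz (hV v (hQ P q _ h1).1 e)
    have hvT : v ∉ TV M := fun e => hvG (T.TVV e)
    have hB := (TB.single q (hQ P q) h1 h2).merge T.toTB hV (by simp [hTV]) T.vT
    have hzS : z ∉ S := fun e => (T.sub z e).2 rfl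
    have hvS : v ∉ S := fun e => hvT (T.sub v e).1
    have hfl : ((v :: (W ++ [z])).filter fun s => decide (s ∈ S)) =
        W.filter fun s => decide (s ∈ S) := by
      simp [List.filter_cons, List.filter_append, hzS, hvS]
    refine ⟨[((v, z), P)] ++ M, v :: (W ++ [z]), S, hB, ?_, rfl, ?_, ?_, ?_, ?_, ?_, ?_⟩
    · simp [TV]
    · rw [cyc2_edge T.hd, tarcs_append]
      have : tarcs [((v, z), P)] = [(v, z), (z, v)] := by simp [tarcs]
      rw [this]
      simp only [List.cons_append, List.nil_append]
      refine List.Perm.cons _ ?_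
      refine (List.perm_append_comm).trans ?_
      simp only [List.cons_append, List.nil_append]
      exact List.Perm.cons _ T.prs
    · intro s hs
      refine ⟨by rw [TV_append]; exact Finset.mem_union_right _ (T.sub s hs).1, fun e => hvS (e ▸ hs)⟩
    · intro s hs hsv
      rw [cnt_append]
      rw [TV_append, hTV] at hs
      have hsM : s ∈ TV M := by
        rcases Finset.mem_union.1 hs with e | e
        · simp only [Finset.mem_insert, Finset.mem_singleton] at e
          rw [e.resolve_left hsv]; exact T.vT
        · exact e
      by_cases hsz : s = z
      · subst hsz
        have e1 : 0 < cnt M s := cnt_pos T.vT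
        have e2 : 0 < cnt [((v, s), P)] s := cnt_pos (by simp [TV])
        constructor
        · intro e; exact absurd e hzS
        · intro e; omega
      · rw [cnt_zero (M := [((v, z), P)]) (by simp [hTV, hsv, hsz]), T.lf s hsM hsz, Nat.zero_add]
    · rw [hfl]; exact T.hy
    · rw [hfl]; exact T.hx
    · intro a
      rw [hfl]
      show a ∈ (del2 P v z).arcs ∪ G.arcs ↔ _
      rw [Finset.mem_union, T.fa]
      constructor
      · rintro (e | ⟨m, hm, e⟩ | e)
        · refine Or.inl ⟨((v, z), P), by simp, ?_⟩
          simpa [del2] using e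
        · exact Or.inl ⟨m, by simp [hm], e⟩
        · exact Or.inr e
      · rintro (⟨m, hm, e⟩ | e)
        · rcases List.mem_append.1 hm with e' | e'
          · rw [List.mem_singleton] at e'
            subst e'
            left; simpa [del2] using e
          · exact Or.inr (Or.inl ⟨m, e', e⟩)
        · exact Or.inr (Or.inr e)
  | seq F1 F2 v x1 y1 x2 y2 h1 h2 hV ih1 ih2 =>
    obtain ⟨M1, W1, S1, T1⟩ := ih1
    obtain ⟨M2, W2, S2, T2⟩ := ih2
    have hB := T1.toTB.merge T2.toTB hV T1.vT T2.vT
    have tt : ∀ t, t ∈ TV M1 → t ∈ TV M2 → t = v := fun t a b => hV t (T1.TVV a) (T2.TVV b)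
    have hfl := filter_append_S (W1 := W1) (W2 := W2) (S1 := S1) (S2 := S2)
      (fun x hx hx' => (T2.sub x hx').2 (tt x (walk_TV T1.prs hx) (T2.sub x hx').1))
      (fun x hx hx' => (T1.sub x hx').2 (tt x (T1.sub x hx').1 (walk_TV T2.prs hx)))
    refine ⟨M1 ++ M2, W1 ++ W2, S1 ∪ S2, hB, ?_, ?_, ?_, ?_, ?_, ?_, ?_, ?_⟩
    · rw [TV_append]; exact Finset.mem_union_left _ T1.vT
    · simp [List.head?_append, T1.hd]
    · rw [cyc2_append T1.hd T2.hd, tarcs_append]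
      exact T1.prs.append T2.prs
    · intro s hs
      rw [TV_append, Finset.mem_union]
      rcases Finset.mem_union.1 hs with e | e
      · exact ⟨Or.inl (T1.sub s e).1, (T1.sub s e).2⟩
      · exact ⟨Or.inr (T2.sub s e).1, (T2.sub s e).2⟩
    · intro s hs hsv
      rw [cnt_append, Finset.mem_union]
      rw [TV_append, Finset.mem_union] at hs
      rcases hs with e | e
      · have hn : s ∉ TV M2 := fun e' => hsv (tt s e e')
        have hn' : s ∉ S2 := fun e' => hn (T2.sub s e').1
        rw [cnt_zero hn, T1.lf s e hsv]; simp [hn']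
      · have hn : s ∉ TV M1 := fun e' => hsv (tt s e' e)
        have hn' : s ∉ S1 := fun e' => hn (T1.sub s e').1
        rw [cnt_zero hn, T2.lf s e hsv]; simp [hn']
    · rw [hfl, List.head?_append, T1.hy]; rfl
    · rw [hfl, List.getLast?_append, T2.hx]; rfl
    · intro a
      rw [hfl, cons2_append _ _ x1 y2 T1.hx T2.hy]
      show a ∈ insert (x1, y2) (F1.arcs ∪ F2.arcs) ↔ _
      rw [Finset.mem_insert, Finset.mem_union, T1.fa, T2.fa, List.mem_append, List.mem_cons]
      constructor
      · rintro (e | (⟨m, hm, e⟩ | e) | (⟨m, hm, e⟩ | e))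
        · exact Or.inr (Or.inr (Or.inl e))
        · exact Or.inl ⟨m, List.mem_append_left _ hm, e⟩
        · exact Or.inr (Or.inl e)
        · exact Or.inl ⟨m, List.mem_append_right _ hm, e⟩
        · exact Or.inr (Or.inr (Or.inr e))
      · rintro (⟨m, hm, e⟩ | e | e | e)
        · rcases List.mem_append.1 hm with e' | e'
          · exact Or.inr (Or.inl (Or.inl ⟨m, e', e⟩))
          · exact Or.inr (Or.inr (Or.inl ⟨m, e', e⟩))
        · exact Or.inr (Or.inl (Or.inr e))
        · exact Or.inl e
        · exact Or.inr (Or.inr (Or.inr e))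

end Dgraph

namespace Dgraph
open Relation
variable {k : ℕ}

/-! ### Closing an open tree join -/

theorem zip_rot {l : List ℕ} {v : ℕ} (h : l.head? = some v) : l.zip (l.rotate 1) = cyc2 l v := by
  cases l with
  | nil => simp at h
  | cons a l =>
    simp at h; subst h
    simp [cyc2]

theorem cnt_card (M : TM) (x : ℕ) :
    (Finset.univ.filter fun i : Fin M.length => M[i].1.1 = x ∨ M[i].1.2 = x).card = cnt M x := by
  have h1 : (Finset.univ.val.map fun i : Fin M.length => M[i]) = (M : Multiset _) := by
    rw [Fin.univ_val_map]
    congr 1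
    exact List.ofFn_getElem
  have h2 : cnt M x = Multiset.countP (fun m => m.1.1 = x ∨ m.1.2 = x)
      (M : Multiset ((ℕ × ℕ) × Dgraph)) := by
    rw [Multiset.coe_countP]; rfl
  rw [h2, ← h1, Multiset.countP_map]
  rfl

theorem walk_reach {R : ℕ → ℕ → Prop} : ∀ (l : List ℕ) (v : ℕ), l.head? = some v →
    (∀ a ∈ cons2 l, R a.1 a.2) → ∀ x ∈ l, ReflTransGen R v x
  | [], _, h, _, _, _ => by simp at h
  | [a], v, h, _, x, hx => by
    simp at h hx; subst h; subst hx; exact .refl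
  | a :: b :: l, v, h, hR, x, hx => by
    simp at h; subst h
    rcases List.mem_cons.1 hx with rfl | hx
    · exact .refl
    · refine ReflTransGen.head (hR (a, b) (by simp [cons2])) ?_
      refine walk_reach (b :: l) b rfl (fun c hc => hR c ?_) x hx
      simp only [cons2, List.tail_cons, List.zip_cons_cons, List.mem_cons] at hc ⊢
      exact Or.inr hc

theorem adj_symm {D : Dgraph} {x y : ℕ} (h : D.adj x y) : D.adj y x := Or.symm h

theorem ureach_symm {D : Dgraph} {x y : ℕ} (h : D.UReach x y) : D.UReach y x := by
  induction h with
  | refl => exact .refl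
  | tail _ h ih => exact ReflTransGen.head (adj_symm h) ih

theorem closing {Q : Dgraph → Prop} (hQ : ∀ P, Q P → P.WF) {F1 F2 : Dgraph}
    {v x1 y1 x2 y2 : ℕ} (h1 : Open Q F1 x1 v y1) (h2 : Open Q F2 x2 v y2)
    (hV : ∀ t, t ∈ F1.verts → t ∈ F2.verts → t = v) :
    ∃ n e Ds, (∀ i, Q (Ds i) ∧ (Ds i).verts ⊆ F1.verts ∪ F2.verts ∧
        ((Ds i).verts ⊆ F1.verts ∨ (Ds i).verts ⊆ F2.verts)) ∧
      IsHajosTreeJoin (closeB F1 F2 x1 y1 x2 y2) n e Ds := by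
  obtain ⟨M1, W1, S1, T1⟩ := h1.data hQ
  obtain ⟨M2, W2, S2, T2⟩ := h2.data hQ
  have hB := T1.toTB.merge T2.toTB hV T1.vT T2.vT
  have tt : ∀ t, t ∈ TV M1 → t ∈ TV M2 → t = v := fun t a b => hV t (T1.TVV a) (T2.TVV b)
  have hfl := filter_append_S (W1 := W1) (W2 := W2) (S1 := S1) (S2 := S2)
    (fun x hx hx' => (T2.sub x hx').2 (tt x (walk_TV T1.prs hx) (T2.sub x hx').1))
    (fun x hx hx' => (T1.sub x hx').2 (tt x (T1.sub x hx').1 (walk_TV T2.prs hx)))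
  have hW0 : (W1 ++ W2).head? = some v := by simp [List.head?_append, T1.hd]
  have hprs : (cyc2 (W1 ++ W2) v).Perm (tarcs (M1 ++ M2)) := by
    rw [cyc2_append T1.hd T2.hd, tarcs_append]
    exact T1.prs.append T2.prs
  have hqv : ∀ m ∈ M1 ++ M2, m.2.verts ⊆ F1.verts ∨ m.2.verts ⊆ F2.verts := by
    intro m hm
    rcases List.mem_append.1 hm with e | e
    · exact Or.inl fun x hx => (T1.vs x).2 ⟨m, e, hx⟩
    · exact Or.inr fun x hx => (T2.vs x).2 ⟨m, e, hx⟩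
  have hcntv : 2 ≤ cnt (M1 ++ M2) v := by
    rw [cnt_append]
    have := cnt_pos T1.vT
    have := cnt_pos T2.vT
    omega
  have hlf : ∀ s ∈ TV (M1 ++ M2), (s ∈ S1 ∪ S2 ↔ cnt (M1 ++ M2) s = 1) := by
    intro s hs
    by_cases hsv : s = v
    · subst hsv
      constructor
      · intro e
        rcases Finset.mem_union.1 e with e | e
        · exact absurd rfl (T1.sub s e).2
        · exact absurd rfl (T2.sub s e).2
      · intro e; omega
    · rw [cnt_append, Finset.mem_union]
      rw [TV_append, Finset.mem_union] at hs
      rcases hs with e | e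
      · have hn : s ∉ TV M2 := fun e' => hsv (tt s e e')
        have hn' : s ∉ S2 := fun e' => hn (T2.sub s e').1
        rw [cnt_zero hn, T1.lf s e hsv]; simp [hn']
      · have hn : s ∉ TV M1 := fun e' => hsv (tt s e' e)
        have hn' : s ∉ S1 := fun e' => hn (T1.sub s e').1
        rw [cnt_zero hn, T2.lf s e hsv]; simp [hn']
  have hfa1 := T1.fa
  have hfa2 := T2.fa
  have hx1 := T1.hx
  have hy1 := T1.hy
  have hx2 := T2.hx
  have hy2 := T2.hy
  obtain ⟨W, hWe⟩ : ∃ W, W = W1 ++ W2 := ⟨_, rfl⟩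
  obtain ⟨M, hMe⟩ : ∃ M, M = M1 ++ M2 := ⟨_, rfl⟩
  rw [← hMe] at hB hprs hqv hcntv hlf
  rw [← hWe] at hfl hW0 hprs
  have hTV : treeVerts M.length (fun i => M[i].1) = TV M := by
    ext x
    simp only [treeVerts, Finset.mem_union, Finset.mem_image, Finset.mem_univ, true_and, mem_TV]
    constructor
    · rintro (⟨i, e⟩ | ⟨i, e⟩)
      · exact ⟨M[i], List.getElem_mem _, Or.inl e⟩
      · exact ⟨M[i], List.getElem_mem _, Or.inr e⟩
    · rintro ⟨m, hm, e⟩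
      obtain ⟨i, hi, rfl⟩ := List.getElem_of_mem hm
      rcases e with e | e
      · exact Or.inl ⟨⟨i, hi⟩, e⟩
      · exact Or.inr ⟨⟨i, hi⟩, e⟩
  have hTA : ∀ a, a ∈ (treeDigraph M.length (fun i => M[i].1)).arcs ↔ a ∈ tarcs M := by
    intro a
    simp only [treeDigraph, Finset.mem_union, Finset.mem_image, Finset.mem_univ, true_and,
      mem_tarcs]
    constructor
    · rintro (⟨i, e⟩ | ⟨i, e⟩)
      · exact ⟨M[i], List.getElem_mem _, Or.inl e.symm⟩
      · exact ⟨M[i], List.getElem_mem _, Or.inr e.symm⟩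
    · rintro ⟨m, hm, e⟩
      obtain ⟨i, hi, rfl⟩ := List.getElem_of_mem hm
      rcases e with e | e
      · exact Or.inl ⟨⟨i, hi⟩, e.symm⟩
      · exact Or.inr ⟨⟨i, hi⟩, e.symm⟩
  have hLS : ∀ x, x ∈ W → (x ∈ leafSet M.length (fun i => M[i].1) ↔ x ∈ S1 ∪ S2) := by
    intro x hx
    have hxT := walk_TV hprs hx
    rw [hlf x hxT, leafSet, Finset.mem_filter, hTV]
    rw [show (Finset.univ.filter fun i : Fin M.length => M[i].1.1 = x ∨ M[i].1.2 = x).card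
      = cnt M x from cnt_card M x]
    exact ⟨fun h => h.2, fun h => ⟨hxT, h⟩⟩
  have hTW : ∀ x ∈ TV M, x ∈ W := by
    intro x hx
    obtain ⟨m, hm, e⟩ := mem_TV.1 hx
    have : ∃ q, (x, q) ∈ tarcs M := by
      rcases e with e | e
      · exact ⟨m.1.2, mem_tarcs.2 ⟨m, hm, Or.inl (by rw [← e])⟩⟩
      · exact ⟨m.1.1, mem_tarcs.2 ⟨m, hm, Or.inr (by rw [← e]; rfl)⟩⟩
    obtain ⟨q, hq⟩ := this
    exact (List.of_mem_zip (hprs.mem_iff.2 hq)).1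
  have hcon : ∀ x ∈ TV M, (treeDigraph M.length (fun i => M[i].1)).UReach v x := by
    intro x hx
    refine walk_reach (W ++ [v]) v (by simp [List.head?_append, hW0]) ?_ x
      (List.mem_append_left _ (hTW x hx))
    intro a ha
    rw [← cyc2_eq _ _ (ne_of_head hW0)] at ha
    exact Or.inl ((hTA _).2 (hprs.mem_iff.1 ha))
  have hndp := List.nodup_flatMap.1 hB.nd
  refine ⟨M.length, fun i => M[i].1, fun i => M[i].2, ?_, ⟨⟨?_, ?_, ⟨?_, ?_⟩, ?_⟩, ?_, ?_, ?_, ?_⟩,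
    W, ?_, ?_⟩
  · intro i
    have hm : M[i] ∈ M := List.getElem_mem _
    refine ⟨hB.q _ hm, ?_, hqv _ hm⟩
    rcases hqv _ hm with h | h
    · exact h.trans Finset.subset_union_left
    · exact h.trans Finset.subset_union_right
  · intro i; exact hB.lp _ (List.getElem_mem _)
  · have key : ∀ i j : Fin M.length, i < j → M[i].1 ≠ M[j].1 ∧ M[i].1 ≠ M[j].1.swap := by
      intro i j hij
      have := List.pairwise_iff_getElem.1 hndp.2 i j i.2 j.2 hij
      simp only [Function.onFun] at this
      constructor
      · intro e
        exact this (List.mem_cons_self) (by simp only [Fin.getElem_fin] at e; rw [e]; simp)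
      · intro e
        exact this (List.mem_cons_self) (by simp only [Fin.getElem_fin] at e; rw [e]; simp)
    intro i j hij
    rcases lt_or_gt_of_ne hij with h | h
    · exact key i j h
    · have := key j i h
      refine ⟨fun e => this.1 e.symm, fun e => this.2 ?_⟩
      have e' : M[i].1 = M[j].1.swap := e
      rw [e', Prod.swap_swap]
  · exact ⟨v, by show v ∈ treeVerts _ _; rw [hTV]; rw [hMe, TV_append]; exact Finset.mem_union_left _ T1.vT⟩
  · intro a ha b hb
    have ha : a ∈ treeVerts M.length (fun i => M[i].1) := ha
    have hb : b ∈ treeVerts M.length (fun i => M[i].1) := hb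
    rw [hTV] at ha hb
    exact (ureach_symm (hcon a ha)).trans (hcon b hb)
  · rw [hTV]; exact hB.card
  · intro i; exact hQ _ (hB.q _ (List.getElem_mem _))
  · intro i
    rw [hTV]; exact hB.int _ (List.getElem_mem _)
  · intro i; exact hB.dig _ (List.getElem_mem _)
  · have key : ∀ i j : Fin M.length, i < j → Disjoint (M[i].2.verts \ {M[i].1.1, M[i].1.2})
        (M[j].2.verts \ {M[j].1.1, M[j].1.2}) := by
      intro i j hij
      exact List.pairwise_iff_getElem.1 hB.dis i j i.2 j.2 hij
    intro i j hij
    rcases lt_or_gt_of_ne hij with h | h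
    · exact key i j h
    · exact (key j i h).symm
  · rw [IsEulerTour, zip_rot hW0]
    refine (Multiset.Nodup.ext ?_ (Finset.nodup _)).2 ?_
    · rw [Multiset.coe_nodup]; exact hprs.nodup_iff.2 hB.nd
    · intro a
      rw [Multiset.mem_coe, hprs.mem_iff, Finset.mem_val, hTA]
  · have hf2 : (W.filter fun x => decide (x ∈ leafSet M.length (fun i => M[i].1))) =
        W.filter fun s => decide (s ∈ S1 ∪ S2) := by
      refine List.filter_congr fun x hx => ?_
      simp only [hLS x hx]
    rw [hf2, hfl]
    generalize W1.filter (fun s => decide (s ∈ S1)) = ℓ1 at *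
    generalize W2.filter (fun s => decide (s ∈ S2)) = ℓ2 at *
    have hcyc : (ℓ1 ++ ℓ2).zip ((ℓ1 ++ ℓ2).rotate 1) =
        cons2 ℓ1 ++ (x1, y2) :: (cons2 ℓ2 ++ [(x2, y1)]) := by
      have hh : (ℓ1 ++ ℓ2).head? = some y1 := by simp [List.head?_append, hy1]
      rw [zip_rot hh, cyc2_eq _ _ (ne_of_head hh), List.append_assoc,
        cons2_append ℓ1 (ℓ2 ++ [y1]) x1 y2 hx1 (by simp [List.head?_append, hy2]),
        cons2_append ℓ2 [y1] x2 y1 hx2 rfl]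
      simp [cons2]
    have ev : (closeB F1 F2 x1 y1 x2 y2).verts = Finset.univ.biUnion fun i : Fin M.length => M[i].2.verts := by
      ext x
      show x ∈ F1.verts ∪ F2.verts ↔ _
      rw [hB.vs, Finset.mem_biUnion]
      constructor
      · rintro ⟨m, hm, hx⟩
        obtain ⟨i, hi, rfl⟩ := List.getElem_of_mem hm
        exact ⟨⟨i, hi⟩, Finset.mem_univ _, hx⟩
      · rintro ⟨i, _, hx⟩
        exact ⟨M[i], List.getElem_mem _, hx⟩
    have ea : (closeB F1 F2 x1 y1 x2 y2).arcs =
        (Finset.univ.biUnion fun i : Fin M.length => M[i].2.arcs \ {M[i].1, M[i].1.swap}) ∪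
          cycArcs (ℓ1 ++ ℓ2) := by
      ext a
      show a ∈ insert (x1, y2) (insert (x2, y1) (F1.arcs ∪ F2.arcs)) ↔ _
      rw [Finset.mem_union, cycArcs, List.mem_toFinset, hcyc, Finset.mem_biUnion,
        Finset.mem_insert, Finset.mem_insert, Finset.mem_union, hfa1, hfa2, List.mem_append,
        List.mem_cons, List.mem_append, List.mem_singleton]
      have hm : (∃ i ∈ (Finset.univ : Finset (Fin M.length)), a ∈ M[i].2.arcs \ {M[i].1, M[i].1.swap}) ↔
          (∃ m ∈ M1, a ∈ m.2.arcs ∧ a ≠ m.1 ∧ a ≠ m.1.swap) ∨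
          (∃ m ∈ M2, a ∈ m.2.arcs ∧ a ≠ m.1 ∧ a ≠ m.1.swap) := by
        have : ∀ m : (ℕ × ℕ) × Dgraph, a ∈ m.2.arcs \ {m.1, m.1.swap} ↔
            (a ∈ m.2.arcs ∧ a ≠ m.1 ∧ a ≠ m.1.swap) := by
          intro m; simp
        constructor
        · rintro ⟨i, _, h⟩
          rw [this] at h
          have hm : M[i] ∈ M1 ++ M2 := by rw [← hMe]; exact List.getElem_mem _
          rcases List.mem_append.1 hm with e | e
          · exact Or.inl ⟨_, e, h⟩
          · exact Or.inr ⟨_, e, h⟩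
        · have : ∀ m ∈ M, (a ∈ m.2.arcs ∧ a ≠ m.1 ∧ a ≠ m.1.swap) →
              (∃ i ∈ (Finset.univ : Finset (Fin M.length)), a ∈ M[i].2.arcs \ {M[i].1, M[i].1.swap}) := by
            intro m hm h
            obtain ⟨i, hi, rfl⟩ := List.getElem_of_mem hm
            exact ⟨⟨i, hi⟩, Finset.mem_univ _, (this _).2 h⟩
          rintro (⟨m, hm, h⟩ | ⟨m, hm, h⟩)
          · exact this m (by rw [hMe]; exact List.mem_append_left _ hm) h
          · exact this m (by rw [hMe]; exact List.mem_append_right _ hm) h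
      rw [hm]
      constructor
      · rintro (h | h | (h | h) | (h | h))
        · exact Or.inr (Or.inr (Or.inl h))
        · exact Or.inr (Or.inr (Or.inr (Or.inr h)))
        · exact Or.inl (Or.inl h)
        · exact Or.inr (Or.inl h)
        · exact Or.inl (Or.inr h)
        · exact Or.inr (Or.inr (Or.inr (Or.inl h)))
      · rintro ((h | h) | h | h | h | h)
        · exact Or.inr (Or.inr (Or.inl (Or.inl h)))
        · exact Or.inr (Or.inr (Or.inr (Or.inl h)))
        · exact Or.inr (Or.inr (Or.inl (Or.inr h)))
        · exact Or.inl h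
        · exact Or.inr (Or.inr (Or.inr (Or.inr h)))
        · exact Or.inr (Or.inl h)
    show (⟨_, _⟩ : Dgraph) = ⟨_, _⟩
    rw [Dgraph.mk.injEq]
    exact ⟨ev, ea⟩

end Dgraph

namespace Dgraph
open Relation
variable {k : ℕ}

/-! ### Rerooting -/

theorem dg_ext {D D' : Dgraph} (hv : ∀ x, x ∈ D.verts ↔ x ∈ D'.verts)
    (ha : ∀ a, a ∈ D.arcs ↔ a ∈ D'.arcs) : D = D' := by
  cases D; cases D'
  rw [Dgraph.mk.injEq]
  exact ⟨Finset.ext hv, Finset.ext ha⟩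

theorem mem_del2 {P : Dgraph} {a b : ℕ} {e : ℕ × ℕ} :
    e ∈ (del2 P a b).arcs ↔ e ∈ P.arcs ∧ e ≠ (a, b) ∧ e ≠ (b, a) := by
  simp [del2]

theorem del2_comm (P : Dgraph) (a b : ℕ) : del2 P a b = del2 P b a := by
  refine dg_ext (fun _ => Iff.rfl) fun e => ?_
  rw [mem_del2, mem_del2]; exact ⟨fun h => ⟨h.1, h.2.2, h.2.1⟩, fun h => ⟨h.1, h.2.2, h.2.1⟩⟩

theorem mem_closeB {F1 F2 : Dgraph} {x1 y1 x2 y2 : ℕ} {e : ℕ × ℕ} :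
    e ∈ (closeB F1 F2 x1 y1 x2 y2).arcs ↔
      e = (x1, y2) ∨ e = (x2, y1) ∨ e ∈ F1.arcs ∨ e ∈ F2.arcs := by
  simp [closeB]

theorem mem_un {F G : Dgraph} {e : ℕ × ℕ} : e ∈ (un F G).arcs ↔ e ∈ F.arcs ∨ e ∈ G.arcs := by
  simp [un]

theorem mem_una {F G : Dgraph} {x y : ℕ} {e : ℕ × ℕ} :
    e ∈ (una F G x y).arcs ↔ e = (x, y) ∨ e ∈ F.arcs ∨ e ∈ G.arcs := by
  simp [una]

theorem vmem_un {F G : Dgraph} {x : ℕ} : x ∈ (un F G).verts ↔ x ∈ F.verts ∨ x ∈ G.verts := by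
  simp [un]
theorem vmem_una {F G : Dgraph} {x p q : ℕ} :
    x ∈ (una F G p q).verts ↔ x ∈ F.verts ∨ x ∈ G.verts := by
  simp [una]
theorem vmem_closeB {F1 F2 : Dgraph} {x1 y1 x2 y2 x : ℕ} :
    x ∈ (closeB F1 F2 x1 y1 x2 y2).verts ↔ x ∈ F1.verts ∨ x ∈ F2.verts := by
  simp [closeB]

theorem closeB_comm (F1 F2 : Dgraph) (x1 y1 x2 y2 : ℕ) :
    closeB F1 F2 x1 y1 x2 y2 = closeB F2 F1 x2 y2 x1 y1 := by
  refine dg_ext (fun x => ?_) fun e => ?_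
  · rw [vmem_closeB, vmem_closeB]; exact Or.comm
  · rw [mem_closeB, mem_closeB]
    constructor <;>
    · rintro (h | h | h | h)
      · exact Or.inr (Or.inl h)
      · exact Or.inl h
      · exact Or.inr (Or.inr (Or.inr h))
      · exact Or.inr (Or.inr (Or.inl h))

theorem closeB_edge (P G F : Dgraph) (a x y x2 y2 : ℕ) (b : ℕ) :
    closeB (un (del2 P a b) G) F x y x2 y2 = closeB G (un (del2 P b a) F) x y x2 y2 := by
  rw [del2_comm P a b]
  refine dg_ext (fun t => ?_) fun e => ?_
  · rw [vmem_closeB, vmem_closeB, vmem_un, vmem_un, or_assoc, or_left_comm]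
  · rw [mem_closeB, mem_closeB, mem_un, mem_un, or_assoc,
      or_left_comm (a := e ∈ (del2 P b a).arcs)]

/-- rotate a three-part cyclic join -/
theorem closeB_rot (F1 F2 F3 : Dgraph) (x1 y1 x2 y2 x3 y3 : ℕ) :
    closeB (una F1 F2 x1 y2) F3 x2 y1 x3 y3 = closeB F1 (una F2 F3 x2 y3) x1 y1 x3 y2 := by
  refine dg_ext (fun t => ?_) fun e => ?_
  · rw [vmem_closeB, vmem_closeB, vmem_una, vmem_una, or_assoc]
  · rw [mem_closeB, mem_closeB, mem_una, mem_una]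
    constructor
    · rintro (h | h | (h | h | h) | h)
      · exact Or.inr (Or.inr (Or.inr (Or.inl h)))
      · exact Or.inr (Or.inl h)
      · exact Or.inl h
      · exact Or.inr (Or.inr (Or.inl h))
      · exact Or.inr (Or.inr (Or.inr (Or.inr (Or.inl h))))
      · exact Or.inr (Or.inr (Or.inr (Or.inr (Or.inr h))))
    · rintro (h | h | h | h | h | h)
      · exact Or.inr (Or.inr (Or.inl (Or.inl h)))
      · exact Or.inr (Or.inl h)
      · exact Or.inr (Or.inr (Or.inl (Or.inr (Or.inl h))))
      · exact Or.inl h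
      · exact Or.inr (Or.inr (Or.inl (Or.inr (Or.inr h))))
      · exact Or.inr (Or.inr (Or.inr h))

structure OP (F : Dgraph) (x0 v0 y0 : ℕ) : Prop where
  wf : F.WF
  v : v0 ∈ F.verts
  x : x0 ∈ F.verts
  y : y0 ∈ F.verts
  xv : x0 ≠ v0
  yv : y0 ≠ v0

theorem Open.props {Q : Dgraph → Prop} (hQ : ∀ P, Q P → P.WF) {F : Dgraph} {x v y : ℕ}
    (h : Open Q F x v y) : OP F x v y := by
  induction h with
  | leaf P v z q h1 h2 =>
    have := hQ P q _ h1
    exact ⟨fun a ha => hQ P q a (mem_del2.1 ha).1, this.1, this.2.1, this.2.1, this.2.2.symm,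
      this.2.2.symm⟩
  | edge P G v z x y q h1 h2 hG hV ih =>
    have w := hQ P q _ h1
    refine ⟨?_, vmem_un.2 (Or.inl w.1), vmem_un.2 (Or.inr ih.x), vmem_un.2 (Or.inr ih.y), ?_, ?_⟩
    · intro a ha
      rcases mem_un.1 ha with h | h
      · have := hQ P q a (mem_del2.1 h).1
        exact ⟨vmem_un.2 (Or.inl this.1), vmem_un.2 (Or.inl this.2.1), this.2.2⟩
      · have := ih.wf a h
        exact ⟨vmem_un.2 (Or.inr this.1), vmem_un.2 (Or.inr this.2.1), this.2.2⟩
    · rintro rfl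
      exact w.2.2 (hV _ w.1 ih.x)
    · rintro rfl
      exact w.2.2 (hV _ w.1 ih.y)
  | seq F1 F2 v x1 y1 x2 y2 h1 h2 hV ih1 ih2 =>
    refine ⟨?_, vmem_una.2 (Or.inl ih1.v), vmem_una.2 (Or.inr ih2.x), vmem_una.2 (Or.inl ih1.y),
      ih2.xv, ih1.yv⟩
    intro a ha
    rcases mem_una.1 ha with h | h | h
    · subst h
      refine ⟨vmem_una.2 (Or.inl ih1.x), vmem_una.2 (Or.inr ih2.y), ?_⟩
      intro e
      have e : x1 = y2 := e
      exact ih2.yv (hV _ (e ▸ ih1.x) ih2.y)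
    · have := ih1.wf a h
      exact ⟨vmem_una.2 (Or.inl this.1), vmem_una.2 (Or.inl this.2.1), this.2.2⟩
    · have := ih2.wf a h
      exact ⟨vmem_una.2 (Or.inr this.1), vmem_una.2 (Or.inr this.2.1), this.2.2⟩

def Meet (F G : Dgraph) (v : ℕ) : Prop := ∀ t, t ∈ F.verts → t ∈ G.verts → t = v

theorem Meet.symm {F G : Dgraph} {v : ℕ} (h : Meet F G v) : Meet G F v := fun t a b => h t b a

theorem meet_edge {P G F : Dgraph} {v z : ℕ} (hv : v ∈ P.verts) (hz : z ∈ P.verts)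
    (hPG : Meet P G z) (h : Meet (un (del2 P v z) G) F v) :
    Meet P F v ∧ Meet G (un (del2 P z v) F) z := by
  refine ⟨fun t a b => h t (vmem_un.2 (Or.inl a)) b, fun t a b => ?_⟩
  rcases vmem_un.1 b with b | b
  · exact hPG t b a
  · have := h t (vmem_un.2 (Or.inr a)) b
    subst this
    exact hPG t hv a

theorem meet_rot {F1 F2 F3 : Dgraph} {v p q r s : ℕ} (h12 : Meet F1 F2 v)
    (h : Meet (una F1 F2 p q) F3 v) : Meet F2 F3 v ∧ Meet F1 (una F2 F3 r s) v := by
  refine ⟨fun t a b => h t (vmem_una.2 (Or.inr a)) b, fun t a b => ?_⟩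
  rcases vmem_una.1 b with b | b
  · exact h12 t a b
  · exact h t (vmem_una.2 (Or.inl a)) b

/-- closed decomposition with a single-piece leaf at `x` seen from `b`, remainder `G` -/
def LeafDec (Q : Dgraph → Prop) (E P G : Dgraph) (b x xG yG : ℕ) : Prop :=
  Q P ∧ (b, x) ∈ P.arcs ∧ (x, b) ∈ P.arcs ∧ Open Q G xG b yG ∧ Meet P G b ∧
    E = closeB (del2 P b x) G x x xG yG

theorem leaf_exit {Q : Dgraph → Prop} (hQ : ∀ P, Q P → P.WF) {F : Dgraph} {x v y : ℕ}
    (h : Open Q F x v y) : ∀ {F2 : Dgraph} {x2 y2 : ℕ}, Open Q F2 x2 v y2 → Meet F F2 v →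
    ∃ P G b xG, LeafDec Q (closeB F F2 x y x2 y2) P G b x xG y2 := by
  induction h with
  | leaf P v z q h1 h2 =>
    intro F2 x2 y2 hF hV
    exact ⟨P, F2, v, x2, q, h1, h2, hF, hV, rfl⟩
  | edge P G v z x y q h1 h2 hG hV ih =>
    intro F2 x2 y2 hF hm
    have w := hQ P q _ h1
    obtain ⟨m1, m2⟩ := meet_edge w.1 w.2.1 hV hm
    rw [closeB_edge]
    exact ih (Open.edge P F2 z v x2 y2 q h2 h1 hF m1) m2
  | seq F1 F2 v x1 y1 x2 y2 h1 h2 hV ih1 ih2 =>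
    intro F3 x3 y3 hF hm
    obtain ⟨m1, m2⟩ := meet_rot (r := x2) (s := y3) hV hm
    rw [closeB_rot, closeB_comm, closeB_rot]
    obtain ⟨m3, m4⟩ := meet_rot (r := x3) (s := y1) m1 m2.symm
    exact ih2 (Open.seq F3 F1 v x3 y3 x1 y1 hF h1 m3) m4

theorem leaf_entry {Q : Dgraph → Prop} (hQ : ∀ P, Q P → P.WF) {F : Dgraph} {x v y : ℕ}
    (h : Open Q F x v y) : ∀ {F2 : Dgraph} {x2 y2 : ℕ}, Open Q F2 x2 v y2 → Meet F F2 v →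
    ∃ P G b yG, LeafDec Q (closeB F F2 x y x2 y2) P G b y x2 yG := by
  induction h with
  | leaf P v z q h1 h2 =>
    intro F2 x2 y2 hF hV
    exact ⟨P, F2, v, y2, q, h1, h2, hF, hV, rfl⟩
  | edge P G v z x y q h1 h2 hG hV ih =>
    intro F2 x2 y2 hF hm
    have w := hQ P q _ h1
    obtain ⟨m1, m2⟩ := meet_edge w.1 w.2.1 hV hm
    rw [closeB_edge]
    exact ih (Open.edge P F2 z v x2 y2 q h2 h1 hF m1) m2
  | seq F1 F2 v x1 y1 x2 y2 h1 h2 hV ih1 ih2 =>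
    intro F3 x3 y3 hF hm
    obtain ⟨m1, m2⟩ := meet_rot (r := x2) (s := y3) hV hm
    rw [closeB_rot]
    exact ih1 (Open.seq F2 F3 v x2 y2 x3 y3 h2 hF m1) m2

/-- arc inside a piece -/
def InPiece (Q : Dgraph → Prop) (E : Dgraph) (α : ℕ × ℕ) : Prop :=
  ∃ P G a b xG yG, Q P ∧ (a, b) ∈ P.arcs ∧ (b, a) ∈ P.arcs ∧ α ∈ (del2 P a b).arcs ∧
    Open Q G xG a yG ∧
    ((Meet P G a ∧ E = closeB (del2 P a b) G b b xG yG) ∨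
     ∃ G' x' y', Open Q G' x' b y' ∧ Meet P G' b ∧ Meet (un (del2 P a b) G') G a ∧
      E = closeB (un (del2 P a b) G') G x' y' xG yG)

def Periph (Q : Dgraph → Prop) (E : Dgraph) (α : ℕ × ℕ) : Prop :=
  (∃ P G b xG, LeafDec Q E P G b α.1 xG α.2) ∧ (∃ P G b yG, LeafDec Q E P G b α.2 α.1 yG)

theorem periph_of {Q : Dgraph → Prop} (hQ : ∀ P, Q P → P.WF) {F1 F2 : Dgraph}
    {v x1 y1 x2 y2 : ℕ} (h1 : Open Q F1 x1 v y1) (h2 : Open Q F2 x2 v y2) (hm : Meet F1 F2 v) :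
    Periph Q (closeB F1 F2 x1 y1 x2 y2) (x1, y2) :=
  ⟨leaf_exit hQ h1 h2 hm, by rw [closeB_comm]; exact leaf_entry hQ h2 h1 hm.symm⟩

theorem reroot_aux {Q : Dgraph → Prop} (hQ : ∀ P, Q P → P.WF) {F : Dgraph} {x v y : ℕ}
    (h : Open Q F x v y) : ∀ {F2 : Dgraph} {x2 y2 : ℕ}, Open Q F2 x2 v y2 → Meet F F2 v →
    ∀ α ∈ F.arcs, InPiece Q (closeB F F2 x y x2 y2) α ∨ Periph Q (closeB F F2 x y x2 y2) α := by
  induction h with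
  | leaf P v z q h1 h2 =>
    intro F2 x2 y2 hF hV α hα
    exact Or.inl ⟨P, F2, v, z, x2, y2, q, h1, h2, hα, hF, Or.inl ⟨hV, rfl⟩⟩
  | edge P G v z x y q h1 h2 hG hV ih =>
    intro F2 x2 y2 hF hm α hα
    rcases mem_un.1 hα with hα | hα
    · exact Or.inl ⟨P, F2, v, z, x2, y2, q, h1, h2, hα, hF, Or.inr ⟨G, x, y, hG, hV, hm, rfl⟩⟩
    have w := hQ P q _ h1
    obtain ⟨m1, m2⟩ := meet_edge w.1 w.2.1 hV hm
    rw [closeB_edge]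
    exact ih (Open.edge P F2 z v x2 y2 q h2 h1 hF m1) m2 α hα
  | seq F1 F2 v x1 y1 x2 y2 h1 h2 hV ih1 ih2 =>
    intro F3 x3 y3 hF hm α hα
    obtain ⟨m1, m2⟩ := meet_rot (r := x2) (s := y3) hV hm
    rw [closeB_rot]
    rcases mem_una.1 hα with hα | hα | hα
    · subst hα
      exact Or.inr (periph_of hQ h1 (Open.seq F2 F3 v x2 y2 x3 y3 h2 hF m1) m2)
    · exact ih1 (Open.seq F2 F3 v x2 y2 x3 y3 h2 hF m1) m2 α hα
    · obtain ⟨m3, m4⟩ := meet_rot (r := x3) (s := y1) m1 m2.symm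
      rw [closeB_comm, closeB_rot]
      exact ih2 (Open.seq F3 F1 v x3 y3 x1 y1 hF h1 m3) m4 α hα

theorem reroot {Q : Dgraph → Prop} (hQ : ∀ P, Q P → P.WF) {F1 F2 : Dgraph}
    {v x1 y1 x2 y2 : ℕ} (h1 : Open Q F1 x1 v y1) (h2 : Open Q F2 x2 v y2) (hm : Meet F1 F2 v)
    {α : ℕ × ℕ} (hα : α ∈ (closeB F1 F2 x1 y1 x2 y2).arcs) :
    InPiece Q (closeB F1 F2 x1 y1 x2 y2) α ∨ Periph Q (closeB F1 F2 x1 y1 x2 y2) α := by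
  rcases mem_closeB.1 hα with h | h | h | h
  · subst h; exact Or.inr (periph_of hQ h1 h2 hm)
  · subst h; rw [closeB_comm]; exact Or.inr (periph_of hQ h2 h1 hm.symm)
  · exact reroot_aux hQ h1 h2 hm α h
  · rw [closeB_comm]; exact reroot_aux hQ h2 h1 hm.symm α h

/-! ### closed joins give bijoin structure -/

theorem closeB_in1 {F1 F2 : Dgraph} {v x1 y1 x2 y2 : ℕ} (h1 : OP F1 x1 v y1)
    (h2 : OP F2 x2 v y2) (hm : Meet F1 F2 v) {p q : ℕ} (hp : p ∈ F1.verts) (hq : q ∈ F1.verts) :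
    (p, q) ∈ (closeB F1 F2 x1 y1 x2 y2).arcs ↔ (p, q) ∈ F1.arcs := by
  rw [mem_closeB]
  constructor
  · rintro (h | h | h | h)
    · rw [Prod.mk.injEq] at h
      exact absurd (hm _ (h.2 ▸ hq) h2.y) h2.yv
    · rw [Prod.mk.injEq] at h
      exact absurd (hm _ (h.1 ▸ hp) h2.x) h2.xv
    · exact h
    · have := h2.wf _ h
      exact absurd ((hm _ hp this.1).trans (hm _ hq this.2.1).symm) this.2.2
  · intro h; exact Or.inr (Or.inr (Or.inl h))

theorem closeB_in2 {F1 F2 : Dgraph} {v x1 y1 x2 y2 : ℕ} (h1 : OP F1 x1 v y1)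
    (h2 : OP F2 x2 v y2) (hm : Meet F1 F2 v) {p q : ℕ} (hp : p ∈ F2.verts) (hq : q ∈ F2.verts) :
    (p, q) ∈ (closeB F1 F2 x1 y1 x2 y2).arcs ↔ (p, q) ∈ F2.arcs := by
  rw [closeB_comm]; exact closeB_in1 h2 h1 hm.symm hp hq

theorem closeB_bij {F1 F2 : Dgraph} {v x1 y1 x2 y2 : ℕ} (h1 : OP F1 x1 v y1)
    (h2 : OP F2 x2 v y2) (hm : Meet F1 F2 v) :
    Bij (closeB F1 F2 x1 y1 x2 y2) v (F1.verts.erase v) (F2.verts.erase v) x1 y1 y2 x2 := by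
  refine ⟨⟨?_, ?_, ?_, ?_, ?_, ?_, ?_, ?_, ?_, ?_, ?_⟩, mem_closeB.2 (Or.inl rfl), mem_closeB.2 (Or.inr (Or.inl rfl))⟩
  · intro a ha
    rw [vmem_closeB, vmem_closeB]
    rcases mem_closeB.1 ha with h | h | h | h
    · subst h
      exact ⟨Or.inl h1.x, Or.inr h2.y, fun e => h2.yv (hm _ ((show x1 = y2 from e) ▸ h1.x) h2.y)⟩
    · subst h
      exact ⟨Or.inr h2.x, Or.inl h1.y, fun e => h1.yv (hm _ h1.y ((show x2 = y1 from e) ▸ h2.x))⟩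
    · have := h1.wf _ h; exact ⟨Or.inl this.1, Or.inl this.2.1, this.2.2⟩
    · have := h2.wf _ h; exact ⟨Or.inr this.1, Or.inr this.2.1, this.2.2⟩
  · ext t
    rw [vmem_closeB, Finset.mem_insert, Finset.mem_union, Finset.mem_erase, Finset.mem_erase]
    constructor
    · by_cases e : t = v
      · exact fun _ => Or.inl e
      · rintro (h | h)
        · exact Or.inr (Or.inl ⟨e, h⟩)
        · exact Or.inr (Or.inr ⟨e, h⟩)
    · rintro (rfl | h | h)
      · exact Or.inl h1.v
      · exact Or.inl h.2
      · exact Or.inr h.2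
  · rw [Finset.disjoint_left]
    intro t ht ht'
    rw [Finset.mem_erase] at ht ht'
    exact ht.1 (hm t ht.2 ht'.2)
  · simp
  · simp
  · exact Finset.mem_erase.2 ⟨h1.xv, h1.x⟩
  · exact Finset.mem_erase.2 ⟨h1.yv, h1.y⟩
  · exact Finset.mem_erase.2 ⟨h2.yv, h2.y⟩
  · exact Finset.mem_erase.2 ⟨h2.xv, h2.x⟩
  · intro p hp q hq ha
    rw [Finset.mem_erase] at hp hq
    rcases mem_closeB.1 ha with h | h | h | h
    · rwa [Prod.mk.injEq] at h
    · rw [Prod.mk.injEq] at h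
      exact absurd (hm p hp.2 (h.1 ▸ h2.x)) hp.1
    · exact absurd (hm q (h1.wf _ h).2.1 hq.2) hq.1
    · exact absurd (hm p hp.2 (h2.wf _ h).1) hp.1
  · intro p hp q hq ha
    rw [Finset.mem_erase] at hp hq
    rcases mem_closeB.1 ha with h | h | h | h
    · rw [Prod.mk.injEq] at h
      exact absurd (hm p (h.1 ▸ h1.x) hp.2) hp.1
    · rwa [Prod.mk.injEq] at h
    · exact absurd (hm p (h1.wf _ h).1 hp.2) hp.1
    · exact absurd (hm q hq.2 (h2.wf _ h).2.1) hq.1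

end Dgraph

namespace Dgraph
open Relation
variable {k : ℕ}

/-! ### Structure of a side of a bijoin -/

def CB (Q : Dgraph → Prop) (E : Dgraph) : Prop :=
  ∃ F1 F2 v x1 y1 x2 y2, Open Q F1 x1 v y1 ∧ Open Q F2 x2 v y2 ∧ Meet F1 F2 v ∧
    E = closeB F1 F2 x1 y1 x2 y2

def Dec (k : ℕ) (D : Dgraph) : Prop := Base k D ∨ HasH D ∨ CB (Ext k) D

theorem mem_ind {D : Dgraph} {S : Finset ℕ} {a b : ℕ} :
    (a, b) ∈ (D.pc S ∅).arcs ↔ (a, b) ∈ D.arcs ∧ a ∈ S ∧ b ∈ S := by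
  simp only [mem_pc, Finset.notMem_empty, or_false]

theorem extWF : ∀ P, Ext k P → P.WF := fun P h => h.wf

theorem Sep.closeB_eq {D : Dgraph} {v A B t w u w'} (h : Bij D v A B t w u w') :
    D = closeB (D.pc (insert v A) ∅) (D.pc (insert v B) ∅) t w w' u := by
  have S := h.1
  refine dg_ext (fun z => ?_) fun e => ?_
  · rw [vmem_closeB, S.memV]
    simp only [pc_verts, Finset.mem_insert]
    constructor
    · rintro (h | h | h)
      · exact Or.inl (Or.inl h)
      · exact Or.inl (Or.inr h)
      · exact Or.inr (Or.inr h)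
    · rintro ((h | h) | h | h)
      · exact Or.inl h
      · exact Or.inr (Or.inl h)
      · exact Or.inl h
      · exact Or.inr (Or.inr h)
  · obtain ⟨a, b⟩ := e
    rw [mem_closeB, mem_ind, mem_ind]
    simp only [Finset.mem_insert, Prod.mk.injEq]
    constructor
    · intro he
      have w1 := S.memV.1 (S.wf _ he).1
      have w2 := S.memV.1 (S.wf _ he).2.1
      rcases w1 with w1 | w1 | w1 <;> rcases w2 with w2 | w2 | w2
      · exact Or.inr (Or.inr (Or.inl ⟨he, Or.inl w1, Or.inl w2⟩))
      · exact Or.inr (Or.inr (Or.inl ⟨he, Or.inl w1, Or.inr w2⟩))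
      · exact Or.inr (Or.inr (Or.inr ⟨he, Or.inl w1, Or.inr w2⟩))
      · exact Or.inr (Or.inr (Or.inl ⟨he, Or.inr w1, Or.inl w2⟩))
      · exact Or.inr (Or.inr (Or.inl ⟨he, Or.inr w1, Or.inr w2⟩))
      · exact Or.inl (S.cAB a w1 b w2 he)
      · exact Or.inr (Or.inr (Or.inr ⟨he, Or.inr w1, Or.inl w2⟩))
      · exact Or.inr (Or.inl (S.cBA a w1 b w2 he))
      · exact Or.inr (Or.inr (Or.inr ⟨he, Or.inr w1, Or.inr w2⟩))
    · rintro (⟨rfl, rfl⟩ | ⟨rfl, rfl⟩ | h | h)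
      · exact h.2.1
      · exact h.2.2
      · exact h.1
      · exact h.1

theorem Sep.meet {D : Dgraph} {v A B t w u w'} (S : Sep D v A B t w u w') :
    Meet (D.pc (insert v A) ∅) (D.pc (insert v B) ∅) v := by
  intro z h1 h2
  simp only [pc_verts, Finset.mem_insert] at h1 h2
  rcases h1 with h1 | h1
  · exact h1
  · rcases h2 with h2 | h2
    · exact h2
    · exact absurd h2 (Finset.disjoint_left.1 S.disj h1)

theorem Bij.cb {D : Dgraph} {v A B t w u w'} (h : Bij D v A B t w u w')
    (h1 : Open (Ext k) (D.pc (insert v A) ∅) t v w)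
    (h2 : Open (Ext k) (D.pc (insert v B) ∅) w' v u) : CB (Ext k) D :=
  ⟨_, _, v, t, w, w', u, h1, h2, h.1.meet, Sep.closeB_eq h⟩

theorem mem_pA {D : Dgraph} {v A B t w u w'} (h : Bij D v A B t w u w') {a b : ℕ} :
    (a, b) ∈ (pA D v A t w u w').arcs ↔
      ((a, b) ∈ D.arcs ∧ a ∈ insert v A ∧ b ∈ insert v A) ∨ (a = t ∧ b = v) ∨ (a = v ∧ b = w) := by
  rw [pA, mem_pc, mem_EA]
  simp only [h.2.1, h.2.2, true_and, Prod.mk.injEq]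

/-- the single-vertex side -/
theorem Bij.leaf_eq {D : Dgraph} {v A B t u w'} (h : Bij D v A B t t u w') (hk : 3 ≤ k)
    (hD : Ext k D) : D.pc (insert v A) ∅ = del2 (pA D v A t t u w') v t := by
  have hE := h.1.ext_pA hk hD (Or.inl rfl)
  have n1 := h.1.tv_new (by omega) hD hE.toCrit h.2.1
  have n2 := h.1.vw_new (by omega) hD hE.toCrit h.2.2
  refine dg_ext (fun _ => Iff.rfl) fun ⟨a, b⟩ => ?_
  rw [mem_ind, mem_del2, mem_pA h]
  simp only [ne_eq, Prod.mk.injEq]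
  constructor
  · intro h1
    refine ⟨Or.inl h1, ?_, ?_⟩
    · rintro ⟨rfl, rfl⟩; exact n2 h1.1
    · rintro ⟨rfl, rfl⟩; exact n1 h1.1
  · rintro ⟨h1 | h1 | h1, h2, h3⟩
    · exact h1
    · exact absurd h1 h3
    · exact absurd h1 h2

theorem Bij.leaf {D : Dgraph} {v A B t u w'} (h : Bij D v A B t t u w') (hk : 3 ≤ k)
    (hD : Ext k D) : Open (Ext k) (D.pc (insert v A) ∅) t v t := by
  rw [h.leaf_eq hk hD]
  exact Open.leaf _ v t (h.1.ext_pA hk hD (Or.inl rfl)) ((mem_pA h).2 (Or.inr (Or.inr ⟨rfl, rfl⟩)))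
    ((mem_pA h).2 (Or.inr (Or.inl ⟨rfl, rfl⟩)))

structure LS (k : ℕ) (D : Dgraph) (v : ℕ) (B Γ : Finset ℕ) (x y q p : ℕ) : Prop where
  hk : 3 ≤ k
  ext : Ext k D
  noH : ¬ HasH D
  bij : Bij D v B Γ x y q p

namespace LS
variable {D : Dgraph} {v : ℕ} {B Γ : Finset ℕ} {x y q p : ℕ}

theorem xB (L : LS k D v B Γ x y q p) : x ∈ B := L.bij.1.tA
theorem yB (L : LS k D v B Γ x y q p) : y ∈ B := L.bij.1.wA
theorem vB (L : LS k D v B Γ x y q p) : v ∉ B := L.bij.1.vA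
theorem xv (L : LS k D v B Γ x y q p) : x ≠ v := fun h => L.vB (h ▸ L.xB)
theorem yv (L : LS k D v B Γ x y q p) : y ≠ v := fun h => L.vB (h ▸ L.yB)

theorem extE (L : LS k D v B Γ x y q p) : Ext k (pA D v B x y q p) :=
  L.bij.1.ext_pA L.hk L.ext (Or.inr L.noH)

theorem xv_not (L : LS k D v B Γ x y q p) : (x, v) ∉ D.arcs :=
  L.bij.1.tv_new (by have := L.hk; omega) L.ext L.extE.toCrit L.bij.2.1

theorem vy_not (L : LS k D v B Γ x y q p) : (v, y) ∉ D.arcs :=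
  L.bij.1.vw_new (by have := L.hk; omega) L.ext L.extE.toCrit L.bij.2.2

theorem xvE (L : LS k D v B Γ x y q p) : (x, v) ∈ (pA D v B x y q p).arcs :=
  (mem_pA L.bij).2 (Or.inr (Or.inl ⟨rfl, rfl⟩))
theorem vyE (L : LS k D v B Γ x y q p) : (v, y) ∈ (pA D v B x y q p).arcs :=
  (mem_pA L.bij).2 (Or.inr (Or.inr ⟨rfl, rfl⟩))

theorem vE (L : LS k D v B Γ x y q p) {z : ℕ} : z ∈ (pA D v B x y q p).verts ↔ z = v ∨ z ∈ B := by
  rw [pA, pc_verts, Finset.mem_insert]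

theorem E_of_D (L : LS k D v B Γ x y q p) {a b : ℕ} (h : (a, b) ∈ D.arcs)
    (ha : a ∈ (pA D v B x y q p).verts) (hb : b ∈ (pA D v B x y q p).verts) :
    (a, b) ∈ (pA D v B x y q p).arcs := (mem_pA L.bij).2 (Or.inl ⟨h, ha, hb⟩)

theorem D_of_E (L : LS k D v B Γ x y q p) {a b : ℕ} (h : (a, b) ∈ (pA D v B x y q p).arcs)
    (h1 : ¬ (a = x ∧ b = v)) (h2 : ¬ (a = v ∧ b = y)) : (a, b) ∈ D.arcs := by
  rcases (mem_pA L.bij).1 h with h | h | h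
  · exact h.1
  · exact absurd h h1
  · exact absurd h h2

theorem ind_eq (L : LS k D v B Γ x y q p) {a b : ℕ} :
    (a, b) ∈ (D.pc (insert v B) ∅).arcs ↔
      (a, b) ∈ (pA D v B x y q p).arcs ∧ ¬ (a = x ∧ b = v) ∧ ¬ (a = v ∧ b = y) := by
  rw [mem_ind, mem_pA L.bij]
  constructor
  · intro h
    refine ⟨Or.inl h, ?_, ?_⟩
    · rintro ⟨rfl, rfl⟩; exact L.xv_not h.1
    · rintro ⟨rfl, rfl⟩; exact L.vy_not h.1
  · rintro ⟨h | h | h, h1, h2⟩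
    · exact h
    · exact absurd h h1
    · exact absurd h h2

theorem FD (L : LS k D v B Γ x y q p) {φ : ℕ → Fin k} (h : (D.pc (insert v B) ∅).Good φ) :
    ReflTransGen ((D.pc (insert v B) ∅).mono φ) y x ∧ φ x = φ v :=
  L.bij.forced L.hk L.ext (Or.inr L.noH) h

def inB (D : Dgraph) (B : Finset ℕ) (θ : ℕ → Fin k) (a b : ℕ) : Prop :=
  (a, b) ∈ D.arcs ∧ a ∈ B ∧ b ∈ B ∧ θ a = θ b

theorem K1 (L : LS k D v B Γ x y q p) {θ : ℕ → Fin k}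
    (h : Good ⟨(pA D v B x y q p).verts, (pA D v B x y q p).arcs.erase (v, y)⟩ θ) :
    ReflTransGen (inB D B θ) y x ∧ θ x = θ v := by
  have hs : ∀ a b, (D.pc (insert v B) ∅).mono θ a b →
      mono ⟨(pA D v B x y q p).verts, (pA D v B x y q p).arcs.erase (v, y)⟩ θ a b := by
    rintro a b ⟨h1, h2⟩
    rw [L.ind_eq] at h1
    exact ⟨Finset.mem_erase.2 ⟨by simpa using h1.2.2, h1.1⟩, h2⟩
  obtain ⟨f1, f2⟩ := L.FD (φ := θ) (h.mono hs)
  have nv : ¬ ReflTransGen ((D.pc (insert v B) ∅).mono θ) v x := by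
    intro hc
    refine h x v ⟨Finset.mem_erase.2 ⟨?_, L.xvE⟩, f2⟩ (ReflTransGen.mono hs _ _ hc)
    simp [L.xv]
  have key : ∀ c, ReflTransGen ((D.pc (insert v B) ∅).mono θ) c x →
      ReflTransGen (inB D B θ) c x := by
    intro c hc
    induction hc using ReflTransGen.head_induction_on with
    | refl => exact .refl
    | head hab hb ih =>
      rename_i a b
      have h1 := mem_ind.1 hab.1
      have na : a ≠ v := by rintro rfl; exact nv (ReflTransGen.head hab hb)
      have nb : b ≠ v := by rintro rfl; exact nv hb
      exact ReflTransGen.head ⟨h1.1, (Finset.mem_insert.1 h1.2.1).resolve_left na,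
        (Finset.mem_insert.1 h1.2.2).resolve_left nb, hab.2⟩ ih
  exact ⟨key y f1, f2⟩

theorem K2 (L : LS k D v B Γ x y q p) {θ : ℕ → Fin k}
    (h : Good ⟨(pA D v B x y q p).verts, (pA D v B x y q p).arcs.erase (x, v)⟩ θ) :
    ReflTransGen (inB D B θ) y x ∧ θ x = θ v := by
  have hs : ∀ a b, (D.pc (insert v B) ∅).mono θ a b →
      mono ⟨(pA D v B x y q p).verts, (pA D v B x y q p).arcs.erase (x, v)⟩ θ a b := by
    rintro a b ⟨h1, h2⟩
    rw [L.ind_eq] at h1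
    exact ⟨Finset.mem_erase.2 ⟨by simpa using h1.2.1, h1.1⟩, h2⟩
  obtain ⟨f1, f2⟩ := L.FD (φ := θ) (h.mono hs)
  have f3 : θ y = θ v := (rtg_mono_color f1).trans f2
  have nv : ¬ ReflTransGen ((D.pc (insert v B) ∅).mono θ) y v := by
    intro hc
    refine h v y ⟨Finset.mem_erase.2 ⟨?_, L.vyE⟩, f3.symm⟩ (ReflTransGen.mono hs _ _ hc)
    simp [L.yv]
  have key : ∀ c, ReflTransGen ((D.pc (insert v B) ∅).mono θ) y c →
      ReflTransGen (inB D B θ) y c := by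
    intro c hc
    induction hc with
    | refl => exact .refl
    | @tail a b ha hab ih =>
      have h1 := mem_ind.1 hab.1
      have na : a ≠ v := by rintro rfl; exact nv ha
      have nb : b ≠ v := by rintro rfl; exact nv (ReflTransGen.tail ha hab)
      exact ReflTransGen.tail ih ⟨h1.1, (Finset.mem_insert.1 h1.2.1).resolve_left na,
        (Finset.mem_insert.1 h1.2.2).resolve_left nb, hab.2⟩
  exact ⟨key x f1, f2⟩

theorem GV (L : LS k D v B Γ x y q p) {z : ℕ} (hz : z ∈ Γ) : z ∉ (pA D v B x y q p).verts := by
  rw [L.vE]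
  rintro (rfl | h)
  · exact L.bij.1.vB hz
  · exact Finset.disjoint_left.1 L.bij.1.disj h hz

theorem DV (L : LS k D v B Γ x y q p) {z : ℕ} :
    z ∈ D.verts ↔ z ∈ (pA D v B x y q p).verts ∨ z ∈ Γ := by
  rw [L.vE, L.bij.1.memV, or_assoc]

theorem toG (L : LS k D v B Γ x y q p) {a b : ℕ} (ha : a ∈ (pA D v B x y q p).verts)
    (hav : a ≠ v) (hb : b ∈ Γ) (h : (a, b) ∈ D.arcs) : a = x ∧ b = q :=
  L.bij.1.cAB a ((L.vE.1 ha).resolve_left hav) b hb h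

theorem fromG (L : LS k D v B Γ x y q p) {a b : ℕ} (hb : b ∈ (pA D v B x y q p).verts)
    (hbv : b ≠ v) (ha : a ∈ Γ) (h : (a, b) ∈ D.arcs) : a = p ∧ b = y :=
  L.bij.1.cBA a ha b ((L.vE.1 hb).resolve_left hbv) h

theorem sepV {E : Dgraph} {a A1 B1 t w u w'} (S : Sep E a A1 B1 t w u w') :
    (∀ z ∈ A1, z ∈ E.verts) ∧ (∀ z ∈ B1, z ∈ E.verts) :=
  ⟨fun z h => S.memV.2 (Or.inr (Or.inl h)), fun z h => S.memV.2 (Or.inr (Or.inr h))⟩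

/-- general transfer of a partition of `V(E)` to `D` with `Γ` on the first side -/
theorem mkSep (L : LS k D v B Γ x y q p) {a A1 B1 t w u w'}
    (S : Sep (pA D v B x y q p) a A1 B1 t w u w') {t2 w2 u2 w2' : ℕ}
    (ht : t2 ∈ A1 ∪ Γ) (hw : w2 ∈ A1 ∪ Γ) (hu : u2 ∈ B1) (hw' : w2' ∈ B1)
    (h1 : ∀ a ∈ A1, ∀ b ∈ B1, (a, b) ∈ D.arcs → a = t2 ∧ b = u2)
    (h2 : ∀ a ∈ Γ, ∀ b ∈ B1, (a, b) ∈ D.arcs → a = t2 ∧ b = u2)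
    (h3 : ∀ a ∈ B1, ∀ b ∈ A1, (a, b) ∈ D.arcs → a = w2' ∧ b = w2)
    (h4 : ∀ a ∈ B1, ∀ b ∈ Γ, (a, b) ∈ D.arcs → a = w2' ∧ b = w2) :
    Sep D a (A1 ∪ Γ) B1 t2 w2 u2 w2' := by
  refine ⟨L.ext.wf, ?_, ?_, ?_, S.vB, ht, hw, hu, hw', ?_, ?_⟩
  · ext z
    rw [L.DV, S.memV]
    simp only [Finset.mem_insert, Finset.mem_union]
    constructor
    · rintro ((h | h | h) | h)
      · exact Or.inl h
      · exact Or.inr (Or.inl (Or.inl h))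
      · exact Or.inr (Or.inr h)
      · exact Or.inr (Or.inl (Or.inr h))
    · rintro (h | (h | h) | h)
      · exact Or.inl (Or.inl h)
      · exact Or.inl (Or.inr (Or.inl h))
      · exact Or.inr h
      · exact Or.inl (Or.inr (Or.inr h))
  · rw [Finset.disjoint_left]
    intro z hz hz'
    rcases Finset.mem_union.1 hz with h | h
    · exact Finset.disjoint_left.1 S.disj h hz'
    · exact L.GV h ((sepV S).2 z hz')
  · intro h
    rcases Finset.mem_union.1 h with h | h
    · exact S.vA h
    · exact L.GV h S.vV
  · intro c hc d hd h
    rcases Finset.mem_union.1 hc with hc | hc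
    · exact h1 c hc d hd h
    · exact h2 c hc d hd h
  · intro c hc d hd h
    rcases Finset.mem_union.1 hd with hd | hd
    · exact h3 c hc d hd h
    · exact h4 c hc d hd h

/-- lifting a separation of `E` to `D` -/
theorem lift (L : LS k D v B Γ x y q p) {a A1 B1 t w u w'}
    (S : Sep (pA D v B x y q p) a A1 B1 t w u w') (hx : x ∉ B1) (hv : v ∉ B1) (hy : y ∉ B1) :
    Sep D a (A1 ∪ Γ) B1 t w u w' ∧ ((t, u) ∈ D.arcs ↔ (t, u) ∈ (pA D v B x y q p).arcs) ∧
      ((w', w) ∈ D.arcs ↔ (w', w) ∈ (pA D v B x y q p).arcs) ∧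
      ((u, t) ∈ D.arcs → (u, t) ∈ (pA D v B x y q p).arcs) := by
  have s1 := (sepV S).1
  have s2 := (sepV S).2
  refine ⟨L.mkSep S (Finset.mem_union_left _ S.tA) (Finset.mem_union_left _ S.wA) S.uB S.wB
    ?_ ?_ ?_ ?_, ?_, ?_, ?_⟩
  · intro c hc d hd h
    exact S.cAB c hc d hd (L.E_of_D h (s1 c hc) (s2 d hd))
  · intro c hc d hd h
    have := (L.fromG (s2 d hd) (fun e => hv (e ▸ hd)) hc h).2
    exact absurd (this ▸ hd) hy
  · intro c hc d hd h
    exact S.cBA c hc d hd (L.E_of_D h (s2 c hc) (s1 d hd))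
  · intro c hc d hd h
    have := (L.toG (s2 c hc) (fun e => hv (e ▸ hc)) hd h).1
    exact absurd (this ▸ hc) hx
  · constructor
    · intro h; exact L.E_of_D h (s1 _ S.tA) (s2 _ S.uB)
    · intro h
      refine L.D_of_E h ?_ ?_
      · rintro ⟨-, rfl⟩; exact hv S.uB
      · rintro ⟨-, rfl⟩; exact hy S.uB
  · constructor
    · intro h; exact L.E_of_D h (s2 _ S.wB) (s1 _ S.wA)
    · intro h
      refine L.D_of_E h ?_ ?_
      · rintro ⟨rfl, -⟩; exact hx S.wB
      · rintro ⟨rfl, -⟩; exact hv S.wB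
  · intro h; exact L.E_of_D h (s2 _ S.uB) (s1 _ S.tA)

theorem lift_H (L : LS k D v B Γ x y q p) {a A1 B1 t u}
    (S : HStr (pA D v B x y q p) a A1 B1 t u) (hx : x ∉ B1) (hv : v ∉ B1) (hy : y ∉ B1) :
    False := by
  obtain ⟨h1, h2, h3, h4⟩ := L.lift S.1 hx hv hy
  exact L.noH ⟨a, _, _, t, u, h1, h2.2 S.2.1, fun h => S.2.2 (h4 h)⟩

theorem lift_H' (L : LS k D v B Γ x y q p) {a A1 B1 t u}
    (S : HStr (pA D v B x y q p) a A1 B1 t u) (hx : x ∉ A1) (hv : v ∉ A1) (hy : y ∉ A1) :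
    False := by
  obtain ⟨h1, h2, h3, h4⟩ := L.lift S.1.symm hx hv hy
  exact L.noH ⟨a, _, _, t, u, h1.symm, h3.2 S.2.1, fun h => S.2.2 (h2.1 h)⟩

/-- HStr of `E` at a vertex other than `v` -/
theorem H_ne (L : LS k D v B Γ x y q p) {a A1 B1 t u}
    (S : HStr (pA D v B x y q p) a A1 B1 t u) (ha : a ≠ v) : False := by
  have s1 := (sepV S.1).1
  have s2 := (sepV S.1).2
  have hdis := Finset.disjoint_left.1 S.1.disj
  have noBA : ∀ c ∈ B1, ∀ d ∈ A1, (c, d) ∉ (pA D v B x y q p).arcs := by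
    intro c hc d hd h
    have := S.1.cBA c hc d hd h
    rw [this.1, this.2] at h
    exact S.2.2 h
  have hvV : v ∈ (pA D v B x y q p).verts := L.vE.2 (Or.inl rfl)
  rcases S.1.memV.1 hvV with h | hvA | hvB
  · exact ha h.symm
  · have hx : x ∉ B1 := fun h => noBA x h v hvA L.xvE
    have hv : v ∉ B1 := hdis hvA
    by_cases hy : y ∈ B1
    · have e := S.1.cAB v hvA y hy L.vyE
      refine L.noH ⟨a, A1 ∪ Γ, B1, p, y, L.mkSep S.1 (Finset.mem_union_right _ L.bij.1.wB)
        (Finset.mem_union_right _ L.bij.1.wB) hy hy ?_ ?_ ?_ ?_, L.bij.2.2, ?_⟩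
      · intro c hc d hd h
        have := S.1.cAB c hc d hd (L.E_of_D h (s1 c hc) (s2 d hd))
        rw [this.1, this.2, ← e.1, ← e.2] at h
        exact absurd h L.vy_not
      · intro c hc d hd h
        exact L.fromG (s2 d hd) (fun e => hv (e ▸ hd)) hc h
      · intro c hc d hd h
        exact absurd (L.E_of_D h (s2 c hc) (s1 d hd)) (noBA c hc d hd)
      · intro c hc d hd h
        have := (L.toG (s2 c hc) (fun e => hv (e ▸ hc)) hd h).1
        exact absurd (this ▸ hc) hx
      · intro h
        have := (L.toG (s2 y hy) L.yv L.bij.1.wB h).1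
        exact hx (this ▸ hy)
    · exact L.lift_H S hx hv hy
  · have hy : y ∉ A1 := fun h => noBA v hvB y h L.vyE
    have hv : v ∉ A1 := fun h => hdis h hvB
    by_cases hx : x ∈ A1
    · have e := S.1.cAB x hx v hvB L.xvE
      refine L.noH ⟨a, A1, B1 ∪ Γ, x, q, (L.mkSep S.1.symm (t2 := q) (w2 := q) (u2 := x) (w2' := x)
        (Finset.mem_union_right _ L.bij.1.uB)
        (Finset.mem_union_right _ L.bij.1.uB) hx hx ?_ ?_ ?_ ?_).symm, L.bij.2.1, ?_⟩
      · intro c hc d hd h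
        exact absurd (L.E_of_D h (s2 c hc) (s1 d hd)) (noBA c hc d hd)
      · intro c hc d hd h
        have := (L.fromG (s1 d hd) (fun e => hv (e ▸ hd)) hc h).2
        exact absurd (this ▸ hd) hy
      · intro c hc d hd h
        have := S.1.cAB c hc d hd (L.E_of_D h (s1 c hc) (s2 d hd))
        rw [this.1, this.2, ← e.1, ← e.2] at h
        exact absurd h L.xv_not
      · intro c hc d hd h
        exact L.toG (s1 c hc) (fun e => hv (e ▸ hc)) hd h
      · intro h
        have := (L.fromG (s1 x hx) L.xv L.bij.1.uB h).2
        exact hy (this ▸ hx)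
    · exact L.lift_H' S hx hv hy

/-- HStr of `E` at `v` -/
theorem H_eq (L : LS k D v B Γ x y q p) {A1 B1 t u}
    (S : HStr (pA D v B x y q p) v A1 B1 t u) :
    Bij D v A1 (B1 ∪ Γ) t y u p ∧ Bij D v B1 (A1 ∪ Γ) x u q t ∧ A1 ∪ B1 = B := by
  have s1 := (sepV S.1).1
  have s2 := (sepV S.1).2
  have hdis := Finset.disjoint_left.1 S.1.disj
  have noBA : ∀ c ∈ B1, ∀ d ∈ A1, (c, d) ∉ (pA D v B x y q p).arcs := by
    intro c hc d hd h
    have := S.1.cBA c hc d hd h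
    rw [this.1, this.2] at h
    exact S.2.2 h
  have hu : A1 ∪ B1 = B := by
    ext z
    rw [Finset.mem_union]
    constructor
    · rintro (h | h)
      · exact (L.vE.1 (s1 z h)).resolve_left fun e => S.1.vA (e ▸ h)
      · exact (L.vE.1 (s2 z h)).resolve_left fun e => S.1.vB (e ▸ h)
    · intro h
      exact (S.1.memV.1 (L.vE.2 (Or.inr h))).resolve_left fun e => L.vB (e ▸ h)
  have hx' : x ∈ A1 ∨ x ∈ B1 := by rw [← Finset.mem_union, hu]; exact L.xB
  have hy' : y ∈ A1 ∨ y ∈ B1 := by rw [← Finset.mem_union, hu]; exact L.yB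
  have hut : (t, u) ∈ D.arcs := by
    refine L.D_of_E S.2.1 ?_ ?_
    · rintro ⟨-, rfl⟩; exact S.1.vB S.1.uB
    · rintro ⟨rfl, -⟩; exact S.1.vA S.1.tA
  rcases hy' with hy | hy
  · rcases hx' with hx | hx
    · exact absurd (L.lift_H S (hdis hx) S.1.vB (hdis hy)) id
    · have ub : u ≠ v := fun e => S.1.vB (e ▸ S.1.uB)
      refine ⟨⟨(L.mkSep S.1.symm (t2 := p) (w2 := u) (u2 := y) (w2' := t)
        (Finset.mem_union_right _ L.bij.1.wB) (Finset.mem_union_left _ S.1.uB) hy S.1.tA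
        ?_ ?_ ?_ ?_).symm, hut, L.bij.2.2⟩,
        ⟨(L.mkSep S.1 (t2 := t) (w2 := q) (u2 := u) (w2' := x)
        (Finset.mem_union_left _ S.1.tA) (Finset.mem_union_right _ L.bij.1.uB) S.1.uB hx
        ?_ ?_ ?_ ?_).symm, L.bij.2.1, hut⟩, hu⟩
      · intro c hc d hd h
        exact absurd (L.E_of_D h (s2 c hc) (s1 d hd)) (noBA c hc d hd)
      · intro c hc d hd h
        exact L.fromG (s1 d hd) (fun e => S.1.vA (e ▸ hd)) hc h
      · intro c hc d hd h
        exact S.1.cAB c hc d hd (L.E_of_D h (s1 c hc) (s2 d hd))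
      · intro c hc d hd h
        have := (L.toG (s1 c hc) (fun e => S.1.vA (e ▸ hc)) hd h).1
        exact absurd (this ▸ hc) fun h => hdis h hx
      · intro c hc d hd h
        exact S.1.cAB c hc d hd (L.E_of_D h (s1 c hc) (s2 d hd))
      · intro c hc d hd h
        have := (L.fromG (s2 d hd) (fun e => S.1.vB (e ▸ hd)) hc h).2
        exact absurd (this ▸ hd) (hdis hy)
      · intro c hc d hd h
        exact absurd (L.E_of_D h (s2 c hc) (s1 d hd)) (noBA c hc d hd)
      · intro c hc d hd h
        exact L.toG (s2 c hc) (fun e => S.1.vB (e ▸ hc)) hd h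
  · rcases hx' with hx | hx
    · exfalso
      obtain ⟨θ, hθ⟩ := L.extE.amin _ L.vyE
      have := (L.K1 hθ).1
      have key : ∀ z, ReflTransGen (inB D B θ) y z → z ∈ B1 := by
        intro z hz
        induction hz with
        | refl => exact hy
        | @tail a b _ hab ih =>
          have hb : b ∈ A1 ∨ b ∈ B1 := by rw [← Finset.mem_union, hu]; exact hab.2.2.1
          refine hb.resolve_left fun hb => ?_
          exact noBA a ih b hb (L.E_of_D hab.1 (s2 a ih) (s1 b hb))
      exact hdis hx (key x this)
    · exact absurd (L.lift_H' S (fun h => hdis h hx) S.1.vA (fun h => hdis h hy)) id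

end LS
end Dgraph

namespace Dgraph
open Relation
variable {k : ℕ}

theorem closeB_ind1 {E F1 F2 : Dgraph} {v x1 y1 x2 y2 : ℕ} (h1 : OP F1 x1 v y1)
    (h2 : OP F2 x2 v y2) (hm : Meet F1 F2 v) (e : E = closeB F1 F2 x1 y1 x2 y2) :
    E.pc (insert v (F1.verts.erase v)) ∅ = F1 := by
  subst e
  refine dg_ext (fun z => ?_) fun ⟨c, d⟩ => ?_
  · rw [pc_verts, Finset.insert_erase h1.v]
  · rw [mem_ind, Finset.insert_erase h1.v]
    constructor
    · rintro ⟨a, b, c⟩; exact (closeB_in1 h1 h2 hm b c).1 a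
    · intro h
      have := h1.wf _ h
      exact ⟨(closeB_in1 h1 h2 hm this.1 this.2.1).2 h, this.1, this.2.1⟩

theorem closeB_ind2 {E F1 F2 : Dgraph} {v x1 y1 x2 y2 : ℕ} (h1 : OP F1 x1 v y1)
    (h2 : OP F2 x2 v y2) (hm : Meet F1 F2 v) (e : E = closeB F1 F2 x1 y1 x2 y2) :
    E.pc (insert v (F2.verts.erase v)) ∅ = F2 :=
  closeB_ind1 h2 h1 hm.symm (e.trans (closeB_comm _ _ _ _ _ _))

theorem Base.symm {D : Dgraph} (h : Base k D) : Symm D := by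
  intro p q hpq
  rcases h with ⟨-, l, x, -, -, -, -, -, hA⟩ | ⟨-, -, hA⟩
  · rw [hA, mem_wheel] at hpq ⊢
    rcases hpq with h | h | ⟨h, h'⟩ | ⟨h, h'⟩
    · exact Or.inr (Or.inl h)
    · exact Or.inl h
    · exact Or.inr (Or.inr (Or.inr ⟨h', h⟩))
    · exact Or.inr (Or.inr (Or.inl ⟨h', h⟩))
  · rw [hA] at hpq ⊢
    simp only [Finset.mem_filter, Finset.mem_product] at hpq ⊢
    exact ⟨⟨hpq.1.2, hpq.1.1⟩, fun h => hpq.2 h.symm⟩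

theorem leafDec_op {P : Dgraph} {b v : ℕ} (hP : P.WF) (h : (b, v) ∈ P.arcs) :
    OP (del2 P b v) v b v := by
  have := hP _ h
  exact ⟨fun a ha => hP a (mem_del2.1 ha).1, this.1, this.2.1, this.2.1, this.2.2.symm,
    this.2.2.symm⟩

namespace LS
variable {D : Dgraph} {v : ℕ} {B Γ : Finset ℕ} {x y q p : ℕ}

theorem inB_color {θ : ℕ → Fin k} {a b : ℕ} (h : ReflTransGen (inB D B θ) a b) : θ a = θ b := by
  induction h with
  | refl => rfl
  | tail _ h ih => exact ih.trans h.2.2.2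

theorem open_of_leafDec (L : LS k D v B Γ x y q p) {P G : Dgraph} {b : ℕ}
    (h : LeafDec (Ext k) (pA D v B x y q p) P G b v x y) :
    Open (Ext k) (D.pc (insert v B) ∅) x v y := by
  obtain ⟨hP, h1, h2, hG, hm, e⟩ := h
  have oG := hG.props extWF
  have hbv := hP.wf _ h1
  have vG : v ∉ G.verts := fun h => hbv.2.2 (hm v hbv.2.1 h).symm
  have xP : x ∉ P.verts := fun h => oG.xv (hm x h oG.x)
  have yP : y ∉ P.verts := fun h => oG.yv (hm y h oG.y)
  have : D.pc (insert v B) ∅ = un (del2 P v b) G := by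
    refine dg_ext (fun z => ?_) fun ⟨c, d⟩ => ?_
    · have : z ∈ (pA D v B x y q p).verts ↔ z ∈ (un (del2 P v b) G).verts := by
        rw [e, vmem_closeB, vmem_un]; rfl
      rw [← this]; rfl
    · rw [L.ind_eq, e, mem_closeB, mem_un, del2_comm P v b]
      simp only [Prod.mk.injEq]
      constructor
      · rintro ⟨h | h | h, n1, n2⟩
        · exact absurd h n2
        · exact absurd h n1
        · exact h
      · intro h
        refine ⟨Or.inr (Or.inr h), ?_, ?_⟩
        · rintro ⟨rfl, rfl⟩
          rcases h with h | h
          · exact xP (hP.wf _ (mem_del2.1 h).1).1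
          · exact vG (oG.wf _ h).2.1
        · rintro ⟨rfl, rfl⟩
          rcases h with h | h
          · exact yP (hP.wf _ (mem_del2.1 h).1).2.1
          · exact vG (oG.wf _ h).1
  rw [this]
  exact Open.edge P G v b x y hP h2 h1 hG hm

theorem leafDec_case (L : LS k D v B Γ x y q p) {P G : Dgraph} {b xG yG : ℕ}
    (h : LeafDec (Ext k) (pA D v B x y q p) P G b v xG yG) (hxy : xG = x ∨ yG = y) :
    Open (Ext k) (D.pc (insert v B) ∅) x v y := by
  have h0 := h
  obtain ⟨hP, h1, h2, hG, hm, e⟩ := h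
  have oG := hG.props extWF
  have oP := leafDec_op hP.wf h1
  have hbv := hP.wf _ h1
  have vG : v ∉ G.verts := fun h => hbv.2.2 (hm v hbv.2.1 h).symm
  have hb := closeB_bij oP oG hm
  rw [← e] at hb
  have a1 : (v, yG) ∈ (pA D v B x y q p).arcs := by rw [e, mem_closeB]; exact Or.inl rfl
  have a2 : (xG, v) ∈ (pA D v B x y q p).arcs := by rw [e, mem_closeB]; exact Or.inr (Or.inl rfl)
  have a3 : ∀ c ∈ G.arcs, c ∈ (pA D v B x y q p).arcs := by
    intro c hc; rw [e, mem_closeB]; exact Or.inr (Or.inr (Or.inr hc))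
  have key : ∀ (α : ℕ × ℕ) (θ : ℕ → Fin k), (α.1 = v ∨ α.2 = v) → (v, yG) ≠ α → (xG, v) ≠ α →
      Good ⟨(pA D v B x y q p).verts, (pA D v B x y q p).arcs.erase α⟩ θ →
      (θ x = θ v ∧ θ y = θ v) → False := by
    intro α θ hα n1 n2 hθ hc
    have hs : ∀ c ∈ G.arcs, c ∈ (pA D v B x y q p).arcs.erase α := by
      intro c hc
      refine Finset.mem_erase.2 ⟨?_, a3 c hc⟩
      rintro rfl
      rcases hα with hα | hα
      · exact vG (hα ▸ (oG.wf _ hc).1)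
      · exact vG (hα ▸ (oG.wf _ hc).2.1)
    have hg : G.Good θ := hθ.sub (D' := G) hs
    have hi := closeB_ind2 oP oG hm e
    obtain ⟨f1, f2⟩ := hb.symm.forced L.hk L.extE (Or.inl rfl) (φ := θ) (by rw [hi]; exact hg)
    rw [hi] at f1
    have c1 := rtg_mono_color f1
    have c2 : θ xG = θ v := by
      rcases hxy with h | h
      · rw [h]; exact hc.1
      · rw [← c1, h]; exact hc.2
    refine hθ xG v ⟨Finset.mem_erase.2 ⟨n2, a2⟩, c2⟩ (ReflTransGen.head
      (b := yG) ⟨Finset.mem_erase.2 ⟨n1, a1⟩, (c1.trans c2).symm⟩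
      (ReflTransGen.mono (fun _ _ h => ⟨hs _ h.1, h.2⟩) _ _ f1))
  have hx : xG = x := by
    by_contra hx
    obtain ⟨θ, hθ⟩ := L.extE.amin _ L.xvE
    obtain ⟨g1, g2⟩ := L.K2 hθ
    refine key _ θ (Or.inr rfl) ?_ ?_ hθ ⟨g2, ?_⟩
    · intro h; exact L.xv (Prod.mk.inj h).1.symm
    · intro h; exact hx (Prod.mk.inj h).1
    · exact (inB_color g1).trans g2
  have hy : yG = y := by
    by_contra hy
    obtain ⟨θ, hθ⟩ := L.extE.amin _ L.vyE
    obtain ⟨g1, g2⟩ := L.K1 hθ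
    refine key _ θ (Or.inl rfl) ?_ ?_ hθ ⟨g2, ?_⟩
    · intro h; exact hy (Prod.mk.inj h).2
    · intro h; exact L.yv (Prod.mk.inj h).2.symm
    · exact (inB_color g1).trans g2
  subst hx hy
  exact L.open_of_leafDec h0

theorem base_case (L : LS k D v B Γ x y q p) (hxy : x ≠ y) (h : Base k (pA D v B x y q p)) :
    False := by
  obtain ⟨θ, hθ⟩ := L.extE.amin _ L.xvE
  obtain ⟨g1, g2⟩ := L.K2 hθ
  have c : θ y = θ v := (inB_color g1).trans g2
  refine hθ v y ⟨Finset.mem_erase.2 ⟨?_, L.vyE⟩, c.symm⟩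
    (ReflTransGen.single ⟨Finset.mem_erase.2 ⟨?_, h.symm _ _ L.vyE⟩, c⟩)
  · intro h; exact L.xv (Prod.mk.inj h).1.symm
  · intro h; exact hxy (Prod.mk.inj h).1.symm

theorem split (L : LS k D v B Γ x y q p) (hH : ¬ HasH (pA D v B x y q p)) {F1 F2 : Dgraph}
    {x1 y1 x2 y2 : ℕ} (h1 : OP F1 x1 v y1) (h2 : OP F2 x2 v y2) (hm : Meet F1 F2 v)
    (e : pA D v B x y q p = closeB F1 F2 x1 y1 x2 y2) (hx : (x, v) ∈ F1.arcs)
    (hy : (v, y) ∈ F2.arcs) : False := by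
  have S : Bij (pA D v B x y q p) v (F1.verts.erase v) (F2.verts.erase v) x1 y1 y2 x2 := by
    rw [e]; exact closeB_bij h1 h2 hm
  have i1 := closeB_ind1 h1 h2 hm e
  have i2 := closeB_ind2 h1 h2 hm e
  have x1v := S.1.ext_pA L.hk L.extE (Or.inr hH)
  have x2v := S.symm.1.ext_pA L.hk L.extE (Or.inr hH)
  set E := pA D v B x y q p with hE
  have hk := L.hk
  have n1 := S.symm.1.vw_new (by omega) L.extE x2v.toCrit S.symm.2.2
  have b1 : (x1, v) ∈ (pA E v (F1.verts.erase v) x1 y1 y2 x2).arcs :=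
    (mem_pA S).2 (Or.inr (Or.inl ⟨rfl, rfl⟩))
  have b2 : (v, y1) ∈ (pA E v (F1.verts.erase v) x1 y1 y2 x2).arcs :=
    (mem_pA S).2 (Or.inr (Or.inr ⟨rfl, rfl⟩))
  have b3 : (x2, v) ∈ (pA E v (F2.verts.erase v) x2 y2 y1 x1).arcs :=
    (mem_pA S.symm).2 (Or.inr (Or.inl ⟨rfl, rfl⟩))
  have b4 : (v, y2) ∈ (pA E v (F2.verts.erase v) x2 y2 y1 x1).arcs :=
    (mem_pA S.symm).2 (Or.inr (Or.inr ⟨rfl, rfl⟩))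
  have t1 : ∀ c ∈ F1.arcs, c ∈ (pA E v (F1.verts.erase v) x1 y1 y2 x2).arcs := by
    rintro ⟨c, d⟩ hc
    rw [← i1, mem_ind] at hc
    exact (mem_pA S).2 (Or.inl hc)
  have t2 : ∀ c ∈ F2.arcs, c ∈ (pA E v (F2.verts.erase v) x2 y2 y1 x1).arcs := by
    rintro ⟨c, d⟩ hc
    rw [← i2, mem_ind] at hc
    exact (mem_pA S.symm).2 (Or.inl hc)
  have t2' : ∀ c ∈ F2.arcs, c ∈ E.arcs := by
    rintro ⟨c, d⟩ hc
    rw [← i2, mem_ind] at hc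
    exact hc.1
  have xx1 : (x1, v) ≠ (x, v) := by
    rintro h
    have := S.1.tv_new (by omega) L.extE x1v.toCrit S.2.1
    rw [h] at this
    exact this L.xvE
  obtain ⟨φ, hφ⟩ := x1v.amin _ (t1 _ hx)
  obtain ⟨ψ, hψ⟩ := x2v.amin _ b4
  have vy1 : (v, y1) ≠ (x, v) := fun h => L.xv (Prod.mk.inj h).1.symm
  have x2v' : (x2, v) ≠ (v, y2) := fun h => h2.xv (Prod.mk.inj h).1
  -- the separation of `E - xv`
  have S' : Sep ⟨E.verts, E.arcs.erase (x, v)⟩ v (F1.verts.erase v) (F2.verts.erase v) x1 y1 y2 x2 := by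
    have T := S.1
    exact ⟨fun a ha => T.wf a (Finset.mem_of_mem_erase ha), T.verts, T.disj, T.vA, T.vB, T.tA, T.wA,
      T.uB, T.wB, fun c hc d hd h => T.cAB c hc d hd (Finset.mem_of_mem_erase h),
      fun c hc d hd h => T.cBA c hc d hd (Finset.mem_of_mem_erase h)⟩
  have u1 : ∀ c d, (c, d) ∈ (pc ⟨E.verts, E.arcs.erase (x, v)⟩ (insert v (F1.verts.erase v)) ∅).arcs →
      (c, d) ∈ (pA E v (F1.verts.erase v) x1 y1 y2 x2).arcs.erase (x, v) := by
    intro c d h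
    rw [mem_ind] at h
    obtain ⟨ha, hb⟩ := Finset.mem_erase.1 h.1
    exact Finset.mem_erase.2 ⟨ha, (mem_pA S).2 (Or.inl ⟨hb, h.2⟩)⟩
  have u2 : ∀ c d, (c, d) ∈ (pc ⟨E.verts, E.arcs.erase (x, v)⟩ (insert v (F2.verts.erase v)) ∅).arcs →
      (c, d) ∈ (pA E v (F2.verts.erase v) x2 y2 y1 x1).arcs.erase (v, y2) := by
    intro c d h
    rw [mem_ind] at h
    obtain ⟨ha, hb⟩ := Finset.mem_erase.1 h.1
    refine Finset.mem_erase.2 ⟨?_, (mem_pA S.symm).2 (Or.inl ⟨hb, h.2⟩)⟩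
    intro e'; rw [e'] at hb; exact n1 hb
  obtain ⟨θ, σ, hθ, r1, r2⟩ := combine S' (φ := φ) (ψ := ψ)
    (hφ.sub (D' := pc ⟨E.verts, E.arcs.erase (x, v)⟩ (insert v (F1.verts.erase v)) ∅) fun c h => u1 c.1 c.2 h)
    (hψ.sub (D' := pc ⟨E.verts, E.arcs.erase (x, v)⟩ (insert v (F2.verts.erase v)) ∅) fun c h => u2 c.1 c.2 h)
    (by
      rintro - ⟨w1, -⟩
      exact hφ x1 v ⟨Finset.mem_erase.2 ⟨xx1, b1⟩, (rtg_mono_color w1).symm⟩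
        (ReflTransGen.mono (fun _ _ h => ⟨u1 _ _ h.1, h.2⟩) _ _ w1))
    (by
      rintro - ⟨w1, -⟩
      exact hψ x2 v ⟨Finset.mem_erase.2 ⟨x2v', b3⟩, (rtg_mono_color w1).symm⟩
        (ReflTransGen.mono (fun _ _ h => ⟨u2 _ _ h.1, h.2⟩) _ _ w1))
    (by
      rintro - - ⟨w1, w2, -⟩
      exact hφ x1 v ⟨Finset.mem_erase.2 ⟨xx1, b1⟩, w2⟩
        (ReflTransGen.head (b := y1) ⟨Finset.mem_erase.2 ⟨vy1, b2⟩, ((rtg_mono_color w1).trans w2).symm⟩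
        (ReflTransGen.mono (fun _ _ h => ⟨u1 _ _ h.1, h.2⟩) _ _ w1)))
    (fun _ => Or.inl hk)
  obtain ⟨g1, g2⟩ := L.K2 hθ
  have hyF := h2.wf _ hy
  have hxF := h1.wf _ hx
  have hF2 : ∀ c ∈ F2.verts, θ c = σ (ψ c) := by
    intro c hc
    exact r2 c (by rw [Finset.insert_erase h2.v]; exact hc)
  have key : ∀ c, ReflTransGen (inB D B θ) y c →
      (c ∈ F2.verts ∧ c ≠ v ∧ ReflTransGen (F2.mono ψ) y c) ∨ ReflTransGen (F2.mono ψ) y x2 := by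
    intro c hc
    induction hc with
    | refl => exact Or.inl ⟨hyF.2.1, hyF.2.2.symm, .refl⟩
    | @tail a b _ hab ih =>
      rcases ih with ⟨h1', h2', h3'⟩ | ih
      · have bv : b ≠ v := fun e => L.vB (e ▸ hab.2.2.1)
        have hE' : (a, b) ∈ E.arcs := L.E_of_D hab.1 (L.vE.2 (Or.inr hab.2.1)) (L.vE.2 (Or.inr hab.2.2.1))
        have aF1 : a ∉ F1.verts := fun h => h2' (hm a h h1')
        rw [e, mem_closeB] at hE'
        rcases hE' with h | h | h | h
        · exact absurd h1.x ((Prod.mk.inj h).1 ▸ aF1)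
        · exact Or.inr ((Prod.mk.inj h).1 ▸ h3')
        · exact absurd (h1.wf _ h).1 aF1
        · have := h2.wf _ h
          refine Or.inl ⟨this.2.1, bv, h3'.tail ⟨h, ?_⟩⟩
          have e2 := hab.2.2.2
          rw [hF2 a h1', hF2 b this.2.1] at e2
          exact σ.injective e2
      · exact Or.inr ih
  have cyx : θ y = θ x := inB_color g1
  have cy : ψ y = ψ v := by
    have := cyx.trans g2
    rw [hF2 y hyF.2.1, hF2 v h2.v] at this
    exact σ.injective this
  have g3 : ReflTransGen (F2.mono ψ) y x2 := by
    rcases key x g1 with h | h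
    · exact absurd (hm x hxF.1 h.1) h.2.1
    · exact h
  have tF : ∀ c ∈ F2.arcs, c ∈ (pA E v (F2.verts.erase v) x2 y2 y1 x1).arcs.erase (v, y2) := by
    intro c hc
    refine Finset.mem_erase.2 ⟨?_, t2 c hc⟩
    rintro rfl
    exact n1 (t2' _ hc)
  exact hψ x2 v ⟨Finset.mem_erase.2 ⟨x2v', b3⟩, (rtg_mono_color g3).symm.trans cy⟩
    (ReflTransGen.head ⟨tF _ hy, cy.symm⟩ (ReflTransGen.mono (fun _ _ h => ⟨tF _ h.1, h.2⟩) _ _ g3))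

theorem lift_ind (L : LS k D v B Γ x y q p) {a A1 B1 t w u w'}
    (S : Sep (pA D v B x y q p) a A1 B1 t w u w') (hx : x ∉ B1) (hv : v ∉ B1) (hy : y ∉ B1) :
    D.pc (insert a B1) ∅ = (pA D v B x y q p).pc (insert a B1) ∅ := by
  have s2 : ∀ c ∈ insert a B1, c ∈ (pA D v B x y q p).verts := by
    intro c hc
    rcases Finset.mem_insert.1 hc with rfl | hc
    · exact S.vV
    · exact (sepV S).2 c hc
  refine dg_ext (fun z => Iff.rfl) fun ⟨c, d⟩ => ?_
  rw [mem_ind, mem_ind]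
  constructor
  · intro h; exact ⟨L.E_of_D h.1 (s2 c h.2.1) (s2 d h.2.2), h.2⟩
  · intro h
    refine ⟨L.D_of_E h.1 ?_ ?_, h.2⟩
    · rintro ⟨rfl, rfl⟩
      exact L.xv (((Finset.mem_insert.1 h.2.1).resolve_right hx).trans
        ((Finset.mem_insert.1 h.2.2).resolve_right hv).symm)
    · rintro ⟨rfl, rfl⟩
      exact L.yv (((Finset.mem_insert.1 h.2.2).resolve_right hy).trans
        ((Finset.mem_insert.1 h.2.1).resolve_right hv).symm)

theorem red_leaf (L : LS k D v B Γ x y q p) {P G : Dgraph} {a b xG yG : ℕ} (hP : Ext k P)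
    (hab : (a, b) ∈ P.arcs) (hx : x ∈ P.verts) (hv : v ∈ P.verts) (hy : y ∈ P.verts)
    (hG : Open (Ext k) G xG a yG) (hm : Meet P G a)
    (e : pA D v B x y q p = closeB (del2 P a b) G b b xG yG) : CB (Ext k) D := by
  have oG := hG.props extWF
  have oP := leafDec_op hP.wf hab
  have S := closeB_bij oP oG hm
  rw [← e] at S
  have nG : ∀ z ∈ P.verts, z ∉ G.verts.erase a := by
    intro z hz hz'
    rw [Finset.mem_erase] at hz'
    exact hz'.1 (hm z hz hz'.2)
  obtain ⟨l1, l2, l3, -⟩ := L.lift S.1 (nG x hx) (nG v hv) (nG y hy)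
  have SD : Bij D a _ _ _ _ _ _ := ⟨l1, l2.2 S.2.1, l3.2 S.2.2⟩
  refine SD.cb (SD.leaf L.hk L.ext) ?_
  rw [L.lift_ind S.1 (nG x hx) (nG v hv) (nG y hy), closeB_ind2 oP oG hm e]
  exact hG

theorem red_edge (L : LS k D v B Γ x y q p) {P G G' : Dgraph} {a b xG yG x' y' : ℕ} (hP : Ext k P)
    (hab : (a, b) ∈ P.arcs) (hba : (b, a) ∈ P.arcs) (hx : x ∈ P.verts) (hv : v ∈ P.verts)
    (hy : y ∈ P.verts) (hG : Open (Ext k) G xG a yG) (hG' : Open (Ext k) G' x' b y')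
    (hm' : Meet P G' b) (hm : Meet (un (del2 P a b) G') G a)
    (e : pA D v B x y q p = closeB (un (del2 P a b) G') G x' y' xG yG) : CB (Ext k) D := by
  have oG := hG.props extWF
  have oG' := hG'.props extWF
  have hF := Open.edge P G' a b x' y' hP hab hba hG' hm'
  have oF := hF.props extWF
  have habw := hP.wf _ hab
  have S := closeB_bij oF oG hm
  rw [← e] at S
  have nG : ∀ z ∈ P.verts, z ∉ G.verts.erase a := by
    intro z hz hz'
    rw [Finset.mem_erase] at hz'
    exact hz'.1 (hm z (vmem_un.2 (Or.inl hz)) hz'.2)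
  have nG' : ∀ z ∈ P.verts, z ∉ G'.verts.erase b := by
    intro z hz hz'
    rw [Finset.mem_erase] at hz'
    exact hz'.1 (hm' z hz hz'.2)
  obtain ⟨l1, l2, l3, -⟩ := L.lift S.1 (nG x hx) (nG v hv) (nG y hy)
  have SD : Bij D a _ _ _ _ _ _ := ⟨l1, l2.2 S.2.1, l3.2 S.2.2⟩
  have L2 : LS k D a ((un (del2 P a b) G').verts.erase a ∪ Γ) (G.verts.erase a) x' y' yG xG :=
    ⟨L.hk, L.ext, L.noH, SD⟩
  refine SD.cb ?_ ?_
  swap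
  · rw [L.lift_ind S.1 (nG x hx) (nG v hv) (nG y hy), closeB_ind2 oF oG hm e]
    exact hG
  have hD1 := L2.extE
  have vE : ∀ z, z ∈ (un (del2 P a b) G').verts → z ∈ (pA D v B x y q p).verts := by
    intro z hz; rw [e, vmem_closeB]; exact Or.inl hz
  have aG' : a ∉ G'.verts := fun h => habw.2.2 (hm' a habw.1 h)
  have x'P : x' ∉ P.verts := fun h => oG'.xv (hm' x' h oG'.x)
  have y'P : y' ∉ P.verts := fun h => oG'.yv (hm' y' h oG'.y)
  have vD1 : ∀ z, z ∈ (pA D a ((un (del2 P a b) G').verts.erase a ∪ Γ) x' y' yG xG).verts ↔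
      z ∈ P.verts ∨ z ∈ G'.verts ∨ z ∈ Γ := by
    intro z
    rw [L2.vE, Finset.mem_union, Finset.mem_erase, vmem_un]
    constructor
    · rintro (rfl | ⟨h, h1 | h1⟩ | h)
      · exact Or.inl habw.1
      · exact Or.inl h1
      · exact Or.inr (Or.inl h1)
      · exact Or.inr (Or.inr h)
    · rintro (h | h | h)
      · by_cases hz : z = a
        · exact Or.inl hz
        · exact Or.inr (Or.inl ⟨hz, Or.inl h⟩)
      · exact Or.inr (Or.inl ⟨fun h' => aG' (h' ▸ h), Or.inr h⟩)
      · exact Or.inr (Or.inr h)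
  have nD : ∀ c d, c ∈ (un (del2 P a b) G').verts → d ∈ (un (del2 P a b) G').verts →
      (c, d) ∈ D.arcs → (c, d) ∈ P.arcs ∨ (c, d) ∈ G'.arcs := by
    intro c d hc hd h
    have := L.E_of_D h (vE c hc) (vE d hd)
    rw [e, closeB_in1 oF oG hm hc hd, mem_un, mem_del2] at this
    exact this.imp And.left id
  have uP : ∀ c ∈ P.verts, c ∈ (un (del2 P a b) G').verts := fun c h => vmem_un.2 (Or.inl h)
  have uG : ∀ c ∈ G'.verts, c ∈ (un (del2 P a b) G').verts := fun c h => vmem_un.2 (Or.inr h)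
  have gv : ∀ c ∈ G'.verts.erase b, c ≠ v := fun c hc h => nG' v hv (h ▸ hc)
  have GF : ∀ c ∈ Γ, c ∉ (un (del2 P a b) G').verts := fun c hc h => L.GV hc (vE c h)
  have dg : ∀ c d, c ∈ P.verts.erase b ∪ Γ → d ∈ G'.verts.erase b → (c, d) ∉ D.arcs := by
    intro c d hc hd h
    have hd' := Finset.mem_of_mem_erase hd
    rcases Finset.mem_union.1 hc with hc | hc
    · have hc' := Finset.mem_of_mem_erase hc
      rcases nD c d (uP c hc') (uG d hd') h with h | h
      · exact nG' d (hP.wf _ h).2.1 hd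
      · exact Finset.ne_of_mem_erase hc (hm' c hc' (oG'.wf _ h).1)
    · have := (L.fromG (vE d (uG d hd')) (gv d hd) hc h).2
      exact nG' y hy (this ▸ hd)
  have dg' : ∀ c d, c ∈ G'.verts.erase b → d ∈ P.verts.erase b ∪ Γ → (c, d) ∉ D.arcs := by
    intro d c hd hc h
    have hd' := Finset.mem_of_mem_erase hd
    rcases Finset.mem_union.1 hc with hc | hc
    · have hc' := Finset.mem_of_mem_erase hc
      rcases nD d c (uG d hd') (uP c hc') h with h | h
      · exact nG' d (hP.wf _ h).1 hd
      · exact Finset.ne_of_mem_erase hc (hm' c hc' (oG'.wf _ h).2.1)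
    · have := (L.toG (vE d (uG d hd')) (gv d hd) hc h).1
      exact nG' x hx (this ▸ hd)
  have S1 : Bij (pA D a ((un (del2 P a b) G').verts.erase a ∪ Γ) x' y' yG xG) b
      (P.verts.erase b ∪ Γ) (G'.verts.erase b) a a y' x' := by
    refine ⟨⟨hD1.wf, ?_, ?_, ?_, Finset.notMem_erase _ _, ?_, ?_, ?_, ?_, ?_, ?_⟩, L2.vyE, L2.xvE⟩
    · ext z
      rw [vD1]
      simp only [Finset.mem_insert, Finset.mem_union, Finset.mem_erase]
      by_cases hz : z = b
      · simp [hz, habw.2.1]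
      · simp [hz]; tauto
    · rw [Finset.disjoint_left]
      intro z hz hz'
      rcases Finset.mem_union.1 hz with h | h
      · exact nG' z (Finset.mem_of_mem_erase h) hz'
      · exact GF z h (uG z (Finset.mem_of_mem_erase hz'))
    · intro h
      rcases Finset.mem_union.1 h with h | h
      · exact Finset.notMem_erase _ _ h
      · exact GF b h (uP b habw.2.1)
    · exact Finset.mem_union_left _ (Finset.mem_erase.2 ⟨habw.2.2, habw.1⟩)
    · exact Finset.mem_union_left _ (Finset.mem_erase.2 ⟨habw.2.2, habw.1⟩)
    · exact Finset.mem_erase.2 ⟨oG'.yv, oG'.y⟩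
    · exact Finset.mem_erase.2 ⟨oG'.xv, oG'.x⟩
    · intro c hc d hd h
      rcases (mem_pA SD).1 h with h | h | h
      · exact absurd h.1 (dg c d hc hd)
      · exact absurd (Finset.mem_of_mem_erase hd) (h.2 ▸ aG')
      · exact h
    · intro c hc d hd h
      rcases (mem_pA SD).1 h with h | h | h
      · exact absurd h.1 (dg' c d hc hd)
      · exact h
      · exact absurd (Finset.mem_of_mem_erase hc) (h.1 ▸ aG')
  have hGe : pc (pA D a ((un (del2 P a b) G').verts.erase a ∪ Γ) x' y' yG xG)
      (insert b (G'.verts.erase b)) ∅ = G' := by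
    rw [Finset.insert_erase oG'.v]
    refine dg_ext (fun z => Iff.rfl) fun ⟨c, d⟩ => ?_
    rw [mem_ind, mem_pA SD]
    constructor
    · rintro ⟨h | h | h, hc, hd⟩
      · have := L.E_of_D h.1 (vE c (uG c hc)) (vE d (uG d hd))
        rw [e, closeB_in1 oF oG hm (uG c hc) (uG d hd), mem_un] at this
        rcases this with h | h
        · have hw := hP.wf _ (mem_del2.1 h).1
          exact absurd ((hm' c hw.1 hc).trans (hm' d hw.2.1 hd).symm) hw.2.2
        · exact h
      · exact absurd hd (h.2 ▸ aG')
      · exact absurd hc (h.1 ▸ aG')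
    · intro h
      have hw := oG'.wf _ h
      refine ⟨Or.inl ⟨?_, ?_, ?_⟩, hw.1, hw.2.1⟩
      · refine L.D_of_E ?_ ?_ ?_
        · rw [e, closeB_in1 oF oG hm (uG c hw.1) (uG d hw.2.1), mem_un]; exact Or.inr h
        · rintro ⟨rfl, rfl⟩
          exact hw.2.2 ((hm' _ hx hw.1).trans (hm' _ hv hw.2.1).symm)
        · rintro ⟨rfl, rfl⟩
          exact hw.2.2 ((hm' _ hv hw.1).trans (hm' _ hy hw.2.1).symm)
      · exact L2.vE.1 ((vD1 c).2 (Or.inr (Or.inl hw.1))) |> fun h => Finset.mem_insert.2 h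
      · exact L2.vE.1 ((vD1 d).2 (Or.inr (Or.inl hw.2.1))) |> fun h => Finset.mem_insert.2 h
  refine L2.open_of_leafDec (b := b) (G := G')
    (P := pA (pA D a ((un (del2 P a b) G').verts.erase a ∪ Γ) x' y' yG xG) b
      (P.verts.erase b ∪ Γ) a a y' x') ⟨S1.1.ext_pA L.hk hD1 (Or.inl rfl),
      (mem_pA S1).2 (Or.inr (Or.inr ⟨rfl, rfl⟩)), (mem_pA S1).2 (Or.inr (Or.inl ⟨rfl, rfl⟩)), hG', ?_, ?_⟩
  · intro z hz hz'
    rw [pA, pc_verts, Finset.mem_insert] at hz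
    rcases hz with h | h
    · exact h
    · by_contra hzb
      exact Finset.disjoint_left.1 S1.1.disj h (Finset.mem_erase.2 ⟨hzb, hz'⟩)
  · have := Sep.closeB_eq S1
    rw [hGe, S1.leaf_eq L.hk hD1] at this
    exact this

theorem cb_case (L : LS k D v B Γ x y q p) (hH : ¬ HasH (pA D v B x y q p))
    (h : CB (Ext k) (pA D v B x y q p)) :
    Open (Ext k) (D.pc (insert v B) ∅) x v y ∨ CB (Ext k) D := by
  by_cases hp1 : Periph (Ext k) (pA D v B x y q p) (x, v)
  · obtain ⟨-, P, G, b, yG, hd⟩ := hp1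
    exact Or.inl (L.leafDec_case hd (Or.inl rfl))
  by_cases hp2 : Periph (Ext k) (pA D v B x y q p) (v, y)
  · obtain ⟨⟨P, G, b, xG, hd⟩, -⟩ := hp2
    exact Or.inl (L.leafDec_case hd (Or.inr rfl))
  obtain ⟨F1, F2, a0, x1, y1, x2, y2, h1, h2, hm, e⟩ := h
  have hin : InPiece (Ext k) (pA D v B x y q p) (x, v) := by
    have := L.xvE
    rw [e] at this hp1 ⊢
    exact (reroot extWF h1 h2 hm this).resolve_right hp1
  clear h1 h2 hm e
  right
  obtain ⟨P, G, a, b, xG, yG, hP, hab, hba, hα, hG, hh⟩ := hin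
  have hxv := hP.wf _ (mem_del2.1 hα).1
  have oG := hG.props extWF
  have hvy := L.vyE
  rcases hh with ⟨hm, e⟩ | ⟨G', x', y', hG', hm', hm, e⟩
  · have hO := Open.leaf P a b hP hab hba
    have pf : Periph (Ext k) (pA D v B x y q p) (b, yG) := by
      rw [e]; exact periph_of extWF hO hG hm
    have pf' : Periph (Ext k) (pA D v B x y q p) (xG, b) := by
      rw [e, closeB_comm]; exact periph_of extWF hG hO hm.symm
    rw [e, mem_closeB] at hvy
    rcases hvy with h | h | h | h
    · exact absurd (h ▸ pf) hp2
    · exact absurd (h ▸ pf') hp2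
    · exact L.red_leaf hP hab hxv.1 hxv.2.1 (hP.wf _ (mem_del2.1 h).1).2.1 hG hm e
    · have : v = a := hm v hxv.2.1 (oG.wf _ h).1
      subst this
      exact (L.split hH (leafDec_op hP.wf hab) oG hm e hα h).elim
  · have hO := Open.edge P G' a b x' y' hP hab hba hG' hm'
    have oG' := hG'.props extWF
    have pf : Periph (Ext k) (pA D v B x y q p) (x', yG) := by
      rw [e]; exact periph_of extWF hO hG hm
    have pf' : Periph (Ext k) (pA D v B x y q p) (xG, y') := by
      rw [e, closeB_comm]; exact periph_of extWF hG hO hm.symm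
    rw [e, mem_closeB, mem_un] at hvy
    rcases hvy with h | h | (h | h) | h
    · exact absurd (h ▸ pf) hp2
    · exact absurd (h ▸ pf') hp2
    · exact L.red_edge hP hab hba hxv.1 hxv.2.1 (hP.wf _ (mem_del2.1 h).1).2.1 hG hG' hm' hm e
    · have : v = b := hm' v hxv.2.1 (oG'.wf _ h).1
      subst this
      have hw := hP.wf _ hab
      obtain ⟨m1, m2⟩ := meet_edge hw.1 hw.2.1 hm' hm
      rw [closeB_edge, closeB_comm] at e
      refine (L.split hH ((Open.edge P G v a xG yG hP hba hab hG m1).props extWF) oG' m2.symm e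
        (mem_un.2 (Or.inl ?_)) h).elim
      rw [del2_comm]; exact hα
    · have : v = a := hm v (vmem_un.2 (Or.inl hxv.2.1)) (oG.wf _ h).1
      subst this
      exact (L.split hH (hO.props extWF) oG hm e (mem_un.2 (Or.inl hα)) h).elim

end LS

/-- Lemma L -/
theorem side (n : ℕ) {D : Dgraph} (hIH : ∀ D', Ext k D' → D'.verts.card < D.verts.card → Dec k D') :
    ∀ {v B Γ x y q p}, LS k D v B Γ x y q p → B.card ≤ n →
    Open (Ext k) (D.pc (insert v B) ∅) x v y ∨ CB (Ext k) D := by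
  induction n with
  | zero =>
    intro v B Γ x y q p L h
    have := Finset.card_pos.2 ⟨x, L.xB⟩
    omega
  | succ n ih =>
    intro v B Γ x y q p L h
    by_cases hxy : x = y
    · subst hxy
      exact Or.inl (L.bij.leaf L.hk L.ext)
    by_cases hH : HasH (pA D v B x y q p)
    · obtain ⟨a, A1, B1, t, u, S⟩ := hH
      by_cases ha : a = v
      swap
      · exact (L.H_ne S ha).elim
      subst ha
      obtain ⟨b1, b2, hu⟩ := L.H_eq S
      have hc : A1.card + B1.card = B.card := by
        rw [← hu, Finset.card_union_of_disjoint S.1.disj]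
      have p1 := Finset.card_pos.2 ⟨t, S.1.tA⟩
      have p2 := Finset.card_pos.2 ⟨u, S.1.uB⟩
      rcases ih ⟨L.hk, L.ext, L.noH, b1⟩ (by omega) with o1 | o1
      swap
      · exact Or.inr o1
      rcases ih ⟨L.hk, L.ext, L.noH, b2⟩ (by omega) with o2 | o2
      swap
      · exact Or.inr o2
      left
      have hm : Meet (D.pc (insert a A1) ∅) (D.pc (insert a B1) ∅) a := by
        intro z h1 h2
        simp only [pc_verts, Finset.mem_insert] at h1 h2
        rcases h1 with h1 | h1
        · exact h1
        · rcases h2 with h2 | h2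
          · exact h2
          · exact absurd h2 (Finset.disjoint_left.1 S.1.disj h1)
      have := Open.seq _ _ a t y x u o1 o2 hm
      convert this using 1
      refine dg_ext (fun z => ?_) fun ⟨c, d⟩ => ?_
      · rw [vmem_una]
        simp only [pc_verts, Finset.mem_insert, ← hu, Finset.mem_union]
        constructor
        · rintro (h | h | h)
          · exact Or.inl (Or.inl h)
          · exact Or.inl (Or.inr h)
          · exact Or.inr (Or.inr h)
        · rintro ((h | h) | (h | h))
          · exact Or.inl h
          · exact Or.inr (Or.inl h)
          · exact Or.inl h
          · exact Or.inr (Or.inr h)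
      · rw [mem_una, mem_ind, mem_ind, mem_ind]
        simp only [Finset.mem_insert, ← hu, Finset.mem_union, Prod.mk.injEq]
        constructor
        · rintro ⟨h, hc, hd⟩
          have cross : c ∈ A1 → d ∈ B1 → c = t ∧ d = u := fun hc hd =>
            b1.1.cAB c hc d (Finset.mem_union_left _ hd) h
          have cross2 : c ∈ B1 → d ∈ A1 → False := by
            intro hc hd
            have := b1.1.cBA c (Finset.mem_union_left _ hc) d hd h
            have hp := L.bij.1.wB
            rw [← this.1] at hp
            exact Finset.disjoint_left.1 L.bij.1.disj (hu ▸ Finset.mem_union_right _ hc) hp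
          rcases hc with hc | hc | hc <;> rcases hd with hd | hd | hd
          · exact Or.inr (Or.inl ⟨h, Or.inl hc, Or.inl hd⟩)
          · exact Or.inr (Or.inl ⟨h, Or.inl hc, Or.inr hd⟩)
          · exact Or.inr (Or.inr ⟨h, Or.inl hc, Or.inr hd⟩)
          · exact Or.inr (Or.inl ⟨h, Or.inr hc, Or.inl hd⟩)
          · exact Or.inr (Or.inl ⟨h, Or.inr hc, Or.inr hd⟩)
          · exact Or.inl (cross hc hd)
          · exact Or.inr (Or.inr ⟨h, Or.inr hc, Or.inl hd⟩)
          · exact (cross2 hc hd).elim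
          · exact Or.inr (Or.inr ⟨h, Or.inr hc, Or.inr hd⟩)
        · rintro (⟨rfl, rfl⟩ | ⟨h, hc, hd⟩ | ⟨h, hc, hd⟩)
          · exact ⟨b1.2.1, Or.inr (Or.inl S.1.tA), Or.inr (Or.inr S.1.uB)⟩
          · exact ⟨h, hc.imp id Or.inl, hd.imp id Or.inl⟩
          · exact ⟨h, hc.imp id Or.inr, hd.imp id Or.inr⟩
    · have hcard : (pA D v B x y q p).verts.card < D.verts.card := L.bij.1.card_lt
      rcases hIH _ L.extE hcard with hb | hb | hb
      · exact (L.base_case hxy hb).elim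
      · exact absurd hb hH
      · exact L.cb_case hH hb

/-- Main decomposition theorem -/
theorem dec (hk : 3 ≤ k) (n : ℕ) : ∀ {D : Dgraph}, D.verts.card ≤ n → Ext k D → Dec k D := by
  induction n using Nat.strong_induction_on with
  | _ n ih =>
    intro D hn h
    by_cases hH : HasH D
    · exact Or.inr (Or.inl hH)
    rcases step2 hk n hn h with hb | ⟨v, A, B, t, w, u, w', S⟩
    · exact Or.inl hb
    have hIH : ∀ D', Ext k D' → D'.verts.card < D.verts.card → Dec k D' := fun D' h' hc =>
      ih _ (by omega) le_rfl h'
    by_cases h1 : (t, u) ∈ D.arcs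
    · by_cases h2 : (w', w) ∈ D.arcs
      · have b : Bij D v A B t w u w' := ⟨S, h1, h2⟩
        rcases side _ hIH ⟨hk, h, hH, b⟩ le_rfl with o1 | o1
        swap
        · exact Or.inr (Or.inr o1)
        rcases side _ hIH ⟨hk, h, hH, b.symm⟩ le_rfl with o2 | o2
        swap
        · exact Or.inr (Or.inr o2)
        exact Or.inr (Or.inr (b.cb o1 o2))
      · refine absurd ?_ hH
        have n2 : ∀ p ∈ B, ∀ q ∈ A, (p, q) ∉ D.arcs := by
          intro p hp q hq hpq
          have e := S.cBA p hp q hq hpq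
          rw [e.1, e.2] at hpq; exact h2 hpq
        exact ⟨v, A, B, t, u, ⟨S.wf, S.verts, S.disj, S.vA, S.vB, S.tA, S.tA, S.uB, S.uB, S.cAB,
          fun p hp q hq hpq => absurd hpq (n2 p hp q hq)⟩, h1, n2 u S.uB t S.tA⟩
    · have n1 : ∀ p ∈ A, ∀ q ∈ B, (p, q) ∉ D.arcs := by
        intro p hp q hq hpq
        have e := S.cAB p hp q hq hpq
        rw [e.1, e.2] at hpq; exact h1 hpq
      by_cases h2 : (w', w) ∈ D.arcs
      · refine absurd ?_ hH
        refine ⟨v, B, A, w', w, ⟨S.wf, S.symm.verts, S.disj.symm, S.vB, S.vA, S.wB, S.wB, S.wA, S.wA,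
          S.cBA, fun p hp q hq hpq => absurd hpq (n1 p hp q hq)⟩, h2, n1 w S.wA w' S.wB⟩
      · have n2 : ∀ p ∈ B, ∀ q ∈ A, (p, q) ∉ D.arcs := by
          intro p hp q hq hpq
          have e := S.cBA p hp q hq hpq
          rw [e.1, e.2] at hpq; exact h2 hpq
        exfalso
        obtain ⟨p, hp, q, hq, hqv, hqA, hpq⟩ := Crit.nocut h.toCrit v S.vV A
          (fun z hz => S.memV.2 (Or.inr (Or.inl hz))) ⟨t, S.tA⟩ S.vA
          ⟨u, S.memV.2 (Or.inr (Or.inr S.uB)), fun e => S.vB (e ▸ S.uB),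
            fun hh => Finset.disjoint_left.1 S.disj hh S.uB⟩
        have hqB : q ∈ B := ((S.memV.1 hq).resolve_left hqv).resolve_left hqA
        rcases hpq with hpq | hpq
        · exact n1 p hp q hqB hpq
        · exact n2 q hqB p hp hpq

end Dgraph

namespace Dgraph
open Relation
variable {k : ℕ}

/-! ### From extremal digraphs to the class -/

def mp (σ : Equiv.Perm ℕ) (D : Dgraph) : Dgraph :=
  ⟨D.verts.map σ.toEmbedding, D.arcs.map (σ.prodCongr σ).toEmbedding⟩

theorem mem_mpV {σ : Equiv.Perm ℕ} {D : Dgraph} {x : ℕ} :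
    x ∈ (mp σ D).verts ↔ σ.symm x ∈ D.verts := by
  simp only [mp, Finset.mem_map_equiv]

theorem mem_mp {σ : Equiv.Perm ℕ} {D : Dgraph} {x y : ℕ} :
    (x, y) ∈ (mp σ D).arcs ↔ (σ.symm x, σ.symm y) ∈ D.arcs := by
  simp only [mp, Finset.mem_map_equiv]
  rfl

theorem acy_comap {r s : ℕ → ℕ → Prop} (f : ℕ → ℕ)
    (h : ∀ p q, s p q → r (f p) (f q)) (hr : Acy r) : Acy s := fun p q hpq hqp =>
  hr _ _ (h p q hpq) (ReflTransGen.lift f (fun a b => h a b) _ _ hqp)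

theorem Ext.mp {D : Dgraph} (h : Ext k D) (σ : Equiv.Perm ℕ) : Ext k (mp σ D) := by
  refine ⟨⟨?_, ?_, ?_, ?_⟩, ?_⟩
  · rintro ⟨a, b⟩ ha
    have := h.wf _ (mem_mp.1 ha)
    exact ⟨mem_mpV.2 this.1, mem_mpV.2 this.2.1, fun e => this.2.2 (congrArg σ.symm e)⟩
  · rintro ⟨φ, hφ⟩
    refine h.nc ⟨fun x => φ (σ x), ?_⟩
    refine acy_comap σ ?_ hφ
    rintro p q ⟨h1, h2⟩
    exact ⟨mem_mp.2 (by simpa using h1), h2⟩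
  · rintro ⟨a, b⟩ ha
    obtain ⟨φ, hφ⟩ := h.amin _ (mem_mp.1 ha)
    refine ⟨fun x => φ (σ.symm x), ?_⟩
    refine acy_comap σ.symm ?_ hφ
    rintro p q ⟨h1, h2⟩
    obtain ⟨n, h1⟩ := Finset.mem_erase.1 h1
    refine ⟨Finset.mem_erase.2 ⟨?_, mem_mp.1 h1⟩, h2⟩
    intro e
    obtain ⟨e1, e2⟩ := Prod.mk.inj e
    exact n (Prod.ext (σ.symm.injective e1) (σ.symm.injective e2))
  · intro x hx
    obtain ⟨⟨a, b⟩, ha, hab⟩ := h.noiso _ (mem_mpV.1 hx)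
    refine ⟨(σ a, σ b), mem_mp.2 (by simpa using ha), ?_⟩
    rcases hab with e | e
    · left; simp only at e ⊢; rw [e]; simp
    · right; simp only at e ⊢; rw [e]; simp
  · intro u hu v hv huv
    obtain ⟨X, h1, h2, h3⟩ := h.cc _ (mem_mpV.1 hu) _ (mem_mpV.1 hv) (fun e => huv (σ.symm.injective e))
    refine ⟨X.map σ.toEmbedding, Finset.mem_map_equiv.2 h1, fun hh => h2 (Finset.mem_map_equiv.1 hh),
      le_trans (Finset.card_le_card_of_injOn (fun a => (σ.symm a.1, σ.symm a.2)) ?_ ?_) h3⟩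
    · rintro ⟨a, b⟩ ha
      have ha := mem_cut.1 (Finset.mem_coe.1 ha)
      refine Finset.mem_coe.2 (mem_cut.2 ⟨mem_mp.1 ha.1, Finset.mem_map_equiv.1 ha.2.1,
        fun hh => ha.2.2 (Finset.mem_map_equiv.2 hh)⟩)
    · rintro ⟨a, b⟩ - ⟨c, d⟩ - e
      obtain ⟨e1, e2⟩ := Prod.mk.inj e
      exact Prod.ext (σ.symm.injective e1) (σ.symm.injective e2)

theorem HStr.join {D : Dgraph} {v A B t u} (S : HStr D v A B t u) (hk : 3 ≤ k) (h : Ext k D)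
    {f : ℕ} (hf : f ∉ D.verts) :
    IsDirHajosJoin D (pA D v A t t u u) (mp (Equiv.swap v f) (pA D v B u u t t)) := by
  have T := S.1
  have hd := Finset.disjoint_left.1 T.disj
  have e1 := T.ext_pA hk h (Or.inl rfl)
  have e2 := T.symm.ext_pA hk h (Or.inl rfl)
  have n1 := T.tv_new (by omega) h e1.toCrit S.2.1
  have n2 := T.symm.vw_new (by omega) h e2.toCrit S.2.1
  have m1 : ∀ a b, (a, b) ∈ (pA D v A t t u u).arcs ↔
      ((a, b) ∈ D.arcs ∧ a ∈ insert v A ∧ b ∈ insert v A) ∨ (a = t ∧ b = v) := by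
    intro a b
    rw [pA, mem_pc, mem_EA]
    simp only [S.2.1, S.2.2, true_and, false_and, or_false, Prod.mk.injEq]
  have m2 : ∀ a b, (a, b) ∈ (pA D v B u u t t).arcs ↔
      ((a, b) ∈ D.arcs ∧ a ∈ insert v B ∧ b ∈ insert v B) ∨ (a = v ∧ b = u) := by
    intro a b
    rw [pA, mem_pc, mem_EA]
    simp only [S.2.1, S.2.2, true_and, false_and, false_or, Prod.mk.injEq]
  have hV : ∀ z, z ∈ D.verts ↔ z = v ∨ z ∈ A ∨ z ∈ B := fun z => T.memV
  have vf : v ≠ f := fun e => hf (e ▸ T.vV)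
  have Af : ∀ z ∈ A, z ≠ f := fun z hz e => hf (e ▸ (hV z).2 (Or.inr (Or.inl hz)))
  have Bf : ∀ z ∈ B, z ≠ f := fun z hz e => hf (e ▸ (hV z).2 (Or.inr (Or.inr hz)))
  have Av : ∀ z ∈ A, z ≠ v := fun z hz e => T.vA (e ▸ hz)
  have Bv : ∀ z ∈ B, z ≠ v := fun z hz e => T.vB (e ▸ hz)
  have sB : ∀ z ∈ B, Equiv.swap v f z = z := fun z hz => Equiv.swap_apply_of_ne_of_ne (Bv z hz) (Bf z hz)
  have v2 : ∀ z, z ∈ (mp (Equiv.swap v f) (pA D v B u u t t)).verts ↔ z = f ∨ z ∈ B := by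
    intro z
    rw [mem_mpV, Equiv.symm_swap, pA, pc_verts, Finset.mem_insert]
    constructor
    · rintro (h | h)
      · left
        have := congrArg (Equiv.swap v f) h
        simpa using this
      · right
        have := sB _ h
        rw [Equiv.swap_apply_self] at this
        rw [← this] at h; exact h
    · rintro (rfl | h)
      · left; simp
      · right; rw [sB z h]; exact h
  have rv : ∀ a : ℕ × ℕ, renArc v v a = a := by
    rintro ⟨a, b⟩
    simp only [renArc, ren]
    by_cases h1 : a = v <;> by_cases h2 : b = v <;> simp [h1, h2]
  have rA : ∀ z ∈ insert v A, ren f v z = z := by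
    intro z hz
    have : z ≠ f := by
      rcases Finset.mem_insert.1 hz with rfl | hz
      · exact vf
      · exact Af z hz
    simp [ren, this]
  have rB : ∀ z ∈ insert v B, ren f v (Equiv.swap v f z) = z := by
    intro z hz
    rcases Finset.mem_insert.1 hz with rfl | hz
    · simp [ren]
    · rw [sB z hz]; simp [ren, Bf z hz]
  refine ⟨t, v, f, u, v, e1.wf, (e2.mp _).wf, ?_, (m1 _ _).2 (Or.inr ⟨rfl, rfl⟩), ?_, ?_, ?_, ?_⟩
  · rw [Finset.disjoint_left]
    intro z hz hz'
    rw [pA, pc_verts] at hz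
    rcases (v2 z).1 hz' with rfl | h
    · rcases Finset.mem_insert.1 hz with rfl | hz
      · exact vf rfl
      · exact Af z hz rfl
    · rcases Finset.mem_insert.1 hz with rfl | hz
      · exact T.vB h
      · exact hd hz h
  · rw [mem_mp, Equiv.symm_swap, Equiv.swap_apply_right, sB u T.uB]
    exact (m2 _ _).2 (Or.inr ⟨rfl, rfl⟩)
  · simp only [Finset.mem_union, Finset.mem_erase, v2]
    rintro (h | ⟨h, h' | h'⟩)
    · exact h.1 rfl
    · exact h h'
    · exact T.vB h'
  · ext z
    rw [hV]
    have v1 : ∀ z, z ∈ (pA D v A t t u u).verts ↔ z = v ∨ z ∈ A := fun z => by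
      rw [pA, pc_verts, Finset.mem_insert]
    simp only [Finset.mem_insert, Finset.mem_union, Finset.mem_erase, v1, v2]
    constructor
    · rintro (h | h | h)
      · exact Or.inl h
      · exact Or.inr (Or.inl ⟨Av z h, Or.inr h⟩)
      · exact Or.inr (Or.inr ⟨Bf z h, Or.inr h⟩)
    · rintro (h | ⟨h, h' | h'⟩ | ⟨h, h' | h'⟩)
      · exact Or.inl h
      · exact absurd h' h
      · exact Or.inr (Or.inl h')
      · exact absurd h' h
      · exact Or.inr (Or.inr h')
  · ext ⟨c, d⟩
    simp only [rv, Finset.mem_insert, Finset.mem_image, Finset.mem_union, Finset.mem_erase,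
      Prod.mk.injEq]
    constructor
    · intro hcd
      have hw := h.wf _ hcd
      have inA : c ∈ insert v A → d ∈ insert v A → _ := fun hc hd =>
        (Or.inr ⟨(c, d), Or.inl ⟨fun e => n1 (e ▸ hcd), (m1 c d).2 (Or.inl ⟨hcd, hc, hd⟩)⟩, by
          simp only [renArc, rA c hc, rA d hd]⟩ : (c = t ∧ d = u) ∨ ∃ a, (¬ a = (t, v) ∧
            a ∈ (pA D v A t t u u).arcs ∨ ¬ a = (f, u) ∧ a ∈ (mp (Equiv.swap v f) (pA D v B u u t t)).arcs) ∧
            renArc f v a = (c, d))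
      have inB : c ∈ insert v B → d ∈ insert v B → _ := fun hc hd =>
        (Or.inr ⟨(Equiv.swap v f c, Equiv.swap v f d), Or.inr ⟨?_, ?_⟩, by
          simp only [renArc, rB c hc, rB d hd]⟩ : (c = t ∧ d = u) ∨ ∃ a, (¬ a = (t, v) ∧
            a ∈ (pA D v A t t u u).arcs ∨ ¬ a = (f, u) ∧ a ∈ (mp (Equiv.swap v f) (pA D v B u u t t)).arcs) ∧
            renArc f v a = (c, d))
      rotate_left
      · intro e
        obtain ⟨e1, e2⟩ := Prod.mk.inj e
        have e3 : c = v := by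
          have := congrArg (Equiv.swap v f) e1; simpa using this
        have e4 : d = u := by
          have := rB d hd
          rw [e2] at this
          simpa [ren, Bf u T.uB] using this.symm
        rw [e3, e4] at hcd; exact n2 hcd
      · rw [mem_mp, Equiv.symm_swap, Equiv.swap_apply_self, Equiv.swap_apply_self]
        exact (m2 c d).2 (Or.inl ⟨hcd, hc, hd⟩)
      rcases (hV c).1 hw.1 with hc | hc | hc <;> rcases (hV d).1 hw.2.1 with hd' | hd' | hd'
      · exact inA (by simp [hc]) (by simp [hd'])
      · exact inA (by simp [hc]) (by simp [hd'])
      · exact inB (by simp [hc]) (by simp [hd'])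
      · exact inA (by simp [hc]) (by simp [hd'])
      · exact inA (by simp [hc]) (by simp [hd'])
      · exact Or.inl (T.cAB c hc d hd' hcd)
      · exact inB (by simp [hc]) (by simp [hd'])
      · have := T.cBA c hc d hd' hcd
        rw [this.1, this.2] at hcd
        exact absurd hcd S.2.2
      · exact inB (by simp [hc]) (by simp [hd'])
    · rintro (⟨rfl, rfl⟩ | ⟨⟨a, b⟩, h1 | h1, h2⟩)
      · exact S.2.1
      · rcases (m1 a b).1 h1.2 with h3 | ⟨rfl, rfl⟩
        · simp only [renArc, rA a h3.2.1, rA b h3.2.2] at h2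
          rw [← h2]; exact h3.1
        · exact absurd rfl h1.1
      · have h3 := h1.2
        rw [mem_mp, Equiv.symm_swap] at h3
        have ea : Equiv.swap v f (Equiv.swap v f a) = a := by simp
        have eb : Equiv.swap v f (Equiv.swap v f b) = b := by simp
        rcases (m2 _ _).1 h3 with h4 | ⟨h4, h5⟩
        · have r1 := rB _ h4.2.1
          have r2 := rB _ h4.2.2
          rw [ea] at r1
          rw [eb] at r2
          simp only [renArc, r1, r2] at h2
          rw [← h2]; exact h4.1
        · refine absurd ?_ h1.1
          rw [← ea, ← eb, h4, h5, sB u T.uB]; simp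

theorem hclass (hk : 3 ≤ k) (n : ℕ) : ∀ {D : Dgraph}, D.verts.card ≤ n → Ext k D → HClass k D := by
  induction n using Nat.strong_induction_on with
  | _ n ih =>
    intro D hn h
    rcases dec hk n hn h with (⟨h1, h2⟩ | ⟨h1, h2⟩) | ⟨v, A, B, t, u, S⟩ |
      ⟨F1, F2, v, x1, y1, x2, y2, h1, h2, hm, e⟩
    · exact HClass.wheel D h1 h2
    · exact HClass.complete D h1 h2
    · obtain ⟨f, hf⟩ := Infinite.exists_notMem_finset D.verts
      have c1 : (pA D v A t t u u).verts.card < D.verts.card := S.1.card_lt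
      have c2 : (pA D v B u u t t).verts.card < D.verts.card := S.1.symm.card_lt
      refine HClass.dirJoin D _ _ (ih _ (by omega) le_rfl (S.1.ext_pA hk h (Or.inl rfl)))
        (ih _ (lt_of_lt_of_le ?_ hn) le_rfl ((S.1.symm.ext_pA hk h (Or.inl rfl)).mp _)) (S.join hk h hf)
      rw [mp, Finset.card_map]
      exact c2
    · obtain ⟨m, g, Ds, hD, hJ⟩ := closing extWF h1 h2 hm
      rw [← e] at hJ
      have o1 := h1.props extWF
      have o2 := h2.props extWF
      have hV : D.verts = F1.verts ∪ F2.verts := by rw [e]; rfl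
      refine HClass.treeJoin D m g Ds (fun i => ?_) hJ
      obtain ⟨q1, q2, q3⟩ := hD i
      refine ih _ (lt_of_lt_of_le (Finset.card_lt_card ?_) hn) le_rfl q1
      rw [Finset.ssubset_iff_of_subset (hV ▸ q2), hV]
      rcases q3 with q3 | q3
      · exact ⟨x2, Finset.mem_union_right _ o2.x, fun hh => o2.xv (hm x2 (q3 hh) o2.x)⟩
      · exact ⟨x1, Finset.mem_union_left _ o1.x, fun hh => o1.xv (hm x1 o1.x (q3 hh))⟩

end Dgraph

namespace Dgraph
open Relation
variable {k : ℕ}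

theorem Good.ne {D : Dgraph} {φ : ℕ → Fin k} (h : D.Good φ) {p q : ℕ} (h1 : (p, q) ∈ D.arcs)
    (h2 : (q, p) ∈ D.arcs) : φ p ≠ φ q := fun e =>
  h p q ⟨h1, e⟩ (.single ⟨h2, e.symm⟩)

theorem nc_arc {D : Dgraph} (h : ¬ D.Col k) {ψ : ℕ → Fin k} {a b : ℕ}
    (hψ : Good ⟨D.verts, D.arcs.erase (a, b)⟩ ψ) :
    ReflTransGen (mono ⟨D.verts, D.arcs.erase (a, b)⟩ ψ) b a := by
  by_contra hn
  refine h ⟨ψ, ?_⟩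
  refine Acy.mono ?_ (acy_add (P := ψ a = ψ b) (x := a) (y := b) hψ fun _ => hn)
  rintro p q ⟨h1, h2⟩
  by_cases e : (p, q) = (a, b)
  · obtain ⟨rfl, rfl⟩ := Prod.mk.inj e
    exact Or.inr ⟨h2, rfl, rfl⟩
  · exact Or.inl ⟨Finset.mem_erase.2 ⟨e, h1⟩, h2⟩

theorem nc_wheel {D : Dgraph} (h : IsSymOddWheel D) : ¬ D.Col 3 := by
  rintro ⟨φ, hφ⟩
  obtain ⟨p, x, h1, h2, hp, hx, hV, hA⟩ := h
  have hub : ∀ y ∈ p, φ y ≠ φ x := fun y hy => hφ.ne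
    (by rw [hA, mem_wheel]; exact Or.inr (Or.inr (Or.inr ⟨hy, rfl⟩)))
    (by rw [hA, mem_wheel]; exact Or.inr (Or.inr (Or.inl ⟨rfl, hy⟩)))
  have dec : ∀ a b c : Fin 3, a ≠ c → b ≠ c → a ≠ b → (b = c + 1 ↔ ¬ a = c + 1) := by decide
  have hn : ∀ i (hi : i < p.length), (φ (p[(i + 1) % p.length]'(Nat.mod_lt _ (by omega))) = φ x + 1 ↔
      ¬ φ p[i] = φ x + 1) := fun i hi => by
    have hc : (p[i], p[(i + 1) % p.length]'(Nat.mod_lt _ (by omega))) ∈ cycArcs p :=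
      mem_cycArcs.2 ⟨i, hi, rfl, rfl⟩
    exact dec _ _ _ (hub _ (List.getElem_mem _)) (hub _ (List.getElem_mem _)) (hφ.ne
      (by rw [hA, mem_wheel]; exact Or.inl hc) (by rw [hA, mem_wheel]; exact Or.inr (Or.inl hc)))
  have key : ∀ i (hi : i < p.length), (φ p[i] = φ x + 1 ↔ (Even i ↔ φ (p[0]'(by omega)) = φ x + 1)) := by
    intro i
    induction i with
    | zero => intro hi; simp
    | succ i ih =>
      intro hi
      have := hn i (by omega)
      simp only [Nat.mod_eq_of_lt hi] at this
      rw [this, ih (by omega), Nat.even_add_one]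
      by_cases hE : Even i <;> simp [hE]
  have a := hn (p.length - 1) (by omega)
  have b := key (p.length - 1) (by omega)
  have ev : Even (p.length - 1) := by
    obtain ⟨m, hm⟩ := h2
    exact ⟨m, by omega⟩
  have e : (p.length - 1 + 1) % p.length = 0 := by
    rw [Nat.sub_add_cancel (by omega), Nat.mod_self]
  simp only [e] at a
  by_cases hh : φ (p[0]'(by omega)) = φ x + 1
  · exact a.1 hh (b.2 ⟨fun _ => hh, fun _ => ev⟩)
  · exact hh (a.2 fun hb => hh ((b.1 hb).1 ev))

theorem nc_complete {D : Dgraph} (h : IsBiComplete D (k + 1)) : ¬ D.Col k := by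
  rintro ⟨φ, hφ⟩
  obtain ⟨hc, hA⟩ := h
  obtain ⟨x, hx, y, hy, hne, he⟩ := Finset.exists_ne_map_eq_of_card_lt_of_maps_to
    (s := D.verts) (t := (Finset.univ : Finset (Fin k))) (f := φ) (by simp [hc]) (by simp [Set.MapsTo])
  refine hφ.ne ?_ ?_ he <;> rw [hA] <;> simp [hx, hy, hne, Ne.symm hne]

theorem nc_dirJoin {D D1 D2 : Dgraph} (h1 : ¬ D1.Col k) (h2 : ¬ D2.Col k)
    (h : IsDirHajosJoin D D1 D2) : ¬ D.Col k := by
  rintro ⟨φ, hφ⟩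
  obtain ⟨u, v1, v2, w, v, w1, w2, hd, ha1, ha2, -, -, hA⟩ := h
  let g : ℕ → ℕ := fun z => ren v2 v (ren v1 v z)
  have hg : ∀ p q, (p, q) ∈ (D1.arcs.erase (u, v1)) ∪ (D2.arcs.erase (v2, w)) →
      (g p, g q) ∈ D.arcs := fun p q hpq => by
    rw [hA]; exact Finset.mem_insert_of_mem (Finset.mem_image.2 ⟨(p, q), hpq, rfl⟩)
  have d12 : ∀ x ∈ D1.verts, ∀ y ∈ D2.verts, x ≠ y := fun x hx y hy e =>
    Finset.disjoint_left.1 hd hx (e ▸ hy)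
  have gv1 : g v1 = v := by simp [g, ren]
  have gv2 : g v2 = v := by
    have := d12 _ (w1 _ ha1).2.1 _ (w2 _ ha2).1
    simp [g, ren, Ne.symm this]
  have gu : g u = u := by
    have := d12 _ (w1 _ ha1).1 _ (w2 _ ha2).1
    have h' := (w1 _ ha1).2.2
    dsimp at this h'
    simp [g, ren, this, h']
  have gw : g w = w := by
    have := d12 _ (w1 _ ha1).2.1 _ (w2 _ ha2).2.1
    have h' := (w2 _ ha2).2.2
    dsimp at this h'
    simp [g, ren, Ne.symm this, Ne.symm h']
  have s1 : ∀ p q, mono ⟨D1.verts, D1.arcs.erase (u, v1)⟩ (fun z => φ (g z)) p q →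
      D.mono φ (g p) (g q) := fun p q h =>
    ⟨hg p q (Finset.mem_union_left _ h.1), h.2⟩
  have s2 : ∀ p q, mono ⟨D2.verts, D2.arcs.erase (v2, w)⟩ (fun z => φ (g z)) p q →
      D.mono φ (g p) (g q) := fun p q h =>
    ⟨hg p q (Finset.mem_union_right _ h.1), h.2⟩
  have r1 := ReflTransGen.lift g s1 _ _ (nc_arc h1 (acy_comap g s1 hφ))
  have r2 := ReflTransGen.lift g s2 _ _ (nc_arc h2 (acy_comap g s2 hφ))
  rw [Function.onFun, gv1, gu] at r1
  rw [Function.onFun, gv2, gw] at r2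
  have r := r2.trans r1
  exact hφ u w ⟨by rw [hA]; exact Finset.mem_insert_self _ _, (rtg_mono_color r).symm⟩ r

theorem tree_leaf {n : ℕ} {e : Fin n → ℕ × ℕ} (h : IsTree n e) : ∃ x, x ∈ leafSet n e := by
  by_contra hn
  push Not at hn
  have hc := h.2.2.2
  have h1 : ∀ x ∈ treeVerts n e,
      2 ≤ (Finset.univ.filter fun i : Fin n => (e i).1 = x ∨ (e i).2 = x).card := by
    intro x hx
    have h0 : (Finset.univ.filter fun i : Fin n => (e i).1 = x ∨ (e i).2 = x).Nonempty := by
      simp only [treeVerts, Finset.mem_union, Finset.mem_image, Finset.mem_univ, true_and] at hx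
      rcases hx with ⟨i, hi⟩ | ⟨i, hi⟩
      · exact ⟨i, by simp [hi]⟩
      · exact ⟨i, by simp [hi]⟩
    have h2 := hn x
    simp only [leafSet, Finset.mem_filter, hx, true_and] at h2
    have := h0.card_pos
    omega
  have h2 := Finset.sum_card_bipartiteAbove_eq_sum_card_bipartiteBelow
    (s := treeVerts n e) (t := (Finset.univ : Finset (Fin n)))
    (fun x i => (e i).1 = x ∨ (e i).2 = x)
  have h3 : 2 * (n + 1) ≤ ∑ a ∈ treeVerts n e, (Finset.bipartiteAbove
      (fun x i => (e i).1 = x ∨ (e i).2 = x) Finset.univ a).card := by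
    rw [← hc, mul_comm, ← smul_eq_mul]
    exact Finset.card_nsmul_le_sum _ _ _ h1
  have h4 : ∑ i : Fin n, (Finset.bipartiteBelow
      (fun x i => (e i).1 = x ∨ (e i).2 = x) (treeVerts n e) i).card ≤ n * 2 := by
    have := Finset.sum_le_card_nsmul (Finset.univ : Finset (Fin n)) (fun i => (Finset.bipartiteBelow
      (fun x i => (e i).1 = x ∨ (e i).2 = x) (treeVerts n e) i).card) 2 ?_
    · simpa using this
    · intro i _
      refine le_trans (Finset.card_le_card (t := {(e i).1, (e i).2}) ?_) Finset.card_le_two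
      intro x hx
      rcases (Finset.mem_filter.1 hx).2 with h | h <;> simp [h]
  omega

theorem nc_treeJoin {D : Dgraph} {n : ℕ} {e : Fin n → ℕ × ℕ} {Ds : Fin n → Dgraph}
    (h : ∀ i, ¬ (Ds i).Col k) (hj : IsHajosTreeJoin D n e Ds) : ¬ D.Col k := by
  rintro ⟨φ, hφ⟩
  obtain ⟨⟨hT, hwf, -, -, -⟩, L, hL, rfl⟩ := hj
  set C := L.filter fun x => decide (x ∈ leafSet n e) with hC
  have heq : ∀ i, φ (e i).1 = φ (e i).2 := by
    intro i
    by_contra hne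
    refine h i ⟨φ, hφ.of_imp fun p q hpq hc => ⟨?_, hc⟩⟩
    refine Finset.mem_union_left _ (Finset.mem_biUnion.2 ⟨i, Finset.mem_univ _, ?_⟩)
    simp only [Finset.mem_sdiff, Finset.mem_insert, Finset.mem_singleton]
    refine ⟨hpq, ?_⟩
    rintro (h' | h')
    · rw [← h'] at hne; exact hne hc
    · rw [← Prod.swap_swap (e i), ← h'] at hne; exact hne hc.symm
  have hre : ∀ a b, (treeDigraph n e).UReach a b → φ a = φ b := by
    intro a b hab
    have h1 : ∀ p q, (p, q) ∈ (treeDigraph n e).arcs → φ p = φ q := by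
      intro p q hpq
      simp only [treeDigraph, Finset.mem_union, Finset.mem_image, Finset.mem_univ, true_and] at hpq
      rcases hpq with ⟨i, hi⟩ | ⟨i, hi⟩
      · have := heq i; rw [hi] at this; exact this
      · have := heq i; rw [← Prod.swap_swap (e i), hi] at this; exact this.symm
    exact hab.rec rfl fun _ hbc ih => ih.trans (hbc.elim (h1 _ _) fun h => (h1 _ _ h).symm)
  obtain ⟨x, hx⟩ := tree_leaf hT
  have hxV : x ∈ treeVerts n e := (Finset.mem_filter.1 hx).1
  have hxL : x ∈ L := by
    have hz : ∀ a : ℕ × ℕ, a ∈ (treeDigraph n e).arcs → a.1 ∈ L ∧ a.2 ∈ L := by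
      rintro ⟨a, b⟩ ha
      have h' : (a, b) ∈ (treeDigraph n e).arcs.val := ha
      rw [← hL, Multiset.mem_coe] at h'
      have := List.of_mem_zip h'
      exact ⟨this.1, by simpa using this.2⟩
    simp only [treeVerts, Finset.mem_union, Finset.mem_image, Finset.mem_univ, true_and] at hxV
    have hi : ∀ i, (e i).1 ∈ L ∧ (e i).2 ∈ L := fun i =>
      hz (e i) (Finset.mem_union_left _ (Finset.mem_image.2 ⟨i, Finset.mem_univ _, rfl⟩))
    rcases hxV with ⟨i, rfl⟩ | ⟨i, rfl⟩
    · exact (hi i).1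
    · exact (hi i).2
  have hxC : x ∈ C := List.mem_filter.2 ⟨hxL, by simpa using hx⟩
  have hpos : 0 < C.length := List.length_pos_of_mem hxC
  let g : ℕ → ℕ := fun j => C[j % C.length]'(Nat.mod_lt _ hpos)
  have hg : ∀ j, (joinOf n e Ds C).mono φ (g j) (g (j + 1)) := fun j => by
    refine ⟨Finset.mem_union_right _ (mem_cycArcs.2 ⟨j % C.length, Nat.mod_lt _ hpos, rfl, ?_⟩), ?_⟩
    · simp only [g, Nat.mod_add_mod]
    · have hV : ∀ j, g j ∈ (treeDigraph n e).verts := fun j => by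
        have := (List.mem_filter.1 (List.getElem_mem (Nat.mod_lt j hpos) : g j ∈ C)).2
        exact (Finset.mem_filter.1 (of_decide_eq_true this)).1
      exact hre _ _ (hT.2.2.1.2 _ (hV j) _ (hV (j + 1)))
  have hr : ∀ j, ReflTransGen ((joinOf n e Ds C).mono φ) (g 1) (g (1 + j)) := fun j => by
    induction j with
    | zero => exact .refl
    | succ j ih => exact ih.tail (hg _)
  have := hr (C.length - 1)
  rw [Nat.add_sub_cancel' hpos] at this
  have e0 : g C.length = g 0 := by simp [g]
  rw [e0] at this
  exact hφ _ _ (hg 0) this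

theorem HClass.nc {D : Dgraph} (h : HClass k D) : ¬ D.Col k := by
  induction h with
  | wheel D hk h => subst hk; exact nc_wheel h
  | complete D hk h => exact nc_complete h
  | dirJoin D D1 D2 _ _ h i1 i2 => exact nc_dirJoin i1 i2 h
  | treeJoin D n e Ds _ hj ih => exact nc_treeJoin ih hj

end Dgraph

namespace Dgraph
open Relation
variable {k : ℕ}

def bal (F : Finset (ℕ × ℕ)) (X : Finset ℕ) : ℤ :=
  ∑ a ∈ F, ((if a.1 ∈ X then 1 else 0) - if a.2 ∈ X then 1 else 0)

theorem bal_insert {F : Finset (ℕ × ℕ)} {a b : ℕ} (h : (a, b) ∉ F) (X : Finset ℕ) :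
    bal (insert (a, b) F) X = bal F X + (if a ∈ X then 1 else 0) - if b ∈ X then 1 else 0 := by
  rw [bal, Finset.sum_insert h, bal]; ring

theorem bal_erase {F : Finset (ℕ × ℕ)} {a b : ℕ} (h : (a, b) ∈ F) (X : Finset ℕ) :
    bal (F.erase (a, b)) X = bal F X - (if a ∈ X then 1 else 0) + if b ∈ X then 1 else 0 := by
  have := bal_insert (Finset.notMem_erase (a, b) F) X
  rw [Finset.insert_erase h] at this
  rw [this]; ring

def res (A F : Finset (ℕ × ℕ)) (p q : ℕ) : Prop := ((p, q) ∈ A ∧ (p, q) ∉ F) ∨ (q, p) ∈ F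

theorem chain_of_off {R S : ℕ → ℕ → Prop} {a : ℕ} : ∀ {l : List ℕ}, a ∉ l →
    (∀ p q, p ≠ a → q ≠ a → R p q → S p q) → l.IsChain R → l.IsChain S
  | [], _, _, _ => by simp
  | [x], _, _, _ => by simp
  | x :: y :: l, ha, h, hc => by
    rw [List.isChain_cons_cons] at hc ⊢
    simp only [List.mem_cons, not_or] at ha
    exact ⟨h _ _ (Ne.symm ha.1) (Ne.symm ha.2.1) hc.1,
      chain_of_off (by simp [ha.2.1, ha.2.2]) h hc.2⟩

theorem aug {A : Finset (ℕ × ℕ)} : ∀ (l : List ℕ) (a b : ℕ) (F : Finset (ℕ × ℕ)), F ⊆ A →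
    l.Nodup → l.head? = some a → l.getLast? = some b → l.IsChain (res A F) →
    ∃ F' ⊆ A, ∀ X, bal F' X = bal F X + (if a ∈ X then 1 else 0) - if b ∈ X then 1 else 0
  | [], _, _, _, _, _, h, _, _ => by simp at h
  | [x], a, b, F, hF, _, h, h', _ => by
    simp at h h'; subst h; subst h'
    exact ⟨F, hF, fun X => by ring⟩
  | x :: y :: l, a, b, F, hF, hn, h, h', hc => by
    simp at h; subst h
    rw [List.isChain_cons_cons] at hc
    rw [List.nodup_cons] at hn
    obtain ⟨F1, hF1, hb, hr⟩ : ∃ F1 ⊆ A, (∀ X, bal F1 X = bal F X + (if x ∈ X then 1 else 0) -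
        if y ∈ X then 1 else 0) ∧ ∀ p q, p ≠ x → q ≠ x → res A F p q → res A F1 p q := by
      rcases hc.1 with ⟨h1, h2⟩ | h1
      · refine ⟨insert (x, y) F, Finset.insert_subset h1 hF, bal_insert h2, ?_⟩
        rintro p q hp hq (⟨h3, h4⟩ | h3)
        · refine Or.inl ⟨h3, fun h5 => ?_⟩
          rcases Finset.mem_insert.1 h5 with h5 | h5
          · exact hp (Prod.mk.inj h5).1
          · exact h4 h5
        · exact Or.inr (Finset.mem_insert_of_mem h3)
      · refine ⟨F.erase (y, x), (Finset.erase_subset _ _).trans hF, fun X => ?_, ?_⟩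
        · rw [bal_erase h1]; ring
        · rintro p q hp hq (⟨h3, h4⟩ | h3)
          · exact Or.inl ⟨h3, fun h5 => h4 (Finset.mem_of_mem_erase h5)⟩
          · exact Or.inr (Finset.mem_erase.2 ⟨fun e => hp (Prod.mk.inj e).2, h3⟩)
    obtain ⟨F', h1, h2⟩ := aug (y :: l) y b F1 hF1 hn.2 rfl (by simpa using h')
      (chain_of_off hn.1 hr hc.2)
    exact ⟨F', h1, fun X => by rw [h2, hb]; ring⟩

theorem bal_path : ∀ (l : List ℕ) (a b : ℕ), l.Nodup → l.head? = some a → l.getLast? = some b →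
    ∀ X, bal (arcsOf l) X = (if a ∈ X then 1 else 0) - if b ∈ X then 1 else 0
  | [], _, _, _, h, _, _ => by simp at h
  | [x], a, b, _, h, h', X => by
    simp at h h'; subst h; subst h'
    simp [arcsOf, bal]
  | x :: y :: l, a, b, hn, h, h', X => by
    simp at h; subst h
    rw [List.nodup_cons] at hn
    have e : arcsOf (x :: y :: l) = insert (x, y) (arcsOf (y :: l)) := by simp [arcsOf]
    rw [e, bal_insert, bal_path (y :: l) y b hn.2 rfl (by simpa using h')]
    · ring
    · intro h1
      exact hn.1 (List.of_mem_zip (List.mem_toFinset.1 h1)).1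

theorem arcs_path {R : ℕ → ℕ → Prop} : ∀ (l : List ℕ), l.IsChain R → ∀ a ∈ arcsOf l, R a.1 a.2
  | [], _ => by simp [arcsOf]
  | [x], _ => by simp [arcsOf]
  | x :: y :: l, h => by
    rw [List.isChain_cons_cons] at h
    have e : arcsOf (x :: y :: l) = insert (x, y) (arcsOf (y :: l)) := by simp [arcsOf]
    rw [e]
    intro a ha
    rcases Finset.mem_insert.1 ha with rfl | ha
    · exact h.1
    · exact arcs_path _ h.2 a ha

theorem exists_flow {D : Dgraph} (hD : D.WF) {u v : ℕ} (hu : u ∈ D.verts) {m : ℕ}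
    (h : ∀ X : Finset ℕ, u ∈ X → v ∉ X → m ≤ D.dO X) : ∀ j ≤ m, ∃ F ⊆ D.arcs,
      ∀ X, bal F X = j * ((if u ∈ X then 1 else 0) - if v ∈ X then 1 else 0) := by
  classical
  intro j
  induction j with
  | zero => exact fun _ => ⟨∅, by simp, fun X => by simp [bal]⟩
  | succ j ih =>
    intro hj
    obtain ⟨F, hF, hb⟩ := ih (by omega)
    by_cases hr : ReflTransGen (res D.arcs F) u v
    · obtain ⟨l, h1, h2, h3, h4, -⟩ := exists_nodup_path hr
      obtain ⟨F', h5, h6⟩ := aug l u v F hF h1 h2 h3 h4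
      exact ⟨F', h5, fun X => by rw [h6, hb]; push_cast; ring⟩
    · exfalso
      set X := D.verts.filter fun x => ReflTransGen (res D.arcs F) u x with hX
      have hmX : ∀ x, x ∈ X ↔ x ∈ D.verts ∧ ReflTransGen (res D.arcs F) u x := fun x => by
        rw [hX, Finset.mem_filter]
      have hcl : ∀ p q, p ∈ X → q ∈ D.verts → res D.arcs F p q → q ∈ X := fun p q hp hq h =>
        (hmX q).2 ⟨hq, ((hmX p).1 hp).2.tail h⟩
      have huX : u ∈ X := (hmX u).2 ⟨hu, .refl⟩
      have hvX : v ∉ X := fun h => hr ((hmX v).1 h).2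
      have h1 := h X huX hvX
      have h2 := hb X
      rw [if_pos huX, if_neg hvX] at h2
      have h3 : (D.dO X : ℤ) ≤ bal F X := by
        have : D.dO X ≤ (F.filter fun a => a.1 ∈ X ∧ a.2 ∉ X).card := by
          refine Finset.card_le_card fun a ha => ?_
          obtain ⟨m1, m2, m3⟩ := mem_cut.1 ha
          refine Finset.mem_filter.2 ⟨?_, m2, m3⟩
          by_contra hn
          exact m3 (hcl _ _ m2 (hD a m1).2.1 (Or.inl ⟨m1, hn⟩))
        refine le_trans (Int.ofNat_le.2 this) ?_
        rw [Finset.card_filter, bal, Nat.cast_sum]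
        refine Finset.sum_le_sum fun a ha => ?_
        have := hcl a.2 a.1
        by_cases c1 : a.1 ∈ X <;> by_cases c2 : a.2 ∈ X <;> simp [c1, c2]
        exact c1 (this c2 (hD a (hF ha)).1 (Or.inr ha))
      push_cast at *
      omega

theorem flow_paths {D : Dgraph} (hD : D.WF) {u v : ℕ} (hu : u ∈ D.verts) : ∀ (m : ℕ)
    (F : Finset (ℕ × ℕ)), F ⊆ D.arcs →
    (∀ X, bal F X = m * ((if u ∈ X then 1 else 0) - if v ∈ X then 1 else 0)) →
    ∃ P : Fin m → List ℕ, (∀ i, D.IsDipath (P i) u v ∧ arcsOf (P i) ⊆ F) ∧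
      Pairwise fun i j => Disjoint (arcsOf (P i)) (arcsOf (P j)) := by
  classical
  intro m
  induction m with
  | zero => exact fun F _ _ => ⟨fun i => [], fun i => i.elim0, fun i => i.elim0⟩
  | succ m ih =>
    intro F hF hb
    have hs : ∀ x, ReflTransGen (fun p q => (p, q) ∈ F) u x → x ∈ D.verts := fun x hx =>
      hx.rec hu fun _ h _ => (hD _ (hF h)).2.1
    have hr : ReflTransGen (fun p q => (p, q) ∈ F) u v := by
      by_contra hr
      set X := D.verts.filter fun x => ReflTransGen (fun p q => (p, q) ∈ F) u x with hX
      have hmX : ∀ x, x ∈ X ↔ ReflTransGen (fun p q => (p, q) ∈ F) u x := fun x => by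
        rw [hX, Finset.mem_filter]; exact ⟨fun h => h.2, fun h => ⟨hs x h, h⟩⟩
      have h2 := hb X
      rw [if_pos ((hmX u).2 .refl), if_neg fun h => hr ((hmX v).1 h)] at h2
      have h3 : bal F X ≤ 0 := by
        refine Finset.sum_nonpos fun a ha => ?_
        by_cases c1 : a.1 ∈ X
        · have c2 : a.2 ∈ X := (hmX _).2 (((hmX _).1 c1).tail ha)
          simp [c1, c2]
        · by_cases c2 : a.2 ∈ X <;> simp [c1, c2]
      push_cast at *
      omega
    obtain ⟨l, h1, h2, h3, h4, h5⟩ := exists_nodup_path hr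
    have hl : arcsOf l ⊆ F := fun a ha => arcs_path l h4 a ha
    obtain ⟨P, hP, hd⟩ := ih (F \ arcsOf l) (Finset.sdiff_subset.trans hF) fun X => by
      have e := Finset.sum_sdiff (f := fun a : ℕ × ℕ =>
        ((if a.1 ∈ X then 1 else 0 : ℤ) - if a.2 ∈ X then 1 else 0)) hl
      have e' : bal (F \ arcsOf l) X + bal (arcsOf l) X = bal F X := e
      rw [hb X, bal_path l u v h1 h2 h3] at e'
      push_cast at e'
      linarith
    have hdl : ∀ i, Disjoint (arcsOf l) (arcsOf (P i)) := fun i =>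
      Finset.disjoint_left.2 fun a h h' => (Finset.mem_sdiff.1 ((hP i).2 h')).2 h
    refine ⟨Fin.cons l P, fun i => ?_, fun i j => ?_⟩
    · refine Fin.cases ?_ (fun i => ?_) i
      · exact ⟨⟨h1, h2, h3, fun x hx => hs x (h5 x hx).1, h4.imp fun _ _ h => hF h⟩, hl⟩
      · exact ⟨(hP i).1, (hP i).2.trans Finset.sdiff_subset⟩
    · refine Fin.cases ?_ (fun i => ?_) i
      · refine Fin.cases (fun h => absurd rfl h) (fun j _ => hdl j) j
      · refine Fin.cases (fun _ => (hdl i).symm) (fun j h => hd fun e => h (congrArg Fin.succ e)) j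

theorem loc_bdd {D : Dgraph} {u v : ℕ} (huv : u ≠ v) :
    BddAbove {n | ∃ P : Fin n → List ℕ, (∀ i, D.IsDipath (P i) u v) ∧
    Pairwise fun i j => Disjoint (arcsOf (P i)) (arcsOf (P j))} := by
  refine ⟨D.arcs.card, ?_⟩
  rintro n ⟨P, hP, hd⟩
  have hne : ∀ i, ∃ a, a ∈ arcsOf (P i) := by
    intro i
    obtain ⟨-, h1, h2, -, -⟩ := hP i
    match P i, h1, h2 with
    | [], h, _ => simp at h
    | [x], h, h' => simp at h h'; exact absurd (h.symm.trans h') huv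
    | x :: y :: l, _, _ => exact ⟨(x, y), by simp [arcsOf]⟩
  choose f hf using hne
  have := Finset.card_le_card_of_injOn (s := (Finset.univ : Finset (Fin n))) (t := D.arcs) f
    (fun i _ => arcs_path (P i) (hP i).2.2.2.2 _ (hf i)) fun i _ j _ e => by
      by_contra hij
      exact Finset.disjoint_left.1 (hd hij) (hf i) (e ▸ hf j)
  simpa using this

theorem cc_of_lam {D : Dgraph} (hD : D.WF) (h : D.lam ≤ k) : CC k D := by
  intro u hu v hv huv
  by_contra hn
  push Not at hn
  obtain ⟨F, hF, hb⟩ := exists_flow hD hu (m := k + 1) (fun X h1 h2 => hn X h1 h2) (k + 1) le_rfl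
  obtain ⟨P, hP, hd⟩ := flow_paths hD hu (k + 1) F hF hb
  have h1 : k + 1 ≤ D.locLam u v := le_csSup (loc_bdd huv) ⟨P, fun i => (hP i).1, hd⟩
  have h2 : D.locLam u v ≤ D.lam := by
    refine le_csSup (Set.Finite.bddAbove ?_) ⟨u, hu, v, hv, huv, rfl⟩
    refine ((D.verts ×ˢ D.verts).finite_toSet.image fun x => D.locLam x.1 x.2).subset ?_
    rintro n ⟨a, ha, b, hb, -, rfl⟩
    exact ⟨(a, b), by simp [ha, hb], rfl⟩
  omega

end Dgraph

namespace Dgraph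
open Relation
variable {k : ℕ}

theorem col_le {D : Dgraph} {j : ℕ} (h : D.Col j) (hj : j ≤ k) : D.Col k := by
  obtain ⟨φ, hφ⟩ := h
  exact ⟨fun x => Fin.castLE hj (φ x),
    hφ.of_imp fun p q h e => ⟨h, Fin.castLE_injective hj e⟩⟩

theorem induce_wf {D : Dgraph} (hD : D.WF) (S : Finset ℕ) : (D.induce S).WF := by
  intro a ha
  obtain ⟨h1, h2, h3⟩ := Finset.mem_filter.1 ha
  have := hD a h1
  exact ⟨Finset.mem_inter.2 ⟨this.1, h2⟩, Finset.mem_inter.2 ⟨this.2.1, h3⟩, this.2.2⟩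

theorem strong_iff {D : Dgraph} (hD : D.WF) : D.Strong ↔ D.Cut1 := by
  constructor
  · intro h a ha b hb
    by_cases e : a = b
    · exact e ▸ .refl
    · obtain ⟨p, -, h1, h2, -, h3⟩ := h a ha b hb e
      exact rtg_of_chain h3 h1 h2
  · intro h a ha b hb e
    obtain ⟨l, h1, h2, h3, h4, h5⟩ := exists_nodup_path (h a ha b hb)
    have hs : ∀ x, ReflTransGen D.arc a x → x ∈ D.verts := fun x hx =>
      hx.rec ha fun _ h _ => (hD _ h).2.1
    exact ⟨l, h1, h2, h3, fun x hx => hs x (h5 x hx).1, h4⟩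

theorem crit_bicon (hk : 2 ≤ k) {H : Dgraph} (h : Crit k H) : H.Biconnected := by
  classical
  obtain ⟨r, hr, -⟩ := h.other (by omega) 0
  refine ⟨⟨⟨r, hr⟩, fun a ha b hb => ReflTransGen.mono (fun _ _ h => Or.inl h) _ _
    (h.cut1 hk a ha b hb)⟩, fun v ⟨hv, hc⟩ => hc ?_⟩
  have hm : ∀ x, x ∈ (H.delVert v).verts ↔ x ∈ H.verts ∧ x ≠ v := fun x => by
    simp only [delVert, induce, Finset.mem_inter, Finset.mem_erase]
    exact ⟨fun h => ⟨h.1, h.2.1⟩, fun h => ⟨h.1, h.2, h.1⟩⟩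
  obtain ⟨y, hy, hyv⟩ := h.other (by omega) v
  refine ⟨⟨y, (hm y).2 ⟨hy, hyv⟩⟩, fun a ha b hb => ?_⟩
  by_contra hn
  obtain ⟨ha, hav⟩ := (hm a).1 ha
  obtain ⟨hb, hbv⟩ := (hm b).1 hb
  obtain ⟨p, hp, q, hq, hqv, hqN, had⟩ := h.nocut v hv
    (H.verts.filter fun x => x ≠ v ∧ (H.delVert v).UReach a x) (Finset.filter_subset _ _)
    ⟨a, Finset.mem_filter.2 ⟨ha, hav, .refl⟩⟩ (fun h => (Finset.mem_filter.1 h).2.1 rfl)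
    ⟨b, hb, hbv, fun h => hn (Finset.mem_filter.1 h).2.2⟩
  obtain ⟨hp, hpv, hpr⟩ := Finset.mem_filter.1 hp
  refine hqN (Finset.mem_filter.2 ⟨hq, hqv, hpr.tail ?_⟩)
  have e1 := Finset.mem_erase.2 ⟨hpv, hp⟩
  have e2 := Finset.mem_erase.2 ⟨hqv, hq⟩
  exact had.imp (fun h => Finset.mem_filter.2 ⟨h, e1, e2⟩) fun h => Finset.mem_filter.2 ⟨h, e2, e1⟩

theorem block_of_nc (hk : 3 ≤ k) {D : Dgraph} (hD : D.WF) (hcc : CC k D) (hnc : ¬ D.Col k) :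
    ∃ S B, D.IsStrongComponent S ∧ (D.induce S).IsBlock B ∧
      HClass k ((D.induce S).induce B) := by
  classical
  obtain ⟨H, hH, hV, hA⟩ := exists_crit hD hnc
  have hE : Ext k H := ⟨hH, hcc.sub ⟨hV, hA⟩⟩
  have hC : HClass k H := hclass hk _ le_rfl hE
  have hle : ∀ S, H.verts ⊆ S → Le H (D.induce S) := fun S hS =>
    ⟨fun x hx => Finset.mem_inter.2 ⟨hV hx, hS hx⟩, fun a ha =>
      Finset.mem_filter.2 ⟨hA ha, hS (hH.wf a ha).1, hS (hH.wf a ha).2.1⟩⟩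
  have h0 : (D.induce H.verts).Strong := (strong_iff (induce_wf hD _)).2 fun a ha b hb =>
    ReflTransGen.mono (fun _ _ h => (hle _ (Finset.Subset.refl _)).2 h) _ _
      (hH.cut1 (by omega) a (Finset.mem_inter.1 ha).2 b (Finset.mem_inter.1 hb).2)
  obtain ⟨S, hS, hmax⟩ := Finset.exists_max_image
    (D.verts.powerset.filter fun S => H.verts ⊆ S ∧ (D.induce S).Strong) Finset.card
    ⟨H.verts, by simp [hV, h0]⟩
  simp only [Finset.mem_filter, Finset.mem_powerset] at hS hmax
  obtain ⟨hSD, hHS, hSs⟩ := hS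
  have hQ := induce_wf hD S
  have hc1 := (strong_iff hQ).1 hSs
  have hl := hle S hHS
  have hQc : CC k (D.induce S) := hcc.sub ⟨Finset.inter_subset_left, Finset.filter_subset _ _⟩
  obtain ⟨r, hr, -⟩ := hH.other (by omega) 0
  have he : (D.induce S).induce H.verts = H := by
    refine dg_ext (fun x => ⟨fun h => (Finset.mem_inter.1 h).2, fun h =>
      Finset.mem_inter.2 ⟨hl.1 h, h⟩⟩) fun a => ⟨fun h => ?_, fun h =>
      Finset.mem_filter.2 ⟨hl.2 h, (hH.wf a h).1, (hH.wf a h).2.1⟩⟩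
    obtain ⟨h1, h2, h3⟩ := Finset.mem_filter.1 h
    exact ear_arcs (by omega) hQ hQc hH hl h1 h2 h3
  refine ⟨S, H.verts, ⟨hSD, ⟨r, hHS hr⟩, hSs, fun S' h1 h2 h3 =>
    (Finset.eq_of_subset_of_card_le h1 (hmax S' ⟨h2, hHS.trans h1, h3⟩)).symm⟩,
    ⟨hl.1, by rw [he]; exact crit_bicon (by omega) hH, fun B' h1 h2 h3 => ?_⟩, by rwa [he]⟩
  refine Finset.Subset.antisymm (fun w hw => ?_) h1
  by_contra hwH
  obtain ⟨z, hz, N, hN, hwN, hNH, hno⟩ := ear (by omega) hQ hQc hc1 hH hl (h2 hw) hwH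
  obtain ⟨y, hy, hyz⟩ := hH.other (by omega) z
  have hzB : z ∈ ((D.induce S).induce B').verts := Finset.mem_inter.2 ⟨hl.1 hz, h1 hz⟩
  have hconn : (((D.induce S).induce B').delVert z).UConnected := by
    by_contra hn
    exact h3.2 z ⟨hzB, hn⟩
  have hin : ∀ x, x ∈ B' → x ≠ z → x ∈ (((D.induce S).induce B').delVert z).verts := fun x hx hxz =>
    have h' : x ∈ ((D.induce S).induce B').verts := Finset.mem_inter.2 ⟨h2 hx, hx⟩
    Finset.mem_inter.2 ⟨h', Finset.mem_erase.2 ⟨hxz, h'⟩⟩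
  have hwz : w ≠ z := fun e => hwH (e ▸ hz)
  obtain ⟨p, q, hpq, hp, hq⟩ := exit_arc (hconn.2 w (hin w hw hwz) y (hin y (h1 hy) hyz)) hwN
    fun h => hNH y h hy
  have hh : ∀ a, a ∈ (((D.induce S).induce B').delVert z).arcs → a ∈ (D.induce S).arcs ∧
      a.1 ≠ z ∧ a.2 ≠ z := fun a ha => by
    obtain ⟨g1, g2, g3⟩ := Finset.mem_filter.1 ha
    exact ⟨(Finset.mem_filter.1 g1).1, (Finset.mem_erase.1 g2).1, (Finset.mem_erase.1 g3).1⟩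
  rcases hpq with h | h
  · exact hno p hp q (hQ _ (hh _ h).1).2.1 (hh _ h).2.2 hq (Or.inl (hh _ h).1)
  · exact hno p hp q (hQ _ (hh _ h).1).1 (hh _ h).2.1 hq (Or.inr (hh _ h).1)

theorem col_succ (hk : 1 ≤ k) {D : Dgraph} (hD : D.WF) (hcc : CC k D) : D.Col (k + 1) := by
  by_contra hn
  obtain ⟨H, hH, hV, hA⟩ := exists_crit hD hn
  obtain ⟨a, ha⟩ := hH.nonempty (by omega)
  have hw := hH.wf a ha
  obtain ⟨X, h1, h2, h3⟩ := hcc.sub ⟨hV, hA⟩ a.1 hw.1 a.2 hw.2.1 hw.2.2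
  have := hH.cut_ge (by omega) ⟨a.1, hw.1, h1⟩ ⟨a.2, hw.2.1, h2⟩
  omega

theorem final (hk : 3 ≤ k) {D : Dgraph} (hD : D.WF) (hlam : D.lam = k) :
    D.dichi = k + 1 ↔
      ∃ S B, D.IsStrongComponent S ∧ (D.induce S).IsBlock B ∧
        HClass k ((D.induce S).induce B) := by
  have hcc : CC k D := cc_of_lam hD hlam.le
  constructor
  · intro h
    refine block_of_nc hk hD hcc ?_
    rintro ⟨φ, hφ⟩
    have : D.dichi ≤ k := Nat.sInf_le ⟨φ, hφ.dicol⟩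
    omega
  · rintro ⟨S, B, -, -, hC⟩
    have hnc : ¬ D.Col k := fun h => hC.nc (h.sub
      ((Finset.filter_subset _ _).trans (Finset.filter_subset _ _)))
    obtain ⟨φ, hφ⟩ := col_succ (by omega) hD hcc
    refine le_antisymm (Nat.sInf_le ⟨φ, hφ.dicol⟩) (le_csInf ⟨k + 1, φ, hφ.dicol⟩ ?_)
    rintro j ⟨ψ, hψ⟩
    by_contra hj
    exact hnc (col_le ⟨ψ, good_of_dicol hD hψ⟩ (by omega))

end Dgraph

/-- Theorem 1.8: for k ≥ 3 and a digraph D with λ(D) = k, we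
have χ⃗(D) = λ(D) + 1 = k + 1 if and only if some block of some strong
component of D belongs to H⃗_k. -/
theorem statement_17 (k : ℕ) (hk : 3 ≤ k) (D : Dgraph) (hWF : D.WF)
    (hlam : D.lam = k) :
    D.dichi = k + 1 ↔
      ∃ S B, D.IsStrongComponent S ∧ (D.induce S).IsBlock B ∧
        HClass k ((D.induce S).induce B) := by
  exact Dgraph.final hk hWF hlam
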